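/- Let d ≥ 1, δ ∈ (0,1], p, q ∈ (1,∞). Then there exist constants â = â(d,δ,p,q) > 0 and N = N(d,δ,p,q) such that for every measurable a : ℝ^{1+d} → 𝕊_δ with a^♯ ≤ â and every u ∈ C₀^∞(ℝ^{1+d}), ‖∂_t u‖_{𝕃_{q,p}} + ‖D²u‖_{𝕃_{q,p}} ≤ N ‖∂_t u + Σ_{i,j} a^{ij}(t,x) D_{ij}u‖_{𝕃_{q,p}}. -/

import Mathlib

open MeasureTheory Metric Set
open scoped ENNReal NNReal

noncomputable section

abbrev Spc (d : ℕ) : Type := EuclideanSpace ℝ (Fin d)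

abbrev Pt (d : ℕ) : Type := ℝ × Spc d

instance matrixMeasurableSpace (d : ℕ) : MeasurableSpace (Matrix (Fin d) (Fin d) ℝ) :=
  (inferInstance : MeasurableSpace (Fin d → Fin d → ℝ))

/-- Membership in `𝕊_δ`: symmetric `d×d` matrices with
`δ|ξ|² ≤ (aξ,ξ) ≤ δ⁻¹|ξ|²`. -/
def inS (d : ℕ) (δ : ℝ) (a : Matrix (Fin d) (Fin d) ℝ) : Prop :=
  a.IsSymm ∧ ∀ ξ : Fin d → ℝ,
    δ * (∑ i, ξ i ^ 2) ≤ (∑ i, ∑ j, a i j * ξ i * ξ j) ∧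
    (∑ i, ∑ j, a i j * ξ i * ξ j) ≤ δ⁻¹ * (∑ i, ξ i ^ 2)

/-- `{a,u} = a^{ij} a^{kr} u_{ik} u_{jr}`. -/
def bra (d : ℕ) (a u : Matrix (Fin d) (Fin d) ℝ) : ℝ :=
  ∑ i, ∑ j, ∑ k, ∑ r, a i j * a k r * u i k * u j r

/-- Frobenius norm of a `d×d` array. -/
def mnorm {d : ℕ} (m : Fin d → Fin d → ℝ) : ℝ :=
  Real.sqrt (∑ i, ∑ j, m i j ^ 2)

/-- Euclidean norm of a vector given as `Fin d → ℝ`. -/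
def vnorm {d : ℕ} (v : Fin d → ℝ) : ℝ :=
  Real.sqrt (∑ i, v i ^ 2)

/-- Parabolic cylinder `C_R(t,x) = (t, t+R²) × B_R(x)`. -/
def cyl (d : ℕ) (R t : ℝ) (x : Spc d) : Set (Pt d) :=
  Ioo t (t + R ^ 2) ×ˢ ball x R

/-- Time derivative `∂_t u`. -/
def Dt {d : ℕ} (u : Pt d → ℝ) (z : Pt d) : ℝ :=
  deriv (fun s => u (s, z.2)) z.1

/-- Spatial derivative `D_i u`. -/
def Dx {d : ℕ} (i : Fin d) (u : Pt d → ℝ) (z : Pt d) : ℝ :=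
  fderiv ℝ (fun y => u (z.1, y)) z.2 (EuclideanSpace.single i 1)

/-- Second spatial derivative `D_{ij} u = D_i D_j u`. -/
def Dxx {d : ℕ} (i j : Fin d) (u : Pt d → ℝ) : Pt d → ℝ :=
  Dx i (Dx j u)

/-- `u ∈ C₀^∞(ℝ^{1+d})`. -/
def CinfC {d : ℕ} (u : Pt d → ℝ) : Prop :=
  ContDiff ℝ (⊤ : ℕ∞) u ∧ HasCompactSupport u

/-- The kernel `p_{α,k}(s,r)`. -/
def pak (d : ℕ) (α k s r : ℝ) : ℝ :=
  if 0 < s then s ^ (-((d : ℝ) + 2 - α) / 2) * Real.exp (-(r ^ 2) / (k * s)) else 0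

/-- Parabolic distance to the origin `ρ(t,x) = |x| + √|t|`. -/
def prho {d : ℕ} (z : Pt d) : ℝ := ‖z.2‖ + Real.sqrt |z.1|

/-- Average of (the positive part of) `g` over `C`, valued in `ℝ≥0∞`. -/
def aveLin {d : ℕ} (C : Set (Pt d)) (g : Pt d → ℝ) : ℝ≥0∞ :=
  (volume C)⁻¹ * ∫⁻ z in C, ENNReal.ofReal (g z)

/-- Parabolic maximal function `𝕄_β g` (for `g ≥ 0`). -/
def maxF {d : ℕ} (β : ℝ) (g : Pt d → ℝ) (z : Pt d) : ℝ≥0∞ :=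
  ⨆ (ρ : ℝ) (_ : 0 < ρ) (t : ℝ) (x : Spc d) (_ : z ∈ cyl d ρ t x),
    ENNReal.ofReal (ρ ^ β) * aveLin (cyl d ρ t x) g

/-- Oscillation of a matrix-valued function over `C`. -/
def oscC {d : ℕ} (C : Set (Pt d)) (g : Pt d → Fin d → Fin d → ℝ) : ℝ :=
  ⨍ z₁ in C, ⨍ z₂ in C, mnorm (fun i j => g z₁ i j - g z₂ i j)

/-- Mixed norm `‖f‖_{𝕃_{q,p}}` (inner integration in `t`, outer in `x`). -/
def mixedNorm {d : ℕ} (q p : ℝ) (f : Pt d → ℝ) : ℝ :=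
  (∫ x : Spc d, (∫ t : ℝ, |f (t, x)| ^ q) ^ (p / q)) ^ (1 / p)

/-- Mixed norm on a set `Γ`. -/
def mixedNormOn {d : ℕ} (q p : ℝ) (Γ : Set (Pt d)) (f : Pt d → ℝ) : ℝ :=
  mixedNorm q p (Γ.indicator f)

/-- Normalized (averaged) mixed norm over the cylinder `C_R(t,x)`, in `ℝ≥0∞`. -/
def cylNormL {d : ℕ} (q p R t : ℝ) (x : Spc d) (f : Pt d → ℝ) : ℝ≥0∞ :=
  ((volume (ball x R))⁻¹ * ∫⁻ y in ball x R,
      ((volume (Ioo t (t + R ^ 2)))⁻¹ * ∫⁻ s in Ioo t (t + R ^ 2),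
        ENNReal.ofReal |f (s, y)| ^ q) ^ (p / q)) ^ (1 / p)

/-- Mixed norm on a set, valued in `ℝ≥0∞`. -/
def mixedNormLe {d : ℕ} (q p : ℝ) (Γ : Set (Pt d)) (f : Pt d → ℝ) : ℝ≥0∞ :=
  (∫⁻ x : Spc d, (∫⁻ t : ℝ, ENNReal.ofReal |Γ.indicator f (t, x)| ^ q) ^ (p / q)) ^ (1 / p)

/-- `ã_C(t)`: average of `a(t,·)` over the ball of the cylinder. -/
def aTilde {d : ℕ} (a : Pt d → Matrix (Fin d) (Fin d) ℝ) (R : ℝ) (x₀ : Spc d) (t : ℝ)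
    (i j : Fin d) : ℝ :=
  ⨍ y in ball x₀ R, a (t, y) i j

/-- The mean oscillation of `a` w.r.t. `x` over one cylinder. -/
def aSharpCyl {d : ℕ} (a : Pt d → Matrix (Fin d) (Fin d) ℝ) (R t₀ : ℝ) (x₀ : Spc d) : ℝ≥0∞ :=
  (volume (cyl d R t₀ x₀))⁻¹ * ∫⁻ z in cyl d R t₀ x₀,
    ENNReal.ofReal (mnorm (fun i j => a z i j - aTilde a R x₀ z.1 i j))

/-- `a^♯`. -/
def aSharp {d : ℕ} (a : Pt d → Matrix (Fin d) (Fin d) ℝ) : ℝ≥0∞ :=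
  ⨆ (R : ℝ) (_ : 0 < R) (t₀ : ℝ) (x₀ : Spc d), aSharpCyl a R t₀ x₀

/-- `a^♯_ρ` (only cylinders of radius `≤ ρa`). -/
def aSharpRho {d : ℕ} (a : Pt d → Matrix (Fin d) (Fin d) ℝ) (ρa : ℝ) : ℝ≥0∞ :=
  ⨆ (R : ℝ) (_ : 0 < R) (_ : R ≤ ρa) (t₀ : ℝ) (x₀ : Spc d), aSharpCyl a R t₀ x₀

/-- Homogeneous Morrey norm `‖g‖_{Ė_{p,β}}`. -/
def morreyP {d : ℕ} (p β : ℝ) (g : Pt d → ℝ) : ℝ≥0∞ :=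
  ⨆ (ρ : ℝ) (_ : 0 < ρ) (t : ℝ) (x : Spc d),
    ENNReal.ofReal (ρ ^ β) *
      ((volume (cyl d ρ t x))⁻¹ * ∫⁻ z in cyl d ρ t x, ENNReal.ofReal |g z| ^ p) ^ (1 / p)

/-- Homogeneous mixed-norm Morrey norm `‖g‖_{Ė_{q,p,β}}`. -/
def morreyQP {d : ℕ} (q p β : ℝ) (g : Pt d → ℝ) : ℝ≥0∞ :=
  ⨆ (ρ : ℝ) (_ : 0 < ρ) (t : ℝ) (x : Spc d),
    ENNReal.ofReal (ρ ^ β) * cylNormL q p ρ t x g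

/-- Inhomogeneous mixed-norm Morrey norm `‖g‖_{E_{q,p,β}}` (radii `ρ ∈ (0,1]`). -/
def morreyI {d : ℕ} (q p β : ℝ) (g : Pt d → ℝ) : ℝ≥0∞ :=
  ⨆ (ρ : ℝ) (_ : 0 < ρ) (_ : ρ ≤ 1) (t : ℝ) (x : Spc d),
    ENNReal.ofReal (ρ ^ β) * cylNormL q p ρ t x g

/-- `b̄_{q',p',ρb}` for a vector field `b`. -/
def bBar {d : ℕ} (q' p' : ℝ) (b : Pt d → Fin d → ℝ) (ρb : ℝ) : ℝ≥0∞ :=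
  ⨆ (R : ℝ) (_ : 0 < R) (_ : R ≤ ρb) (t : ℝ) (x : Spc d),
    ENNReal.ofReal R * cylNormL q' p' R t x (fun z => vnorm (b z))

/-- Test function supported in the open set `Q`. -/
def IsTest {d : ℕ} (Q : Set (Pt d)) (φ : Pt d → ℝ) : Prop :=
  ContDiff ℝ (⊤ : ℕ∞) φ ∧ HasCompactSupport φ ∧ tsupport φ ⊆ Q

/-- `ut` is the weak time derivative of `u` on `Q`. -/
def WeakDtOn {d : ℕ} (Q : Set (Pt d)) (u ut : Pt d → ℝ) : Prop :=
  ∀ φ, IsTest Q φ → ∫ z in Q, u z * Dt φ z = - ∫ z in Q, ut z * φ z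

/-- `ui` is the weak `i`-th spatial derivative of `u` on `Q`. -/
def WeakDxOn {d : ℕ} (Q : Set (Pt d)) (i : Fin d) (u ui : Pt d → ℝ) : Prop :=
  ∀ φ, IsTest Q φ → ∫ z in Q, u z * Dx i φ z = - ∫ z in Q, ui z * φ z

set_option linter.all false
set_option linter.deprecated false
set_option linter.unusedSectionVars false
set_option linter.style.haveILetI false
open ENNReal (ofReal)
open Filter.Eventually (of_forall)
open Real (exp)
structure Grid (X : Type) [TopologicalSpace X] [MeasurableSpace X] (μ : Measure X) where
  I : Type
  cI : Countable I
  c : ℤ → X → I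
  meas : ∀ k i, MeasurableSet {x | c k x = i}
  nest : ∀ k x y, c (k+1) x = c (k+1) y → c k x = c k y
  v : ℤ → ENNReal
  vol : ∀ k x, μ {y | c k y = c k x} = v k
  v0 : ∀ k, v k ≠ 0
  vt : ∀ k, v k ≠ ∞
  D : ENNReal
  D1 : 1 ≤ D
  Dt : D ≠ ∞
  dbl : ∀ k, v k ≤ D * v (k+1)
  small : ∀ O : Set X, IsOpen O → ∀ x ∈ O, ∃ k0, ∀ k, k0 ≤ k → {y | c k y = c k x} ⊆ O
  big : ∀ C : ENNReal, C ≠ ∞ → ∃ k0, ∀ k ≤ k0, C ≤ v k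

namespace Grid
variable {X : Type} [TopologicalSpace X] [MeasurableSpace X] {μ : Measure X} (G : Grid X μ)

def Q (k : ℤ) (x : X) : Set X := {y | G.c k y = G.c k x}

def E (k : ℤ) (g : X → ENNReal) (x : X) : ENNReal := (G.v k)⁻¹ * ∫⁻ y in G.Q k x, g y ∂μ

def M (g : X → ENNReal) (x : X) : ENNReal := ⨆ k, G.E k g x

def Sat (k : ℤ) (S : Set X) : Prop := ∀ x y, G.c k x = G.c k y → x ∈ S → y ∈ S

lemma mem_Q (k x) : x ∈ G.Q k x := by simp [Q]

lemma mQ (k x) : MeasurableSet (G.Q k x) := G.meas k _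

lemma nest' {j k : ℤ} (h : j ≤ k) {x y : X} (hxy : G.c k x = G.c k y) : G.c j x = G.c j y := by
  obtain ⟨n, rfl⟩ := Int.le.dest h
  induction n with
  | zero => simpa using hxy
  | succ n ih =>
    apply ih (by omega)
    apply G.nest
    convert hxy using 2 <;> (push_cast; ring)

lemma Sat.mono {G : Grid X μ} {j k : ℤ} (h : j ≤ k) {S : Set X} (hS : G.Sat j S) : G.Sat k S :=
  fun _ _ hxy hx => hS _ _ (G.nest' h hxy) hx

lemma mc (k : ℤ) (P : G.I → Prop) : MeasurableSet {x | P (G.c k x)} := by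
  haveI := G.cI
  have : {x | P (G.c k x)} = ⋃ i ∈ {i | P i}, {x | G.c k x = i} := by
    ext x; simp
  rw [this]
  exact MeasurableSet.biUnion (to_countable _) fun i _ => G.meas k i

lemma Sat.meas {G : Grid X μ} {k : ℤ} {S : Set X} (hS : G.Sat k S) : MeasurableSet S := by
  have : S = {x | (fun i => ∃ y ∈ S, G.c k y = i) (G.c k x)} := by
    ext x
    exact ⟨fun h => ⟨x, h, rfl⟩, fun ⟨y, hy, h⟩ => hS _ _ h hy⟩
  rw [this]; exact G.mc k (fun i => ∃ y ∈ S, G.c k y = i)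

lemma Q_eq {k : ℤ} {x y : X} (h : G.c k x = G.c k y) : G.Q k x = G.Q k y := by
  simp [Q, h]

lemma E_eq {k : ℤ} {x y : X} (h : G.c k x = G.c k y) (g) : G.E k g x = G.E k g y := by
  simp [E, G.Q_eq h]

lemma Q_sub_sat {k : ℤ} {S : Set X} (hS : G.Sat k S) {x : X} (hx : x ∈ S) : G.Q k x ⊆ S :=
  fun _ hy => hS _ _ (Eq.symm hy) hx

lemma lint_sum (k : ℤ) (f : X → ENNReal) :
    ∫⁻ x, f x ∂μ = ∑' i : G.I, ∫⁻ x in {x | G.c k x = i}, f x ∂μ := by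
  haveI := G.cI
  rw [← lintegral_iUnion (fun i => G.meas k i)]
  · have : (⋃ i, {x | G.c k x = i}) = univ := by ext x; simp
    rw [this, setLIntegral_univ]
  · intro i j hij
    exact Set.disjoint_left.2 fun x (hx : _ = i) (hx' : _ = j) => hij (hx.symm.trans hx')

lemma sat_le {k : ℤ} {S : Set X} (hS : G.Sat k S) {f h : X → ENNReal}
    (H : ∀ x ∈ S, ∫⁻ y in G.Q k x, f y ∂μ ≤ ∫⁻ y in G.Q k x, h y ∂μ) :
    ∫⁻ x in S, f x ∂μ ≤ ∫⁻ x in S, h x ∂μ := by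
  rw [← lintegral_indicator hS.meas, ← lintegral_indicator hS.meas, G.lint_sum k, G.lint_sum k]
  refine ENNReal.tsum_le_tsum fun i => ?_
  by_cases hi : ∃ x ∈ S, G.c k x = i
  · obtain ⟨x, hx, rfl⟩ := hi
    have e : ∀ f : X → ENNReal, ∫⁻ y in {y | G.c k y = G.c k x}, S.indicator f y ∂μ
        = ∫⁻ y in G.Q k x, f y ∂μ := fun f =>
      setLIntegral_congr_fun (G.meas k _) fun y hy =>
        indicator_of_mem (hS _ _ (Eq.symm hy) hx) _
    rw [e, e]; exact H x hx
  · push Not at hi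
    rw [setLIntegral_congr_fun (g := fun _ => 0) (G.meas k i)
      (fun y hy => indicator_of_notMem (fun h => hi y h hy) _)]
    simp

lemma vol' (k x) : μ (G.Q k x) = G.v k := G.vol k x

lemma lint_E (k : ℤ) (x : X) (g) : ∫⁻ y in G.Q k x, g y ∂μ = G.v k * G.E k g x := by
  rw [E, ← mul_assoc, ENNReal.mul_inv_cancel (G.v0 k) (G.vt k), one_mul]

lemma mE (k : ℤ) (g) : Measurable (G.E k g) := by
  haveI := G.cI
  letI : MeasurableSpace G.I := ⊤
  have : Measurable (G.c k) := measurable_to_countable' fun i => G.meas k i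
  have h2 : Measurable fun i : G.I => (G.v k)⁻¹ * ∫⁻ y in {y | G.c k y = i}, g y ∂μ :=
    measurable_from_top
  exact h2.comp this

lemma mM (g) : Measurable (G.M g) := Measurable.iSup fun k => G.mE k g

lemma E_le_M (k g x) : G.E k g x ≤ G.M g x := le_iSup (fun k => G.E k g x) k

lemma E_mono {k : ℤ} {f g : X → ENNReal} (h : ∀ x, f x ≤ g x) (x) : G.E k f x ≤ G.E k g x := by
  unfold E; gcongr; exact h _

lemma M_mono {f g : X → ENNReal} (h : ∀ x, f x ≤ g x) (x) : G.M f x ≤ G.M g x :=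
  iSup_mono fun _ => G.E_mono h x

lemma E_const (k : ℤ) (a : ENNReal) (x) : G.E k (fun _ => a) x = a := by
  simp only [E, lintegral_const, Measure.restrict_apply_univ, vol']
  rw [mul_comm a, ← mul_assoc, ENNReal.inv_mul_cancel (G.v0 k) (G.vt k), one_mul]

lemma M_one (a : ENNReal) (x) : G.M (fun _ => a) x = a := by simp [M, E_const]

lemma E_add (k : ℤ) {f g : X → ENNReal} (hf : Measurable f) (x) :
    G.E k (fun y => f y + g y) x = G.E k f x + G.E k g x := by
  simp [E, lintegral_add_left hf, mul_add]

lemma M_add {f g : X → ENNReal} (hf : Measurable f) (x) :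
    G.M (fun y => f y + g y) x ≤ G.M f x + G.M g x :=
  iSup_le fun k => (G.E_add k hf x).le.trans (add_le_add (G.E_le_M k f x) (G.E_le_M k g x))

lemma E_dbl (k : ℤ) (g x) : G.E (k+1) g x ≤ G.D * G.E k g x := by
  unfold E
  rw [← mul_assoc]
  have h : (G.v (k+1))⁻¹ ≤ G.D * (G.v k)⁻¹ := by
    rw [ENNReal.inv_le_iff_le_mul (fun _ => G.v0 _) (fun h => absurd h (G.vt _)), ← mul_assoc]
    calc (1:ENNReal) = G.v k * (G.v k)⁻¹ := (ENNReal.mul_inv_cancel (G.v0 k) (G.vt k)).symm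
      _ ≤ (G.D * G.v (k+1)) * (G.v k)⁻¹ := by gcongr; exact G.dbl k
      _ = _ := by ring
  gcongr
  · exact fun y hy => G.nest k _ _ hy

lemma adj {k : ℤ} {S : Set X} (hS : G.Sat k S) {g w : X → ENNReal} (hg : Measurable g)
    (hw : Measurable w) :
    ∫⁻ x in S, G.E k g x * w x ∂μ = ∫⁻ x in S, g x * G.E k w x ∂μ := by
  have key : ∀ x, ∀ g w : X → ENNReal, Measurable w →
      ∫⁻ y in G.Q k x, G.E k g y * w y ∂μ = G.v k * (G.E k g x * G.E k w x) := by
    intro x g w hw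
    rw [setLIntegral_congr_fun (g := fun y => G.E k g x * w y) (G.mQ k x)
      (fun y hy => by simp only [G.E_eq hy]), lintegral_const_mul _ hw, lint_E]
    ring
  have : ∀ x, ∫⁻ y in G.Q k x, G.E k g y * w y ∂μ = ∫⁻ y in G.Q k x, g y * G.E k w y ∂μ := by
    intro x
    rw [key x g w hw]
    simp_rw [mul_comm (g _)]
    rw [key x w g hg, mul_comm (G.E k g x)]
  exact le_antisymm (G.sat_le hS fun x _ => (this x).le) (G.sat_le hS fun x _ => (this x).ge)

lemma lint_sat {k : ℤ} {S : Set X} (hS : G.Sat k S) {g : X → ENNReal} (hg : Measurable g) :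
    ∫⁻ x in S, G.E k g x ∂μ = ∫⁻ x in S, g x ∂μ := by
  have := G.adj hS hg (w := fun _ => 1) measurable_const
  simpa [E_const] using this

def St (k0 : ℤ) (P : ℤ → X → Prop) (k : ℤ) : Set X :=
  {x | k0 ≤ k ∧ P k x ∧ ∀ j, k0 ≤ j → j < k → ¬ P j x}

lemma St_sat (k0 : ℤ) {P : ℤ → X → Prop} (hP : ∀ k x y, G.c k x = G.c k y → P k x → P k y)
    (k : ℤ) : G.Sat k (St k0 P k) := by
  rintro x y hxy ⟨h0, h1, h2⟩
  exact ⟨h0, hP k x y hxy h1, fun j hj hjk h => h2 j hj hjk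
    (hP j y x (G.nest' hjk.le hxy).symm h)⟩

lemma St_disj (k0 : ℤ) (P : ℤ → X → Prop) : Pairwise (Function.onFun Disjoint (St k0 P)) := by
  intro i j hij
  refine Set.disjoint_left.2 fun x hx hy => ?_
  rcases lt_or_gt_of_ne hij with h | h
  · exact hy.2.2 i hx.1 h hx.2.1
  · exact hx.2.2 j hy.1 h hy.2.1

lemma St_union (k0 : ℤ) (P : ℤ → X → Prop) :
    (⋃ k, St k0 P k) = {x | ∃ k, k0 ≤ k ∧ P k x} := by
  classical
  ext x
  simp only [mem_iUnion, mem_setOf_eq]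
  constructor
  · rintro ⟨k, h⟩; exact ⟨k, h.1, h.2.1⟩
  · rintro ⟨k, hk, hP⟩
    obtain ⟨n, rfl⟩ := Int.le.dest hk
    have hex : ∃ n : ℕ, P (k0 + n) x := ⟨n, hP⟩
    refine ⟨k0 + Nat.find hex, by omega, Nat.find_spec hex, fun j hj hjk h => ?_⟩
    obtain ⟨m, rfl⟩ := Int.le.dest hj
    exact Nat.find_min hex (by omega) h

lemma lint_St (k0 : ℤ) {P : ℤ → X → Prop} (hP : ∀ k x y, G.c k x = G.c k y → P k x → P k y)
    (f : X → ENNReal) : ∫⁻ x in {x | ∃ k, k0 ≤ k ∧ P k x}, f x ∂μ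
      = ∑' k, ∫⁻ x in St k0 P k, f x ∂μ := by
  rw [← St_union, lintegral_iUnion (fun k => (G.St_sat k0 hP k).meas) (St_disj k0 P)]

lemma weak0 (k0 : ℤ) {g w : X → ENNReal} (hg : Measurable g) (hw : Measurable w) (l : ENNReal) :
    l * ∫⁻ x in {x | ∃ k, k0 ≤ k ∧ l < G.E k g x}, w x ∂μ ≤
      ∫⁻ x in {x | ∃ k, k0 ≤ k ∧ l < G.E k g x}, g x * G.M w x ∂μ := by
  have hP : ∀ k x y, G.c k x = G.c k y → l < G.E k g x → l < G.E k g y :=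
    fun k x y h h' => by rwa [← G.E_eq h]
  rw [G.lint_St k0 hP, G.lint_St k0 hP, ← ENNReal.tsum_mul_left]
  refine ENNReal.tsum_le_tsum fun k => ?_
  have hs := G.St_sat k0 hP k
  calc l * ∫⁻ x in St k0 _ k, w x ∂μ = ∫⁻ x in St k0 _ k, l * w x ∂μ :=
        (lintegral_const_mul _ hw).symm
    _ ≤ ∫⁻ x in St k0 _ k, G.E k g x * w x ∂μ :=
        setLIntegral_mono' hs.meas fun x hx => by gcongr; exact hx.2.1.le
    _ = ∫⁻ x in St k0 _ k, g x * G.E k w x ∂μ := G.adj hs hg hw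
    _ ≤ _ := lintegral_mono fun x => by gcongr; exact G.E_le_M _ _ _

lemma weak {g w : X → ENNReal} (hg : Measurable g) (hw : Measurable w) (l : ENNReal) :
    l * ∫⁻ x in {x | l < G.M g x}, w x ∂μ ≤ ∫⁻ x, g x * G.M w x ∂μ := by
  have hU : {x | l < G.M g x} = ⋃ n : ℕ, {x | ∃ k, -(n:ℤ) ≤ k ∧ l < G.E k g x} := by
    ext x
    simp only [mem_setOf_eq, mem_iUnion, M, lt_iSup_iff]
    constructor
    · rintro ⟨k, hk⟩; exact ⟨k.natAbs, k, by omega, hk⟩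
    · rintro ⟨_, k, _, hk⟩; exact ⟨k, hk⟩
  have hm : ∀ n : ℕ, MeasurableSet {x | ∃ k, -(n:ℤ) ≤ k ∧ l < G.E k g x} := fun n => by
    have : {x | ∃ k, -(n:ℤ) ≤ k ∧ l < G.E k g x} =
        ⋃ k, ⋃ (_ : -(n:ℤ) ≤ k), {x | l < G.E k g x} := by ext x; simp
    rw [this]
    exact MeasurableSet.iUnion fun k => MeasurableSet.iUnion fun _ =>
      measurableSet_lt measurable_const (G.mE k g)
  rw [← withDensity_apply _ (measurableSet_lt measurable_const (G.mM g)), hU,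
    Monotone.measure_iUnion, ENNReal.mul_iSup]
  · refine iSup_le fun n => ?_
    rw [withDensity_apply _ (hm n)]
    exact (G.weak0 _ hg hw l).trans (setLIntegral_le_lintegral _ _)
  · intro m n h x ⟨k, hk, h'⟩
    exact ⟨k, by omega, h'⟩

lemma weak1 {g : X → ENNReal} (hg : Measurable g) (l : ENNReal) :
    l * μ {x | l < G.M g x} ≤ ∫⁻ x, g x ∂μ := by
  have := G.weak hg (w := fun _ => 1) measurable_const l
  simpa [M_one] using this

lemma diff [OpensMeasurableSpace X] [μ.OuterRegular] {F : X → ENNReal} (hF : Measurable F)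
    (hfin : ∫⁻ x, F x ∂μ ≠ ∞) : ∀ᵐ x ∂μ, F x ≤ G.M F x := by
  have key : ∀ r s : ℝ≥0, r < s → μ {x | G.M F x ≤ r ∧ (s : ENNReal) < F x} = 0 := by
    intro r s hrs
    set Z := {x | G.M F x ≤ r ∧ (s : ENNReal) < F x}
    have hZ : MeasurableSet Z := (measurableSet_le (G.mM F) measurable_const).inter
      (measurableSet_lt measurable_const hF)
    have h1 : s * μ Z ≤ ∫⁻ x in Z, F x ∂μ := by
      rw [← setLIntegral_const]
      exact setLIntegral_mono' hZ fun x hx => hx.2.le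
    have h2 : ∀ O, Z ⊆ O → IsOpen O → ∫⁻ x in Z, F x ∂μ ≤ r * μ O := by
      intro O hZO hO
      let P : ℤ → X → Prop := fun k x => G.Q k x ⊆ O ∧ (G.Q k x ∩ Z).Nonempty
      have hP : ∀ k x y, G.c k x = G.c k y → P k x → P k y := fun k x y h h' => by
        simp only [P]; rw [← G.Q_eq h]; exact h'
      have hsub : Z ⊆ {x | ∃ k, 0 ≤ k ∧ P k x} := fun x hx => by
        obtain ⟨k0, hk⟩ := G.small O hO x (hZO hx)
        exact ⟨max k0 0, le_max_right _ _, hk _ (le_max_left _ _), x, G.mem_Q _ _, hx⟩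
      have hsub2 : {x | ∃ k, 0 ≤ k ∧ P k x} ⊆ O := fun x ⟨k, _, h, _⟩ => h (G.mem_Q k x)
      calc ∫⁻ x in Z, F x ∂μ ≤ ∫⁻ x in {x | ∃ k, 0 ≤ k ∧ P k x}, F x ∂μ :=
            lintegral_mono_set hsub
        _ = ∑' k, ∫⁻ x in St 0 P k, F x ∂μ := G.lint_St 0 hP F
        _ ≤ ∑' k, ∫⁻ x in St 0 P k, r ∂μ := by
            refine ENNReal.tsum_le_tsum fun k => ?_
            have hs := G.St_sat 0 hP k
            rw [← G.lint_sat hs hF]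
            refine setLIntegral_mono' hs.meas fun x hx => ?_
            obtain ⟨z, hz, hzZ⟩ := hx.2.1.2
            rw [← G.E_eq hz]
            exact (G.E_le_M k F z).trans hzZ.1
        _ = r * μ {x | ∃ k, 0 ≤ k ∧ P k x} := by
            rw [← G.lint_St 0 hP, setLIntegral_const]
        _ ≤ r * μ O := by gcongr
    have hs0 : (s : ENNReal) ≠ 0 := by simpa using (pos_of_gt hrs).ne'
    have hfZ : μ Z ≠ ∞ := by
      intro h
      rw [h, ENNReal.mul_top hs0] at h1
      exact hfin (top_le_iff.1 (h1.trans (setLIntegral_le_lintegral _ _)))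
    by_contra h0
    have h3 : s * μ Z ≤ r * μ Z := by
      refine ENNReal.le_of_forall_pos_le_add fun ε hε _ => ?_
      obtain ⟨O, hZO, hO, hlt⟩ := Z.exists_isOpen_lt_add hfZ
        (ε := ε / (s : ℝ≥0)) (ENNReal.div_pos (by simpa using hε.ne') (by simp)).ne'
      refine (h1.trans (h2 O hZO hO)).trans ?_
      calc (r : ENNReal) * μ O ≤ r * (μ Z + ε / s) := by gcongr
        _ ≤ r * μ Z + s * (ε / s) := by rw [mul_add]; gcongr
        _ = _ := by rw [ENNReal.mul_div_cancel hs0 (by simp)]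
    exact absurd h3 (not_le.2 ((ENNReal.mul_lt_mul_iff_left h0 hfZ).2 (by exact_mod_cast hrs)))
  have : ∀ᵐ x ∂μ, ∀ r s : ℚ, ∀ h0 : 0 ≤ r, ∀ h : r < s,
      ¬ (G.M F x ≤ ofReal r ∧ ofReal s < F x) := by
    rw [ae_all_iff]; intro r; rw [ae_all_iff]; intro s
    rw [ae_all_iff]; intro h0; rw [ae_all_iff]; intro h
    have h0' : (0:ℝ) ≤ r := by exact_mod_cast h0
    have h' : (r:ℝ) < s := by exact_mod_cast h
    have := key (Real.toNNReal r) (Real.toNNReal s) ((Real.toNNReal_lt_toNNReal_iff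
      (h0'.trans_lt h')).2 h')
    rw [ae_iff]; simpa [ofReal] using this
  filter_upwards [this] with x hx
  by_contra hlt
  push Not at hlt
  obtain ⟨s, hs1, hs2, hs3⟩ := ENNReal.lt_iff_exists_rat_btwn.1 hlt
  obtain ⟨r, hr1, hr2, hr3⟩ := ENNReal.lt_iff_exists_rat_btwn.1 hs2
  refine hx r s hr1 ?_ ⟨hr2.le, hs3⟩
  have := (ENNReal.ofReal_lt_ofReal_iff'.1 hr3).1
  exact_mod_cast this

end Grid

lemma lc_low {s : ℝ} (hs : 0 < s) (a : ENNReal) :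
    ∫⁻ l in Ioi (0:ℝ), (if ofReal l < a then ofReal (l ^ (s-1)) else 0)
      = ofReal s⁻¹ * a ^ s := by
  have fin : ∀ b : ℝ, 0 ≤ b →
      ∫⁻ l in Ioi (0:ℝ), (if l < b then ofReal (l ^ (s-1)) else 0)
      = ofReal s⁻¹ * ofReal b ^ s := by
    intro b hb
    have e : (fun l : ℝ => if l < b then ofReal (l ^ (s-1)) else 0)
        = (Iio b).indicator (fun l => ofReal (l ^ (s-1))) := by
      ext l; simp [indicator]
    rw [e, lintegral_indicator measurableSet_Iio, Measure.restrict_restrict measurableSet_Iio,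
      inter_comm, Ioi_inter_Iio, restrict_Ioo_eq_restrict_Ioc]
    have hi : IntervalIntegrable (fun l : ℝ => l ^ (s-1)) volume 0 b :=
      intervalIntegral.intervalIntegrable_rpow' (by linarith)
    rw [← ofReal_integral_eq_lintegral_ofReal ((intervalIntegrable_iff_integrableOn_Ioc_of_le hb).1 hi)
      ((ae_restrict_iff' measurableSet_Ioc).2 (of_forall fun l hl =>
        Real.rpow_nonneg hl.1.le _)), ← intervalIntegral.integral_of_le hb,
      integral_rpow (Or.inl (by linarith)), ENNReal.ofReal_rpow_of_nonneg hb hs.le,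
      ← ENNReal.ofReal_mul (by positivity)]
    congr 1
    rw [sub_add_cancel, Real.zero_rpow hs.ne']; field_simp; ring
  induction a with
  | top =>
    rw [ENNReal.top_rpow_of_pos hs, ENNReal.mul_top (by simpa using hs)]
    refine ENNReal.eq_top_of_forall_nnreal_le fun r => ?_
    have : (r:ENNReal) ≤ ofReal s⁻¹ * ofReal ((s * r) ^ s⁻¹) ^ s := by
      rw [ENNReal.ofReal_rpow_of_nonneg (by positivity) hs.le, ← Real.rpow_mul (by positivity),
        inv_mul_cancel₀ hs.ne', Real.rpow_one, ← ENNReal.ofReal_mul (by positivity),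
        ← mul_assoc, inv_mul_cancel₀ hs.ne', one_mul]
      simp
    refine this.trans ?_
    rw [← fin _ (by positivity)]
    refine lintegral_mono fun l => ?_
    split_ifs <;> simp_all
  | coe b =>
    rw [← ENNReal.ofReal_coe_nnreal, ← fin b b.2]
    refine setLIntegral_congr_fun measurableSet_Ioi fun l hl => ?_
    have : ofReal l < ofReal b ↔ l < b :=
      ENNReal.ofReal_lt_ofReal_iff_of_nonneg (le_of_lt hl)
    simp only [this]

lemma lc_high {p q : ℝ} (hp : 0 < p) (hq : p < q) (a : ENNReal) :
    a ^ q * ∫⁻ l in Ioi (0:ℝ), (if a ≤ ofReal l then ofReal (l ^ (p-1-q)) else 0)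
      ≤ ofReal (q-p)⁻¹ * a ^ p := by
  induction a with
  | top => rw [ENNReal.top_rpow_of_pos (y := p) (by linarith), ENNReal.mul_top (by simpa using hq)]; simp
  | coe b =>
    rcases eq_or_ne b 0 with rfl | hb
    · simp [ENNReal.zero_rpow_of_pos (by linarith : 0 < q)]
    have hb' : (0:ℝ) < b := by positivity
    have : ∫⁻ l in Ioi (0:ℝ), (if (b:ENNReal) ≤ ofReal l then ofReal (l ^ (p-1-q)) else 0)
      = ofReal ((q-p)⁻¹ * (b:ℝ)^(p-q)) := by
      have e : ∀ l ∈ Ioi (0:ℝ), (if (b:ENNReal) ≤ ofReal l then ofReal (l ^ (p-1-q)) else 0)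
        = (Ici (b:ℝ)).indicator (fun l => ofReal (l ^ (p-1-q))) l := by
        intro l hl
        have : (b:ENNReal) ≤ ofReal l ↔ (b:ℝ) ≤ l := by
          rw [← ENNReal.ofReal_coe_nnreal, ENNReal.ofReal_le_ofReal_iff (le_of_lt hl)]
        simp [indicator, this]
      rw [setLIntegral_congr_fun measurableSet_Ioi e, lintegral_indicator measurableSet_Ici,
        Measure.restrict_restrict measurableSet_Ici,
        inter_eq_left.2 (show Ici (b:ℝ) ⊆ Ioi 0 from fun x hx => lt_of_lt_of_le hb' hx), ← restrict_Ioi_eq_restrict_Ici,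
        ← ofReal_integral_eq_lintegral_ofReal (integrableOn_Ioi_rpow_of_lt (by linarith) hb')
        ((ae_restrict_iff' measurableSet_Ioi).2 (of_forall fun l hl =>
        Real.rpow_nonneg (hb'.le.trans (le_of_lt hl)) _)),
        integral_Ioi_rpow_of_lt (by linarith) hb']
      congr 1
      have h1 : p - 1 - q + 1 = p - q := by ring
      have h2 : p - q ≠ 0 := by linarith
      have h3 : q - p ≠ 0 := by linarith
      rw [h1]; field_simp; ring
    rw [this, ← ENNReal.ofReal_coe_nnreal, ENNReal.ofReal_rpow_of_pos hb', ENNReal.ofReal_rpow_of_pos hb',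
      ← ENNReal.ofReal_mul (by positivity), ← ENNReal.ofReal_mul (by
        have := inv_pos.2 (sub_pos.2 hq); positivity)]
    apply le_of_eq; congr 1
    rw [mul_left_comm, ← Real.rpow_add hb']; congr 2; ring

lemma marc {X Y : Type} [MeasurableSpace X] [MeasurableSpace Y] {W : Measure X} {V : Measure Y}
    [SFinite W] [SFinite V] {p q : ℝ} (hp : 1 < p) (hq : p < q) {F : X → ENNReal} {h : Y → ENNReal}
    (hF : Measurable F) (hh : Measurable h) (A : ENNReal)
    (H : ∀ l : ℝ, 0 < l → W {x | ofReal (2*l) < F x} ≤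
      A * (ofReal l⁻¹ * ∫⁻ y in {y | ofReal l < h y}, h y ∂V +
        ofReal (l^(-q)) * ∫⁻ y in {y | h y ≤ ofReal l}, h y ^ q ∂V)) :
    ∫⁻ x, F x ^ p ∂W ≤ A * ofReal (2^p * p * ((p-1)⁻¹ + (q-p)⁻¹)) * ∫⁻ y, h y ^ p ∂V := by
  have hp0 : 0 < p := by linarith
  have e1 : ∀ x, F x ^ p = ofReal (2^p * p) *
      ∫⁻ l in Ioi (0:ℝ), (if ofReal l < F x / 2 then ofReal (l ^ (p-1)) else 0) := by
    intro x
    rw [lc_low hp0, ← mul_assoc, ← ENNReal.ofReal_mul (by positivity), mul_assoc,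
      mul_inv_cancel₀ hp0.ne', mul_one, ← ENNReal.ofReal_rpow_of_pos (by norm_num),
      ← ENNReal.mul_rpow_of_nonneg _ _ hp0.le]
    congr 1
    rw [ENNReal.ofReal_ofNat, ENNReal.mul_div_cancel (by norm_num) (by norm_num)]
  have mj : Measurable fun z : X × ℝ =>
      (if ofReal z.2 < F z.1 / 2 then ofReal (z.2 ^ (p-1)) else 0) :=
    Measurable.ite (measurableSet_lt (by fun_prop) ((hF.comp measurable_fst).div_const _))
      (by fun_prop) measurable_const
  have ma : Measurable fun z : Y × ℝ => (if ofReal z.2 < h z.1 then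
      ofReal (z.2 ^ (p-1-1)) else 0) :=
    Measurable.ite (measurableSet_lt (by fun_prop) (hh.comp measurable_fst))
      (by fun_prop) measurable_const
  have mb : Measurable fun z : Y × ℝ => (if h z.1 ≤ ofReal z.2 then
      ofReal (z.2 ^ (p-1-q)) else 0) :=
    Measurable.ite (measurableSet_le (hh.comp measurable_fst) (by fun_prop))
      (by fun_prop) measurable_const
  have ma' : Measurable fun z : Y × ℝ => h z.1 * (if ofReal z.2 < h z.1 then
      ofReal (z.2 ^ (p-1-1)) else 0) := (hh.comp measurable_fst).mul ma
  have mb' : Measurable fun z : Y × ℝ => h z.1 ^ q * (if h z.1 ≤ ofReal z.2 then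
      ofReal (z.2 ^ (p-1-q)) else 0) := ((hh.comp measurable_fst).pow_const q).mul mb
  simp_rw [e1]
  rw [lintegral_const_mul _ mj.lintegral_prod_right', lintegral_lintegral_swap mj.aemeasurable]
  have step : ∀ l ∈ Ioi (0:ℝ), ∫⁻ x, (if ofReal l < F x / 2 then
        ofReal (l ^ (p-1)) else 0) ∂W ≤
      A * (∫⁻ y, h y * (if ofReal l < h y then ofReal (l ^ (p-1-1)) else 0) ∂V +
      ∫⁻ y, h y ^ q * (if h y ≤ ofReal l then ofReal (l ^ (p-1-q)) else 0) ∂V) := by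
    intro l hl
    have hl : 0 < l := hl
    have e2 : ∫⁻ x, (if ofReal l < F x / 2 then
        ofReal (l ^ (p-1)) else 0) ∂W =
        ofReal (l ^ (p-1)) * W {x | ofReal (2*l) < F x} := by
      rw [← lintegral_indicator_const (measurableSet_lt measurable_const hF)]
      refine lintegral_congr fun x => ?_
      have : ofReal l < F x / 2 ↔ ofReal (2*l) < F x := by
        rw [ENNReal.lt_div_iff_mul_lt (by simp) (by simp), ENNReal.ofReal_mul (by norm_num), mul_comm]
        simp
      simp only [this, indicator, mem_setOf_eq]
    rw [e2]
    refine (mul_le_mul_right (H l hl) _).trans ?_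
    rw [mul_left_comm]
    gcongr
    rw [mul_add]
    gcongr
    · rw [← mul_assoc, ← ENNReal.ofReal_mul (by positivity),
        ← lintegral_const_mul _ hh, ← lintegral_indicator (measurableSet_lt measurable_const hh)]
      refine lintegral_mono fun y => ?_
      simp only [indicator, mem_setOf_eq]
      split_ifs
      · rw [mul_comm]; gcongr
        rw [← Real.rpow_neg_one l, ← Real.rpow_add hl]; rfl
      · simp
    · rw [← mul_assoc, ← ENNReal.ofReal_mul (by positivity),
        ← lintegral_const_mul _ (hh.pow_const q), ← lintegral_indicator (measurableSet_le hh measurable_const)]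
      refine lintegral_mono fun y => ?_
      simp only [indicator, mem_setOf_eq]
      split_ifs
      · rw [mul_comm]; gcongr
        rw [← Real.rpow_add hl]; rfl
      · simp
  refine (mul_le_mul_right (setLIntegral_mono' measurableSet_Ioi step) _).trans ?_
  have mA : Measurable fun l : ℝ => ∫⁻ y, h y * (if ofReal l < h y then
      ofReal (l ^ (p-1-1)) else 0) ∂V := ma'.lintegral_prod_left'
  have mB : Measurable fun l : ℝ => ∫⁻ y, h y ^ q * (if h y ≤ ofReal l then
      ofReal (l ^ (p-1-q)) else 0) ∂V := mb'.lintegral_prod_left'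
  have sw1 := lintegral_lintegral_swap (μ := V) (ν := volume.restrict (Ioi (0:ℝ)))
    (f := fun y l => h y * (if ofReal l < h y then
      ofReal (l ^ (p-1-1)) else 0)) ma'.aemeasurable
  have sw2 := lintegral_lintegral_swap (μ := V) (ν := volume.restrict (Ioi (0:ℝ)))
    (f := fun y l => h y ^ q * (if h y ≤ ofReal l then
      ofReal (l ^ (p-1-q)) else 0)) mb'.aemeasurable
  rw [lintegral_const_mul _ (mA.fun_add mB), lintegral_add_left mA, ← sw1, ← sw2]
  have i1 : ∀ y, ∫⁻ l in Ioi (0:ℝ), h y * (if ofReal l < h y then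
      ofReal (l ^ (p-1-1)) else 0) ≤ ofReal (p-1)⁻¹ * h y ^ p := by
    intro y
    rw [lintegral_const_mul (f := fun l => if ofReal l < h y then ofReal (l ^ (p-1-1)) else 0) _
      (ma.comp measurable_prodMk_left), lc_low (by linarith)]
    rw [mul_left_comm]
    gcongr
    nth_rewrite 1 [← ENNReal.rpow_one (h y)]
    rw [← ENNReal.rpow_add_of_nonneg _ _ (by norm_num) (by linarith)]
    simp
  have i2 : ∀ y, ∫⁻ l in Ioi (0:ℝ), h y ^ q * (if h y ≤ ofReal l then
      ofReal (l ^ (p-1-q)) else 0) ≤ ofReal (q-p)⁻¹ * h y ^ p := by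
    intro y
    rw [lintegral_const_mul (f := fun l => if h y ≤ ofReal l then ofReal (l ^ (p-1-q)) else 0) _
      (mb.comp measurable_prodMk_left)]
    exact lc_high hp0 hq _
  have j1 := lintegral_mono (μ := V) i1
  have j2 := lintegral_mono (μ := V) i2
  rw [lintegral_const_mul _ (hh.pow_const p)] at j1 j2
  refine (mul_le_mul_right (mul_le_mul_right (add_le_add j1 j2) _) _).trans ?_
  rw [← add_mul, ← ENNReal.ofReal_add (by simp; linarith) (by simp; linarith),
    ENNReal.ofReal_mul (p := 2^p*p) (by positivity)]
  apply le_of_eq; ring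

lemma conv_holder {X : Type} [MeasurableSpace X] {μ : Measure X} [SigmaFinite μ] {r r' : ℝ}
    (hr : r.HolderConjugate r') {H : X → ENNReal} (hH : Measurable H) {K : ENNReal}
    (h : ∀ w : X → ENNReal, Measurable w → ∫⁻ x, H x * w x ∂μ ≤ K * (∫⁻ x, w x ^ r' ∂μ) ^ (1/r')) :
    (∫⁻ x, H x ^ r ∂μ) ≤ K ^ r := by
  have hr0 := hr.pos
  let f : ℕ → X → ENNReal := fun n => (spanningSets μ n).indicator fun x => min (H x) n
  have hf : ∀ n, Measurable (f n) := fun n =>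
    (hH.min measurable_const).indicator (measurableSet_spanningSets μ n)
  have hfm : Monotone f := by
    intro m n hmn x
    simp only [f]
    by_cases hx : x ∈ spanningSets μ m
    · rw [indicator_of_mem hx, indicator_of_mem (monotone_spanningSets μ hmn hx)]
      gcongr
    · rw [indicator_of_notMem hx]; simp
  have hsup : ∀ x, H x ^ r = ⨆ n, f n x ^ r := by
    intro x
    apply le_antisymm
    · have : H x = ⨆ n, f n x := by
        apply le_antisymm
        · refine le_of_forall_lt fun a ha => ?_
          obtain ⟨m, hm⟩ := ENNReal.exists_nat_gt ha.ne_top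
          have hx : x ∈ spanningSets μ (max m (spanningSetsIndex μ x)) :=
            monotone_spanningSets μ (le_max_right _ _) (mem_spanningSetsIndex μ x)
          refine lt_iSup_iff.2 ⟨max m (spanningSetsIndex μ x), ?_⟩
          simp only [f]; rw [indicator_of_mem hx, lt_min_iff]
          exact ⟨ha, hm.trans_le (by exact_mod_cast le_max_left _ _)⟩
        · exact iSup_le fun n => by
            simp only [f]; exact (indicator_le_self' (by simp) x).trans (min_le_left _ _)
      rw [this, ← ENNReal.orderIsoRpow_apply r hr0, OrderIso.map_iSup]
      rfl
    · refine iSup_le fun n => ENNReal.rpow_le_rpow ?_ hr0.le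
      simp only [f]; exact (indicator_le_self' (by simp) x).trans (min_le_left _ _)
  simp_rw [hsup]
  rw [lintegral_iSup (fun n => (hf n).pow_const r)
    (fun m n hmn x => ENNReal.rpow_le_rpow (hfm hmn x) hr0.le)]
  refine iSup_le fun n => ?_
  set J := ∫⁻ x, f n x ^ r ∂μ
  have hJ : J ≠ ∞ := by
    have : J ≤ ∫⁻ x in spanningSets μ n, (n:ENNReal) ^ r ∂μ := by
      rw [← lintegral_indicator (measurableSet_spanningSets μ n)]
      refine lintegral_mono fun x => ?_
      simp only [f, indicator]
      split_ifs
      · exact ENNReal.rpow_le_rpow (min_le_right _ _) hr0.le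
      · simp [hr0]
    refine ne_top_of_le_ne_top ?_ this
    rw [setLIntegral_const]
    exact ENNReal.mul_ne_top (ENNReal.rpow_ne_top_of_nonneg hr0.le (by simp))
      (measure_spanningSets_lt_top μ n).ne
  have hr1 := hr.sub_one_pos
  have h1 := h (fun x => f n x ^ (r-1)) ((hf n).pow_const _)
  have e : ∀ x, (f n x ^ (r-1)) ^ r' = f n x ^ r := fun x => by
    rw [← ENNReal.rpow_mul, hr.sub_one_mul_conj]
  have h2 : J ≤ ∫⁻ x, H x * f n x ^ (r-1) ∂μ := by
    refine lintegral_mono fun x => ?_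
    have : f n x ^ r = f n x * f n x ^ (r-1) := by
      nth_rewrite 2 [← ENNReal.rpow_one (f n x)]
      rw [← ENNReal.rpow_add_of_nonneg _ _ (by norm_num) hr1.le]; simp
    rw [this]; gcongr
    simp only [f]; exact (indicator_le_self' (by simp) x).trans (min_le_left _ _)
  simp only [e] at h1
  have h3 : J ≤ K * J ^ (1/r') := h2.trans h1
  rcases eq_or_ne J 0 with h0 | h0
  · rw [h0]; simp
  have h4 : J ^ (1/r) ≤ K := by
    have : J = J ^ (1/r) * J ^ (1/r') := by
      rw [← ENNReal.rpow_add _ _ h0 hJ, one_div, one_div, hr.inv_add_inv_eq_one, ENNReal.rpow_one]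
    nth_rewrite 1 [this] at h3
    exact (ENNReal.mul_le_mul_iff_left (by simp [h0, hJ]) (by
      exact ENNReal.rpow_ne_top_of_nonneg (by simp [hr.symm.nonneg]) hJ)).1 h3
  calc J = (J ^ (1/r)) ^ r := by rw [← ENNReal.rpow_mul, one_div, inv_mul_cancel₀ hr0.ne', ENNReal.rpow_one]
    _ ≤ K ^ r := ENNReal.rpow_le_rpow h4 hr0.le

lemma le_inv_mul_of {l a b : ENNReal} (h0 : l ≠ 0) (h1 : l ≠ ∞) (h : l * a ≤ b) : a ≤ l⁻¹ * b := by
  rw [← ENNReal.inv_mul_le_iff (by simpa using h1) (by simpa using h0), inv_inv]; exact h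

def cM (p : ℝ) : ENNReal := ofReal (2^p * p * ((p-1)⁻¹ + (p+1-p)⁻¹))

lemma cM_top (p : ℝ) : cM p ≠ ∞ := ENNReal.ofReal_ne_top

lemma cM_marc {X : Type} [MeasurableSpace X] {W V : Measure X}
    [SFinite W] [SFinite V] {p : ℝ} (hp : 1 < p) {F : X → ENNReal} {h : X → ENNReal}
    (hF : Measurable F) (hh : Measurable h)
    (H : ∀ l : ℝ, 0 < l → ofReal l * W {x | ofReal (2*l) < F x} ≤
        ∫⁻ y in {y | ofReal l < h y}, h y ∂V) :
    ∫⁻ x, F x ^ p ∂W ≤ cM p * ∫⁻ y, h y ^ p ∂V := by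
  have := marc (W := W) (V := V) hp (by linarith : p < p + 1) hF hh 1 (fun l hl => by
    rw [one_mul]
    refine le_add_right ?_
    rw [ENNReal.ofReal_inv_of_pos hl]
    exact le_inv_mul_of (by simpa using hl) (by simp) (H l hl))
  simpa [cM] using this

namespace Grid
variable {X : Type} [TopologicalSpace X] [MeasurableSpace X] {μ : Measure X} (G : Grid X μ)

lemma ind_le_add {g : X → ENNReal} (l : ENNReal) (x) :
    g x ≤ {y | l < g y}.indicator g x + l := by
  by_cases h : l < g x
  · rw [indicator_of_mem (by exact h)]; exact le_self_add
  · exact (not_lt.1 h).trans le_add_self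

lemma wstrong [SFinite μ] {q : ℝ} (hq : 1 < q) {g w : X → ENNReal} (hg : Measurable g)
    (hw : Measurable w) :
    ∫⁻ x, w x * G.M g x ^ q ∂μ ≤ cM q * ∫⁻ x, G.M w x * g x ^ q ∂μ := by
  have hmw := G.mM w
  have hmg := G.mM g
  have := cM_marc (W := μ.withDensity w) (V := μ.withDensity (G.M w)) hq hmg hg (fun l hl => by
    have hs : MeasurableSet {y | ofReal l < g y} := measurableSet_lt measurable_const hg
    have hm := measurableSet_lt (measurable_const (a := ofReal (2*l))) hmg
    rw [setLIntegral_withDensity_eq_setLIntegral_mul _ hmw hg hs, withDensity_apply _ hm,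
      ← lintegral_indicator hs]
    refine le_trans ?_ ((G.weak (hg.indicator hs) hw (ofReal l)).trans (le_of_eq ?_))
    · gcongr 1
      refine lintegral_mono_set fun x hx => ?_
      simp only [mem_setOf_eq] at hx ⊢
      rw [two_mul, ENNReal.ofReal_add hl.le hl.le] at hx
      have h1 := hx.trans_le (G.M_mono (ind_le_add (g := g) (ofReal l)) _)
      have h2 := h1.trans_le (G.M_add (hg.indicator hs) _)
      rw [M_one] at h2
      exact lt_of_add_lt_add_right h2
    · congr 1; ext x
      simp only [indicator, Pi.mul_apply]
      split_ifs <;> simp [mul_comm])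
  rwa [lintegral_withDensity_eq_lintegral_mul _ hw (hmg.pow_const q),
    lintegral_withDensity_eq_lintegral_mul _ hmw (hg.pow_const q)] at this

lemma strong [SFinite μ] {q : ℝ} (hq : 1 < q) {g : X → ENNReal} (hg : Measurable g) :
    ∫⁻ x, G.M g x ^ q ∂μ ≤ cM q * ∫⁻ x, g x ^ q ∂μ := by
  have := G.wstrong hq hg (w := fun _ => 1) measurable_const
  simpa [M_one] using this

lemma lint_Q_lt {F : X → ENNReal} {p : ℝ} (hp : 1 ≤ p) (hF : ∫⁻ x, F x ^ p ∂μ ≠ ∞) (k x) :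
    ∫⁻ y in G.Q k x, F y ∂μ ≠ ∞ := by
  have : ∫⁻ y in G.Q k x, F y ∂μ ≤ ∫⁻ y in G.Q k x, (1 + F y ^ p) ∂μ := by
    refine lintegral_mono fun y => ?_
    rcases le_total (F y) 1 with h | h
    · exact h.trans le_self_add
    · refine le_trans ?_ le_add_self
      nth_rewrite 1 [← ENNReal.rpow_one (F y)]
      exact ENNReal.rpow_le_rpow_of_exponent_le h hp
  refine ne_top_of_le_ne_top ?_ this
  rw [lintegral_add_left measurable_const, setLIntegral_const, vol']
  exact ENNReal.add_ne_top.2 ⟨by simp [G.vt], ne_top_of_le_ne_top hF (setLIntegral_le_lintegral _ _)⟩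

lemma diff' [OpensMeasurableSpace X] [μ.OuterRegular] {F : X → ENNReal} (hF : Measurable F)
    (hfin : ∀ x, ∫⁻ y in G.Q 0 x, F y ∂μ ≠ ∞) : ∀ᵐ x ∂μ, F x ≤ G.M F x := by
  haveI := G.cI
  have : ∀ i : G.I, ∀ᵐ x ∂μ, {x | G.c 0 x = i}.indicator F x ≤
      G.M ({x | G.c 0 x = i}.indicator F) x := by
    intro i
    refine G.diff (hF.indicator (G.meas 0 i)) ?_
    rw [lintegral_indicator (G.meas 0 i)]
    by_cases h : ∃ x, G.c 0 x = i
    · obtain ⟨x, rfl⟩ := h; exact hfin x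
    · push Not at h
      have : {x | G.c 0 x = i} = ∅ := by ext x; simp [h x]
      simp [this]
  rw [← ae_all_iff] at this
  filter_upwards [this] with x hx
  have := hx (G.c 0 x)
  rw [indicator_of_mem (by simp)] at this
  exact this.trans (G.M_mono (fun y => indicator_le_self' (by simp) y) x)

def cK (θ : ℝ) : ENNReal := 2 + ofReal θ * ofReal (1-θ)⁻¹

lemma coif [SFinite μ] {F : X → ENNReal} (hF : Measurable F) {θ : ℝ} (h0 : 0 < θ) (h1 : θ < 1) (k x) :
    G.E k (fun y => G.M F y ^ θ) x ≤ cK θ * G.M F x ^ θ := by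
  set A := G.M F x
  set S := G.Q k x
  have hS : MeasurableSet S := G.mQ k x
  set f := S.indicator F
  have hf : Measurable f := hF.indicator hS
  have hmf := G.mM f
  have b1 : ∀ y ∈ S, G.M F y ^ θ ≤ G.M f y ^ θ + A ^ θ := by
    intro y hy
    have : G.M F y ≤ max (G.M f y) A := by
      refine iSup_le fun j => ?_
      rcases le_total k j with h | h
      · refine le_max_of_le_left (le_trans (le_of_eq ?_) (G.E_le_M j f y))
        unfold E
        congr 1
        refine setLIntegral_congr_fun (G.mQ j y) fun z hz => ?_
        have : z ∈ S := Eq.trans (G.nest' h hz) hy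
        simp only [f]
        rw [indicator_of_mem this]
      · exact le_max_of_le_right ((G.E_eq (G.nest' h hy) F).le.trans (G.E_le_M j F x))
    rcases le_max_iff.1 this with h | h
    · exact (ENNReal.rpow_le_rpow h h0.le).trans le_self_add
    · exact (ENNReal.rpow_le_rpow h h0.le).trans le_add_self
  have hv : ∫⁻ y, f y ∂μ ≤ G.v k * A := by
    rw [lintegral_indicator hS, lint_E]; gcongr; exact G.E_le_M _ _ _
  have wk : ∀ l : ℝ, 0 < l → μ (S ∩ {y | ofReal l < G.M f y}) ≤
      G.v k * (if ofReal l < A then 1 else 0) +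
      G.v k * A * (if A ≤ ofReal l then ofReal l⁻¹ else 0) := by
    intro l hl
    by_cases h : ofReal l < A
    · simp only [h, if_true, mul_one]
      exact (measure_mono inter_subset_left).trans ((G.vol' k x).le.trans le_self_add)
    · simp only [h, if_false, mul_zero, zero_add, not_lt.1 h, if_true]
      have := (G.weak1 hf (ofReal l)).trans hv
      rw [ENNReal.ofReal_inv_of_pos hl, mul_comm (G.v k * A)]
      refine le_inv_mul_of (by simpa using hl) (by simp) (le_trans ?_ this)
      gcongr; exact inter_subset_right
  have e1 : ∀ y, G.M f y ^ θ = ofReal θ * ∫⁻ l in Ioi (0:ℝ),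
      (if ofReal l < G.M f y then ofReal (l ^ (θ-1)) else 0) := fun y => by
    rw [lc_low h0, ← mul_assoc, ← ENNReal.ofReal_mul h0.le, mul_inv_cancel₀ h0.ne']; simp
  have mj : Measurable fun z : X × ℝ =>
      (if ofReal z.2 < G.M f z.1 then ofReal (z.2 ^ (θ-1)) else 0) :=
    Measurable.ite (measurableSet_lt (by fun_prop) (hmf.comp measurable_fst))
      (by fun_prop) measurable_const
  have b2 : ∫⁻ y in S, G.M f y ^ θ ∂μ ≤ G.v k * ((1 + ofReal θ * ofReal (1-θ)⁻¹) * A ^ θ) := by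
    simp_rw [e1]
    rw [lintegral_const_mul _ mj.lintegral_prod_right', lintegral_lintegral_swap mj.aemeasurable]
    have st : ∀ l ∈ Ioi (0:ℝ), ∫⁻ y in S, (if ofReal l < G.M f y then
        ofReal (l ^ (θ-1)) else 0) ∂μ ≤
        G.v k * (if ofReal l < A then ofReal (l ^ (θ-1)) else 0) +
        G.v k * A * (if A ≤ ofReal l then ofReal (l ^ (θ-1-1)) else 0) := by
      intro l hl
      have hl : 0 < l := hl
      have e2 : ∫⁻ y in S, (if ofReal l < G.M f y then
        ofReal (l ^ (θ-1)) else 0) ∂μ = ofReal (l ^ (θ-1)) *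
          μ (S ∩ {y | ofReal l < G.M f y}) := by
        have hm := measurableSet_lt (measurable_const (a := ofReal l)) hmf
        rw [inter_comm, ← Measure.restrict_apply hm, ← lintegral_indicator_const hm]
        exact lintegral_congr fun y => by simp [indicator]
      rw [e2]
      refine (mul_le_mul_right (wk l hl) _).trans ?_
      rw [mul_add, Real.rpow_sub_one hl.ne' (θ-1), div_eq_mul_inv,
        ENNReal.ofReal_mul (Real.rpow_nonneg hl.le _)]
      refine add_le_add ?_ ?_
      · split_ifs <;> simp [mul_comm]
      · split_ifs
        · apply le_of_eq; ring
        · simp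
    refine (mul_le_mul_right (setLIntegral_mono' measurableSet_Ioi st) _).trans ?_
    have m1 : Measurable fun l : ℝ => (if ofReal l < A then ofReal (l ^ (θ-1)) else 0) :=
      Measurable.ite (measurableSet_lt (by fun_prop) measurable_const) (by fun_prop) measurable_const
    have m2 : Measurable fun l : ℝ => (if A ≤ ofReal l then ofReal (l ^ (θ-1-1)) else 0) :=
      Measurable.ite (measurableSet_le measurable_const (by fun_prop)) (by fun_prop) measurable_const
    rw [lintegral_add_left (m1.const_mul _), lintegral_const_mul _ m1, lintegral_const_mul _ m2, lc_low h0]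
    have := lc_high h0 h1 A
    rw [ENNReal.rpow_one] at this
    calc _ ≤ ofReal θ * (G.v k * (ofReal θ⁻¹ * A ^ θ) +
          G.v k * (ofReal (1-θ)⁻¹ * A ^ θ)) := by
          rw [mul_assoc (G.v k) A]; gcongr
      _ = G.v k * ((ofReal θ * ofReal θ⁻¹ + ofReal θ * ofReal (1-θ)⁻¹) * A ^ θ) := by ring
      _ = _ := by rw [← ENNReal.ofReal_mul h0.le, mul_inv_cancel₀ h0.ne', ENNReal.ofReal_one]
  unfold E
  rw [ENNReal.inv_mul_le_iff (G.v0 k) (G.vt k)]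
  refine (setLIntegral_mono' hS b1).trans ?_
  rw [lintegral_add_left (hmf.pow_const _), setLIntegral_const, vol']
  refine (add_le_add_left b2 _).trans (le_of_eq ?_)
  unfold cK; ring

lemma weakA1 {g σ : X → ENNReal} (hg : Measurable g) (hσ : Measurable σ) (l C : ENNReal)
    (hA : ∀ k x, G.E k σ x ≤ C * σ x) :
    l * ∫⁻ x in {x | l * C * σ x < G.M g x}, σ x ∂μ ≤ ∫⁻ x, g x ∂μ := by
  have key : ∀ n : ℕ, l * ∫⁻ x in {x | ∃ k, -(n:ℤ) ≤ k ∧ l * G.E k σ x < G.E k g x}, σ x ∂μ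
      ≤ ∫⁻ x, g x ∂μ := by
    intro n
    have hP : ∀ k x y, G.c k x = G.c k y → l * G.E k σ x < G.E k g x → l * G.E k σ y < G.E k g y :=
      fun k x y h h' => by rwa [← G.E_eq h, ← G.E_eq h]
    refine le_trans ?_ (setLIntegral_le_lintegral {x | ∃ k, -(n:ℤ) ≤ k ∧ l * G.E k σ x < G.E k g x} _)
    rw [G.lint_St _ hP, G.lint_St _ hP, ← ENNReal.tsum_mul_left]
    refine ENNReal.tsum_le_tsum fun k => ?_
    have hs := G.St_sat (-(n:ℤ)) hP k
    rw [← G.lint_sat hs hσ, ← G.lint_sat hs hg, ← lintegral_const_mul _ (G.mE k σ)]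
    exact setLIntegral_mono' hs.meas fun x hx => hx.2.1.le
  have hm : ∀ n : ℕ, MeasurableSet {x | ∃ k, -(n:ℤ) ≤ k ∧ l * G.E k σ x < G.E k g x} := fun n => by
    have : {x | ∃ k, -(n:ℤ) ≤ k ∧ l * G.E k σ x < G.E k g x} =
        ⋃ k, ⋃ (_ : -(n:ℤ) ≤ k), {x | l * G.E k σ x < G.E k g x} := by ext x; simp
    rw [this]
    exact MeasurableSet.iUnion fun k => MeasurableSet.iUnion fun _ =>
      measurableSet_lt ((G.mE k σ).const_mul _) (G.mE k g)
  have hU : {x | l * C * σ x < G.M g x} ⊆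
      ⋃ n : ℕ, {x | ∃ k, -(n:ℤ) ≤ k ∧ l * G.E k σ x < G.E k g x} := by
    intro x hx
    simp only [mem_setOf_eq, mem_iUnion, M, lt_iSup_iff] at hx ⊢
    obtain ⟨k, hk⟩ := hx
    refine ⟨k.natAbs, k, by omega, lt_of_le_of_lt ?_ hk⟩
    rw [mul_assoc]; gcongr; exact hA k x
  refine (mul_le_mul_right (lintegral_mono_set hU) _).trans ?_
  rw [← withDensity_apply _ (MeasurableSet.iUnion hm),
    Monotone.measure_iUnion, ENNReal.mul_iSup]
  · refine iSup_le fun n => ?_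
    rw [withDensity_apply _ (hm n)]; exact key n
  · intro m n h x ⟨k, hk, h'⟩
    exact ⟨k, by omega, h'⟩

lemma A1strong [SFinite μ] {q : ℝ} (hq : 1 < q) {g σ : X → ENNReal} (hg : Measurable g) (hσ : Measurable σ)
    {C : ENNReal} (hC0 : C ≠ 0) (hC : C ≠ ∞) (hA : ∀ k x, G.E k σ x ≤ C * σ x)
    (hp : ∀ x, σ x ≠ 0) (hf : ∀ᵐ x ∂μ, σ x ≠ ∞) :
    ∫⁻ x, G.M g x ^ q * σ x ^ (1-q) ∂μ ≤ C ^ q * cM q * ∫⁻ x, g x ^ q * σ x ^ (1-q) ∂μ := by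
  have q0 : 0 < q := by linarith
  have hmg := G.mM g
  have hd : Measurable fun x => g x / σ x := hg.div hσ
  have hD : Measurable fun x => G.M g x / (C * σ x) := hmg.div (hσ.const_mul C)
  have := cM_marc (W := μ.withDensity σ) (V := μ.withDensity σ) hq
    (F := fun x => G.M g x / (C * σ x)) (h := fun x => g x / σ x) hD hd (fun l hl => by
    have hs : MeasurableSet {y | ofReal l < g y / σ y} := measurableSet_lt measurable_const hd
    have hm := measurableSet_lt (measurable_const (a := ofReal (2*l))) hD
    rw [setLIntegral_withDensity_eq_setLIntegral_mul _ hσ hd hs, withDensity_apply _ hm,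
      ← lintegral_indicator hs]
    set f := {y | ofReal l < g y / σ y}.indicator g
    have hfm : Measurable f := hg.indicator hs
    have hle : ∀ y, g y ≤ f y + ofReal l * σ y := by
      intro y
      by_cases h : ofReal l < g y / σ y
      · simp only [f]; rw [indicator_of_mem (by exact h)]; exact le_self_add
      · refine le_trans ?_ le_add_self
        rcases eq_or_ne (σ y) ∞ with h' | h'
        · rw [h', ENNReal.mul_top (by simpa using hl)]; exact le_top
        · exact (ENNReal.div_le_iff (hp y) h').1 (not_lt.1 h)
    have hM : ∀ x, G.M g x ≤ G.M f x + ofReal l * C * σ x := by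
      intro x
      refine (G.M_mono hle x).trans ((G.M_add hfm x).trans ?_)
      gcongr
      refine iSup_le fun k => ?_
      have : G.E k (fun y => ofReal l * σ y) x = ofReal l * G.E k σ x := by
        unfold E; rw [lintegral_const_mul _ hσ]; ring
      rw [this, mul_assoc]; gcongr; exact hA k x
    refine le_trans ?_ ((G.weakA1 hfm hσ (ofReal l) C hA).trans (le_of_eq ?_))
    · gcongr 1
      have hm' : MeasurableSet {x | ofReal l * C * σ x < G.M f x} :=
        measurableSet_lt (hσ.const_mul _) (G.mM f)
      rw [← lintegral_indicator hm, ← lintegral_indicator hm']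
      refine lintegral_mono_ae ?_
      filter_upwards [hf] with x hx
      by_cases h : ofReal (2*l) < G.M g x / (C * σ x)
      · rw [indicator_of_mem (by exact h), indicator_of_mem]
        have h2 := (ENNReal.lt_div_iff_mul_lt (Or.inl (mul_ne_zero hC0 (hp x)))
          (Or.inl (ENNReal.mul_ne_top hC hx))).1 h
        rw [two_mul, ENNReal.ofReal_add hl.le hl.le, add_mul, ← mul_assoc] at h2
        exact lt_of_add_lt_add_right (h2.trans_le (hM x))
      · rw [indicator_of_notMem (by exact h)]; simp
    · refine lintegral_congr_ae ?_
      filter_upwards [hf] with x hx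
      simp only [f, indicator, Pi.mul_apply]
      split_ifs
      · rw [ENNReal.mul_div_cancel (hp x) hx]
      · rfl)
  rw [lintegral_withDensity_eq_lintegral_mul _ hσ (hD.pow_const q),
    lintegral_withDensity_eq_lintegral_mul _ hσ (hd.pow_const q)] at this
  have e : ∀ (a : X → ENNReal) x, σ x ≠ ∞ → σ x * (a x / σ x) ^ q = a x ^ q * σ x ^ (1-q) := by
    intro a x hx
    rw [ENNReal.div_rpow_of_nonneg _ _ q0.le, ENNReal.rpow_sub _ _ (hp x) hx, ENNReal.rpow_one,
      div_eq_mul_inv, div_eq_mul_inv]; ring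
  have e1 : ∫⁻ x, g x ^ q * σ x ^ (1-q) ∂μ = ∫⁻ x, (σ * fun x => (g x / σ x) ^ q) x ∂μ := by
    refine lintegral_congr_ae ?_
    filter_upwards [hf] with x hx
    simp only [Pi.mul_apply]; exact (e g x hx).symm
  have e2 : ∫⁻ x, G.M g x ^ q * σ x ^ (1-q) ∂μ = C ^ q * ∫⁻ x, (σ * fun x => (G.M g x / (C * σ x)) ^ q) x ∂μ := by
    rw [← lintegral_const_mul _ (hσ.mul (hD.pow_const q))]
    refine lintegral_congr_ae ?_
    filter_upwards [hf] with x hx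
    simp only [Pi.mul_apply]
    rw [← e (G.M g) x hx, mul_left_comm, ← ENNReal.mul_rpow_of_nonneg _ _ q0.le]
    congr 2
    rw [div_eq_mul_inv, div_eq_mul_inv, ENNReal.mul_inv (Or.inl hC0) (Or.inl hC),
      show C * (G.M g x * (C⁻¹ * (σ x)⁻¹)) = C * C⁻¹ * (G.M g x * (σ x)⁻¹) by ring,
      ENNReal.mul_inv_cancel hC0 hC, one_mul]
  rw [e1, e2, mul_assoc]; gcongr

lemma mMj {T : Type} [MeasurableSpace T] [SFinite μ] {g : T × X → ENNReal} (hg : Measurable g) :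
    Measurable fun z : T × X => G.M (fun y => g (z.1, y)) z.2 := by
  refine Measurable.iSup fun k => ?_
  haveI := G.cI
  letI : MeasurableSpace G.I := ⊤
  have hc : Measurable (G.c k) := measurable_to_countable' fun i => G.meas k i
  have h2 : Measurable fun z : T × G.I => (G.v k)⁻¹ * ∫⁻ y in {y | G.c k y = z.2}, g (z.1, y) ∂μ := by
    refine measurable_from_prod_countable_left fun i => ?_
    exact (Measurable.lintegral_prod_right' (ν := μ.restrict {y | G.c k y = i}) hg).const_mul _
  exact h2.comp (measurable_fst.prodMk (hc.comp measurable_snd))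

set_option maxHeartbeats 1000000 in
lemma mixA [SigmaFinite μ] {T : Type} [MeasurableSpace T] {ν : Measure T} [SFinite ν]
    {p q : ℝ} (hq : 1 < q) (hpq : q < p) :
    ∃ C : ENNReal, C ≠ ∞ ∧ ∀ g : T × X → ENNReal, Measurable g →
    ∫⁻ x, (∫⁻ t, G.M (fun y => g (t, y)) x ^ q ∂ν) ^ (p/q) ∂μ ≤
      C * ∫⁻ x, (∫⁻ t, g (t, x) ^ q ∂ν) ^ (p/q) ∂μ := by
  have q0 : 0 < q := by linarith
  have hr1 : 1 < p/q := by rw [lt_div_iff₀ q0]; linarith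
  have hr := Real.HolderConjugate.conjExponent hr1
  set r := p/q
  set r' := r.conjExponent
  refine ⟨(cM q * cM r' ^ (1/r')) ^ r, ENNReal.rpow_ne_top_of_nonneg hr.nonneg
    (ENNReal.mul_ne_top (cM_top _) (ENNReal.rpow_ne_top_of_nonneg (by simp [hr.symm.nonneg]) (cM_top _))),
    fun g hg => ?_⟩
  have mM := G.mMj hg
  have mh : Measurable fun x => ∫⁻ t, g (t, x) ^ q ∂ν := (hg.pow_const q).lintegral_prod_left'
  have := conv_holder (μ := μ) hr (H := fun x => ∫⁻ t, G.M (fun y => g (t, y)) x ^ q ∂ν)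
    (mM.pow_const q).lintegral_prod_left'
    (K := cM q * cM r' ^ (1/r') * (∫⁻ x, (∫⁻ t, g (t, x) ^ q ∂ν) ^ r ∂μ) ^ (1/r)) (fun w hw => by
    calc ∫⁻ x, (∫⁻ t, G.M (fun y => g (t, y)) x ^ q ∂ν) * w x ∂μ
        = ∫⁻ t, ∫⁻ x, w x * G.M (fun y => g (t, y)) x ^ q ∂μ ∂ν := by
          have hm : Measurable fun z : X × T => w z.1 * G.M (fun y => g (z.2, y)) z.1 ^ q :=
            (hw.comp measurable_fst).mul ((mM.pow_const q).comp measurable_swap)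
          rw [← lintegral_lintegral_swap hm.aemeasurable]
          refine lintegral_congr fun x => ?_
          exact (mul_comm _ _).trans (lintegral_const_mul (w x)
            ((mM.pow_const q).comp (measurable_prodMk_right (y := x)))).symm
      _ ≤ ∫⁻ t, cM q * ∫⁻ x, G.M w x * g (t, x) ^ q ∂μ ∂ν :=
          lintegral_mono fun t => G.wstrong hq (hg.comp measurable_prodMk_left) hw
      _ = cM q * ∫⁻ x, ((fun x => ∫⁻ t, g (t, x) ^ q ∂ν) * G.M w) x ∂μ := by
          have hm : Measurable fun z : X × T => G.M w z.1 * g (z.2, z.1) ^ q :=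
            ((G.mM w).comp measurable_fst).mul ((hg.pow_const q).comp measurable_swap)
          rw [lintegral_const_mul _ hm.lintegral_prod_left', ← lintegral_lintegral_swap hm.aemeasurable]
          congr 1
          refine lintegral_congr fun x => ?_
          exact (lintegral_const_mul (G.M w x)
            ((hg.pow_const q).comp (measurable_prodMk_right (y := x)))).trans (mul_comm _ _)
      _ ≤ cM q * ((∫⁻ x, (∫⁻ t, g (t, x) ^ q ∂ν) ^ r ∂μ) ^ (1/r) * (∫⁻ x, G.M w x ^ r' ∂μ) ^ (1/r')) := by
          gcongr
          exact ENNReal.lintegral_mul_le_Lp_mul_Lq μ hr mh.aemeasurable (G.mM w).aemeasurable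
      _ ≤ cM q * ((∫⁻ x, (∫⁻ t, g (t, x) ^ q ∂ν) ^ r ∂μ) ^ (1/r) *
            (cM r' * ∫⁻ x, w x ^ r' ∂μ) ^ (1/r')) := by
          have := hr.symm.nonneg
          gcongr
          exact G.strong hr.symm.lt hw
      _ = _ := by
          rw [ENNReal.mul_rpow_of_nonneg _ _ (by simp [hr.symm.nonneg])]; ring)
  refine this.trans (le_of_eq ?_)
  rw [ENNReal.mul_rpow_of_nonneg _ _ hr.nonneg]
  congr 1
  rw [← ENNReal.rpow_mul, one_div, inv_mul_cancel₀ hr.ne_zero, ENNReal.rpow_one]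

lemma mixB [SigmaFinite μ] [OpensMeasurableSpace X] [μ.OuterRegular]
    {T : Type} [MeasurableSpace T] {ν : Measure T} [SFinite ν]
    {p q : ℝ} (hp : 1 < p) (hpq : p < q) :
    ∃ C : ENNReal, C ≠ ∞ ∧ ∀ g : T × X → ENNReal, Measurable g →
    ∫⁻ x, (∫⁻ t, G.M (fun y => g (t, y)) x ^ q ∂ν) ^ (p/q) ∂μ ≤
      C * ∫⁻ x, (∫⁻ t, g (t, x) ^ q ∂ν) ^ (p/q) ∂μ := by
  have hq : 1 < q := hp.trans hpq
  have q0 : 0 < q := by linarith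
  have p0 : 0 < p := by linarith
  set θ := (q-p)/(q-1)
  have θ0 : 0 < θ := div_pos (by linarith) (by linarith)
  have θ1 : θ < 1 := by rw [div_lt_one (by linarith)]; linarith
  have hK : cK θ ≠ ∞ := by unfold cK; simp [ENNReal.mul_eq_top]
  have hK0 : cK θ ≠ 0 := by unfold cK; simp
  set C0 := cK θ ^ q * cM q
  have hC0 : C0 ≠ ∞ := ENNReal.mul_ne_top (ENNReal.rpow_ne_top_of_nonneg q0.le hK) (cM_top _)
  set C1 := C0 ^ (p/q) * cM p ^ (1-p/q) 
  have hs : 0 ≤ 1 - p/q := by rw [sub_nonneg, div_le_one q0]; exact hpq.le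
  have hC1 : C1 ≠ ∞ := ENNReal.mul_ne_top (ENNReal.rpow_ne_top_of_nonneg (by positivity) hC0)
    (ENNReal.rpow_ne_top_of_nonneg hs (cM_top _))
  refine ⟨C1 * 2 ^ (p-1), ENNReal.mul_ne_top hC1 (by
    exact ENNReal.rpow_ne_top_of_nonneg (by linarith) (by simp)), fun g hg => ?_⟩
  have mM := G.mMj hg
  have mh : Measurable fun x => ∫⁻ t, g (t, x) ^ q ∂ν := (hg.pow_const q).lintegral_prod_left'
  set h := fun x => ∫⁻ t, g (t, x) ^ q ∂ν
  have mH : Measurable fun x => ∫⁻ t, G.M (fun y => g (t, y)) x ^ q ∂ν := (mM.pow_const q).lintegral_prod_left'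
  set H := fun x => ∫⁻ t, G.M (fun y => g (t, y)) x ^ q ∂ν
  set J := ∫⁻ x, h x ^ (p/q) ∂μ
  by_cases hJ : J = ∞
  · rcases eq_or_ne (C1 * 2 ^ (p-1)) 0 with h0 | h0
    · exfalso
      simp only [mul_eq_zero, C1, C0] at h0
      have z1 : cM q ≠ 0 := by
        unfold cM; simp only [ne_eq, ENNReal.ofReal_eq_zero, not_le]
        have : 0 < (q-1)⁻¹ := by simpa using hq
        simp; positivity
      have z2 : cM p ≠ 0 := by
        unfold cM; simp only [ne_eq, ENNReal.ofReal_eq_zero, not_le]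
        have : 0 < (p-1)⁻¹ := by simpa using hp
        simp; positivity
      have := hq
      simp [z1, z2, hK0, ENNReal.rpow_eq_zero_iff, hK, cM_top, ENNReal.mul_eq_top, hq.le, q0.le, hp.le] at h0
    · change _ ≤ C1 * 2 ^ (p-1) * J
      rw [hJ, ENNReal.mul_top h0]; exact le_top
  suffices hsuf : ∀ ε : ENNReal, ε ≠ 0 → ε ≠ ∞ → ∫⁻ x, H x ^ (p/q) ∂μ ≤ C1 * (2 ^ (p-1) * (J + ε)) by
    have key : ∀ ε : ℝ≥0, 0 < ε → C1 * 2 ^ (p-1) * J < ∞ →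
        ∫⁻ x, H x ^ (p/q) ∂μ ≤ C1 * 2 ^ (p-1) * J + ε := by
      intro ε hε _
      have hcf : C1 * 2 ^ (p-1) ≠ ∞ := ENNReal.mul_ne_top hC1 (by
        exact ENNReal.rpow_ne_top_of_nonneg (by linarith) (by simp))
      have := hsuf (ε / (C1 * 2 ^ (p-1) + 1)) (ENNReal.div_pos (by simpa using hε.ne')
        (by simp [hcf])).ne' (ENNReal.div_ne_top (by simp) (by simp))
      refine this.trans ?_
      rw [← mul_assoc, mul_add]
      gcongr
      calc C1 * 2 ^ (p-1) * (ε / (C1 * 2 ^ (p-1) + 1)) ≤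
          (C1 * 2 ^ (p-1) + 1) * (ε / (C1 * 2 ^ (p-1) + 1)) := by gcongr; exact le_self_add
        _ = ε := ENNReal.mul_div_cancel (by simp) (by simp [hcf])
    exact ENNReal.le_of_forall_pos_le_add key
  intro ε he0 het
  obtain ⟨e, hepos, hem, heint⟩ := exists_pos_lintegral_lt_of_sigmaFinite μ he0
  set F : X → ENNReal := fun x => h x ^ (1/q) + min (e x : ENNReal) 1
  have mF : Measurable F := (mh.pow_const _).add (hem.coe_nnreal_ennreal.min measurable_const)
  have hFp : ∫⁻ x, F x ^ p ∂μ ≤ 2 ^ (p-1) * (J + ε) := by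
    calc ∫⁻ x, F x ^ p ∂μ ≤ ∫⁻ x, 2 ^ (p-1) * (h x ^ (p/q) + e x) ∂μ := by
          refine lintegral_mono fun x => ?_
          refine (ENNReal.rpow_add_le_mul_rpow_add_rpow _ _ hp.le).trans ?_
          gcongr
          · rw [← ENNReal.rpow_mul, one_div_mul_eq_div]
          · refine le_trans ?_ (min_le_left _ 1)
            nth_rewrite 2 [← ENNReal.rpow_one (min _ _)]
            exact ENNReal.rpow_le_rpow_of_exponent_ge (min_le_right _ _) hp.le
      _ = 2 ^ (p-1) * (J + ∫⁻ x, e x ∂μ) := by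
          rw [lintegral_const_mul _ ((mh.pow_const _).fun_add hem.coe_nnreal_ennreal),
            lintegral_add_left (mh.pow_const _)]
      _ ≤ _ := by gcongr
  have hFt : ∫⁻ x, F x ^ p ∂μ ≠ ∞ := ne_top_of_le_ne_top (ENNReal.mul_ne_top (by
    exact ENNReal.rpow_ne_top_of_nonneg (by linarith) (by simp)) (ENNReal.add_ne_top.2 ⟨hJ, het⟩)) hFp
  set m := G.M F
  have mm : Measurable m := G.mM F
  have hFpos : ∀ x, 0 < F x := fun x => by
    refine lt_of_lt_of_le ?_ le_add_self
    simp [hepos x]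
  have hm0 : ∀ x, m x ≠ 0 := by
    intro x h0
    have : G.E 0 F x = 0 := le_antisymm ((G.E_le_M 0 F x).trans h0.le) (by simp)
    have h1 : ∫⁻ y in G.Q 0 x, F y ∂μ = 0 := by rw [G.lint_E, this, mul_zero]
    rw [lintegral_eq_zero_iff mF] at h1
    have h2 : μ (G.Q 0 x) = 0 := by
      have := h1.mono (fun y hy => (hFpos y).ne' hy)
      rwa [Filter.eventually_false_iff_eq_bot, ae_eq_bot, Measure.restrict_eq_zero] at this
    exact G.v0 0 (by rw [← G.vol' 0 x, h2])
  have hmp : ∫⁻ x, m x ^ p ∂μ ≤ cM p * ∫⁻ x, F x ^ p ∂μ := G.strong hp mF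
  have hmt : ∀ᵐ x ∂μ, m x ≠ ∞ := by
    have := ae_lt_top (mm.pow_const p) (ne_top_of_le_ne_top (ENNReal.mul_ne_top (cM_top p) hFt) hmp)
    filter_upwards [this] with x hx h
    rw [h, ENNReal.top_rpow_of_pos p0] at hx
    exact lt_irrefl _ hx
  have hFm : ∀ᵐ x ∂μ, F x ≤ m x := G.diff' mF fun x => G.lint_Q_lt hp.le hFt 0 x
  have hσe : ∀ x, (m x ^ θ) ^ (1-q) = m x ^ (p-q) := fun x => by
    rw [← ENNReal.rpow_mul]; congr 1
    have : q - 1 ≠ 0 := by linarith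
    simp only [θ]; field_simp; ring
  have mσ : Measurable fun x => m x ^ (p-q) := mm.pow_const _
  have A : ∀ t, ∫⁻ x, G.M (fun y => g (t, y)) x ^ q * m x ^ (p-q) ∂μ ≤
      C0 * ∫⁻ x, g (t, x) ^ q * m x ^ (p-q) ∂μ := by
    intro t
    have := G.A1strong hq (hg.comp (measurable_prodMk_left (x := t))) (mm.pow_const θ) hK0 hK
      (fun k x => G.coif mF θ0 θ1 k x) (fun x => by
        have := hm0 x
        simp [ENNReal.rpow_eq_zero_iff, this, θ0, θ0.le]) (by
        filter_upwards [hmt] with x hx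
        exact ENNReal.rpow_ne_top_of_nonneg θ0.le hx)
    simp only [hσe] at this
    exact this
  have B : ∫⁻ x, H x * m x ^ (p-q) ∂μ ≤ C0 * ∫⁻ x, h x * m x ^ (p-q) ∂μ := by
    have hm1 : Measurable fun z : X × T => G.M (fun y => g (z.2, y)) z.1 ^ q * m z.1 ^ (p-q) :=
      ((mM.pow_const q).comp measurable_swap).mul (mσ.comp measurable_fst)
    have hm2 : Measurable fun z : X × T => g (z.2, z.1) ^ q * m z.1 ^ (p-q) :=
      ((hg.pow_const q).comp measurable_swap).mul (mσ.comp measurable_fst)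
    have e1 : ∫⁻ x, H x * m x ^ (p-q) ∂μ =
        ∫⁻ t, ∫⁻ x, G.M (fun y => g (t, y)) x ^ q * m x ^ (p-q) ∂μ ∂ν := by
      rw [← lintegral_lintegral_swap hm1.aemeasurable]
      refine lintegral_congr fun x => ?_
      exact (lintegral_mul_const (m x ^ (p-q))
        ((mM.pow_const q).comp (measurable_prodMk_right (y := x)))).symm
    have e2 : ∫⁻ x, h x * m x ^ (p-q) ∂μ =
        ∫⁻ t, ∫⁻ x, g (t, x) ^ q * m x ^ (p-q) ∂μ ∂ν := by
      rw [← lintegral_lintegral_swap hm2.aemeasurable]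
      refine lintegral_congr fun x => ?_
      exact (lintegral_mul_const (m x ^ (p-q))
        ((hg.pow_const q).comp (measurable_prodMk_right (y := x)))).symm
    rw [e1, e2, ← lintegral_const_mul _ hm2.lintegral_prod_left']
    exact lintegral_mono A
  have D : ∫⁻ x, h x * m x ^ (p-q) ∂μ ≤ ∫⁻ x, F x ^ p ∂μ := by
    refine lintegral_mono_ae ?_
    filter_upwards [hFm, hmt] with x h1 h2
    have h3 : h x ≤ F x ^ q := by
      have : h x = (h x ^ (1/q)) ^ q := by
        rw [← ENNReal.rpow_mul, one_div, inv_mul_cancel₀ q0.ne', ENNReal.rpow_one]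
      rw [this]; exact ENNReal.rpow_le_rpow le_self_add q0.le
    have hF0 := (hFpos x).ne'
    have hFt' : F x ≠ ∞ := ne_top_of_le_ne_top h2 h1
    have h4 : m x ^ (p-q) ≤ F x ^ (p-q) := by
      rw [show p - q = -(q-p) by ring, ENNReal.rpow_neg, ENNReal.rpow_neg, ENNReal.inv_le_inv]
      exact ENNReal.rpow_le_rpow h1 (by linarith)
    calc h x * m x ^ (p-q) ≤ F x ^ q * F x ^ (p-q) := mul_le_mul' h3 h4
      _ = F x ^ p := by rw [← ENNReal.rpow_add _ _ hF0 hFt']; congr 1; ring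
  calc ∫⁻ x, H x ^ (p/q) ∂μ ≤ ∫⁻ x, (H x * m x ^ (p-q)) ^ (p/q) * (m x ^ p) ^ (1-p/q) ∂μ := by
        refine lintegral_mono_ae ?_
        filter_upwards [hmt] with x hx
        rw [ENNReal.mul_rpow_of_nonneg _ _ (by positivity), mul_assoc, ← ENNReal.rpow_mul,
          ← ENNReal.rpow_mul, ← ENNReal.rpow_add _ _ (hm0 x) hx]
        have : (p - q) * (p/q) + p * (1-p/q) = 0 := by field_simp; ring
        rw [this]; simp
    _ ≤ (∫⁻ x, H x * m x ^ (p-q) ∂μ) ^ (p/q) * (∫⁻ x, m x ^ p ∂μ) ^ (1-p/q) :=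
        ENNReal.lintegral_mul_norm_pow_le (mH.mul mσ).aemeasurable (mm.pow_const p).aemeasurable
          (by positivity) hs (by ring)
    _ ≤ (C0 * ∫⁻ x, F x ^ p ∂μ) ^ (p/q) * (cM p * ∫⁻ x, F x ^ p ∂μ) ^ (1-p/q) := by
        gcongr
        exact B.trans (by gcongr)
    _ = C1 * ∫⁻ x, F x ^ p ∂μ := by
        rw [ENNReal.mul_rpow_of_nonneg _ _ (by positivity), ENNReal.mul_rpow_of_nonneg _ _ hs,
          mul_mul_mul_comm, ← ENNReal.rpow_add_of_nonneg _ _ (by positivity) hs]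
        simp [C1]
    _ ≤ _ := by gcongr

lemma mix [SigmaFinite μ] [OpensMeasurableSpace X] [μ.OuterRegular]
    {T : Type} [MeasurableSpace T] (ν : Measure T) [SFinite ν]
    {p q : ℝ} (hp : 1 < p) (hq : 1 < q) :
    ∃ C : ENNReal, C ≠ ∞ ∧ ∀ g : T × X → ENNReal, Measurable g →
    ∫⁻ x, (∫⁻ t, G.M (fun y => g (t, y)) x ^ q ∂ν) ^ (p/q) ∂μ ≤
      C * ∫⁻ x, (∫⁻ t, g (t, x) ^ q ∂ν) ^ (p/q) ∂μ := by
  rcases lt_trichotomy p q with h | h | h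
  · exact G.mixB hp h
  · subst h
    refine ⟨cM p, cM_top p, fun g hg => ?_⟩
    rw [div_self (by linarith)]
    simp only [ENNReal.rpow_one]
    have m1 : Measurable fun z : X × T => G.M (fun y => g (z.2, y)) z.1 ^ p :=
      ((G.mMj hg).pow_const p).comp measurable_swap
    have m2 : Measurable fun z : X × T => g (z.2, z.1) ^ p := (hg.pow_const p).comp measurable_swap
    have s1 := lintegral_lintegral_swap (μ := μ) (ν := ν)
      (f := fun x t => G.M (fun y => g (t, y)) x ^ p) m1.aemeasurable
    have s2 := lintegral_lintegral_swap (μ := μ) (ν := ν)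
      (f := fun x t => g (t, x) ^ p) m2.aemeasurable
    rw [s1, s2, ← lintegral_const_mul _ m2.lintegral_prod_left']
    exact lintegral_mono fun t => G.strong hp (hg.comp measurable_prodMk_left)
  · exact G.mixA hq h

end Grid

namespace Grid
variable {X : Type} [TopologicalSpace X] [MeasurableSpace X] {μ : Measure X} (G : Grid X μ)

lemma sharp_step [SFinite μ] {U : X → ℝ} (hU : Measurable U) {Γ g : X → ENNReal} (hΓ : Measurable Γ)
    (hg : Measurable g) {ct : ℤ → G.I → ℝ} {γ : ℤ → G.I → ENNReal}
    (h1 : ∀ k x, γ k (G.c k x) ≤ Γ x)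
    (h2 : ∀ k x, 8 * G.D * μ {y | y ∈ G.Q k x ∧ γ k (G.c k x) < ofReal |U y - ct k (G.c k x)|} ≤ G.v k)
    {ε : ℝ} (hε : 0 ≤ ε) {K : ℤ} (hK : ∀ x y, G.c K x = G.c K y → |U x - U y| ≤ ε) :
    ∀ n : ℕ, ∀ k : ℤ, K - k = n → ∀ x,
      ∫⁻ y in G.Q k x, (ofReal |U y - ct k (G.c k x)| + γ k (G.c k x)) * g y ∂μ ≤
      ∫⁻ y in G.Q k x, (4 * (Γ y * G.M g y) + ofReal ε * g y) ∂μ := by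
  intro n
  induction n using Nat.strong_induction_on with
  | _ n ih =>
  intro k hk x
  have hD0 : G.D ≠ 0 := (zero_lt_one.trans_le G.D1).ne'
  have hDt := G.Dt
  set cQ := ct k (G.c k x)
  set γQ := γ k (G.c k x)
  set Q := G.Q k x
  have mQ : MeasurableSet Q := G.mQ k x
  set E := {y | y ∈ Q ∧ γQ < ofReal |U y - cQ|}
  have mE : MeasurableSet E := mQ.inter (measurableSet_lt measurable_const (show Measurable fun y => ofReal |U y - cQ| by fun_prop))
  set e : X → ENNReal := E.indicator 1
  have me : Measurable e := measurable_one.indicator mE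
  have hEx : 8 * G.D * μ E ≤ G.v k := h2 k x
  let P : ℤ → X → Prop := fun j y => j ≤ K ∧ 1 < 4 * G.D * G.E j e y
  have hP : ∀ j x y, G.c j x = G.c j y → P j x → P j y := fun j x y h h' => by
    simp only [P]; rw [← G.E_eq h]; exact h'
  set S := {y | ∃ j, k + 1 ≤ j ∧ P j y}
  have mS : MeasurableSet S := by
    rw [show S = ⋃ j, St (k+1) P j from (St_union (k+1) P).symm]
    exact MeasurableSet.iUnion fun j => (G.St_sat (k+1) hP j).meas
  have he : ∀ j y, G.E j e y = (G.v j)⁻¹ * μ (G.Q j y ∩ E) := by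
    intro j y
    unfold Grid.E
    simp only [e]
    rw [lintegral_indicator_one mE, Measure.restrict_apply mE, inter_comm]
  have hSQ : S ⊆ Q := by
    rintro y ⟨j, hj, _, hy⟩
    by_contra hyQ
    have : G.Q j y ∩ E = ∅ := by
      ext z; simp only [mem_inter_iff, mem_empty_iff_false, iff_false, not_and]
      intro hz hzE
      exact hyQ (Eq.trans (G.nest' (by omega : k ≤ j) hz).symm hzE.1)
    rw [he, this] at hy; simp at hy
  have hSm : G.v k ≤ 2 * μ (Q \ S) := by
    have a1 : (4 * G.D)⁻¹ * μ S ≤ μ E := by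
      refine le_trans ?_ ((G.weak1 me (4 * G.D)⁻¹).trans (lintegral_indicator_one mE).le)
      gcongr
      rintro y ⟨j, hj, _, hy⟩
      refine lt_of_lt_of_le ?_ (G.E_le_M j e y)
      rw [← one_div]
      exact ENNReal.div_lt_of_lt_mul' hy
    rw [ENNReal.inv_mul_le_iff (by simp [hD0]) (ENNReal.mul_ne_top (by simp) hDt)] at a1
    have a2 : 2 * μ S ≤ G.v k := by
      refine le_trans ?_ hEx
      calc 2 * μ S ≤ 2 * (4 * G.D * μ E) := by gcongr
        _ = _ := by ring
    have a3 : μ (Q \ S) = G.v k - μ S := by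
      rw [measure_diff hSQ mS.nullMeasurableSet (ne_top_of_le_ne_top (G.vt k)
        ((measure_mono hSQ).trans (G.vol' k x).le)), G.vol']
    rw [a3, ENNReal.mul_sub (by simp)]
    refine ENNReal.le_sub_of_add_le_right (ne_top_of_le_ne_top (G.vt k) a2) ?_
    rw [two_mul (G.v k)]; gcongr
  have hQe : G.E k e x ≤ (8 * G.D)⁻¹ := by
    rw [he, ENNReal.inv_mul_le_iff (G.v0 k) (G.vt k), mul_comm]
    refine le_inv_mul_of (by simp [hD0]) (ENNReal.mul_ne_top (by simp) hDt) (le_trans ?_ hEx)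
    gcongr; exact inter_subset_right

  have hon : ∫⁻ y in S, (ofReal |U y - cQ| + γQ) * g y ∂μ ≤
      ∫⁻ y in S, (4 * (Γ y * G.M g y) + ofReal ε * g y + 2 * γQ * g y) ∂μ := by
    rw [show S = {y | ∃ j, k + 1 ≤ j ∧ P j y} from rfl, G.lint_St _ hP, G.lint_St _ hP]
    refine ENNReal.tsum_le_tsum fun j => G.sat_le (G.St_sat _ hP j) fun y hy => ?_
    have hyS : y ∈ S := ⟨j, hy.1, hy.2.1⟩
    have hyQ := hSQ hyS
    have hj : k + 1 ≤ j := hy.1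
    have hjK : j ≤ K := hy.2.1.1
    have b1 : 4 * G.E j e y ≤ 1 := by
      have b0 : 4 * G.D * G.E (j-1) e y ≤ 1 := by
        rcases eq_or_lt_of_le hj with h | h
        · have : j - 1 = k := by omega
          rw [this, G.E_eq (show G.c k y = G.c k x from hyQ)]
          calc 4 * G.D * G.E k e x ≤ 8 * G.D * (8 * G.D)⁻¹ := by gcongr; norm_num
            _ ≤ 1 := ENNReal.mul_inv_le_one _
        · by_contra hc
          exact hy.2.2 (j-1) (by omega) (by omega) ⟨by omega, not_le.1 hc⟩
      calc 4 * G.E j e y ≤ 4 * (G.D * G.E (j-1) e y) := by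
            gcongr
            have := G.E_dbl (j-1) e y
            rwa [sub_add_cancel] at this
        _ = 4 * G.D * G.E (j-1) e y := by ring
        _ ≤ 1 := b0
    set cP := ct j (G.c j y)
    set γP := γ j (G.c j y)
    have b2 : ofReal |cP - cQ| ≤ γP + γQ := by
      have : ∃ z ∈ G.Q j y, z ∉ E ∧ ofReal |U z - cP| ≤ γP := by
        by_contra hc
        push Not at hc
        have hsub : G.Q j y ⊆ (G.Q j y ∩ E) ∪ {z | z ∈ G.Q j y ∧ γP < ofReal |U z - cP|} := by
          intro z hz
          by_cases hzE : z ∈ E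
          · exact Or.inl ⟨hz, hzE⟩
          · exact Or.inr ⟨hz, hc z hz hzE⟩
        have m1 : 4 * μ (G.Q j y ∩ E) ≤ G.v j := by
          rw [he, mul_left_comm, ENNReal.inv_mul_le_iff (G.v0 j) (G.vt j), mul_one] at b1
          exact b1
        have m2 : 8 * μ {z | z ∈ G.Q j y ∧ γP < ofReal |U z - cP|} ≤ G.v j := by
          refine le_trans ?_ (h2 j y)
          gcongr
          calc (8:ENNReal) = 8 * 1 := by norm_num
            _ ≤ 8 * G.D := by gcongr; exact G.D1
        have m3 := (measure_mono (μ := μ) hsub).trans (measure_union_le _ _)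
        rw [G.vol'] at m3
        have m4 : 8 * G.v j ≤ 3 * G.v j := by
          calc 8 * G.v j ≤ 8 * (μ (G.Q j y ∩ E) + μ {z | z ∈ G.Q j y ∧ γP < ofReal |U z - cP|}) := by gcongr
            _ = 2 * (4 * μ (G.Q j y ∩ E)) + 8 * μ {z | z ∈ G.Q j y ∧ γP < ofReal |U z - cP|} := by ring
            _ ≤ 2 * G.v j + G.v j := by gcongr
            _ = _ := by ring
        exact absurd m4 (not_le.2 ((ENNReal.mul_lt_mul_iff_left (G.v0 j) (G.vt j)).2 (by norm_num)))
      obtain ⟨z, hz, hzE, hzP⟩ := this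
      have hzQ : z ∈ Q := Eq.trans (G.nest' (by omega : k ≤ j) hz) hyQ
      have hzQ' : ofReal |U z - cQ| ≤ γQ := by
        by_contra hc; exact hzE ⟨hzQ, not_le.1 hc⟩
      refine le_trans ?_ (add_le_add hzP hzQ')
      rw [← ENNReal.ofReal_add (abs_nonneg _) (abs_nonneg _)]
      apply ENNReal.ofReal_le_ofReal
      have := abs_sub_le cP (U z) cQ
      rwa [abs_sub_comm cP (U z)] at this
    have ihj := ih (K - j).toNat (by omega) j (by omega) y
    rw [lintegral_add_right _ (hg.const_mul _)]
    refine le_trans ?_ (add_le_add_left ihj _)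
    rw [← lintegral_add_right _ (hg.const_mul _)]
    refine lintegral_mono fun z => ?_
    rw [← add_mul]
    refine mul_le_mul' ?_ le_rfl
    calc ofReal |U z - cQ| + γQ ≤ ofReal |U z - cP| + ofReal |cP - cQ| + γQ := by
          gcongr
          rw [← ENNReal.ofReal_add (abs_nonneg _) (abs_nonneg _)]
          exact ENNReal.ofReal_le_ofReal (abs_sub_le _ _ _)
      _ ≤ ofReal |U z - cP| + (γP + γQ) + γQ := by gcongr
      _ = _ := by ring
  have hoff : ∫⁻ y in Q \ S, (ofReal |U y - cQ| + γQ) * g y ∂μ ≤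
      ∫⁻ y in Q \ S, (ofReal ε * g y + 2 * γQ * g y) ∂μ := by
    refine setLIntegral_mono' (mQ.diff mS) fun y hy => ?_
    rw [← add_mul]
    refine mul_le_mul' ?_ le_rfl
    have : ofReal |U y - cQ| ≤ γQ + ofReal ε := by
      by_cases hyE : y ∈ E
      · have hz : ∃ z ∈ G.Q K y, z ∉ E := by
          by_contra hc
          push Not at hc
          rcases eq_or_lt_of_le (by omega : k ≤ K) with h | h
          · have : G.Q k y ⊆ E := by rw [h]; exact hc
            have hq := measure_mono (μ := μ) this
            rw [G.vol'] at hq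
            have : 8 * G.D * G.v k ≤ 1 * G.v k := by
              rw [one_mul]; exact (mul_le_mul_right hq _).trans hEx
            rw [ENNReal.mul_le_mul_iff_left (G.v0 k) (G.vt k)] at this
            have h8 : (8:ENNReal) * 1 ≤ 1 := (mul_le_mul_right G.D1 8).trans this
            norm_num at h8
          · refine hy.2 ⟨K, by omega, le_rfl, ?_⟩
            rw [he, inter_eq_left.2 (show G.Q K y ⊆ E from hc), G.vol',
              ENNReal.inv_mul_cancel (G.v0 K) (G.vt K), mul_one]
            calc (1:ENNReal) < 4 * 1 := by norm_num
              _ ≤ 4 * G.D := by gcongr; exact G.D1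
        obtain ⟨z, hz, hzE⟩ := hz
        have hzQ : z ∈ Q := Eq.trans (G.nest' (by omega : k ≤ K) hz) hy.1
        have hzQ' : ofReal |U z - cQ| ≤ γQ := by
          by_contra hc; exact hzE ⟨hzQ, not_le.1 hc⟩
        refine le_trans ?_ (add_le_add_left hzQ' _)
        rw [← ENNReal.ofReal_add (abs_nonneg _) hε]
        apply ENNReal.ofReal_le_ofReal
        have a1 := hK z y hz
        have a2 := abs_sub_le (U y) (U z) cQ
        rw [abs_sub_comm (U y) (U z)] at a2
        linarith
      · refine le_trans ?_ le_self_add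
        by_contra hc; exact hyE ⟨hy.1, not_le.1 hc⟩
    calc _ ≤ γQ + ofReal ε + γQ := by gcongr
      _ = _ := by ring
  have hfin : 2 * γQ * ∫⁻ y in Q, g y ∂μ ≤ ∫⁻ y in Q \ S, 4 * (Γ y * G.M g y) ∂μ := by
    rw [G.lint_E]
    calc 2 * γQ * (G.v k * G.E k g x) ≤ 2 * γQ * (2 * μ (Q \ S) * G.E k g x) := by gcongr
      _ = 4 * (γQ * G.E k g x) * μ (Q \ S) := by ring
      _ = ∫⁻ y in Q \ S, 4 * (γQ * G.E k g x) ∂μ := (setLIntegral_const _ _).symm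
      _ ≤ _ := by
        refine setLIntegral_mono' (mQ.diff mS) fun y hy => ?_
        have hy1 : G.c k y = G.c k x := hy.1
        gcongr
        · simp only [γQ]; rw [← hy1]; exact h1 k y
        · rw [← G.E_eq hy1]; exact G.E_le_M _ _ _
  have spl : ∀ F : X → ENNReal, ∫⁻ y in Q, F y ∂μ = ∫⁻ y in S, F y ∂μ + ∫⁻ y in Q \ S, F y ∂μ := by
    intro F
    have := lintegral_inter_add_diff (μ := μ) F Q mS
    rw [inter_eq_right.2 hSQ] at this
    exact this.symm
  have mm : Measurable fun y => 4 * (Γ y * G.M g y) := (hΓ.mul (G.mM g)).const_mul 4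
  rw [spl]
  refine (add_le_add hon hoff).trans ?_
  rw [lintegral_add_left (mm.fun_add (hg.const_mul _)), lintegral_add_left mm,
    lintegral_add_left (hg.const_mul _), lintegral_add_left mm]
  calc _ = (∫⁻ y in S, 4 * (Γ y * G.M g y) ∂μ) + (∫⁻ y in S, ofReal ε * g y ∂μ +
        ∫⁻ y in Q \ S, ofReal ε * g y ∂μ) + (∫⁻ y in S, 2 * γQ * g y ∂μ +
        ∫⁻ y in Q \ S, 2 * γQ * g y ∂μ) := by ring
    _ = (∫⁻ y in S, 4 * (Γ y * G.M g y) ∂μ) + (∫⁻ y in Q, ofReal ε * g y ∂μ) +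
        2 * γQ * ∫⁻ y in Q, g y ∂μ := by
        rw [← spl, ← spl, lintegral_const_mul (2 * γQ) hg]
    _ ≤ (∫⁻ y in S, 4 * (Γ y * G.M g y) ∂μ) + (∫⁻ y in Q, ofReal ε * g y ∂μ) +
        ∫⁻ y in Q \ S, 4 * (Γ y * G.M g y) ∂μ := by gcongr
    _ = _ := by rw [spl fun y => 4 * (Γ y * G.M g y)]; ring

lemma sharp [SFinite μ] {U : X → ℝ} (hU : Measurable U) {Γ g : X → ENNReal} (hΓ : Measurable Γ)
    (hg : Measurable g)
    (H : ∀ k x, ∃ (c : ℝ) (γ : ENNReal), (∀ y ∈ G.Q k x, γ ≤ Γ y) ∧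
      8 * G.D * μ {y | y ∈ G.Q k x ∧ γ < ofReal |U y - c|} ≤ G.v k)
    (hf : ∀ ε : ℝ, 0 < ε → ∃ K, ∀ x y, G.c K x = G.c K y → |U x - U y| ≤ ε)
    (hs : μ {x | U x ≠ 0} ≠ ∞) :
    ∫⁻ x, ofReal |U x| * g x ∂μ ≤ 4 * ∫⁻ x, Γ x * G.M g x ∂μ := by
  have hsel : ∀ k (i : G.I), ∃ (c : ℝ) (γ : ENNReal), ∀ x, G.c k x = i → (∀ y ∈ G.Q k x, γ ≤ Γ y) ∧
      8 * G.D * μ {y | y ∈ G.Q k x ∧ γ < ofReal |U y - c|} ≤ G.v k := by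
    intro k i
    by_cases h : ∃ x, G.c k x = i
    · obtain ⟨x, hx⟩ := h
      obtain ⟨c, γ, h⟩ := H k x
      refine ⟨c, γ, fun y hy => ?_⟩
      rw [G.Q_eq (hy.trans hx.symm)]; exact h
    · exact ⟨0, 0, fun x hx => absurd ⟨x, hx⟩ h⟩
  choose ct γ hcγ using hsel
  have h1 : ∀ k x, γ k (G.c k x) ≤ Γ x := fun k x => (hcγ k _ x rfl).1 x (G.mem_Q k x)
  have h2 := fun k x => (hcγ k _ x rfl).2
  set A := {x | U x ≠ 0}
  have mA : MeasurableSet A := (measurableSet_eq_fun hU measurable_const).compl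
  have key : ∀ g : X → ENNReal, Measurable g → ∫⁻ x, g x ∂μ ≠ ∞ →
      ∫⁻ x, ofReal |U x| * g x ∂μ ≤ 4 * ∫⁻ x, Γ x * G.M g x ∂μ := by
    intro g hg hgt
    have st : ∀ ε : ℝ, 0 < ε → ∫⁻ x, ofReal |U x| * g x ∂μ ≤
        4 * ∫⁻ x, Γ x * G.M g x ∂μ + ofReal ε * ∫⁻ x, g x ∂μ := by
      intro ε hε
      obtain ⟨K, hK⟩ := hf ε hε
      obtain ⟨k0, hk0⟩ := G.big (8 * μ A) (ENNReal.mul_ne_top (by simp) hs)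
      set k := min k0 K
      have hk := hk0 k (min_le_left _ _)
      have hkK : k ≤ K := min_le_right _ _
      have mm : Measurable fun y => 4 * (Γ y * G.M g y) := (hΓ.mul (G.mM g)).const_mul 4
      have := G.sat_le (k := k) (S := univ) (f := fun x => ofReal |U x| * g x)
        (h := fun y => 4 * (Γ y * G.M g y) + ofReal ε * g y) (fun _ _ _ _ => mem_univ _)
        (fun x _ => by
          refine le_trans ?_ (G.sharp_step hU hΓ hg h1 h2 hε.le hK (K-k).toNat k (by omega) x)
          have hz : ∃ z ∈ G.Q k x, z ∉ A ∧ ofReal |U z - ct k (G.c k x)| ≤ γ k (G.c k x) := by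
            by_contra hc
            push Not at hc
            have hsub : G.Q k x ⊆ A ∪ {z | z ∈ G.Q k x ∧ γ k (G.c k x) < ofReal |U z - ct k (G.c k x)|} := by
              intro z hz
              by_cases hzE : z ∈ A
              · exact Or.inl hzE
              · exact Or.inr ⟨hz, hc z hz hzE⟩
            have m3 := (measure_mono (μ := μ) hsub).trans (measure_union_le _ _)
            rw [G.vol'] at m3
            have m2 : 8 * μ {z | z ∈ G.Q k x ∧ γ k (G.c k x) < ofReal |U z - ct k (G.c k x)|} ≤ G.v k := by
              refine le_trans ?_ (h2 k x)
              gcongr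
              calc (8:ENNReal) = 8 * 1 := by norm_num
                _ ≤ 8 * G.D := by gcongr; exact G.D1
            have m4 : 8 * G.v k ≤ 2 * G.v k := by
              refine (mul_le_mul_right m3 8).trans ?_
              rw [mul_add, two_mul]; gcongr
            exact absurd m4 (not_le.2 ((ENNReal.mul_lt_mul_iff_left (G.v0 k) (G.vt k)).2 (by norm_num)))
          obtain ⟨z, _, hzA, hzc⟩ := hz
          have hz0 : U z = 0 := by simpa [A] using hzA
          rw [hz0, zero_sub, abs_neg] at hzc
          refine lintegral_mono fun y => ?_
          gcongr
          refine le_trans ?_ (add_le_add_right hzc _)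
          rw [← ENNReal.ofReal_add (abs_nonneg _) (abs_nonneg _)]
          apply ENNReal.ofReal_le_ofReal
          have := abs_add_le (U y - ct k (G.c k x)) (ct k (G.c k x))
          rwa [sub_add_cancel] at this)
      rw [setLIntegral_univ, setLIntegral_univ, lintegral_add_left mm, lintegral_const_mul _ (hΓ.fun_mul (G.mM g)),
        lintegral_const_mul _ hg] at this
      exact this
    have lim : Filter.Tendsto (fun n : ℕ => 4 * ∫⁻ x, Γ x * G.M g x ∂μ +
        ofReal (1 / ((n:ℝ) + 1)) * ∫⁻ x, g x ∂μ) Filter.atTop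
        (nhds (4 * ∫⁻ x, Γ x * G.M g x ∂μ + ofReal 0 * ∫⁻ x, g x ∂μ)) :=
      Filter.Tendsto.add tendsto_const_nhds (ENNReal.Tendsto.mul_const
        (ENNReal.tendsto_ofReal tendsto_one_div_add_atTop_nhds_zero_nat) (Or.inr hgt))
    rw [ENNReal.ofReal_zero, zero_mul, add_zero] at lim
    exact ge_of_tendsto' lim fun n => st _ (by positivity)
  let gn : ℕ → X → ENNReal := fun n => A.indicator fun x => min (g x) n
  have mgn : ∀ n, Measurable (gn n) := fun n => (hg.min measurable_const).indicator mA
  have hle : ∀ n x, gn n x ≤ g x := fun n x =>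
    (indicator_le_self' (by simp) x).trans (min_le_left _ _)
  have e1 : ∀ x, ofReal |U x| * g x = ⨆ n, ofReal |U x| * gn n x := by
    intro x
    rw [← ENNReal.mul_iSup]
    by_cases hx : x ∈ A
    · congr 1
      apply le_antisymm
      · refine le_of_forall_lt fun a ha => ?_
        obtain ⟨m, hm⟩ := ENNReal.exists_nat_gt ha.ne_top
        refine lt_iSup_iff.2 ⟨m, ?_⟩
        simp only [gn]; rw [indicator_of_mem hx, lt_min_iff]; exact ⟨ha, hm⟩
      · exact iSup_le fun n => hle n x
    · have : U x = 0 := by simpa [A] using hx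
      simp [this]
  simp_rw [e1]
  rw [lintegral_iSup (fun n => (by fun_prop : Measurable fun x => ofReal |U x|).fun_mul (mgn n))]
  · refine iSup_le fun n => (key (gn n) (mgn n) ?_).trans ?_
    · have : ∫⁻ x, gn n x ∂μ ≤ ∫⁻ x in A, (n:ENNReal) ∂μ := by
        rw [← lintegral_indicator mA]
        refine lintegral_mono fun x => indicator_le_indicator (min_le_right _ _)
      refine ne_top_of_le_ne_top ?_ this
      rw [setLIntegral_const]
      exact ENNReal.mul_ne_top (by simp) hs
    · gcongr
      exact G.M_mono (hle n) _
  · intro m n hmn x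
    simp only [gn, indicator]
    split_ifs <;> gcongr

end Grid

namespace Grid
variable {X Y : Type} [TopologicalSpace X] [MeasurableSpace X] {μ : Measure X} [TopologicalSpace Y]
  [MeasurableSpace Y] {ν : Measure Y}

def prod [SFinite ν] (G : Grid X μ) (H : Grid Y ν) : Grid (X × Y) (μ.prod ν) where
  I := G.I × H.I
  cI := by haveI := G.cI; haveI := H.cI; infer_instance
  c k z := (G.c k z.1, H.c k z.2)
  meas k i := by
    have : {x : X × Y | (G.c k x.1, H.c k x.2) = i} = {x | G.c k x = i.1} ×ˢ {x | H.c k x = i.2} := by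
      ext z; simp [Prod.ext_iff]
    rw [this]; exact (G.meas k _).prod (H.meas k _)
  nest k x y h := by
    simp only [Prod.ext_iff] at h ⊢
    exact ⟨G.nest _ _ _ h.1, H.nest _ _ _ h.2⟩
  v k := G.v k * H.v k
  vol k x := by
    have : {y : X × Y | (G.c k y.1, H.c k y.2) = (G.c k x.1, H.c k x.2)} = {y | G.c k y = G.c k x.1} ×ˢ {y | H.c k y = H.c k x.2} := by
      ext z; simp [Prod.ext_iff]
    rw [this, Measure.prod_prod, G.vol, H.vol]
  v0 k := mul_ne_zero (G.v0 k) (H.v0 k)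
  vt k := ENNReal.mul_ne_top (G.vt k) (H.vt k)
  D := G.D * H.D
  D1 := by simpa using mul_le_mul' G.D1 H.D1
  Dt := ENNReal.mul_ne_top G.Dt H.Dt
  dbl k := by
    refine (mul_le_mul' (G.dbl k) (H.dbl k)).trans (le_of_eq ?_)
    ring
  small O hO x hx := by
    obtain ⟨U, V, hU, hV, h1, h2, h3⟩ := isOpen_prod_iff.1 hO x.1 x.2 hx
    obtain ⟨k1, hk1⟩ := G.small U hU _ h1
    obtain ⟨k2, hk2⟩ := H.small V hV _ h2
    refine ⟨max k1 k2, fun k hk y hy => h3 ⟨hk1 k ((le_max_left _ _).trans hk) ?_, hk2 k ((le_max_right _ _).trans hk) ?_⟩⟩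
    · exact congrArg Prod.fst hy
    · exact congrArg Prod.snd hy
  big C hC := by
    obtain ⟨k1, hk1⟩ := G.big C hC
    obtain ⟨k2, hk2⟩ := H.big 1 (by simp)
    refine ⟨min k1 k2, fun k hk => ?_⟩
    simpa using mul_le_mul' (hk1 k (hk.trans (min_le_left _ _))) (hk2 k (hk.trans (min_le_right _ _)))

lemma prod_E [SFinite μ] [SFinite ν] (G : Grid X μ) (H : Grid Y ν) (k : ℤ) {g : X × Y → ENNReal} (hg : Measurable g) (t x) :
    (G.prod H).E k g (t, x) = H.E k (fun y => G.E k (fun s => g (s, y)) t) x := by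
  have : (G.prod H).Q k (t, x) = G.Q k t ×ˢ H.Q k x := by
    ext z; simp [Q, prod, Prod.ext_iff]
  unfold E
  rw [this, ← Measure.prod_restrict, lintegral_prod_symm _ hg.aemeasurable]
  rw [lintegral_const_mul _ hg.lintegral_prod_left', ← mul_assoc]
  congr 1
  show (G.v k * H.v k)⁻¹ = _
  rw [ENNReal.mul_inv (Or.inl (G.v0 k)) (Or.inl (G.vt k)), mul_comm]

lemma prod_M [SFinite μ] [SFinite ν] (G : Grid X μ) (H : Grid Y ν) {g : X × Y → ENNReal} (hg : Measurable g) (t x) :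
    (G.prod H).M g (t, x) ≤ H.M (fun y => G.M (fun s => g (s, y)) t) x := by
  refine iSup_le fun k => ?_
  rw [prod_E G H k hg]
  exact (H.E_mono (fun y => G.E_le_M k _ t) x).trans (H.E_le_M _ _ _)

lemma prod_mix [SFinite μ] [SigmaFinite ν] [OpensMeasurableSpace Y] [ν.OuterRegular] (G : Grid X μ) (H : Grid Y ν)
    {p q : ℝ} (hp : 1 < p) (hq : 1 < q) :
    ∃ C : ENNReal, C ≠ ∞ ∧ ∀ g : X × Y → ENNReal, Measurable g →
    ∫⁻ x, (∫⁻ t, (G.prod H).M g (t, x) ^ q ∂μ) ^ (p/q) ∂ν ≤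
      C * ∫⁻ x, (∫⁻ t, g (t, x) ^ q ∂μ) ^ (p/q) ∂ν := by
  obtain ⟨C, hC, h⟩ := H.mix μ hp hq
  have hpq : 0 ≤ p / q := by positivity
  refine ⟨C * cM q ^ (p/q), ENNReal.mul_ne_top hC (ENNReal.rpow_ne_top_of_nonneg hpq (cM_top q)), fun g hg => ?_⟩
  have mg : Measurable fun z : X × Y => G.M (fun s => g (s, z.2)) z.1 :=
    (G.mMj (g := fun z : Y × X => g (z.2, z.1)) (hg.comp measurable_swap)).comp measurable_swap
  have h1 := h _ mg
  calc _ ≤ _ := by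
        refine lintegral_mono fun x => ENNReal.rpow_le_rpow (lintegral_mono fun t => ?_) hpq
        exact ENNReal.rpow_le_rpow (prod_M G H hg t x) (by positivity)
    _ ≤ _ := h1
    _ ≤ C * ∫⁻ x, cM q ^ (p/q) * (∫⁻ t, g (t, x) ^ q ∂μ) ^ (p/q) ∂ν := by
        gcongr with x
        rw [← ENNReal.mul_rpow_of_nonneg _ _ hpq]
        exact ENNReal.rpow_le_rpow (G.strong hq (hg.comp measurable_prodMk_right)) hpq
    _ = _ := by
        rw [lintegral_const_mul _ (by
          exact (Measurable.lintegral_prod_left' (hg.pow_const q)).pow_const _), mul_assoc]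

end Grid

def sh (b : Bool) : ℝ := if b then 1/3 else 0

def cd (B : ℕ) (α : Bool) (k : ℤ) (x : ℝ) : ℤ := ⌊(B:ℝ)^k * x - sh α⌋

lemma cd_cell {B : ℕ} (hB : 0 < B) (α : Bool) (k n : ℤ) :
    {y | cd B α k y = n} = Ico (((B:ℝ)^k)⁻¹ * (n + sh α)) (((B:ℝ)^k)⁻¹ * (n + sh α) + ((B:ℝ)^k)⁻¹) := by
  ext y
  have hb : (0:ℝ) < (B:ℝ)^k := by positivity
  simp only [mem_setOf_eq, cd, Int.floor_eq_iff, mem_Ico]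
  rw [inv_mul_le_iff₀ hb, show ((B:ℝ)^k)⁻¹ * (n + sh α) + ((B:ℝ)^k)⁻¹ = ((B:ℝ)^k)⁻¹ * (n + sh α + 1) by ring,
    lt_inv_mul_iff₀ hb]
  constructor <;> rintro ⟨h1, h2⟩ <;> constructor <;> linarith

lemma cd_nest {B m : ℕ} (hB : B = 3 * m + 1) (α : Bool) (k : ℤ) (x y : ℝ)
    (h : cd B α (k+1) x = cd B α (k+1) y) : cd B α k x = cd B α k y := by
  have hb : (0:ℝ) < B := by rw [hB]; positivity
  have key : ∀ x, cd B α k x = (cd B α (k+1) x - (if α then (m:ℤ) else 0)) / (B:ℤ) := by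
    intro x
    unfold cd
    rw [← Int.floor_sub_intCast, ← Int.floor_div_natCast, zpow_add_one₀ hb.ne']
    congr 1
    have : (B:ℝ) = 3 * m + 1 := by exact_mod_cast hB
    rw [eq_div_iff hb.ne']
    cases α
    · simp [sh]; ring
    · simp [sh]; rw [this]; ring
  rw [key, key, h]

lemma cd_close {B : ℕ} (hB : 0 < B) {α : Bool} {k : ℤ} {x y : ℝ}
    (h : cd B α k x = cd B α k y) : |x - y| ≤ ((B:ℝ)^k)⁻¹ := by
  have hb : (0:ℝ) < (B:ℝ)^k := by positivity
  have := Int.abs_sub_lt_one_of_floor_eq_floor h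
  rw [sub_sub_sub_cancel_right, ← mul_sub, abs_mul, abs_of_pos hb] at this
  rw [← mul_one ((B:ℝ)^k)⁻¹, le_inv_mul_iff₀ hb]; exact this.le

lemma cd_third {B : ℕ} (hB : 0 < B) {k : ℤ} {R x0 : ℝ} (h : 6 * R * (B:ℝ)^k ≤ 1) :
    ∃ α, ∀ x y, |x - x0| ≤ R → |y - x0| ≤ R → cd B α k x = cd B α k y := by
  have hb : (0:ℝ) < (B:ℝ)^k := by positivity
  by_contra hc
  push Not at hc
  have key : ∀ α, ∃ n : ℤ, (B:ℝ)^k * (x0 - R) < n + sh α ∧ n + sh α ≤ (B:ℝ)^k * (x0 + R) := by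
    intro α
    obtain ⟨x, y, hx, hy, hne⟩ := hc α
    wlog hlt : cd B α k x < cd B α k y generalizing x y
    · exact this y x hy hx hne.symm (lt_of_le_of_ne (not_lt.1 hlt) hne.symm)
    refine ⟨cd B α k y, ?_, ?_⟩
    · have := Int.floor_lt.1 hlt
      rw [abs_le] at hx
      have h2 : (B:ℝ)^k * (x0 - R) ≤ (B:ℝ)^k * x := by gcongr; linarith
      linarith
    · have := Int.floor_le ((B:ℝ)^k * y - sh α)
      rw [abs_le] at hy
      have h2 : (B:ℝ)^k * y ≤ (B:ℝ)^k * (x0 + R) := by gcongr; linarith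
      unfold cd
      linarith
  obtain ⟨n, h1, h2⟩ := key false
  obtain ⟨m, h3, h4⟩ := key true
  simp only [sh] at h1 h2 h3 h4
  norm_num at h1 h2 h3 h4
  have a1 : (m:ℝ) < n := by nlinarith
  have a2 : (n:ℝ) < m + 1 := by nlinarith
  have b1 : m < n := by exact_mod_cast a1
  have b2 : n < m + 1 := by exact_mod_cast a2
  omega

lemma cd_lim {B : ℕ} (hB : 1 < B) {e : ℝ} (he : 0 < e) : ∃ k0 : ℤ, ∀ k, k0 ≤ k → ((B:ℝ)^k)⁻¹ ≤ e := by
  have hB' : (1:ℝ) < B := by exact_mod_cast hB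
  obtain ⟨n, hn⟩ := pow_unbounded_of_one_lt e⁻¹ hB'
  refine ⟨n, fun k hk => ?_⟩
  rw [inv_le_comm₀ (by positivity) he]
  refine hn.le.trans ?_
  rw [← zpow_natCast]
  exact zpow_le_zpow_right₀ hB'.le hk

lemma cd_lim' {B : ℕ} (hB : 1 < B) (C : ℝ) : ∃ k0 : ℤ, ∀ k, k ≤ k0 → C ≤ ((B:ℝ)^k)⁻¹ := by
  have hB' : (1:ℝ) < B := by exact_mod_cast hB
  obtain ⟨n, hn⟩ := pow_unbounded_of_one_lt C hB'
  refine ⟨-n, fun k hk => ?_⟩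
  refine hn.le.trans ?_
  rw [← zpow_natCast, ← zpow_neg]
  exact zpow_le_zpow_right₀ hB'.le (by omega)

lemma dblB (B : ℕ) (hB : 0 < B) (k : ℤ) : ofReal ((B:ℝ)^k)⁻¹ ≤ B * ofReal ((B:ℝ)^(k+1))⁻¹ := by
  have : (B:ℝ) ≠ 0 := by positivity
  rw [← ENNReal.ofReal_natCast, ← ENNReal.ofReal_mul (by positivity), zpow_add_one₀ this, mul_inv]
  apply ENNReal.ofReal_le_ofReal
  rw [mul_comm, mul_assoc, inv_mul_cancel₀ this, mul_one]

def gT (α : Bool) : Grid ℝ (volume : Measure ℝ) where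
  I := ℤ
  cI := inferInstance
  c := cd 16 α
  meas k i := by rw [cd_cell (by norm_num)]; exact measurableSet_Ico
  nest := cd_nest (m := 5) (by norm_num) α
  v k := ofReal (((16:ℕ):ℝ)^k)⁻¹
  vol k x := by rw [cd_cell (by norm_num), Real.volume_Ico]; simp
  v0 k := by simp; positivity
  vt k := by simp
  D := 16
  D1 := by norm_num
  Dt := by simp
  dbl k := by
    exact dblB 16 (by norm_num) k
  small O hO x hx := by
    obtain ⟨e, he, h⟩ := Metric.isOpen_iff.1 hO x hx
    obtain ⟨k0, h0⟩ := cd_lim (B := 16) (by norm_num) (half_pos he)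
    refine ⟨k0, fun k hk y hy => h ?_⟩
    have := (cd_close (by norm_num) hy).trans (h0 k hk)
    rw [mem_ball, Real.dist_eq]; linarith
  big C hC := by
    obtain ⟨k0, h0⟩ := cd_lim' (B := 16) (by norm_num) C.toReal
    refine ⟨k0, fun k hk => ?_⟩
    exact ENNReal.le_ofReal_iff_toReal_le hC (by positivity) |>.2 (h0 k hk)

lemma nsp {d : ℕ} {x : Spc d} {e : ℝ} (he : 0 ≤ e) (h : ∀ i, |x i| ≤ e) : ‖x‖ ≤ d * e := by
  rw [EuclideanSpace.norm_eq]
  refine Real.sqrt_le_iff.2 ⟨by positivity, ?_⟩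
  calc ∑ i, ‖x i‖ ^ 2 ≤ ∑ i : Fin d, e ^ 2 := Finset.sum_le_sum fun i _ => by
        rw [Real.norm_eq_abs]; exact pow_le_pow_left₀ (abs_nonneg _) (h i) 2
    _ = d * e ^ 2 := by simp
    _ ≤ (d:ℝ)^2 * e ^ 2 := by
        gcongr
        rcases Nat.eq_zero_or_pos d with h | h
        · simp [h]
        · exact le_self_pow₀ (by exact_mod_cast h) (by norm_num)
    _ = _ := by ring

def gX (d : ℕ) (hd : 1 ≤ d) (β : Fin d → Bool) : Grid (Spc d) (volume : Measure (Spc d)) where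
  I := Fin d → ℤ
  cI := inferInstance
  c k x i := cd 4 (β i) k (x i)
  meas k n := by
    have : {x : Spc d | (fun i => cd 4 (β i) k (x i)) = n} = ⋂ i, (fun x : Spc d => x i) ⁻¹' {y | cd 4 (β i) k y = n i} := by
      ext x; simp [funext_iff]
    rw [this]
    refine MeasurableSet.iInter fun i => ?_
    rw [cd_cell (by norm_num)]
    exact measurableSet_Ico.preimage (by fun_prop)
  nest k x y h := funext fun i => cd_nest (m := 1) (by norm_num) (β i) k _ _ (congrFun h i)
  v k := ofReal (((4:ℕ):ℝ)^k)⁻¹ ^ d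
  vol k x := by
    have : {y : Spc d | (fun i => cd 4 (β i) k (y i)) = fun i => cd 4 (β i) k (x i)} =
      WithLp.ofLp ⁻¹' (Set.univ.pi fun i => {y | cd 4 (β i) k y = cd 4 (β i) k (x i)}) := by
      ext y; simp [funext_iff]
    rw [this, (PiLp.volume_preserving_ofLp (Fin d)).measure_preimage, volume_pi_pi]
    · simp only [cd_cell (show 0 < 4 by norm_num), Real.volume_Ico, add_sub_cancel_left, Finset.prod_const, Finset.card_univ,
        Fintype.card_fin]
    · refine (MeasurableSet.univ_pi fun i => ?_).nullMeasurableSet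
      rw [cd_cell (by norm_num)]; exact measurableSet_Ico
  v0 k := by simp only [ne_eq, pow_eq_zero_iff', ENNReal.ofReal_eq_zero, not_le, not_and_or]; left; positivity
  vt k := by simp
  D := 4 ^ d
  D1 := one_le_pow₀ (by norm_num)
  Dt := by simp
  dbl k := by
    rw [← mul_pow]
    gcongr
    exact dblB 4 (by norm_num) k
  small O hO x hx := by
    obtain ⟨e, he, h⟩ := Metric.isOpen_iff.1 hO x hx
    have hd' : (0:ℝ) < d := by exact_mod_cast hd
    obtain ⟨k0, h0⟩ := cd_lim (B := 4) (by norm_num) (show 0 < e / (2 * d) by positivity)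
    refine ⟨k0, fun k hk y hy => h ?_⟩
    have := nsp (x := y - x) (by positivity) fun i => (cd_close (by norm_num) (congrFun hy i)).trans (h0 k hk)
    rw [mem_ball, dist_eq_norm]
    refine this.trans_lt ?_
    field_simp; linarith
  big C hC := by
    obtain ⟨k0, h0⟩ := cd_lim' (B := 4) (by norm_num) (max C.toReal 1)
    refine ⟨k0, fun k hk => ?_⟩
    have h1 := h0 k hk
    calc C ≤ ofReal (((4:ℕ):ℝ)^k)⁻¹ := ENNReal.le_ofReal_iff_toReal_le hC (by positivity) |>.2 ((le_max_left _ _).trans h1)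
      _ ≤ _ := by
        refine le_self_pow₀ ?_ (by omega)
        rw [ENNReal.one_le_ofReal]; exact (le_max_right _ _).trans h1

def gP (d : ℕ) (hd : 1 ≤ d) (α : Bool × (Fin d → Bool)) : Grid (Pt d) (volume : Measure (Pt d)) :=
  (gT α.1).prod (gX d hd α.2)

def MM {d : ℕ} (hd : 1 ≤ d) (g : Pt d → ENNReal) (z : Pt d) : ENNReal := ∑ α, (gP d hd α).M g z

def bx {d : ℕ} (z : Pt d) (R : ℝ) : Set (Pt d) := {w | |w.1 - z.1| ≤ R ^ 2 ∧ ∀ i, |w.2 i - z.2 i| ≤ R}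

section
variable {d : ℕ} (hd : 1 ≤ d)

lemma mMM (g : Pt d → ENNReal) : Measurable (MM hd g) :=
  Finset.measurable_sum _ fun α _ => (gP d hd α).mM g

lemma M_le_MM (α) (g : Pt d → ENNReal) (z) : (gP d hd α).M g z ≤ MM hd g z :=
  Finset.single_le_sum (f := fun α => (gP d hd α).M g z) (fun _ _ => zero_le) (Finset.mem_univ α)

lemma box_cube (z : Pt d) {R : ℝ} (hR : 0 < R) : ∃ α k, (∀ y ∈ bx z R, bx z R ⊆ (gP d hd α).Q k y) ∧
    (gP d hd α).v k ≤ ofReal ((24 * R) ^ (d + 2)) := by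
  obtain ⟨k, hk1, hk2⟩ := exists_mem_Ico_zpow (x := (6 * R)⁻¹) (by positivity) (show (1:ℝ) < 4 by norm_num)
  have e1 : 6 * R * ((4:ℕ):ℝ)^k ≤ 1 := by
    rw [le_inv_comm₀ (by positivity) (by positivity)] at hk1
    push_cast
    calc 6 * R * 4^k ≤ (4^k)⁻¹ * (4:ℝ)^k := by gcongr
      _ = 1 := inv_mul_cancel₀ (by positivity)
  have e16 : ((16:ℕ):ℝ)^k = ((4:ℝ)^k)^2 := by
    rw [← zpow_natCast, ← zpow_mul, mul_comm, zpow_mul]; norm_num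
  have e2 : 6 * R^2 * ((16:ℕ):ℝ)^k ≤ 1 := by
    rw [e16]; push_cast at e1
    have : 0 < R * (4:ℝ)^k := by positivity
    nlinarith
  have e3 : ((4:ℝ)^k)⁻¹ ≤ 24 * R := by
    rw [zpow_add_one₀ (by norm_num)] at hk2
    rw [inv_le_comm₀ (by positivity) (by positivity)]
    rw [mul_inv] at hk2 ⊢
    linarith
  obtain ⟨α, hα⟩ := cd_third (B := 16) (by norm_num) (x0 := z.1) e2
  have := fun i => cd_third (B := 4) (by norm_num) (x0 := z.2 i) e1
  choose β hβ using this
  refine ⟨(α, β), k, fun y hy w hw => ?_, ?_⟩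
  · exact Prod.ext (hα _ _ hw.1 hy.1) (funext fun i => hβ i _ _ (hw.2 i) (hy.2 i))
  · show ofReal (((16:ℕ):ℝ)^k)⁻¹ * ofReal (((4:ℕ):ℝ)^k)⁻¹ ^ d ≤ _
    rw [e16, ← ENNReal.ofReal_pow (by positivity), ← ENNReal.ofReal_mul (by positivity)]
    apply ENNReal.ofReal_le_ofReal
    push_cast
    rw [← inv_pow, ← pow_add, add_comm]
    gcongr

lemma MM_box (z : Pt d) {R : ℝ} (hR : 0 < R) (g : Pt d → ENNReal) {y : Pt d} (hy : y ∈ bx z R) :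
    ∫⁻ w in bx z R, g w ≤ ofReal ((24 * R) ^ (d + 2)) * MM hd g y := by
  obtain ⟨α, k, h1, h2⟩ := box_cube hd z hR
  calc ∫⁻ w in bx z R, g w ≤ ∫⁻ w in (gP d hd α).Q k y, g w := lintegral_mono_set (h1 y hy)
    _ = _ := (gP d hd α).lint_E k y g
    _ ≤ _ := mul_le_mul' h2 (((gP d hd α).E_le_M _ _ _).trans (M_le_MM hd _ _ _))

lemma MM_one (z : Pt d) : MM hd (fun _ => 1) z = Fintype.card (Bool × (Fin d → Bool)) := by
  unfold MM
  simp [Grid.M_one]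

end

def NN {d : ℕ} (q p : ℝ) (g : Pt d → ENNReal) : ENNReal := ∫⁻ x, (∫⁻ t, g (t, x) ^ q) ^ (p / q)

lemma pw2 {s : ℝ} (hs : 0 ≤ s) (a b : ENNReal) : (a + b) ^ s ≤ 2 ^ s * (a ^ s + b ^ s) := by
  wlog h : a ≤ b generalizing a b
  · rw [add_comm a, add_comm (a ^ s)]; exact this b a (le_of_not_ge h)
  calc (a + b) ^ s ≤ (2 * b) ^ s := by
        apply ENNReal.rpow_le_rpow _ hs
        rw [two_mul]; gcongr
    _ = 2 ^ s * b ^ s := ENNReal.mul_rpow_of_nonneg _ _ hs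
    _ ≤ _ := by gcongr; exact le_add_self

section
variable {d : ℕ} {q p : ℝ}

lemma NN_mono (hq : 0 < q) (hp : 0 < p) {f g : Pt d → ENNReal} (h : ∀ z, f z ≤ g z) : NN q p f ≤ NN q p g :=
  lintegral_mono fun x => ENNReal.rpow_le_rpow (lintegral_mono fun t => ENNReal.rpow_le_rpow (h _) hq.le) (by positivity)

lemma mNN {g : Pt d → ENNReal} (hg : Measurable g) (s : ℝ) :
    Measurable fun x : Spc d => ∫⁻ t, g (t, x) ^ s :=
  Measurable.lintegral_prod_left' (hg.pow_const s)

lemma mst {g : Pt d → ENNReal} (hg : Measurable g) (s : ℝ) (x : Spc d) : Measurable fun t => g (t, x) ^ s :=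
  (hg.comp measurable_prodMk_right).pow_const s

lemma NN_smul (hq : 0 < q) (hp : 0 < p) (c : ENNReal) {g : Pt d → ENNReal} (hg : Measurable g) :
    NN q p (fun z => c * g z) = c ^ p * NN q p g := by
  unfold NN
  rw [← lintegral_const_mul _ ((mNN hg q).pow_const _)]
  refine lintegral_congr fun x => ?_
  simp_rw [ENNReal.mul_rpow_of_nonneg _ _ hq.le]
  rw [lintegral_const_mul _ (mst hg q x),
    ENNReal.mul_rpow_of_nonneg _ _ (by positivity : 0 ≤ p / q), ← ENNReal.rpow_mul, mul_div_cancel₀ _ hq.ne']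

lemma NN_add (hq : 0 < q) (hp : 0 < p) : ∃ C : ENNReal, C ≠ ∞ ∧ ∀ f g : Pt d → ENNReal, Measurable f → Measurable g →
    NN q p (fun z => f z + g z) ≤ C * (NN q p f + NN q p g) := by
  have hpq : 0 ≤ p / q := by positivity
  refine ⟨(2 ^ q) ^ (p / q) * 2 ^ (p/q), by finiteness, fun f g hf hg => ?_⟩
  unfold NN
  rw [← lintegral_add_left ((mNN hf q).pow_const _), ← lintegral_const_mul _ (((mNN hf q).pow_const _).fun_add ((mNN hg q).pow_const _))]
  refine lintegral_mono fun x => ?_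
  have mf : Measurable fun t => f (t, x) ^ q := (hf.comp measurable_prodMk_right).pow_const q
  have mg : Measurable fun t => g (t, x) ^ q := (hg.comp measurable_prodMk_right).pow_const q
  calc (∫⁻ t, (f (t, x) + g (t, x)) ^ q) ^ (p/q) ≤ (2 ^ q * ((∫⁻ t, f (t, x) ^ q) + ∫⁻ t, g (t, x) ^ q)) ^ (p/q) := by
        apply ENNReal.rpow_le_rpow _ hpq
        rw [← lintegral_add_left mf, ← lintegral_const_mul _ (mf.fun_add mg)]
        exact lintegral_mono fun t => pw2 hq.le _ _
    _ ≤ _ := by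
        rw [ENNReal.mul_rpow_of_nonneg _ _ hpq, mul_assoc]
        gcongr
        exact pw2 hpq _ _

lemma NN_sum (hq : 0 < q) (hp : 0 < p) {ι : Type} (s : Finset ι) : ∃ C : ENNReal, C ≠ ∞ ∧ ∀ f : ι → Pt d → ENNReal,
    (∀ i, Measurable (f i)) → NN q p (fun z => ∑ i ∈ s, f i z) ≤ C * ∑ i ∈ s, NN q p (f i) := by
  classical
  obtain ⟨A, hA, h⟩ := NN_add (d := d) hq hp
  induction s using Finset.induction_on with
  | empty => exact ⟨0, by simp, fun f _ => by simp [NN, hq, hp, div_pos hp hq]⟩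
  | insert a s has ih =>
    obtain ⟨C, hC, ih⟩ := ih
    refine ⟨A * (1 + C), by finiteness, fun f hf => ?_⟩
    simp only [Finset.sum_insert has]
    refine (h _ _ (hf a) (Finset.measurable_sum s fun i _ => hf i)).trans ?_
    rw [mul_assoc]
    gcongr
    rw [mul_add]
    refine add_le_add ?_ ((ih f hf).trans ?_)
    · exact le_mul_of_one_le_left zero_le le_self_add
    · gcongr; exact le_add_self

lemma MM_NN (hd : 1 ≤ d) (hq : 1 < q) (hp : 1 < p) : ∃ C : ENNReal, C ≠ ∞ ∧ ∀ g : Pt d → ENNReal, Measurable g →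
    NN q p (MM hd g) ≤ C * NN q p g := by
  obtain ⟨A, hA, h⟩ := NN_sum (d := d) (q := q) (p := p) (by positivity) (by positivity) (Finset.univ : Finset (Bool × (Fin d → Bool)))
  have := fun α : Bool × (Fin d → Bool) => (gT α.1).prod_mix (gX d hd α.2) hp hq
  choose C hC hh using this
  refine ⟨A * ∑ α, C α, ENNReal.mul_ne_top hA (ENNReal.sum_ne_top.2 fun α _ => hC α), fun g hg => ?_⟩
  refine (h _ fun α => (gP d hd α).mM g).trans ?_
  rw [mul_assoc, Finset.sum_mul]
  gcongr with α
  exact hh α g hg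

lemma NN_rpow {r : ℝ} (hr : 0 < r) (hq : 0 < q) (h : Pt d → ENNReal) :
    NN q p (fun z => h z ^ (1/r)) = NN (q/r) (p/r) h := by
  unfold NN
  simp_rw [← ENNReal.rpow_mul]
  rw [div_div_div_cancel_right₀ hr.ne', one_div_mul_eq_div]

lemma mixed_holder {q' p' : ℝ} (hq : q.HolderConjugate q') (hp : p.HolderConjugate p') {f g : Pt d → ENNReal}
    (hf : Measurable f) (hg : Measurable g) :
    ∫⁻ z, f z * g z ≤ NN q p f ^ (1/p) * NN q' p' g ^ (1/p') := by
  have e : ∫⁻ z, f z * g z = ∫⁻ x : Spc d, ∫⁻ t, f (t, x) * g (t, x) :=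
    lintegral_prod_symm _ (hf.mul hg).aemeasurable
  rw [e]
  calc _ ≤ ∫⁻ x : Spc d, (∫⁻ t, f (t, x) ^ q) ^ (1/q) * (∫⁻ t, g (t, x) ^ q') ^ (1/q') :=
        lintegral_mono fun x => ENNReal.lintegral_mul_le_Lp_mul_Lq _ hq
          (hf.comp measurable_prodMk_right).aemeasurable (hg.comp measurable_prodMk_right).aemeasurable
    _ ≤ _ := ENNReal.lintegral_mul_le_Lp_mul_Lq _ hp ((mNN hf q).pow_const _).aemeasurable ((mNN hg q').pow_const _).aemeasurable
    _ = _ := by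
        unfold NN
        simp_rw [← ENNReal.rpow_mul, one_div_mul_eq_div]

lemma dual_NN (hd : 1 ≤ d) (hq : 1 < q) (hp : 1 < p) (α) : ∃ C : ENNReal, C ≠ ∞ ∧ ∀ U Γ : Pt d → ENNReal,
    Measurable U → Measurable Γ → NN q p U ≠ ∞ →
    (∀ g, Measurable g → ∫⁻ z, U z * g z ≤ 4 * ∫⁻ z, Γ z * (gP d hd α).M g z) → NN q p U ≤ C * NN q p Γ := by
  have hcq := Real.HolderConjugate.conjExponent hq
  have hcp := Real.HolderConjugate.conjExponent hp
  set q' := q.conjExponent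
  set p' := p.conjExponent
  obtain ⟨C, hC, h⟩ := MM_NN (d := d) hd hcq.symm.lt hcp.symm.lt
  have hp0 : 0 < p := by positivity
  have hq0 : 0 < q := by positivity
  have hp0' : 0 < p' := hcp.symm.pos
  have hq0' : 0 < q' := hcq.symm.pos
  refine ⟨(4 * C ^ (1/p')) ^ p, by finiteness, fun U Γ hU hΓ hfin H => ?_⟩
  set Φ : Spc d → ENNReal := fun x => ∫⁻ t, U (t, x) ^ q
  have mΦ : Measurable Φ := mNN hU q
  set g : Pt d → ENNReal := fun z => U z ^ (q-1) * Φ z.2 ^ (p/q-1)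
  have mg : Measurable g := (hU.pow_const _).mul ((mΦ.comp measurable_snd).pow_const _)
  have hΦt : ∀ᵐ x, Φ x < ∞ := by
    have := ae_lt_top (mΦ.pow_const (p/q)) hfin
    filter_upwards [this] with x hx
    rwa [ENNReal.rpow_lt_top_iff_of_pos (by positivity)] at hx
  have e1 : ∫⁻ z, U z * g z = NN q p U := by
    have e : ∫⁻ z, U z * g z = ∫⁻ x : Spc d, ∫⁻ t, U (t, x) * g (t, x) :=
      lintegral_prod_symm _ (hU.mul mg).aemeasurable
    rw [e]
    refine lintegral_congr_ae ?_
    filter_upwards [hΦt] with x hx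
    have : ∀ t, U (t, x) * g (t, x) = U (t, x) ^ q * Φ x ^ (p/q-1) := by
      intro t
      simp only [g]
      rw [← mul_assoc]
      congr 1
      nth_rw 1 [← ENNReal.rpow_one (U (t, x))]
      rw [← ENNReal.rpow_add_of_nonneg _ _ (by norm_num) (by linarith)]
      congr 1; ring
    simp_rw [this]
    rw [lintegral_mul_const _ (mst hU q x)]
    show Φ x * Φ x ^ (p/q-1) = Φ x ^ (p/q)
    by_cases h0 : Φ x = 0
    · rw [h0, zero_mul, ENNReal.zero_rpow_of_pos (by positivity)]
    · nth_rw 1 [← ENNReal.rpow_one (Φ x)]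
      rw [← ENNReal.rpow_add _ _ h0 hx.ne]; congr 1; ring
  have e2 : NN q' p' g = NN q p U := by
    refine lintegral_congr_ae ?_
    filter_upwards [hΦt] with x hx
    have a1 : (q - 1) * q' = q := by rw [hcq.sub_one_mul_conj]
    have : ∀ t, g (t, x) ^ q' = U (t, x) ^ q * Φ x ^ ((p/q-1) * q') := by
      intro t
      simp only [g]
      rw [ENNReal.mul_rpow_of_nonneg _ _ hq0'.le, ← ENNReal.rpow_mul, ← ENNReal.rpow_mul, a1]
    simp_rw [this]
    rw [lintegral_mul_const _ (mst hU q x)]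
    show (Φ x * Φ x ^ ((p/q-1)*q')) ^ (p'/q') = Φ x ^ (p/q)
    by_cases h0 : Φ x = 0
    · rw [h0, zero_mul, ENNReal.zero_rpow_of_pos (by positivity), ENNReal.zero_rpow_of_pos (by positivity)]
    · nth_rw 1 [← ENNReal.rpow_one (Φ x)]
      rw [← ENNReal.rpow_add _ _ h0 hx.ne, ← ENNReal.rpow_mul]; congr 1
      have a2 : p' = p / (p - 1) := rfl
      have a3 : q' = q / (q - 1) := rfl
      have : p - 1 ≠ 0 := by linarith
      have : q - 1 ≠ 0 := by linarith
      rw [a2, a3]; field_simp; ring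
  by_cases hz : NN q p U = 0
  · rw [hz]; exact zero_le
  have key : NN q p U ≤ 4 * (NN q p Γ ^ (1/p) * (C * NN q p U) ^ (1/p')) := by
    have := H g mg
    rw [e1] at this
    refine this.trans ?_
    gcongr
    refine (mixed_holder hcq hcp hΓ ((gP d hd α).mM g)).trans ?_
    gcongr
    rw [← e2]
    exact (NN_mono hq0' hp0' (M_le_MM hd α g)).trans (h g mg)
  have hs : 1/p + 1/p' = 1 := by have := hcp.inv_add_inv_eq_one; simpa using this
  have key2 : NN q p U ^ (1/p) ≤ 4 * C ^ (1/p') * NN q p Γ ^ (1/p) := by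
    have hx0 : NN q p U ^ (1/p') ≠ 0 := by simp [ENNReal.rpow_eq_zero_iff, hz, hfin]
    have hxt : NN q p U ^ (1/p') ≠ ∞ := ENNReal.rpow_ne_top_of_nonneg (by positivity) hfin
    rw [← ENNReal.mul_le_mul_iff_left hx0 hxt, ← ENNReal.rpow_add _ _ hz hfin, hs, ENNReal.rpow_one]
    refine key.trans (le_of_eq ?_)
    rw [ENNReal.mul_rpow_of_nonneg _ _ (by positivity : 0 ≤ 1/p')]; ring
  have := ENNReal.rpow_le_rpow key2 hp0.le
  rwa [ENNReal.mul_rpow_of_nonneg _ _ hp0.le, ← ENNReal.rpow_mul, ← ENNReal.rpow_mul, one_div_mul_cancel hp0.ne',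
    ENNReal.rpow_one, ENNReal.rpow_one] at this

end

section
variable {d : ℕ}

lemma mbx (z : Pt d) (R : ℝ) : MeasurableSet (bx z R) := by
  have : bx z R = {w | |w.1 - z.1| ≤ R ^ 2} ∩ ⋂ i, {w | |w.2 i - z.2 i| ≤ R} := by
    ext w; simp [bx]
  rw [this]
  refine (isClosed_le (by fun_prop) (by fun_prop)).measurableSet.inter (MeasurableSet.iInter fun i => ?_)
  exact (isClosed_le (by fun_prop) (by fun_prop)).measurableSet

lemma mprho : Measurable (prho (d := d)) := by unfold prho; fun_prop

lemma prho_nonneg (z : Pt d) : 0 ≤ prho z := by unfold prho; positivity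

lemma prho_bx {z w : Pt d} {R : ℝ} (h : prho (w - z) ≤ R) : w ∈ bx z R := by
  have h1 : ‖w.2 - z.2‖ + √|w.1 - z.1| ≤ R := h
  have h2 := norm_nonneg (w.2 - z.2)
  have h3 := Real.sqrt_nonneg |w.1 - z.1|
  refine ⟨?_, fun i => ?_⟩
  · exact (Real.sqrt_le_left (by linarith)).1 (by linarith)
  · have := PiLp.norm_apply_le (w.2 - z.2) i
    rw [Real.norm_eq_abs] at this
    exact this.trans (by linarith)

lemma bx_mono {z w : Pt d} {R S : ℝ} (h0 : 0 ≤ R) (h : R ≤ S) (hw : w ∈ bx z R) : w ∈ bx z S :=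
  ⟨hw.1.trans (pow_le_pow_left₀ h0 h 2), fun i => (hw.2 i).trans h⟩

lemma ann (hd : 1 ≤ d) {g : Pt d → ENNReal} (hg : Measurable g) (z : Pt d) {R : ℝ} (hR : 0 < R) {y : Pt d} (hy : y ∈ bx z R) :
    ∫⁻ w in {w | R ≤ prho (w - z)}, ofReal ((prho (w - z))⁻¹ ^ (d+3)) * g w ≤
      ofReal (2 * 48 ^ (d+2) * R⁻¹) * MM hd g y := by
  have mS : MeasurableSet {w : Pt d | R ≤ prho (w - z)} :=
    measurableSet_le measurable_const (mprho.comp (measurable_id.sub_const z))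
  have h1 : ∀ w ∈ {w : Pt d | R ≤ prho (w - z)}, ofReal ((prho (w - z))⁻¹ ^ (d+3)) * g w ≤
      ∑' j : ℕ, (bx z (2^(j+1) * R)).indicator (fun w => ofReal ((2^j * R)⁻¹ ^ (d+3)) * g w) w := by
    intro w hw
    have hw : R ≤ prho (w - z) := hw
    obtain ⟨j, hj1, hj2⟩ := exists_nat_pow_near (x := prho (w-z) / R) (by rwa [one_le_div hR]) (show (1:ℝ) < 2 by norm_num)
    rw [le_div_iff₀ hR] at hj1
    rw [div_lt_iff₀ hR] at hj2
    refine le_trans ?_ (ENNReal.le_tsum j)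
    rw [indicator_of_mem (prho_bx hj2.le)]
    gcongr
    exact inv_nonneg.2 (prho_nonneg _)
  refine (setLIntegral_mono' mS h1).trans ((setLIntegral_le_lintegral _ _).trans ?_)
  rw [lintegral_tsum fun j => ((hg.const_mul _).indicator (mbx _ _)).aemeasurable]
  have h2 : ∀ j : ℕ, ∫⁻ w, (bx z (2^(j+1) * R)).indicator (fun w => ofReal ((2^j * R)⁻¹ ^ (d+3)) * g w) w ≤
      ofReal (48 ^ (d+2) * R⁻¹ * (1/2)^j) * MM hd g y := by
    intro j
    rw [lintegral_indicator (mbx _ _), lintegral_const_mul _ hg]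
    have hy' : y ∈ bx z (2^(j+1) * R) := bx_mono hR.le (le_mul_of_one_le_left hR.le (one_le_pow₀ (by norm_num))) hy
    refine (mul_le_mul' le_rfl (MM_box hd z (by positivity) g hy')).trans ?_
    rw [← mul_assoc, ← ENNReal.ofReal_mul (by positivity)]
    refine mul_le_mul' (ENNReal.ofReal_le_ofReal ?_) le_rfl
    apply le_of_eq
    rw [show (24:ℝ) * (2^(j+1) * R) = 48 * (2^j * R) by ring, mul_pow, pow_succ _ (d+2)]
    have : (2:ℝ)^j * R ≠ 0 := by positivity
    field_simp
    rw [← mul_pow, one_div_mul_cancel this, ← mul_pow]; norm_num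
  refine (ENNReal.tsum_le_tsum h2).trans ?_
  rw [ENNReal.tsum_mul_right]
  gcongr
  rw [← ENNReal.ofReal_tsum_of_nonneg (fun j => by positivity) (summable_geometric_two.mul_left _), tsum_mul_left, tsum_geometric_two]
  apply ENNReal.ofReal_le_ofReal
  apply le_of_eq; ring

end

section
open scoped FourierTransform RealInnerProductSpace ContDiff
variable {d : ℕ}

def qf (A : Fin d → Fin d → ℝ) (ξ : Spc d) : ℝ := ∑ i, ∑ j, A i j * (ξ i * ξ j)

def El (c τ : ℝ) (A : Fin d → Fin d → ℝ) : Prop :=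
  (∀ ξ : Spc d, c * τ * ‖ξ‖ ^ 2 ≤ qf A ξ) ∧ ∀ i j, |A i j| ≤ c⁻¹ * τ

def mono (l : List (Fin d)) (ξ : Spc d) : ℝ := (l.map fun i => ξ i).prod

lemma mono_nil (ξ : Spc d) : mono [] ξ = 1 := rfl
lemma mono_cons (i : Fin d) (l) (ξ : Spc d) : mono (i :: l) ξ = ξ i * mono l ξ := by simp [mono]

lemma mono_cd (l : List (Fin d)) : ContDiff ℝ ∞ (mono l) := by
  induction l with
  | nil => exact contDiff_const
  | cons i l ih =>
    have : mono (i :: l) = fun ξ => ξ i * mono l ξ := by ext; rw [mono_cons]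
    rw [this]
    exact (by fun_prop : ContDiff ℝ ∞ fun ξ : Spc d => ξ i).mul ih

lemma qf_cd (A : Fin d → Fin d → ℝ) : ContDiff ℝ ∞ (qf A) := by unfold qf; fun_prop

lemma itd_coord (i : Fin d) (n : ℕ) (ξ : Spc d) : ‖iteratedFDeriv ℝ n (fun ξ : Spc d => ξ i) ξ‖ ≤ 1 + ‖ξ‖ := by
  have h0 := norm_nonneg ξ
  have hc := PiLp.norm_apply_le ξ i
  rcases n with _ | n
  · rw [norm_iteratedFDeriv_zero]; linarith
  · rw [← norm_iteratedFDeriv_fderiv]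
    have e : fderiv ℝ (fun ξ : Spc d => ξ i) = fun _ => (EuclideanSpace.proj i : Spc d →L[ℝ] ℝ) := by
      ext1 ξ
      exact (EuclideanSpace.proj i : Spc d →L[ℝ] ℝ).fderiv
    rw [e]
    rcases n with _ | n
    · rw [norm_iteratedFDeriv_zero]
      refine le_trans (ContinuousLinearMap.opNorm_le_bound _ zero_le_one fun x => ?_) (by linarith : (1:ℝ) ≤ _)
      rw [one_mul]; exact PiLp.norm_apply_le x i
    · rw [iteratedFDeriv_succ_const]; simp; linarith

lemma itd_mul {f g : Spc d → ℝ} (hf : ContDiff ℝ ∞ f) (hg : ContDiff ℝ ∞ g) (n : ℕ) (ξ) {F G : ℝ}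
    (h1 : ∀ i ≤ n, ‖iteratedFDeriv ℝ i f ξ‖ ≤ F) (h2 : ∀ i ≤ n, ‖iteratedFDeriv ℝ i g ξ‖ ≤ G) (i : ℕ) (hi : i ≤ n) :
    ‖iteratedFDeriv ℝ i (fun y => f y * g y) ξ‖ ≤ 2 ^ n * (F * G) := by
  have hF := (norm_nonneg _).trans (h1 0 n.zero_le)
  have hG := (norm_nonneg _).trans (h2 0 n.zero_le)
  refine (norm_iteratedFDeriv_mul_le hf hg ξ (n := i) (by exact_mod_cast le_top)).trans ?_
  calc _ ≤ ∑ j ∈ Finset.range (i+1), (i.choose j : ℝ) * (F * G) := by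
        apply Finset.sum_le_sum
        intro j hj
        rw [Finset.mem_range] at hj
        rw [mul_assoc]
        gcongr
        · exact h1 j (by omega)
        · exact h2 _ (by omega)
    _ = 2 ^ i * (F * G) := by
        rw [← Finset.sum_mul]; congr 1
        exact_mod_cast Nat.sum_range_choose i
    _ ≤ _ := by gcongr; norm_num

lemma itd_mono (l : List (Fin d)) (n : ℕ) (ξ : Spc d) (i : ℕ) (hi : i ≤ n) :
    ‖iteratedFDeriv ℝ i (mono l) ξ‖ ≤ (2 ^ n) ^ l.length * (1 + ‖ξ‖) ^ l.length := by
  induction l generalizing i with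
  | nil =>
    have : mono ([] : List (Fin d)) = fun _ => 1 := rfl
    rw [this]
    rcases i with _ | i
    · rw [norm_iteratedFDeriv_zero]; simp
    · rw [iteratedFDeriv_succ_const]; simp
  | cons k l ih =>
    have : mono (k :: l) = fun ξ => ξ k * mono l ξ := by ext; rw [mono_cons]
    rw [this]
    refine (itd_mul (by fun_prop) (mono_cd l) n ξ (fun i _ => itd_coord k i ξ) (fun i hi => ih i hi) i hi).trans (le_of_eq ?_)
    rw [List.length_cons]; ring

lemma itd_qf {c : ℝ} (hc : 0 < c) (n : ℕ) {A : Fin d → Fin d → ℝ} (hA : El c 1 A) (ξ) (i : ℕ) (hi : i ≤ n) :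
    ‖iteratedFDeriv ℝ i (fun ξ => - qf A ξ) ξ‖ ≤ (d^2 * c⁻¹ * (2 ^ n) ^ 2 + 1) * (1 + ‖ξ‖) ^ 2 := by
  have e : (fun ξ => - qf A ξ) = fun ξ => ∑ p ∈ (Finset.univ : Finset (Fin d × Fin d)), (- A p.1 p.2) • mono [p.1, p.2] ξ := by
    ext ξ
    rw [Fintype.sum_prod_type]
    simp [qf, mono]
  have hcd : ∀ k l : Fin d, ContDiff ℝ i (mono [k,l]) := fun k l => (mono_cd _).of_le (by exact_mod_cast le_top)
  rw [e, iteratedFDeriv_sum (f := fun (p : Fin d × Fin d) ξ => (- A p.1 p.2) • mono [p.1, p.2] ξ) fun j _ => (hcd j.1 j.2).const_smul (- A j.1 j.2)]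
  rw [Finset.sum_apply]
  refine (norm_sum_le _ _).trans ?_
  have : ∀ p ∈ (Finset.univ : Finset (Fin d × Fin d)), ‖iteratedFDeriv ℝ i (fun ξ => (- A p.1 p.2) • mono [p.1, p.2] ξ) ξ‖ ≤
      c⁻¹ * ((2 ^ n) ^ 2 * (1 + ‖ξ‖) ^ 2) := by
    intro p _
    rw [iteratedFDeriv_const_smul_apply' (hcd _ _).contDiffAt, norm_smul, norm_neg, Real.norm_eq_abs]
    have := hA.2 p.1 p.2
    rw [mul_one] at this
    have h2 := itd_mono [p.1, p.2] n ξ i hi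
    simp only [List.length_cons, List.length_nil, zero_add, Nat.reduceAdd] at h2
    gcongr
  refine (Finset.sum_le_sum this).trans ?_
  simp only [Finset.sum_const, Finset.card_univ, Fintype.card_prod, Fintype.card_fin, nsmul_eq_mul]
  push_cast
  nlinarith [sq_nonneg (1 + ‖ξ‖)]

lemma itd_exp {c : ℝ} (hc : 0 < c) (n : ℕ) {A : Fin d → Fin d → ℝ} (hA : El c 1 A) (ξ) (i : ℕ) (hi : i ≤ n) :
    ‖iteratedFDeriv ℝ i (fun ξ => exp (- qf A ξ)) ξ‖ ≤ n.factorial * exp (-c * ‖ξ‖^2) * ((d^2 * c⁻¹ * (2 ^ n) ^ 2 + 1) * (1 + ‖ξ‖) ^ 2) ^ n := by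
  have h0 := norm_nonneg ξ
  set D := (d^2 * c⁻¹ * (2 ^ n) ^ 2 + 1) * (1 + ‖ξ‖) ^ 2 with hD
  have hD1 : 1 ≤ D := by
    have : 0 ≤ d^2 * c⁻¹ * (2 ^ n) ^ 2 := by positivity
    have : 1 ≤ (1 + ‖ξ‖) ^ 2 := by nlinarith
    nlinarith
  have := norm_iteratedFDeriv_comp_le (g := exp) (f := fun ξ => - qf A ξ) (n := i) (N := ∞) (Real.contDiff_exp) (qf_cd A).neg
    (by exact_mod_cast le_top) ξ (C := exp (- qf A ξ)) (D := D) (fun j _ => by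
      rw [norm_iteratedFDeriv_eq_norm_iteratedDeriv, iteratedDeriv_eq_iterate, Real.iter_deriv_exp, Real.norm_eq_abs, Real.abs_exp])
    (fun j hj1 hj2 => (itd_qf hc n hA ξ j (hj2.trans hi)).trans (le_self_pow₀ hD1 (by omega)))
  refine this.trans ?_
  have := hA.1 ξ
  rw [mul_one] at this
  gcongr
  linarith

lemma expdec {c : ℝ} (hc : 0 < c) (m : ℕ) : ∃ C, 0 < C ∧ ∀ r : ℝ, 0 ≤ r → (1 + r) ^ m * exp (-c * r^2) ≤ C := by
  refine ⟨exp c * ((2/c) ^ m * m.factorial), by positivity, fun r hr => ?_⟩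
  have h1 := Real.pow_div_factorial_le_exp (c * (1+r)^2/2) (by positivity) m
  rw [div_le_iff₀ (by positivity)] at h1
  have h2 : exp (-c * r^2) ≤ exp c * exp (- (c * (1+r)^2/2)) := by
    rw [← Real.exp_add]; apply Real.exp_le_exp.2; nlinarith [mul_nonneg hc.le (sq_nonneg (1-r))]
  have h3 : (1+r)^m ≤ (2/c)^m * (c * (1+r)^2/2)^m := by
    rw [← mul_pow]
    apply pow_le_pow_left₀ (by linarith)
    rw [show 2 / c * (c * (1+r)^2/2) = (1+r)^2 by field_simp]
    nlinarith
  calc _ ≤ ((2/c)^m * (exp (c * (1+r)^2/2) * m.factorial)) * (exp c * exp (- (c * (1+r)^2/2))) := by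
        apply mul_le_mul (h3.trans _) h2 (by positivity) (by positivity)
        gcongr
    _ = exp c * ((2/c) ^ m * m.factorial) * (exp (c * (1+r)^2/2) * exp (- (c * (1+r)^2/2))) := by ring
    _ = _ := by rw [← Real.exp_add]; simp

def wR (l : List (Fin d)) (A : Fin d → Fin d → ℝ) (ξ : Spc d) : ℝ := mono l ξ * exp (- qf A ξ)
def wC (l : List (Fin d)) (A : Fin d → Fin d → ℝ) (ξ : Spc d) : ℂ := (wR l A ξ : ℂ)

lemma wR_cd (l : List (Fin d)) (A : Fin d → Fin d → ℝ) : ContDiff ℝ ∞ (wR l A) :=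
  (mono_cd l).mul (Real.contDiff_exp.comp (qf_cd A).neg)

lemma wC_cd (l : List (Fin d)) (A : Fin d → Fin d → ℝ) : ContDiff ℝ ∞ (wC l A) :=
  Complex.ofRealCLM.contDiff.comp (wR_cd l A)

def J (ξ : Spc d) : ℝ := ((1 + ‖ξ‖) ^ (d+1))⁻¹
lemma J_pos (ξ : Spc d) : 0 < J ξ := by unfold J; positivity
lemma J_int : Integrable (J (d := d)) := by
  have := integrable_one_add_norm (E := Spc d) (μ := volume) (r := d+1) (by simp)
  refine this.congr (of_forall fun x => ?_)
  simp only [J]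
  rw [Real.rpow_neg (by positivity)]
  norm_cast

lemma wB {c : ℝ} (hc : 0 < c) (l : List (Fin d)) (n : ℕ) : ∃ C, 0 < C ∧ ∀ A, El c 1 A → ∀ ξ, ∀ i ≤ n,
    ‖iteratedFDeriv ℝ i (wC l A) ξ‖ ≤ C * J ξ := by
  obtain ⟨C, hC, h⟩ := expdec hc (l.length + 2 * n + (d + 1))
  set K := (d^2 * c⁻¹ * (2 ^ n) ^ 2 + 1) with hK
  have hK0 : 0 < K := by positivity
  refine ⟨2^n * ((2 ^ n) ^ l.length * (n.factorial * K ^ n)) * C, by positivity, fun A hA ξ i hi => ?_⟩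
  have e : ‖iteratedFDeriv ℝ i (wC l A) ξ‖ = ‖iteratedFDeriv ℝ i (wR l A) ξ‖ :=
    LinearIsometry.norm_iteratedFDeriv_comp_left (n := ∞) Complex.ofRealLI (wR_cd l A).contDiffAt (by exact_mod_cast le_top)
  rw [e]
  refine (itd_mul (mono_cd l) (Real.contDiff_exp.comp (qf_cd A).neg) n ξ (fun i hi => itd_mono l n ξ i hi) (fun i hi => itd_exp hc n hA ξ i hi) i hi).trans ?_
  have := h ‖ξ‖ (norm_nonneg _)
  rw [J, ← hK]
  rw [← div_eq_mul_inv, le_div_iff₀ (by positivity)]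
  calc _ = 2^n * ((2 ^ n) ^ l.length * (n.factorial * K ^ n)) * ((1 + ‖ξ‖)^(l.length + 2 * n + (d + 1)) * exp (-c * ‖ξ‖^2)) := by
        generalize 1 + ‖ξ‖ = y
        rw [pow_add y _ (d+1), pow_add y l.length, pow_mul y 2, mul_pow K]; ring
    _ ≤ _ := by gcongr

end

section
open scoped FourierTransform RealInnerProductSpace ContDiff
variable {d : ℕ}

def Psi (l : List (Fin d)) (A : Fin d → Fin d → ℝ) : Spc d → ℂ := 𝓕 (wC l A)

lemma K0 {c : ℝ} (hc : 0 < c) (l : List (Fin d)) (N : ℕ) : ∃ C, 0 < C ∧ ∀ A, El c 1 A → ∀ x,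
    (1 + ‖x‖) ^ N * ‖Psi l A x‖ ≤ C := by
  obtain ⟨C, hC, h⟩ := wB hc l N
  have hJ : 0 ≤ ∫ ξ, J (d := d) ξ := integral_nonneg fun ξ => (J_pos ξ).le
  set B := 2 ^ N * ((N + 1) * (C * ∫ ξ, J (d := d) ξ)) with hB
  have hB0 : 0 ≤ B := by positivity
  refine ⟨2 ^ (N-1) * (B + B) + 1, by positivity, fun A hA x => ?_⟩
  have hint : ∀ n ≤ N, Integrable (fun v => ‖v‖ ^ 0 * ‖iteratedFDeriv ℝ n (wC l A) v‖) := by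
    intro n hn
    simp only [pow_zero, one_mul]
    refine (J_int.const_mul C).mono' ?_ (of_forall fun ξ => by rw [norm_norm]; exact h A hA ξ n hn)
    exact ((wC_cd l A).continuous_iteratedFDeriv (m := n) (by exact_mod_cast le_top)).norm.aestronglyMeasurable
  have key : ∀ n ≤ N, ‖x‖ ^ n * ‖Psi l A x‖ ≤ B := by
    intro n hn
    have := Real.pow_mul_norm_iteratedFDeriv_fourier_le (f := wC l A) (K := (0:ℕ)) (N := n) ((wC_cd l A).of_le (by exact_mod_cast le_top))
      (fun k m hk hm => by
        have : k = 0 := by simpa using hk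
        subst this
        exact hint m (le_trans (by exact_mod_cast hm) hn)) (k := 0) (n := n) (by simp) le_rfl x
    rw [norm_iteratedFDeriv_zero] at this
    refine this.trans ?_
    have h2 : ∀ p ∈ Finset.range (0+1) ×ˢ Finset.range (n+1), ∫ v, ‖v‖ ^ p.1 * ‖iteratedFDeriv ℝ p.2 (wC l A) v‖ ≤ C * ∫ ξ, J (d := d) ξ := by
      rintro ⟨a, b⟩ hp
      simp only [Finset.mem_product, Finset.mem_range] at hp
      have ha : a = 0 := by omega
      subst ha
      rw [← integral_const_mul]
      refine integral_mono (hint b (by omega)) (J_int.const_mul C) fun ξ => ?_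
      simp only [pow_zero, one_mul]
      exact h A hA ξ b (by omega)
    have h3 := Finset.sum_le_sum h2
    rw [Finset.sum_const, Finset.card_product, Finset.card_range, Finset.card_range, nsmul_eq_mul] at h3
    push_cast at h3
    rw [hB]
    have h4 : (2:ℝ)^n ≤ 2^N := pow_le_pow_right₀ (by norm_num) hn
    have h5 : (n:ℝ) ≤ N := by exact_mod_cast hn
    simp only [pow_zero, one_mul, Nat.cast_zero, mul_zero, zero_add]
    simp only [zero_add, one_mul] at h3
    refine mul_le_mul h4 (h3.trans ?_) (Finset.sum_nonneg fun p _ => integral_nonneg fun ξ => by positivity) (by positivity)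
    gcongr
  have h1 := key 0 N.zero_le
  have h2 := key N le_rfl
  rw [pow_zero, one_mul] at h1
  calc _ ≤ 2 ^ (N-1) * (1 ^ N + ‖x‖^N) * ‖Psi l A x‖ := by
        gcongr
        exact add_pow_le zero_le_one (norm_nonneg _) N
    _ = 2 ^ (N-1) * (‖Psi l A x‖ + ‖x‖^N * ‖Psi l A x‖) := by rw [one_pow]; ring
    _ ≤ _ := by
        have : 2 ^ (N-1) * (‖Psi l A x‖ + ‖x‖^N * ‖Psi l A x‖) ≤ 2 ^ (N-1) * (B + B) := by gcongr
        linarith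

lemma mono_smul (l : List (Fin d)) (r : ℝ) (ξ : Spc d) : mono l (r • ξ) = r ^ l.length * mono l ξ := by
  induction l with
  | nil => simp [mono]
  | cons i l ih => rw [mono_cons, mono_cons, ih, List.length_cons]; simp; ring

lemma qf_smul (A : Fin d → Fin d → ℝ) (r : ℝ) (ξ : Spc d) : qf A (r • ξ) = r ^ 2 * qf A ξ := by
  simp only [qf, Finset.mul_sum]
  refine Finset.sum_congr rfl fun i _ => Finset.sum_congr rfl fun j _ => ?_
  simp; ring

lemma qf_scale (A : Fin d → Fin d → ℝ) (r : ℝ) (ξ : Spc d) : qf (fun i j => r * A i j) ξ = r * qf A ξ := by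
  simp only [qf, Finset.mul_sum]
  refine Finset.sum_congr rfl fun i _ => Finset.sum_congr rfl fun j _ => ?_
  ring

lemma qf_add (A B : Fin d → Fin d → ℝ) (ξ : Spc d) : qf (fun i j => A i j + B i j) ξ = qf A ξ + qf B ξ := by
  simp only [qf, ← Finset.sum_add_distrib]
  refine Finset.sum_congr rfl fun i _ => Finset.sum_congr rfl fun j _ => ?_
  ring

lemma El.scale {c τ r : ℝ} {A : Fin d → Fin d → ℝ} (h : El c τ A) (hr : 0 ≤ r) : El c (r * τ) fun i j => r * A i j := by
  refine ⟨fun ξ => ?_, fun i j => ?_⟩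
  · rw [qf_scale]; have := mul_le_mul_of_nonneg_left (h.1 ξ) hr; linarith
  · rw [abs_mul, abs_of_nonneg hr]; have := mul_le_mul_of_nonneg_left (h.2 i j) hr; linarith

lemma El.add {c τ σ : ℝ} {A B : Fin d → Fin d → ℝ} (h : El c τ A) (h' : El c σ B) : El c (τ + σ) fun i j => A i j + B i j := by
  refine ⟨fun ξ => ?_, fun i j => ?_⟩
  · rw [qf_add]; have := h.1 ξ; have := h'.1 ξ; linarith
  · have := h.2 i j; have := h'.2 i j; have := abs_add_le (A i j) (B i j); linarith

lemma Psi_scale (l : List (Fin d)) (A : Fin d → Fin d → ℝ) {σ : ℝ} (hσ : 0 < σ) (x : Spc d) :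
    ‖Psi l (fun i j => σ^2 * A i j) x‖ = (σ ^ (d + l.length))⁻¹ * ‖Psi l A (σ⁻¹ • x)‖ := by
  have e : Psi l (fun i j => σ^2 * A i j) x = ((σ ^ l.length)⁻¹ : ℝ) • ∫ v, (fun y : Spc d => Complex.exp (↑(-2 * Real.pi * ⟪y, σ⁻¹ • x⟫) * Complex.I) • wC l A y) (σ • v) := by
    rw [Psi, Real.fourier_eq', ← integral_smul]
    congr 1; ext v
    simp only [wC, wR]
    rw [mono_smul, qf_smul, qf_scale, real_inner_smul_left, real_inner_smul_right]
    rw [show σ * (σ⁻¹ * ⟪v, x⟫) = ⟪v, x⟫ by field_simp]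
    rw [mul_assoc (σ ^ l.length), Complex.ofReal_mul (σ ^ l.length), Complex.real_smul, smul_eq_mul, smul_eq_mul]
    have : ((((σ ^ l.length)⁻¹ : ℝ) : ℂ)) * ((σ ^ l.length : ℝ) : ℂ) = 1 := by
      rw [← Complex.ofReal_mul, inv_mul_cancel₀ (by positivity)]; simp
    linear_combination (-(Complex.exp (↑(-2 * Real.pi * ⟪v, x⟫) * Complex.I) * ((mono l v * exp (-(σ ^ 2 * qf A v)) : ℝ) : ℂ))) * this
  rw [e, Measure.integral_comp_smul volume (fun y : Spc d => Complex.exp (↑(-2 * Real.pi * ⟪y, σ⁻¹ • x⟫) * Complex.I) • wC l A y) σ, norm_smul, norm_smul, Psi, Real.fourier_eq']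
  rw [finrank_euclideanSpace, Fintype.card_fin, Real.norm_eq_abs, Real.norm_eq_abs, abs_abs, abs_of_pos (by positivity), abs_of_pos (by positivity), pow_add]
  rw [mul_inv]; ring

lemma K1 {c : ℝ} (hc : 0 < c) (l : List (Fin d)) : ∃ C, 0 < C ∧ ∀ A τ, 0 < τ → El c τ A → ∀ x,
    ‖Psi l A x‖ ≤ C * τ / (√τ + ‖x‖) ^ (d + l.length + 2) := by
  obtain ⟨C, hC, h⟩ := K0 hc l (d + l.length + 2)
  refine ⟨C, hC, fun A τ hτ hA x => ?_⟩
  have hσ : 0 < √τ := Real.sqrt_pos.2 hτ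
  have hs : √τ ^ 2 = τ := Real.sq_sqrt hτ.le
  have e : A = fun i j => √τ^2 * (τ⁻¹ * A i j) := by
    ext i j; rw [hs]; field_simp
  have hE := hA.scale (inv_nonneg.2 hτ.le)
  rw [inv_mul_cancel₀ hτ.ne'] at hE
  have := h _ hE ((√τ)⁻¹ • x)
  rw [e, Psi_scale _ _ hσ, le_div_iff₀ (by positivity)]
  rw [norm_smul, norm_inv, Real.norm_eq_abs, abs_of_pos hσ] at this
  calc _ = √τ ^ 2 * ((1 + (√τ)⁻¹ * ‖x‖) ^ (d + l.length + 2) * ‖Psi l (fun i j => τ⁻¹ * A i j) ((√τ)⁻¹ • x)‖) := by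
        rw [show √τ + ‖x‖ = √τ * (1 + (√τ)⁻¹ * ‖x‖) by field_simp, mul_pow, pow_add (√τ) (d + l.length) 2]
        field_simp
    _ ≤ √τ ^ 2 * C := by gcongr
    _ = _ := by rw [hs]; ring

lemma K1' {c : ℝ} (hc : 0 < c) (l : List (Fin d)) : ∃ C, 0 < C ∧ ∀ A τ, 0 < τ → El c τ A → ∀ x,
    ‖Psi l A x‖ ≤ C / (√τ + ‖x‖) ^ (d + l.length) := by
  obtain ⟨C, hC, h⟩ := K1 hc l
  refine ⟨C, hC, fun A τ hτ hA x => (h A τ hτ hA x).trans ?_⟩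
  have hσ : 0 < √τ := Real.sqrt_pos.2 hτ
  have hs : √τ ^ 2 = τ := Real.sq_sqrt hτ.le
  rw [div_le_div_iff₀ (by positivity) (by positivity), pow_add _ _ 2]
  have : τ ≤ (√τ + ‖x‖)^2 := by nlinarith [norm_nonneg x]
  calc _ = C * (√τ + ‖x‖) ^ (d + l.length) * τ := by ring
    _ ≤ C * (√τ + ‖x‖) ^ (d + l.length) * (√τ + ‖x‖)^2 := by gcongr
    _ = _ := by ring

end

section
open scoped FourierTransform RealInnerProductSpace ContDiff
variable {d : ℕ}

lemma El.one {c τ : ℝ} (hc : 0 < c) (hτ : 0 < τ) {A : Fin d → Fin d → ℝ} (h : El c τ A) {b : ℝ} (hb : 0 < b)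
    (h1 : b ≤ c * τ) (h2 : b ≤ c / τ) : El b 1 A := by
  refine ⟨fun ξ => le_trans ?_ (h.1 ξ), fun i j => (h.2 i j).trans ?_⟩
  · rw [mul_one]; gcongr
  · rw [mul_one, ← inv_inv (c⁻¹ * τ)]
    apply inv_anti₀ hb
    rw [mul_inv, inv_inv]; exact h2

lemma w_int {c : ℝ} (hc : 0 < c) {A : Fin d → Fin d → ℝ} (h : El c 1 A) (l) : Integrable (wC l A) := by
  obtain ⟨C, hC, hw⟩ := wB hc l 0
  refine (J_int.const_mul C).mono' (wC_cd l A).continuous.aestronglyMeasurable (of_forall fun ξ => ?_)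
  have := hw A h ξ 0 le_rfl
  rwa [norm_iteratedFDeriv_zero] at this

def ex (x ξ : Spc d) : ℂ := Complex.exp (↑(-2 * Real.pi * ⟪ξ, x⟫) * Complex.I)

lemma ex_norm (x ξ : Spc d) : ‖ex x ξ‖ = 1 := by rw [ex, Complex.norm_exp_ofReal_mul_I]

lemma ex_cont : Continuous fun p : Spc d × Spc d => ex p.1 p.2 := by unfold ex; fun_prop

lemma Psi_eq (l : List (Fin d)) (A) (x : Spc d) : Psi l A x = ∫ ξ, ex x ξ * wC l A ξ := by
  rw [Psi, Real.fourier_eq']; rfl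

lemma exw_int {c : ℝ} (hc : 0 < c) {A : Fin d → Fin d → ℝ} (h : El c 1 A) (l) (x) : Integrable fun ξ => ex x ξ * wC l A ξ := by
  refine (w_int hc h l).norm.mono' ?_ (of_forall fun ξ => by rw [norm_mul, ex_norm, one_mul])
  exact ((ex_cont.comp (by fun_prop : Continuous fun ξ : Spc d => (x, ξ))).mul (wC_cd l A).continuous).aestronglyMeasurable

def Gr (l : List (Fin d)) (A D : Fin d → Fin d → ℝ) (x y : Spc d) (ξ : Spc d) : ℂ :=
  (∑ i, ∑ j, ((- D i j : ℝ) : ℂ) * (ex x ξ * wC (i :: j :: l) A ξ)) + ∑ k, (((-2 * Real.pi * y k : ℝ) : ℂ) * Complex.I) * (ex x ξ * wC (k :: l) A ξ)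

lemma Gr_eq (l : List (Fin d)) (A D : Fin d → Fin d → ℝ) (x y : Spc d) (ξ : Spc d) :
    Gr l A D x y ξ = (((- qf D ξ : ℝ) : ℂ) + ↑(-2 * Real.pi * ⟪ξ, y⟫) * Complex.I) * (ex x ξ * wC l A ξ) := by
  have h1 : (∑ i, ∑ j, ((- D i j : ℝ) : ℂ) * (ex x ξ * wC (i :: j :: l) A ξ)) = ((- qf D ξ : ℝ) : ℂ) * (ex x ξ * wC l A ξ) := by
    rw [qf, ← Finset.sum_neg_distrib, Complex.ofReal_sum, Finset.sum_mul]
    refine Finset.sum_congr rfl fun i _ => ?_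
    rw [← Finset.sum_neg_distrib, Complex.ofReal_sum, Finset.sum_mul]
    refine Finset.sum_congr rfl fun j _ => ?_
    simp only [wC, wR, mono_cons]; push_cast; ring
  have h2 : (∑ k, (((-2 * Real.pi * y k : ℝ) : ℂ) * Complex.I) * (ex x ξ * wC (k :: l) A ξ)) = (↑(-2 * Real.pi * ⟪ξ, y⟫) * Complex.I) * (ex x ξ * wC l A ξ) := by
    rw [PiLp.inner_apply, Finset.mul_sum, Complex.ofReal_sum, Finset.sum_mul, Finset.sum_mul]
    refine Finset.sum_congr rfl fun k _ => ?_
    simp only [wC, wR, mono_cons]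
    simp
    ring
  rw [Gr, h1, h2]; ring

lemma Gr_int {c : ℝ} (hc : 0 < c) (l : List (Fin d)) {A : Fin d → Fin d → ℝ} (hA : El c 1 A) (D) (x y : Spc d) :
    ∫ ξ, Gr l A D x y ξ = (∑ i, ∑ j, ((- D i j : ℝ) : ℂ) * Psi (i :: j :: l) A x) + ∑ k, (((-2 * Real.pi * y k : ℝ) : ℂ) * Complex.I) * Psi (k :: l) A x := by
  have h1 : ∀ i j, Integrable fun ξ => ((- D i j : ℝ) : ℂ) * (ex x ξ * wC (i :: j :: l) A ξ) := fun i j => (exw_int hc hA _ x).const_mul _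
  have h2 : ∀ k, Integrable fun ξ => (((-2 * Real.pi * y k : ℝ) : ℂ) * Complex.I) * (ex x ξ * wC (k :: l) A ξ) := fun k => (exw_int hc hA _ x).const_mul _
  simp only [Gr]
  rw [integral_add (integrable_finsetSum _ fun i _ => integrable_finsetSum _ fun j _ => h1 i j) (integrable_finsetSum _ fun k _ => h2 k)]
  rw [integral_finsetSum _ fun i _ => integrable_finsetSum _ fun j _ => h1 i j, integral_finsetSum _ fun k _ => h2 k]
  congr 1
  · refine Finset.sum_congr rfl fun i _ => ?_
    rw [integral_finsetSum _ fun j _ => h1 i j]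
    refine Finset.sum_congr rfl fun j _ => ?_
    rw [integral_const_mul, Psi_eq]
  · refine Finset.sum_congr rfl fun k _ => ?_
    rw [integral_const_mul, Psi_eq]

def pth (A A' : Fin d → Fin d → ℝ) (r : ℝ) : Fin d → Fin d → ℝ := fun i j => (1 - r) * A i j + r * A' i j

lemma pth_El {c τ τ' r : ℝ} {A A' : Fin d → Fin d → ℝ} (h : El c τ A) (h' : El c τ' A') (h0 : 0 ≤ r) (h1 : r ≤ 1) :
    El c ((1 - r) * τ + r * τ') (pth A A' r) := (h.scale (by linarith)).add (h'.scale h0)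

def Fr (l : List (Fin d)) (A A' : Fin d → Fin d → ℝ) (x x' : Spc d) (r : ℝ) (ξ : Spc d) : ℂ :=
  ex (x + r • (x' - x)) ξ * wC l (pth A A' r) ξ

lemma Fr_eq (l : List (Fin d)) (A A' : Fin d → Fin d → ℝ) (x x' : Spc d) (r : ℝ) (ξ : Spc d) :
    Fr l A A' x x' r ξ = (mono l ξ : ℂ) * Complex.exp ((((- qf A ξ : ℝ) : ℂ) + ↑(-2 * Real.pi * ⟪ξ, x⟫) * Complex.I) + r * (((- qf (fun i j => A' i j - A i j) ξ : ℝ) : ℂ) + ↑(-2 * Real.pi * ⟪ξ, x' - x⟫) * Complex.I)) := by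
  have e : qf (pth A A' r) ξ = qf A ξ + r * qf (fun i j => A' i j - A i j) ξ := by
    rw [← qf_scale, ← qf_add]; congr 1; ext i j; simp only [pth]; ring
  rw [Fr, ex, wC, wR, e, inner_add_right, real_inner_smul_right]
  push_cast
  rw [mul_left_comm, ← Complex.exp_add]
  congr 2; ring

lemma Fr_deriv (l : List (Fin d)) (A A' : Fin d → Fin d → ℝ) (x x' : Spc d) (r : ℝ) (ξ : Spc d) :
    HasDerivAt (fun r => Fr l A A' x x' r ξ) (Gr l (pth A A' r) (fun i j => A' i j - A i j) (x + r • (x' - x)) (x' - x) ξ) r := by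
  rw [Gr_eq]
  change HasDerivAt _ (_ * Fr l A A' x x' r ξ) r
  simp only [Fr_eq]
  generalize (((- qf A ξ : ℝ) : ℂ) + ↑(-2 * Real.pi * ⟪ξ, x⟫) * Complex.I) = E0
  generalize (((- qf (fun i j => A' i j - A i j) ξ : ℝ) : ℂ) + ↑(-2 * Real.pi * ⟪ξ, x' - x⟫) * Complex.I) = E1
  have h1 : HasDerivAt (fun r : ℝ => E0 + (r:ℂ) * E1) E1 r := by
    have := ((Complex.ofRealCLM.hasDerivAt (x := r)).mul_const E1).const_add E0
    simpa using this
  have := (h1.cexp).const_mul (mono l ξ : ℂ)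
  convert! this using 1
  ring

lemma Gr_cont (l : List (Fin d)) (A A' : Fin d → Fin d → ℝ) (x x' : Spc d) :
    Continuous fun p : ℝ × Spc d => Gr l (pth A A' p.1) (fun i j => A' i j - A i j) (x + p.1 • (x' - x)) (x' - x) p.2 := by
  have : (fun p : ℝ × Spc d => Gr l (pth A A' p.1) (fun i j => A' i j - A i j) (x + p.1 • (x' - x)) (x' - x) p.2) = fun p : ℝ × Spc d =>
      (((- qf (fun i j => A' i j - A i j) p.2 : ℝ) : ℂ) + ↑(-2 * Real.pi * ⟪p.2, x' - x⟫) * Complex.I) * ((mono l p.2 : ℂ) * Complex.exp ((((- qf A p.2 : ℝ) : ℂ) + ↑(-2 * Real.pi * ⟪p.2, x⟫) * Complex.I) + p.1 * (((- qf (fun i j => A' i j - A i j) p.2 : ℝ) : ℂ) + ↑(-2 * Real.pi * ⟪p.2, x' - x⟫) * Complex.I))) := by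
    ext p
    rw [Gr_eq, ← Fr_eq]; rfl
  rw [this]
  have h1 := fun B : Fin d → Fin d → ℝ => (qf_cd B).continuous
  have h2 := (mono_cd l).continuous
  have h3 := h1 A
  have h4 := h1 fun i j => A' i j - A i j
  fun_prop

end

section
open scoped FourierTransform RealInnerProductSpace ContDiff
variable {d : ℕ}

lemma Psi_path {c : ℝ} (hc : 0 < c) (l : List (Fin d)) {A A' : Fin d → Fin d → ℝ} (hA : El c 1 A) (hA' : El c 1 A') (x x' : Spc d) :
    Psi l A' x' - Psi l A x = ∫ r in Ioc (0:ℝ) 1, ∫ ξ, Gr l (pth A A' r) (fun i j => A' i j - A i j) (x + r • (x' - x)) (x' - x) ξ := by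
  have hp : ∀ r ∈ Ioc (0:ℝ) 1, El c 1 (pth A A' r) := fun r hr => by
    have := pth_El hA hA' hr.1.le hr.2
    rwa [show (1 - r) * 1 + r * 1 = 1 by ring] at this
  rw [integral_integral_swap]
  · rw [Psi_eq, Psi_eq, ← integral_sub (exw_int hc hA' l x') (exw_int hc hA l x)]
    congr 1; ext ξ
    rw [← intervalIntegral.integral_of_le zero_le_one]
    rw [intervalIntegral.integral_eq_sub_of_hasDerivAt (fun r _ => Fr_deriv l A A' x x' r ξ)]
    · simp only [Fr]
      congr 2
      · simp
      · congr 1; ext i j; simp [pth]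
      · simp
      · congr 1; ext i j; simp [pth]
    · exact ((Gr_cont l A A' x x').comp (by fun_prop : Continuous fun r : ℝ => (r, ξ))).intervalIntegrable _ _
  · choose C hC h using fun l' : List (Fin d) => wB hc l' 0
    set K := (∑ i, ∑ j, |A' i j - A i j| * C (i :: j :: l)) + ∑ k, |2 * Real.pi * (x' - x) k| * C (k :: l) with hK
    have hI : Integrable (fun p : ℝ × Spc d => K * J p.2) ((volume.restrict (Ioc 0 1)).prod volume) :=
      (Integrable.mul_prod (f := fun _ : ℝ => K) (g := J) (integrable_const _) J_int)
    refine hI.mono' (Gr_cont l A A' x x').aestronglyMeasurable ?_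
    have : ∀ᵐ p : ℝ × Spc d ∂((volume.restrict (Ioc 0 1)).prod volume), p.1 ∈ Ioc (0:ℝ) 1 := by
      have h1 : ∀ᵐ r : ℝ ∂(volume.restrict (Ioc 0 1)), r ∈ Ioc (0:ℝ) 1 := ae_restrict_mem measurableSet_Ioc
      exact Measure.quasiMeasurePreserving_fst.ae h1
    filter_upwards [this] with p hp1
    have hb : ∀ l', ‖ex (x + p.1 • (x' - x)) p.2 * wC l' (pth A A' p.1) p.2‖ ≤ C l' * J p.2 := fun l' => by
      rw [norm_mul, ex_norm, one_mul]
      have := h l' _ (hp p.1 hp1) p.2 0 le_rfl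
      rwa [norm_iteratedFDeriv_zero] at this
    simp only [Function.uncurry, Gr]
    rw [hK, add_mul, Finset.sum_mul, Finset.sum_mul]
    refine (norm_add_le _ _).trans (add_le_add ?_ ?_)
    · refine (norm_sum_le _ _).trans (Finset.sum_le_sum fun i _ => ?_)
      rw [Finset.sum_mul]
      refine (norm_sum_le _ _).trans (Finset.sum_le_sum fun j _ => ?_)
      rw [norm_mul, Complex.norm_real, norm_neg, Real.norm_eq_abs, mul_assoc]
      gcongr
      exact hb _
    · refine (norm_sum_le _ _).trans (Finset.sum_le_sum fun k _ => ?_)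
      rw [norm_mul, norm_mul, Complex.norm_I, mul_one, Complex.norm_real, Real.norm_eq_abs, neg_mul, neg_mul, abs_neg, mul_assoc _ (C _)]
      gcongr
      exact hb _

lemma K2 {c : ℝ} (hc : 0 < c) (l : List (Fin d)) : ∃ C, 0 < C ∧ ∀ A A' τ τ', 0 < τ → 0 < τ' → El c τ A → El c τ' A' →
    ∀ (x x' : Spc d) (m Δ η : ℝ), 0 < m → 0 ≤ Δ → (∀ r, 0 ≤ r → r ≤ 1 → m ≤ √((1 - r) * τ + r * τ') + ‖x + r • (x' - x)‖) →
    (∀ i j, |A' i j - A i j| ≤ Δ) → ‖x' - x‖ ≤ η →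
    ‖Psi l A' x' - Psi l A x‖ ≤ C * (Δ / m ^ (d + l.length + 2) + η / m ^ (d + l.length + 1)) := by
  choose C hC h using fun l' : List (Fin d) => K1' hc l'
  refine ⟨(∑ i, ∑ j, C (i :: j :: l)) + (∑ k, 2 * Real.pi * C (k :: l)) + 1, ?_, ?_⟩
  · have := Finset.sum_nonneg fun (i : Fin d) (_ : i ∈ Finset.univ) => Finset.sum_nonneg fun (j : Fin d) (_ : j ∈ Finset.univ) => (hC (i :: j :: l)).le
    have := Finset.sum_nonneg fun (k : Fin d) (_ : k ∈ Finset.univ) => (mul_pos Real.two_pi_pos (hC (k :: l))).le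
    positivity
  intro A A' τ τ' hτ hτ' hA hA' x x' m Δ η hm hΔ0 hr hΔ hη
  have hη0 := (norm_nonneg _).trans hη
  obtain ⟨b, hb, h1, h2, h3, h4⟩ : ∃ b > 0, b ≤ c * τ ∧ b ≤ c / τ ∧ b ≤ c * τ' ∧ b ≤ c / τ' :=
    ⟨min (min (c*τ) (c/τ)) (min (c*τ') (c/τ')), by simp; exact ⟨⟨by positivity, by positivity⟩, by positivity, by positivity⟩, by simp, by simp, by simp, by simp⟩
  have eA := hA.one hc hτ hb h1 h2
  have eA' := hA'.one hc hτ' hb h3 h4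
  rw [Psi_path hb l eA eA']
  set S1 := ∑ i, ∑ j, C (i :: j :: l) with hS1
  set S2 := ∑ k, 2 * Real.pi * C (k :: l) with hS2
  have hbd : ∀ r ∈ Ioc (0:ℝ) 1, ‖∫ ξ, Gr l (pth A A' r) (fun i j => A' i j - A i j) (x + r • (x' - x)) (x' - x) ξ‖ ≤
      S1 * (Δ / m ^ (d + l.length + 2)) + S2 * (η / m ^ (d + l.length + 1)) := by
    intro r hr1
    have e1 : El b 1 (pth A A' r) := by
      have := pth_El eA eA' hr1.1.le hr1.2
      rwa [show (1 - r) * 1 + r * 1 = 1 by ring] at this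
    have e2 := pth_El hA hA' hr1.1.le hr1.2
    have hr2 : 0 ≤ 1 - r := by linarith [hr1.2]
    have e3 : 0 < (1 - r) * τ + r * τ' := by have := hr1.1; positivity
    have hP : ∀ l', ‖Psi l' (pth A A' r) (x + r • (x' - x))‖ ≤ C l' / m ^ (d + l'.length) := fun l' => by
      refine (h l' _ _ e3 e2 _).trans ?_
      have := (hC l').le
      gcongr
      exact hr r hr1.1.le hr1.2
    rw [Gr_int hb l e1, hS1, hS2, Finset.sum_mul, Finset.sum_mul]
    refine (norm_add_le _ _).trans (add_le_add ?_ ?_)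
    · refine (norm_sum_le _ _).trans (Finset.sum_le_sum fun i _ => ?_)
      rw [Finset.sum_mul]
      refine (norm_sum_le _ _).trans (Finset.sum_le_sum fun j _ => ?_)
      rw [norm_mul, Complex.norm_real, norm_neg, Real.norm_eq_abs]
      refine (mul_le_mul (hΔ i j) (hP _) (norm_nonneg _) ((abs_nonneg _).trans (hΔ i j))).trans (le_of_eq ?_)
      simp only [List.length_cons, add_assoc]; norm_num; ring
    · refine (norm_sum_le _ _).trans (Finset.sum_le_sum fun k _ => ?_)
      rw [norm_mul, norm_mul, Complex.norm_I, mul_one, Complex.norm_real, Real.norm_eq_abs, neg_mul, neg_mul, abs_neg, abs_mul, abs_of_pos Real.two_pi_pos]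
      have h5 : |(x' - x) k| ≤ η := by
        have := PiLp.norm_apply_le (x' - x) k
        rw [Real.norm_eq_abs] at this; linarith
      have := Real.two_pi_pos
      refine (mul_le_mul (mul_le_mul_of_nonneg_left h5 this.le) (hP _) (norm_nonneg _) (by positivity)).trans (le_of_eq ?_)
      simp only [List.length_cons, add_assoc]; ring
  have := norm_setIntegral_le_of_norm_le_const (μ := volume) (s := Ioc (0:ℝ) 1) (by simp) hbd
  refine this.trans ?_
  simp only [Real.volume_real_Ioc, sub_zero, max_eq_left zero_le_one, mul_one]
  have hS1' : 0 ≤ S1 := Finset.sum_nonneg fun i _ => Finset.sum_nonneg fun j _ => (hC _).le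
  have hS2' : 0 ≤ S2 := Finset.sum_nonneg fun i _ => by have := (hC (i :: l)).le; positivity
  have a1 : 0 ≤ Δ / m ^ (d + l.length + 2) := by positivity
  have a2 : 0 ≤ η / m ^ (d + l.length + 1) := by positivity
  nlinarith [mul_nonneg hS1' a2, mul_nonneg hS2' a1]

end

section
variable {d : ℕ}

structure Ac (c : ℝ) (𝒜 : ℝ → ℝ → Fin d → Fin d → ℝ) : Prop where
  el : ∀ t s, t ≤ s → El c (s - t) (𝒜 t s)
  lip : ∀ t s t' s' i j, |𝒜 t s i j - 𝒜 t' s' i j| ≤ c⁻¹ * (|t - t'| + |s - s'|)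

def chi (r : ℝ) : ℝ := min 1 r

lemma chi_diff {a b : ℝ} (ha : 0 ≤ a) (hab : a ≤ b) : |chi b - chi a| ≤ 2 * (b - a) / (b + 1) := by
  rw [le_div_iff₀ (by linarith)]
  unfold chi
  rcases le_total 1 b with hb | hb <;> rcases le_total 1 a with ha1 | ha1
  · rw [min_eq_left hb, min_eq_left ha1]; simp; linarith
  · rw [min_eq_left hb, min_eq_right ha1, abs_of_nonneg (by linarith)]; nlinarith
  · rw [min_eq_right hb, min_eq_left ha1, abs_of_nonneg (by linarith)]; nlinarith
  · rw [min_eq_right hb, min_eq_right ha1, abs_of_nonneg (by linarith)]; nlinarith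

lemma chi_bd {a : ℝ} (ha : 0 ≤ a) : |chi a| ≤ 1 := by
  unfold chi; rw [abs_of_nonneg (le_min zero_le_one ha)]; exact min_le_left _ _

def Am (𝒜 : ℝ → ℝ → Fin d → Fin d → ℝ) (ε t s : ℝ) : Fin d → Fin d → ℝ :=
  fun i j => 𝒜 t (max s t) i j + if i = j then ε else 0

lemma qf_id (ε : ℝ) (ξ : Spc d) : qf (fun i j => if i = j then ε else 0) ξ = ε * ‖ξ‖^2 := by
  rw [EuclideanSpace.norm_sq_eq, qf, Finset.mul_sum]
  refine Finset.sum_congr rfl fun i _ => ?_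
  rw [Finset.sum_eq_single i (fun j _ hj => by rw [if_neg (Ne.symm hj), zero_mul]) (by simp)]
  rw [if_pos rfl, Real.norm_eq_abs, sq_abs, sq]

lemma El_id {c : ℝ} (hc : 0 < c) (hc1 : c ≤ 1) {ε : ℝ} (hε : 0 ≤ ε) : El (d := d) c ε fun i j => if i = j then ε else 0 := by
  have h1 : ε ≤ c⁻¹ * ε := le_mul_of_one_le_left hε ((one_le_inv₀ hc).2 hc1)
  refine ⟨fun ξ => ?_, fun i j => ?_⟩
  · rw [qf_id]; gcongr; exact mul_le_of_le_one_left hε hc1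
  · show |if i = j then ε else 0| ≤ _
    split_ifs
    · rwa [abs_of_nonneg hε]
    · rw [abs_zero]; positivity

lemma Am_El {c : ℝ} (hc : 0 < c) (hc1 : c ≤ 1) {𝒜} (h𝒜 : Ac (d := d) c 𝒜) {ε : ℝ} (hε : 0 < ε) (t s : ℝ) :
    El c ((max s t - t) + ε) (Am 𝒜 ε t s) := (h𝒜.el t _ (le_max_right _ _)).add (El_id hc hc1 hε.le)

def KC (l : List (Fin d)) (𝒜 : ℝ → ℝ → Fin d → Fin d → ℝ) (ε : ℝ) (z w : Pt d) : ℂ :=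
  (chi ((max w.1 z.1 - z.1) / ε) : ℂ) * Psi l (Am 𝒜 ε z.1 w.1) (w.2 - z.2)

lemma KC_diff0 {a b : ℝ} {P Q : ℂ} {e B m : ℝ} (ha : 0 ≤ a) (hab : a ≤ b) (hP : ‖P‖ ≤ B * (e * (b + 1))) (hPQ : ‖P - Q‖ ≤ m) :
    ‖(chi b : ℂ) * P - chi a * Q‖ ≤ 2 * (e * (b - a)) * B + m := by
  have h1 : (chi b : ℂ) * P - chi a * Q = ((chi b - chi a : ℝ) : ℂ) * P + chi a * (P - Q) := by push_cast; ring
  rw [h1]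
  refine (norm_add_le _ _).trans (add_le_add ?_ ?_)
  · rw [norm_mul, Complex.norm_real, Real.norm_eq_abs]
    have := chi_diff ha hab
    refine (mul_le_mul this hP (norm_nonneg _) (div_nonneg (by linarith) (by linarith))).trans (le_of_eq ?_)
    have : b + 1 ≠ 0 := by linarith
    field_simp
  · rw [norm_mul, Complex.norm_real, Real.norm_eq_abs]
    have := chi_bd ha
    calc _ ≤ 1 * m := by gcongr
      _ = m := one_mul m

set_option maxHeartbeats 600000 in
lemma KD {c : ℝ} (hc : 0 < c) (hc1 : c ≤ 1) (l : List (Fin d)) (hl : l.length = 2) : ∃ C, 0 < C ∧ ∀ 𝒜, Ac c 𝒜 → ∀ ε, 0 < ε →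
    ∀ (z w z' w' : Pt d) (e : ℝ), 0 < e → |z.1 - z'.1| ≤ e^2 → |w.1 - w'.1| ≤ e^2 → ‖z.2 - z'.2‖ ≤ e → ‖w.2 - w'.2‖ ≤ e →
    12 * e ≤ prho (w - z) → ‖KC l 𝒜 ε z w - KC l 𝒜 ε z' w'‖ ≤ C * e * (prho (w - z))⁻¹ ^ (d + 3) := by
  obtain ⟨C1, hC1, h1⟩ := K1 hc l
  obtain ⟨C2, hC2, h2⟩ := K2 hc l
  rw [hl] at h1 h2
  refine ⟨(C1 + C2 * (c⁻¹ + 2)) * 2 ^ (d+3), by positivity, ?_⟩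
  rintro 𝒜 h𝒜 ε hε ⟨t, x⟩ ⟨s, y⟩ ⟨t', x'⟩ ⟨s', y'⟩ e he ht hs hx hy hM
  simp only at ht hs hx hy
  set M := prho ((s, y) - (t, x)) with hMd
  have hMe : M = ‖y - x‖ + √|s - t| := rfl
  simp only [KC]
  set σ := max s t - t with hσ
  set σ' := max s' t' - t' with hσ'
  have hσ0 : 0 ≤ σ := by rw [hσ]; linarith [le_max_right s t]
  have hσ0' : 0 ≤ σ' := by rw [hσ']; linarith [le_max_right s' t']
  rw [abs_le] at ht hs
  have hmm : |max s t - max s' t'| ≤ e^2 := by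
    rw [abs_le]; constructor
    · have : max s' t' ≤ max s t + e^2 := max_le (by linarith [le_max_left s t]) (by linarith [le_max_right s t])
      linarith
    · have : max s t ≤ max s' t' + e^2 := max_le (by linarith [le_max_left s' t']) (by linarith [le_max_right s' t'])
      linarith
  have hss : |σ - σ'| ≤ 2 * e^2 := by
    rw [abs_le] at hmm ⊢; constructor <;> linarith
  have hM0 : 0 < M := by linarith
  by_cases hz : σ = 0 ∧ σ' = 0
  · rw [hz.1, hz.2]
    simp [chi]
    positivity
  have hst : |s - t| ≤ σ + 2 * e^2 := by
    rcases le_total t s with h | h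
    · rw [abs_of_nonneg (by linarith), hσ, max_eq_left h]; nlinarith
    · rw [abs_of_nonpos (by linarith)]
      have : σ = 0 := by rw [hσ, max_eq_right h]; ring
      have h3 : σ' ≠ 0 := fun h' => hz ⟨this, h'⟩
      have h4 : t' < s' := by
        by_contra hcon
        push Not at hcon
        exact h3 (by rw [hσ', max_eq_right hcon]; ring)
      linarith
  have hsq : √|s - t| ≤ √σ + 2 * e := by
    apply Real.sqrt_le_iff.2
    refine ⟨by positivity, hst.trans ?_⟩
    nlinarith [Real.sq_sqrt hσ0, Real.sqrt_nonneg σ, mul_nonneg (Real.sqrt_nonneg σ) he.le]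
  set X := y - x with hX
  set X' := y' - x' with hX'
  have hXX : ‖X' - X‖ ≤ 2 * e := by
    rw [show X' - X = -(y - y') + (x - x') by rw [hX, hX']; abel]
    refine (norm_add_le _ _).trans ?_
    rw [norm_neg]; linarith
  have hr : ∀ r, 0 ≤ r → r ≤ 1 → M / 2 ≤ √((1 - r) * (σ + ε) + r * (σ' + ε)) + ‖X + r • (X' - X)‖ := by
    intro r hr0 hr1
    have i1 : ‖X‖ ≤ ‖X + r • (X' - X)‖ + 2 * e := by
      have : X = (X + r • (X' - X)) - r • (X' - X) := by abel
      calc ‖X‖ = ‖(X + r • (X' - X)) - r • (X' - X)‖ := by rw [← this]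
        _ ≤ _ := (norm_sub_le _ _).trans (by
            gcongr
            rw [norm_smul, Real.norm_eq_abs, abs_of_nonneg hr0]
            calc r * ‖X' - X‖ ≤ 1 * (2 * e) := by gcongr
              _ = _ := one_mul _)
    have hT : 0 ≤ (1 - r) * (σ + ε) + r * (σ' + ε) := by
      have : 0 ≤ 1 - r := by linarith
      positivity
    have i2 : √σ ≤ √((1 - r) * (σ + ε) + r * (σ' + ε)) + 2 * e := by
      apply Real.sqrt_le_iff.2
      refine ⟨by positivity, ?_⟩
      have : σ ≤ (1 - r) * (σ + ε) + r * (σ' + ε) + 2 * e^2 := by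
        rw [abs_le] at hss
        nlinarith
      nlinarith [Real.sq_sqrt hT, Real.sqrt_nonneg ((1 - r) * (σ + ε) + r * (σ' + ε)), mul_nonneg (Real.sqrt_nonneg ((1 - r) * (σ + ε) + r * (σ' + ε))) he.le]
    linarith
  have hE := Am_El hc hc1 h𝒜 hε t s
  have hE' := Am_El hc hc1 h𝒜 hε t' s'
  rw [← hσ] at hE
  rw [← hσ'] at hE'
  have hm : 0 < M / 2 := by linarith
  have hA : ∀ i j, |Am 𝒜 ε t' s' i j - Am 𝒜 ε t s i j| ≤ c⁻¹ * (2 * e^2) := by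
    intro i j
    simp only [Am]
    rw [add_sub_add_right_eq_sub]
    refine (h𝒜.lip _ _ _ _ i j).trans ?_
    rw [abs_sub_comm t' t, abs_sub_comm (max s' t')]
    have : |t - t'| ≤ e^2 := abs_le.2 ht
    gcongr; linarith
  have P2 := h2 _ _ (σ + ε) (σ' + ε) (by positivity) (by positivity) hE hE' X X' (M/2) (c⁻¹ * (2 * e^2)) (2 * e) hm (by positivity) hr hA hXX
  have P1 : ‖Psi l (Am 𝒜 ε t s) X‖ ≤ (C1 / (M/2)^(d+4)) * (σ + ε) := by
    refine (h1 _ _ (by positivity) hE X).trans ?_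
    rw [div_mul_eq_mul_div]
    gcongr
    have := hr 0 le_rfl zero_le_one
    simpa using this
  have P1' : ‖Psi l (Am 𝒜 ε t' s') X'‖ ≤ (C1 / (M/2)^(d+4)) * (σ' + ε) := by
    refine (h1 _ _ (by positivity) hE' X').trans ?_
    rw [div_mul_eq_mul_div]
    gcongr
    have := hr 1 zero_le_one le_rfl
    simpa using this
  have q1 : (ε * (σ / ε + 1)) = σ + ε := by field_simp
  have q1' : (ε * (σ' / ε + 1)) = σ' + ε := by field_simp
  have q2 : (ε * (σ / ε - σ' / ε)) = σ - σ' := by field_simp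
  have q2' : (ε * (σ' / ε - σ / ε)) = σ' - σ := by field_simp
  have key : ‖(chi (σ/ε) : ℂ) * Psi l (Am 𝒜 ε t s) X - chi (σ'/ε) * Psi l (Am 𝒜 ε t' s') X'‖ ≤ 2 * (2 * e^2) * (C1 / (M/2)^(d+4)) + C2 * (c⁻¹ * (2 * e^2) / (M/2) ^ (d + 2 + 2) + 2 * e / (M/2) ^ (d + 2 + 1)) := by
    rw [abs_le] at hss
    rcases le_total σ' σ with h | h
    · rw [norm_sub_rev] at P2
      refine (KC_diff0 (e := ε) (by positivity) (div_le_div_of_nonneg_right h hε.le) (by rw [q1]; exact P1) P2).trans ?_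
      rw [q2]; gcongr; linarith
    · rw [norm_sub_rev]
      refine (KC_diff0 (e := ε) (by positivity) (div_le_div_of_nonneg_right h hε.le) (by rw [q1']; exact P1') P2).trans ?_
      rw [q2']; gcongr; linarith
  refine key.trans ?_
  have r1 : e^2 / (M/2)^(d+4) ≤ (1/4) * (e / (M/2)^(d+3)) := by
    rw [pow_succ (M/2) (d+3), show (1/4:ℝ) * (e / (M/2)^(d+3)) = (1/4*e)/(M/2)^(d+3) by ring, div_le_div_iff₀ (by positivity) (by positivity)]
    have : 0 < (M/2)^(d+3) := by positivity
    have h6 : e ^ 2 ≤ 1/4 * e * (M/2) := by nlinarith only [he, hM]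
    calc e^2 * (M/2)^(d+3) ≤ (1/4 * e * (M/2)) * (M/2)^(d+3) := by gcongr
      _ = _ := by ring
  calc _ = (4 * C1 + C2 * c⁻¹ * 2) * (e^2 / (M/2)^(d+4)) + C2 * 2 * (e / (M/2)^(d+3)) := by
        rw [show d + 2 + 2 = d + 4 by ring, show d + 2 + 1 = d + 3 by ring]; ring
    _ ≤ (4 * C1 + C2 * c⁻¹ * 2) * ((1/4) * (e / (M/2)^(d+3))) + C2 * 2 * (e / (M/2)^(d+3)) := by gcongr
    _ = (C1 + C2 * (c⁻¹ * (1/2) + 2)) * (e / (M/2)^(d+3)) := by ring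
    _ ≤ (C1 + C2 * (c⁻¹ * 1 + 2)) * (e / (M/2)^(d+3)) := by gcongr; norm_num
    _ = _ := by
      rw [div_pow, inv_pow, mul_one]; field_simp

end

section
open scoped FourierTransform RealInnerProductSpace
variable {d : ℕ}

lemma fubx {X : Type*} [MeasurableSpace X] {μ : Measure X} [SFinite μ] {φ : X → ℂ} (hφ : Integrable φ μ) {θ : X → Spc d} (hθ : Measurable θ)
    {m : X → Spc d → ℂ} (hm : Measurable (Function.uncurry m)) {W : Spc d → ℝ} (hW : Integrable W) (hmW : ∀ x ξ, ‖m x ξ‖ ≤ W ξ) :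
    ∫ x, (φ x * ∫ ξ, ex (θ x) ξ * m x ξ) ∂μ = ∫ ξ, ∫ x, φ x * (ex (θ x) ξ * m x ξ) ∂μ := by
  simp_rw [← integral_const_mul]
  refine integral_integral_swap ?_
  refine (hφ.norm.mul_prod hW).mono' ?_ (of_forall fun p => ?_)
  · have h1 : Measurable fun p : X × Spc d => ex (θ p.1) p.2 * m p.1 p.2 :=
      (ex_cont.measurable.comp ((hθ.comp measurable_fst).prodMk measurable_snd)).mul hm
    exact hφ.1.comp_fst.mul h1.aestronglyMeasurable
  · simp only [Function.uncurry, norm_mul, ex_norm, one_mul]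
    gcongr
    exact hmW _ _

lemma ex_sub (x y ξ : Spc d) : ex (x - y) ξ = ex x ξ * (starRingEnd ℂ) (ex y ξ) := by
  simp only [ex]
  rw [← Complex.exp_conj, ← Complex.exp_add, inner_sub_right]
  congr 1
  simp only [map_mul, Complex.conj_ofReal, Complex.conj_I]
  push_cast
  ring

lemma PsiL1 : ∃ C, ∀ a : ℝ, 0 < a → ∫⁻ x, ‖Psi (d := d) [] (fun i j => if i = j then a else 0) x‖ₑ ≤ ofReal C := by
  obtain ⟨C, hC, h⟩ := K1 (d := d) one_pos []
  refine ⟨C * ∫ x, J (d := d) x, fun a ha => ?_⟩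
  have hs : 0 < √a := Real.sqrt_pos.2 ha
  have h1 : ∀ x : Spc d, ‖Psi (d := d) [] (fun i j => if i = j then a else 0) x‖ₑ ≤ ofReal (C * ((√a)^d)⁻¹ * J ((√a)⁻¹ • x)) := by
    intro x
    rw [← ofReal_norm_eq_enorm]
    apply ENNReal.ofReal_le_ofReal
    refine (h _ a ha (El_id one_pos le_rfl ha.le) x).trans ?_
    have e1 : √a + ‖x‖ = √a * (1 + ‖(√a)⁻¹ • x‖) := by
      rw [norm_smul, Real.norm_eq_abs, abs_of_pos (inv_pos.2 hs)]; field_simp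
    rw [e1, J, List.length_nil, add_zero, mul_pow, mul_assoc, ← mul_inv, ← div_eq_mul_inv]
    have e2 : C * a / (√a ^ (d + 2) * (1 + ‖(√a)⁻¹ • x‖) ^ (d + 2)) = C / (√a ^ d * (1 + ‖(√a)⁻¹ • x‖) ^ (d + 2)) := by
      rw [pow_add (√a) d 2, Real.sq_sqrt ha.le]; field_simp
    rw [e2]
    gcongr
    · have := norm_nonneg ((√a)⁻¹ • x); linarith
    · norm_num
  refine (lintegral_mono h1).trans ?_
  have hi : Integrable fun x : Spc d => C * ((√a)^d)⁻¹ * J ((√a)⁻¹ • x) :=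
    ((integrable_comp_smul_iff volume (J (d := d)) (inv_ne_zero hs.ne')).2 J_int).const_mul _
  rw [← ofReal_integral_eq_lintegral_ofReal hi (of_forall fun x => mul_nonneg (by positivity) (J_pos _).le), integral_const_mul, Measure.integral_comp_inv_smul]
  apply ENNReal.ofReal_le_ofReal
  rw [abs_of_pos (by positivity), smul_eq_mul, finrank_euclideanSpace, Fintype.card_fin]
  apply le_of_eq
  field_simp

def Ft (g : Spc d → ℝ) (ξ : Spc d) : ℂ := ∫ y, ex y ξ * (g y : ℂ)

lemma amgm (x y : ℝ) : ‖x‖ₑ * ‖y‖ₑ ≤ ofReal (x^2) + ofReal (y^2) := by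
  rw [Real.enorm_eq_ofReal_abs, Real.enorm_eq_ofReal_abs, ← ENNReal.ofReal_mul (abs_nonneg _), ← ENNReal.ofReal_add (sq_nonneg _) (sq_nonneg _)]
  apply ENNReal.ofReal_le_ofReal
  nlinarith [sq_nonneg (|x| - |y|), sq_abs x, sq_abs y, abs_nonneg x, abs_nonneg y]

lemma mexl {g : Spc d → ℝ} (hg : Integrable g) (ξ) : Integrable fun y => ex y ξ * (g y : ℂ) := by
  refine hg.norm.mono' ?_ (of_forall fun y => by simp [ex_norm])
  exact (ex_cont.comp (by fun_prop : Continuous fun y : Spc d => (y, ξ))).aestronglyMeasurable.mul hg.ofReal.1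

lemma mFt {S : Type*} [MeasurableSpace S] {f : S × Spc d → ℝ} (hf : Measurable f) : Measurable fun p : S × Spc d => Ft (fun y => f (p.1, y)) p.2 := by
  have h : Measurable fun q : (S × Spc d) × Spc d => ex q.2 q.1.2 * (f (q.1.1, q.2) : ℂ) :=
    (ex_cont.measurable.comp (by fun_prop : Measurable fun q : (S × Spc d) × Spc d => (q.2, q.1.2))).mul (Complex.measurable_ofReal.comp (hf.comp (by fun_prop)))
  exact (h.stronglyMeasurable.integral_prod_right (ν := volume)).measurable

lemma mPsi (l : List (Fin d)) (A) : Measurable (Psi l A) := by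
  have h : Measurable fun q : Spc d × Spc d => ex q.1 q.2 * wC l A q.2 :=
    ex_cont.measurable.mul ((wC_cd l A).continuous.measurable.comp measurable_snd)
  have := (StronglyMeasurable.integral_prod_right (f := fun x ξ => ex x ξ * wC l A ξ) (ν := volume) h.stronglyMeasurable).measurable
  rwa [show Psi l A = _ from funext fun x => Psi_eq l A x]

set_option maxHeartbeats 600000 in
lemma wpl : ∃ C : ENNReal, C ≠ ∞ ∧ ∀ a : ℝ, 0 < a → ∀ g : Spc d → ℝ, Measurable g → Integrable g →
    ∫⁻ ξ, ofReal (exp (-(a * ‖ξ‖^2)) * ‖Ft g ξ‖^2) ≤ C * ∫⁻ y, ofReal ((g y)^2) := by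
  obtain ⟨C, h⟩ := PsiL1 (d := d)
  refine ⟨2 * ofReal C, by finiteness, fun a ha g hgm hg => ?_⟩
  set A : Fin d → Fin d → ℝ := fun i j => if i = j then a else 0 with hA
  have hE : El (min a a⁻¹) 1 A := El.one one_pos ha (El_id one_pos le_rfl ha.le) (by positivity) (by simp) (by simp)
  have hw : ∀ ξ, wC [] A ξ = (exp (-(a * ‖ξ‖^2)) : ℂ) := by
    intro ξ; rw [wC, wR, mono_nil, hA, qf_id, one_mul]; 
  have hwi := w_int (by positivity) hE []
  have hphi : Integrable (fun p : Spc d × Spc d => (g p.1 : ℂ) * (g p.2 : ℂ)) := hg.ofReal.mul_prod hg.ofReal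
  have e := fubx (d := d) hphi (θ := fun p => p.1 - p.2) (by fun_prop) (m := fun _ ξ => wC [] A ξ) ((wC_cd [] A).continuous.measurable.comp measurable_snd) hwi.norm (fun _ _ => le_rfl)
  simp_rw [← Psi_eq] at e
  have e2 : ∀ ξ, ∫ p : Spc d × Spc d, (g p.1 : ℂ) * (g p.2 : ℂ) * (ex (p.1 - p.2) ξ * wC [] A ξ) = ((exp (-(a * ‖ξ‖^2)) * ‖Ft g ξ‖^2 : ℝ) : ℂ) := by
    intro ξ
    have : ∀ p : Spc d × Spc d, (g p.1 : ℂ) * (g p.2 : ℂ) * (ex (p.1 - p.2) ξ * wC [] A ξ) = wC [] A ξ * ((ex p.1 ξ * (g p.1 : ℂ)) * ((starRingEnd ℂ) (ex p.2 ξ * (g p.2 : ℂ)))) := by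
      intro p; rw [ex_sub, map_mul, Complex.conj_ofReal]; ring
    simp_rw [this]
    rw [integral_const_mul, Measure.volume_eq_prod, integral_prod_mul (fun y => ex y ξ * (g y : ℂ)) (fun y => (starRingEnd ℂ) (ex y ξ * (g y : ℂ))), integral_conj, ← Ft, Complex.mul_conj, hw, Complex.normSq_eq_norm_sq]
    push_cast; rfl
  simp_rw [e2] at e
  rw [integral_complex_ofReal] at e
  have hnn : ∀ ξ : Spc d, 0 ≤ exp (-(a * ‖ξ‖^2)) * ‖Ft g ξ‖^2 := fun ξ => by positivity
  have hint : Integrable fun ξ : Spc d => exp (-(a * ‖ξ‖^2)) * ‖Ft g ξ‖^2 := by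
    refine (hwi.norm.mul_const ((∫ y, ‖g y‖)^2)).mono' ?_ (of_forall fun ξ => ?_)
    · have h0 := (mFt (S := ℝ) (f := fun p => g p.2) (hgm.comp measurable_snd)).comp (measurable_const.prodMk measurable_id : Measurable fun ξ : Spc d => ((0:ℝ), ξ))
      have : Measurable fun ξ => Ft g ξ := h0
      exact Measurable.aestronglyMeasurable (by fun_prop)
    · rw [Real.norm_of_nonneg (hnn ξ), hw, Complex.norm_real, Real.norm_of_nonneg (Real.exp_pos _).le]
      gcongr
      refine (norm_integral_le_integral_norm _).trans (le_of_eq ?_)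
      simp [ex_norm]
  rw [← ofReal_integral_eq_lintegral_ofReal hint (of_forall hnn)]
  have e3 : ofReal (∫ ξ : Spc d, exp (-(a * ‖ξ‖^2)) * ‖Ft g ξ‖^2) = ‖∫ p : Spc d × Spc d, (g p.1 : ℂ) * (g p.2 : ℂ) * Psi [] A (p.1 - p.2)‖ₑ := by
    rw [e, ← ofReal_norm_eq_enorm, Complex.norm_real, Real.norm_of_nonneg (integral_nonneg hnn)]
  rw [e3]
  refine (enorm_integral_le_lintegral_enorm _).trans ?_
  have hP := (mPsi [] A).enorm
  have hg2 : Measurable fun x => ofReal (g x ^ 2) := by fun_prop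
  have hP1 : Measurable fun p : Spc d × Spc d => ‖Psi [] A (p.1 - p.2)‖ₑ := hP.comp (by fun_prop)
  have hQ1 : ∀ x, Measurable fun y => ‖Psi [] A (x - y)‖ₑ := fun x => hP.comp (measurable_const.sub measurable_id)
  have hQ2 : ∀ x, Measurable fun y => ‖Psi [] A (y - x)‖ₑ := fun x => hP.comp (measurable_id.sub measurable_const)
  have m1 : Measurable fun p : Spc d × Spc d => ofReal (g p.1 ^ 2) * ‖Psi [] A (p.1 - p.2)‖ₑ := Measurable.fun_mul (hg2.comp measurable_fst) hP1
  have m2 : Measurable fun p : Spc d × Spc d => ofReal (g p.2 ^ 2) * ‖Psi [] A (p.1 - p.2)‖ₑ := Measurable.fun_mul (hg2.comp measurable_snd) hP1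
  calc _ ≤ ∫⁻ p : Spc d × Spc d, (ofReal (g p.1 ^ 2) * ‖Psi [] A (p.1 - p.2)‖ₑ + ofReal (g p.2 ^ 2) * ‖Psi [] A (p.1 - p.2)‖ₑ) := by
        refine lintegral_mono fun p => ?_
        rw [enorm_mul, ← add_mul, enorm_mul]
        refine mul_le_mul' ?_ le_rfl
        have := amgm (g p.1) (g p.2)
        simpa [← ofReal_norm_eq_enorm] using this
    _ = (∫⁻ p : Spc d × Spc d, ofReal (g p.1 ^ 2) * ‖Psi [] A (p.1 - p.2)‖ₑ) + ∫⁻ p : Spc d × Spc d, ofReal (g p.2 ^ 2) * ‖Psi [] A (p.1 - p.2)‖ₑ :=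
        lintegral_add_left (Measurable.fun_mul (hg2.comp measurable_fst) hP1) _
    _ ≤ ofReal C * (∫⁻ y, ofReal (g y ^ 2)) + ofReal C * (∫⁻ y, ofReal (g y ^ 2)) := by
        gcongr
        · rw [Measure.volume_eq_prod, lintegral_prod _ m1.aemeasurable, ← lintegral_const_mul _ hg2]
          refine lintegral_mono fun x => ?_
          dsimp only
          rw [lintegral_const_mul _ (hQ1 x), mul_comm]
          refine mul_le_mul' ?_ le_rfl
          have := lintegral_sub_left_eq_self (μ := volume) (fun y => ‖Psi [] A y‖ₑ) x
          exact this.le.trans (h a ha)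
        · rw [Measure.volume_eq_prod, lintegral_prod_symm _ m2.aemeasurable, ← lintegral_const_mul _ hg2]
          refine lintegral_mono fun x => ?_
          dsimp only
          rw [lintegral_const_mul _ (hQ2 x), mul_comm]
          refine mul_le_mul' ?_ le_rfl
          have := lintegral_sub_right_eq_self (μ := volume) (fun y => ‖Psi [] A y‖ₑ) x
          exact this.le.trans (h a ha)
    _ = _ := by ring

end

section
variable {d : ℕ}

def mtt (l : List (Fin d)) (𝒜 : ℝ → ℝ → Fin d → Fin d → ℝ) (ε : ℝ) (ξ : Spc d) (t s : ℝ) : ℝ :=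
  chi ((max s t - t) / ε) * wR l (Am 𝒜 ε t s) ξ

lemma KC_eq (l : List (Fin d)) (𝒜 ε) (z w : Pt d) : KC l 𝒜 ε z w = ∫ ξ, ex (w.2 - z.2) ξ * (mtt l 𝒜 ε ξ z.1 w.1 : ℂ) := by
  rw [KC, Psi_eq, ← integral_const_mul]
  congr 1; ext ξ; simp only [mtt, wC]; push_cast; ring

lemma Ac.cont {c} (hc : 0 < c) {𝒜} (h : Ac (d := d) c 𝒜) (i j) : Continuous fun p : ℝ × ℝ => 𝒜 p.1 p.2 i j := by
  have : LipschitzWith (Real.toNNReal (c⁻¹ * 2)) fun p : ℝ × ℝ => 𝒜 p.1 p.2 i j := by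
    refine LipschitzWith.of_dist_le_mul fun p q => ?_
    rw [Real.coe_toNNReal _ (by positivity), Real.dist_eq]
    refine (h.lip _ _ _ _ i j).trans ?_
    rw [mul_assoc]
    gcongr
    have h1 : |p.1 - q.1| ≤ dist p q := le_max_left _ _
    have h2 : |p.2 - q.2| ≤ dist p q := le_max_right _ _
    linarith
  exact this.continuous

lemma mtt_cont {c} (hc : 0 < c) {𝒜} (h : Ac (d := d) c 𝒜) (l : List (Fin d)) (ε) : Continuous fun p : (ℝ × ℝ) × Spc d => mtt l 𝒜 ε p.2 p.1.1 p.1.2 := by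
  have h1 : ∀ i j, Continuous fun p : (ℝ × ℝ) × Spc d => 𝒜 p.1.1 (max p.1.2 p.1.1) i j := fun i j =>
    (h.cont hc i j).comp (by fun_prop : Continuous fun p : (ℝ × ℝ) × Spc d => (p.1.1, max p.1.2 p.1.1))
  have h2 : Continuous fun p : (ℝ × ℝ) × Spc d => mono l p.2 := (mono_cd l).continuous.comp continuous_snd
  have h3 : Continuous fun p : (ℝ × ℝ) × Spc d => qf (Am 𝒜 ε p.1.1 p.1.2) p.2 := by
    unfold qf Am
    refine continuous_finset_sum _ fun i _ => continuous_finset_sum _ fun j _ => ?_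
    exact ((h1 i j).add continuous_const).mul (by fun_prop)
  unfold mtt wR chi
  exact Continuous.mul (by fun_prop) (h2.mul (Real.continuous_exp.comp h3.neg))

lemma mtt_bd {c : ℝ} (hc : 0 < c) (hc1 : c ≤ 1) (l : List (Fin d)) (hl : l.length = 2) {𝒜} (h𝒜 : Ac c 𝒜) {ε : ℝ} (hε : 0 < ε) (ξ : Spc d) (t s : ℝ) :
    |mtt l 𝒜 ε ξ t s| ≤ if t < s then exp (-(c * ε * ‖ξ‖^2)) * (‖ξ‖^2 * exp (-(c * ‖ξ‖^2) * (s - t))) else 0 := by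
  split_ifs with h
  · have hE := (Am_El hc hc1 h𝒜 hε t s).1 ξ
    rw [max_eq_left h.le] at hE
    have hch : |chi ((max s t - t)/ε)| ≤ 1 := chi_bd (div_nonneg (by linarith [le_max_right s t]) hε.le)
    have hm : |mono l ξ| ≤ ‖ξ‖^2 := by
      match l, hl with
      | [i, j], _ =>
        simp only [mono_cons, mono_nil, mul_one]
        rw [abs_mul, sq]
        have h1 := PiLp.norm_apply_le ξ i
        have h2 := PiLp.norm_apply_le ξ j
        simp only [Real.norm_eq_abs] at h1 h2
        gcongr
    rw [mtt, wR, abs_mul, abs_mul, abs_of_pos (Real.exp_pos _)]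
    calc _ ≤ 1 * (‖ξ‖^2 * (exp (-(c * ε * ‖ξ‖^2)) * exp (-(c * ‖ξ‖^2) * (s - t)))) := by
          rw [← Real.exp_add]
          gcongr
          linarith
      _ = _ := by ring
  · rw [mtt, max_eq_right (not_lt.1 h)]; simp [chi]

lemma schur {c b : ℝ} (hc : 0 < c) (hb : 0 ≤ b) (t : ℝ) : ∫⁻ r in Ioi (0:ℝ), ofReal (b * exp (-(c * b) * r)) ≤ ofReal c⁻¹ := by
  rcases hb.eq_or_lt with rfl | hb
  · simp
  have h0 : -(c * b) < 0 := by have := mul_pos hc hb; linarith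
  have hi := (integrableOn_exp_mul_Ioi h0 0).const_mul b
  rw [← ofReal_integral_eq_lintegral_ofReal hi (of_forall fun x => by positivity), integral_const_mul, integral_exp_mul_Ioi h0]
  apply ENNReal.ofReal_le_ofReal
  apply le_of_eq
  simp; field_simp

def kt (c : ℝ) (ξ : Spc d) (r : ℝ) : ENNReal := (Ioi (0:ℝ)).indicator (fun r => ofReal (‖ξ‖^2 * exp (-(c * ‖ξ‖^2) * r))) r

lemma kt_int {c : ℝ} (hc : 0 < c) (ξ : Spc d) : ∫⁻ r, kt c ξ r ≤ ofReal c⁻¹ := by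
  unfold kt
  rw [lintegral_indicator measurableSet_Ioi]
  exact schur hc (sq_nonneg _) 0

lemma kt_meas (c : ℝ) (ξ : Spc d) : Measurable (kt c ξ) := by
  unfold kt
  exact Measurable.indicator (by fun_prop) measurableSet_Ioi

lemma schur2 {c : ℝ} (hc : 0 < c) (ξ : Spc d) {F H : ℝ → ℂ} (hF : Measurable F) (hH : Measurable H) :
    ∫⁻ t, ∫⁻ s, kt c ξ (s - t) * (‖H t‖ₑ * ‖F s‖ₑ) ≤ ofReal c⁻¹ * ((∫⁻ t, ofReal (‖H t‖^2)) + ∫⁻ s, ofReal (‖F s‖^2)) := by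
  have hk : Measurable fun p : ℝ × ℝ => kt c ξ (p.2 - p.1) := (kt_meas c ξ).comp (by fun_prop)
  have hk1 : ∀ t, Measurable fun s => kt c ξ (s - t) := fun t => (kt_meas c ξ).comp (by fun_prop)
  have hk2 : ∀ s, Measurable fun t => kt c ξ (s - t) := fun t => (kt_meas c ξ).comp (by fun_prop)
  have hF2 : Measurable fun s => ofReal (‖F s‖^2) := by fun_prop
  have hH2 : Measurable fun s => ofReal (‖H s‖^2) := by fun_prop
  have m1 : Measurable fun p : ℝ × ℝ => kt c ξ (p.2 - p.1) * ofReal (‖F p.2‖^2) := hk.mul (hF2.comp measurable_snd)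
  calc _ ≤ ∫⁻ t, ∫⁻ s, (kt c ξ (s - t) * ofReal (‖H t‖^2) + kt c ξ (s - t) * ofReal (‖F s‖^2)) := by
        refine lintegral_mono fun t => lintegral_mono fun s => ?_
        rw [← mul_add]
        refine mul_le_mul' le_rfl ?_
        have := amgm ‖H t‖ ‖F s‖
        simpa using this
    _ = (∫⁻ t, ∫⁻ s, kt c ξ (s - t) * ofReal (‖H t‖^2)) + ∫⁻ t, ∫⁻ s, kt c ξ (s - t) * ofReal (‖F s‖^2) := by
        rw [← lintegral_add_right _ m1.lintegral_prod_right']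
        refine lintegral_congr fun t => ?_
        rw [lintegral_add_right _ (Measurable.fun_mul (hk1 t) hF2)]
    _ ≤ _ := by
        rw [mul_add]
        gcongr
        · rw [← lintegral_const_mul _ hH2]
          refine lintegral_mono fun t => ?_
          rw [lintegral_mul_const _ (hk1 t)]
          refine mul_le_mul' ?_ le_rfl
          exact (lintegral_sub_right_eq_self (kt c ξ) t).le.trans (kt_int hc ξ)
        · rw [lintegral_lintegral_swap m1.aemeasurable, ← lintegral_const_mul _ hF2]
          refine lintegral_mono fun t => ?_
          rw [lintegral_mul_const _ (hk2 t)]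
          refine mul_le_mul' ?_ le_rfl
          exact (lintegral_sub_left_eq_self (kt c ξ) t).le.trans (kt_int hc ξ)

end

section
variable {d : ℕ}

lemma W_int {a : ℝ} (ha : 0 < a) : Integrable fun ξ : Spc d => exp (-(a * ‖ξ‖^2)) * ‖ξ‖^2 := by
  obtain ⟨C, hC, h⟩ := expdec ha (d + 3)
  refine (J_int.const_mul C).mono' (by fun_prop) (of_forall fun ξ => ?_)
  have h0 := norm_nonneg ξ
  rw [Real.norm_of_nonneg (by positivity), J, ← div_eq_mul_inv, le_div_iff₀ (by positivity)]
  refine le_trans ?_ (h ‖ξ‖ h0)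
  rw [show -(a * ‖ξ‖^2) = -a * ‖ξ‖^2 by ring]
  calc _ = ‖ξ‖^2 * (1 + ‖ξ‖)^(d+1) * exp (-a * ‖ξ‖^2) := by ring
    _ ≤ (1 + ‖ξ‖)^2 * (1 + ‖ξ‖)^(d+1) * exp (-a * ‖ξ‖^2) := by gcongr; linarith
    _ = _ := by ring

lemma mtt_W {c : ℝ} (hc : 0 < c) (hc1 : c ≤ 1) (l : List (Fin d)) (hl : l.length = 2) {𝒜} (h𝒜 : Ac c 𝒜) {ε : ℝ} (hε : 0 < ε) (ξ : Spc d) (t s : ℝ) :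
    |mtt l 𝒜 ε ξ t s| ≤ exp (-(c * ε * ‖ξ‖^2)) * ‖ξ‖^2 := by
  refine (mtt_bd hc hc1 l hl h𝒜 hε ξ t s).trans ?_
  split_ifs with h
  · gcongr
    refine mul_le_of_le_one_right (by positivity) (Real.exp_le_one_iff.2 ?_)
    have : 0 ≤ c * ‖ξ‖^2 * (s - t) := mul_nonneg (by positivity) (by linarith)
    linarith
  · positivity

lemma mtt_k {c : ℝ} (hc : 0 < c) (hc1 : c ≤ 1) (l : List (Fin d)) (hl : l.length = 2) {𝒜} (h𝒜 : Ac c 𝒜) {ε : ℝ} (hε : 0 < ε) (ξ : Spc d) (t s : ℝ) :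
    ‖(mtt l 𝒜 ε ξ t s : ℂ)‖ₑ ≤ ofReal (exp (-(c * ε * ‖ξ‖^2))) * kt c ξ (s - t) := by
  rw [← ofReal_norm_eq_enorm, Complex.norm_real, Real.norm_eq_abs]
  refine (ENNReal.ofReal_le_ofReal (mtt_bd hc hc1 l hl h𝒜 hε ξ t s)).trans ?_
  split_ifs with h
  · rw [kt, indicator_of_mem (by simpa using h), ← ENNReal.ofReal_mul (Real.exp_pos _).le]
  · simp

lemma mFt' {f : Pt d → ℝ} (hf : Measurable f) : Measurable fun p : Spc d × ℝ => Ft (fun y => f (p.2, y)) p.1 := by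
  have h := (mFt hf).comp (measurable_swap : Measurable (Prod.swap : Spc d × ℝ → ℝ × Spc d))
  exact h

lemma mFt1 {f : Pt d → ℝ} (hf : Measurable f) (ξ) : Measurable fun s : ℝ => Ft (fun y => f (s, y)) ξ := by
  have h := (mFt' hf).comp (measurable_const.prodMk measurable_id : Measurable fun s : ℝ => (ξ, s))
  exact h

lemma mFt'' {f : Pt d → ℝ} (hf : Measurable f) : Measurable fun p : Spc d × ℝ => ofReal (‖Ft (fun y => f (p.2, y)) p.1‖^2) :=
  ENNReal.measurable_ofReal.comp ((mFt' hf).norm.pow_const 2)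

set_option maxHeartbeats 800000 in
lemma Ixi {c : ℝ} (hc : 0 < c) (hc1 : c ≤ 1) (l : List (Fin d)) (hl : l.length = 2) {𝒜} (h𝒜 : Ac c 𝒜) {ε : ℝ} (hε : 0 < ε) (ξ : Spc d)
    {f h : Pt d → ℝ} (hf : Measurable f) (hfi : Integrable f) (hh : Measurable h) (hhi : Integrable h) :
    ‖∫ p : Pt d × Pt d, ((h p.1 : ℂ) * (f p.2 : ℂ)) * (ex (p.2.2 - p.1.2) ξ * (mtt l 𝒜 ε ξ p.1.1 p.2.1 : ℂ))‖ₑ ≤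
      ofReal (exp (-(c * ε * ‖ξ‖^2))) * (ofReal c⁻¹ * ((∫⁻ t, ofReal (‖Ft (fun y => h (t, y)) ξ‖^2)) + ∫⁻ s, ofReal (‖Ft (fun y => f (s, y)) ξ‖^2))) := by
  have hmc := (mtt_cont hc h𝒜 l ε)
  have hex : Continuous fun y : Spc d => ex y ξ := ex_cont.comp (by fun_prop : Continuous fun y : Spc d => (y, ξ))
  have hb := mtt_W hc hc1 l hl h𝒜 hε ξ
  have i1 : Integrable fun p : Pt d × Pt d => ((h p.1 : ℂ) * (f p.2 : ℂ)) * (ex (p.2.2 - p.1.2) ξ * (mtt l 𝒜 ε ξ p.1.1 p.2.1 : ℂ)) := by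
    refine (hhi.ofReal.mul_prod hfi.ofReal).mul_bdd (c := exp (-(c * ε * ‖ξ‖^2)) * ‖ξ‖^2) ?_ (of_forall fun p => ?_)
    · refine Continuous.aestronglyMeasurable ((hex.comp (by fun_prop)).mul (Complex.continuous_ofReal.comp ?_))
      exact hmc.comp (by fun_prop : Continuous fun p : Pt d × Pt d => ((p.1.1, p.2.1), ξ))
    · rw [norm_mul, ex_norm, one_mul, Complex.norm_real]; exact hb _ _
  have i2 : ∀ t, Integrable fun w : Pt d => (mtt l 𝒜 ε ξ t w.1 : ℂ) * (ex w.2 ξ * (f w : ℂ)) := by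
    intro t
    refine Integrable.bdd_mul (c := exp (-(c * ε * ‖ξ‖^2)) * ‖ξ‖^2) ?_ ?_ (of_forall fun p => ?_)
    · refine hfi.ofReal.bdd_mul (c := 1) (hex.comp continuous_snd).aestronglyMeasurable (of_forall fun p => (ex_norm _ _).le)
    · exact (Complex.continuous_ofReal.comp (hmc.comp (by fun_prop : Continuous fun w : Pt d => ((t, w.1), ξ)))).aestronglyMeasurable
    · rw [Complex.norm_real]; exact hb _ _
  set F : ℝ → ℂ := fun s => Ft (fun y => f (s, y)) ξ with hF
  set H : ℝ → ℂ := fun s => Ft (fun y => h (s, y)) ξ with hH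
  have e1 : ∀ z : Pt d, ∫ w : Pt d, ((h z : ℂ) * (f w : ℂ)) * (ex (w.2 - z.2) ξ * (mtt l 𝒜 ε ξ z.1 w.1 : ℂ)) = (starRingEnd ℂ) (ex z.2 ξ * (h z : ℂ)) * ∫ s, (mtt l 𝒜 ε ξ z.1 s : ℂ) * F s := by
    intro z
    have : ∀ w : Pt d, ((h z : ℂ) * (f w : ℂ)) * (ex (w.2 - z.2) ξ * (mtt l 𝒜 ε ξ z.1 w.1 : ℂ)) = (starRingEnd ℂ) (ex z.2 ξ * (h z : ℂ)) * ((mtt l 𝒜 ε ξ z.1 w.1 : ℂ) * (ex w.2 ξ * (f w : ℂ))) := by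
      intro w; rw [ex_sub, map_mul, Complex.conj_ofReal]; ring
    simp_rw [this]
    rw [integral_const_mul, Measure.volume_eq_prod, integral_prod _ (i2 z.1)]
    simp_rw [integral_const_mul]
    rfl
  have e2 : ∫ p : Pt d × Pt d, ((h p.1 : ℂ) * (f p.2 : ℂ)) * (ex (p.2.2 - p.1.2) ξ * (mtt l 𝒜 ε ξ p.1.1 p.2.1 : ℂ)) = ∫ t, (starRingEnd ℂ) (H t) * ∫ s, (mtt l 𝒜 ε ξ t s : ℂ) * F s := by
    have i3 := i1.integral_prod_left
    simp only [e1] at i3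
    rw [Measure.volume_eq_prod, integral_prod _ i1]
    simp only [e1]
    rw [Measure.volume_eq_prod, integral_prod _ i3]
    simp_rw [integral_mul_const, integral_conj]
    rfl
  have hFm : Measurable F := mFt1 hf ξ
  have hHm : Measurable H := mFt1 hh ξ
  have hkm : ∀ t, Measurable fun s => kt c ξ (s - t) * (‖H t‖ₑ * ‖F s‖ₑ) := fun t =>
    Measurable.mul ((kt_meas c ξ).comp (by fun_prop : Measurable fun s => s - t)) (by fun_prop)
  have hkm2 : Measurable fun p : ℝ × ℝ => kt c ξ (p.2 - p.1) * (‖H p.1‖ₑ * ‖F p.2‖ₑ) := 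
    Measurable.mul ((kt_meas c ξ).comp (by fun_prop : Measurable fun p : ℝ × ℝ => p.2 - p.1)) (by fun_prop)
  rw [e2]
  refine (enorm_integral_le_lintegral_enorm _).trans ?_
  calc _ ≤ ∫⁻ t, ∫⁻ s, ofReal (exp (-(c * ε * ‖ξ‖^2))) * (kt c ξ (s - t) * (‖H t‖ₑ * ‖F s‖ₑ)) := by
        refine lintegral_mono fun t => ?_
        rw [enorm_mul, RCLike.enorm_conj]
        refine (mul_le_mul' le_rfl (enorm_integral_le_lintegral_enorm _)).trans ?_
        rw [← lintegral_const_mul' _ _ enorm_ne_top]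
        refine lintegral_mono fun s => ?_
        rw [enorm_mul]
        calc _ ≤ ‖H t‖ₑ * (ofReal (exp (-(c * ε * ‖ξ‖^2))) * kt c ξ (s - t) * ‖F s‖ₑ) := by
              gcongr; exact mtt_k hc hc1 l hl h𝒜 hε ξ t s
          _ = _ := by ring
    _ = ofReal (exp (-(c * ε * ‖ξ‖^2))) * ∫⁻ t, ∫⁻ s, kt c ξ (s - t) * (‖H t‖ₑ * ‖F s‖ₑ) := by
        rw [← lintegral_const_mul _ hkm2.lintegral_prod_right']
        refine lintegral_congr fun t => ?_
        rw [lintegral_const_mul _ (hkm t)]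
    _ ≤ _ := mul_le_mul' le_rfl (schur2 hc ξ hFm hHm)

set_option maxHeartbeats 800000 in
lemma wplT : ∃ C : ENNReal, C ≠ ⊤ ∧ ∀ a : ℝ, 0 < a → ∀ f : Pt d → ℝ, Measurable f → Integrable f →
    ∫⁻ ξ : Spc d, ofReal (exp (-(a * ‖ξ‖^2))) * ∫⁻ s, ofReal (‖Ft (fun y => f (s, y)) ξ‖^2) ≤ C * ∫⁻ z, ofReal ((f z)^2) := by
  obtain ⟨C, hC, h⟩ := wpl (d := d)
  refine ⟨C, hC, fun a ha f hf hfi => ?_⟩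
  have m0 := mFt hf
  have m1 : Measurable fun p : Spc d × ℝ => ofReal (exp (-(a * ‖p.1‖^2)) * ‖Ft (fun y => f (p.2, y)) p.1‖^2) := by
    exact ENNReal.measurable_ofReal.comp (Measurable.fun_mul (by fun_prop) ((mFt' hf).norm.pow_const 2))
  have m2 : Measurable fun z => ofReal ((f z)^2) := by fun_prop
  calc _ = ∫⁻ ξ : Spc d, ∫⁻ s, ofReal (exp (-(a * ‖ξ‖^2)) * ‖Ft (fun y => f (s, y)) ξ‖^2) := by
        refine lintegral_congr fun ξ => ?_
        rw [← lintegral_const_mul' _ _ ENNReal.ofReal_ne_top]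
        refine lintegral_congr fun s => ?_
        rw [ENNReal.ofReal_mul (Real.exp_pos _).le]
    _ = ∫⁻ s, ∫⁻ ξ : Spc d, ofReal (exp (-(a * ‖ξ‖^2)) * ‖Ft (fun y => f (s, y)) ξ‖^2) := lintegral_lintegral_swap m1.aemeasurable
    _ ≤ ∫⁻ s, C * ∫⁻ y, ofReal ((f (s, y))^2) := by
        refine lintegral_mono_ae ?_
        have := hfi.prod_right_ae
        filter_upwards [this] with s hs
        exact h a ha _ (hf.comp (by fun_prop)) hs
    _ = _ := by
        rw [lintegral_const_mul' _ _ hC, Measure.volume_eq_prod, lintegral_prod _ m2.aemeasurable]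

set_option maxHeartbeats 800000 in
lemma BL {c : ℝ} (hc : 0 < c) (hc1 : c ≤ 1) (l : List (Fin d)) (hl : l.length = 2) : ∃ C : ENNReal, C ≠ ⊤ ∧ ∀ 𝒜, Ac c 𝒜 → ∀ ε, 0 < ε →
    ∀ f h : Pt d → ℝ, Measurable f → Integrable f → Measurable h → Integrable h →
    ‖∫ p : Pt d × Pt d, ((h p.1 : ℂ) * (f p.2 : ℂ)) * KC l 𝒜 ε p.1 p.2‖ₑ ≤ C * ((∫⁻ z, ofReal ((h z)^2)) + ∫⁻ z, ofReal ((f z)^2)) := by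
  obtain ⟨C, hC, h0⟩ := wplT (d := d)
  refine ⟨ofReal c⁻¹ * C, by finiteness, fun 𝒜 h𝒜 ε hε f h hf hfi hh hhi => ?_⟩
  have hphi : Integrable fun p : Pt d × Pt d => (h p.1 : ℂ) * (f p.2 : ℂ) := hhi.ofReal.mul_prod hfi.ofReal
  have hmm : Measurable (Function.uncurry fun (p : Pt d × Pt d) (ξ : Spc d) => (mtt l 𝒜 ε ξ p.1.1 p.2.1 : ℂ)) := 
    (Complex.continuous_ofReal.comp ((mtt_cont hc h𝒜 l ε).comp (by fun_prop : Continuous fun q : (Pt d × Pt d) × Spc d => ((q.1.1.1, q.1.2.1), q.2)))).measurable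
  have e := fubx (d := d) hphi (θ := fun p => p.2.2 - p.1.2) (by fun_prop) hmm (W_int (mul_pos hc hε))
    (fun p ξ => by rw [Complex.norm_real]; exact mtt_W hc hc1 l hl h𝒜 hε ξ _ _)
  simp_rw [KC_eq]
  rw [e]
  refine (enorm_integral_le_lintegral_enorm _).trans ?_
  have hce := mul_pos hc hε
  have key : ∀ {f : Pt d → ℝ}, Measurable f → Measurable fun ξ : Spc d => ofReal (exp (-(c * ε * ‖ξ‖^2))) * ∫⁻ s, ofReal (‖Ft (fun y => f (s, y)) ξ‖^2) := by
    intro f hf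
    refine Measurable.fun_mul (by fun_prop) ?_
    exact (mFt'' hf).lintegral_prod_right'
  calc _ ≤ ∫⁻ ξ : Spc d, ofReal c⁻¹ * (ofReal (exp (-(c * ε * ‖ξ‖^2))) * (∫⁻ s, ofReal (‖Ft (fun y => h (s, y)) ξ‖^2)) + 
            ofReal (exp (-(c * ε * ‖ξ‖^2))) * ∫⁻ s, ofReal (‖Ft (fun y => f (s, y)) ξ‖^2)) := by
        refine lintegral_mono fun ξ => ?_
        refine (Ixi hc hc1 l hl h𝒜 hε ξ hf hfi hh hhi).trans (le_of_eq ?_)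
        ring
    _ ≤ _ := by
        rw [lintegral_const_mul' _ _ ENNReal.ofReal_ne_top, lintegral_add_left (key hh), mul_assoc, mul_add C]
        gcongr
        · exact h0 _ hce h hh hhi
        · exact h0 _ hce f hf hfi

end

section
variable {d : ℕ}

structure Kn (A : ℝ) (K : Pt d → Pt d → ℝ) : Prop where
  meas : Measurable fun p : Pt d × Pt d => K p.1 p.2
  bdd : ∃ B, 0 ≤ B ∧ ∀ z w, |K z w| ≤ B
  bl : ∀ f h : Pt d → ℝ, Measurable f → Integrable f → Measurable h → Integrable h →
    ofReal |∫ p : Pt d × Pt d, (h p.1 * f p.2) * K p.1 p.2| ≤ ofReal A * ((∫⁻ z, ofReal ((h z)^2)) + ∫⁻ z, ofReal ((f z)^2))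
  kd : ∀ z w z' w' : Pt d, ∀ e, 0 < e → |z.1 - z'.1| ≤ e^2 → |w.1 - w'.1| ≤ e^2 → ‖z.2 - z'.2‖ ≤ e → ‖w.2 - w'.2‖ ≤ e →
    12 * e ≤ prho (w - z) → |K z w - K z' w'| ≤ A * e * (prho (w - z))⁻¹^(d+3)

def KR (l : List (Fin d)) (𝒜 : ℝ → ℝ → Fin d → Fin d → ℝ) (ε : ℝ) (z w : Pt d) : ℝ := (KC l 𝒜 ε z w).re

lemma mKC {c : ℝ} (hc : 0 < c) {𝒜} (h𝒜 : Ac (d := d) c 𝒜) (l : List (Fin d)) (ε : ℝ) :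
    Measurable fun p : Pt d × Pt d => KC l 𝒜 ε p.1 p.2 := by
  simp_rw [KC_eq]
  have h1 : Measurable fun q : (Pt d × Pt d) × Spc d => (mtt l 𝒜 ε q.2 q.1.1.1 q.1.2.1 : ℂ) := 
    (Complex.continuous_ofReal.comp ((mtt_cont hc h𝒜 l ε).comp (by fun_prop : Continuous fun q : (Pt d × Pt d) × Spc d => ((q.1.1.1, q.1.2.1), q.2)))).measurable
  have h2 : Measurable fun q : (Pt d × Pt d) × Spc d => ex (q.1.2.2 - q.1.1.2) q.2 := by
    unfold ex
    fun_prop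
  exact (h2.mul h1).stronglyMeasurable.integral_prod_right.measurable

lemma Kn_KR {c : ℝ} (hc : 0 < c) (hc1 : c ≤ 1) (l : List (Fin d)) (hl : l.length = 2) : ∃ A : ℝ, 0 < A ∧ ∀ 𝒜, Ac c 𝒜 → ∀ ε, 0 < ε →
    Kn A (KR l 𝒜 ε) := by
  obtain ⟨C1, hC1, h1⟩ := BL hc hc1 l hl
  obtain ⟨C2, hC2, h2⟩ := KD hc hc1 l hl
  refine ⟨C1.toReal + C2, by positivity, fun 𝒜 h𝒜 ε hε => ?_⟩
  have hB : ∀ z w, ‖KC l 𝒜 ε z w‖ ≤ ∫ ξ : Spc d, exp (-(c * ε * ‖ξ‖^2)) * ‖ξ‖^2 := by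
    intro z w
    rw [KC_eq]
    refine norm_integral_le_of_norm_le (W_int (mul_pos hc hε)) (of_forall fun ξ => ?_)
    rw [norm_mul, ex_norm, one_mul, Complex.norm_real]
    exact mtt_W hc hc1 l hl h𝒜 hε ξ _ _
  have hm := mKC hc h𝒜 l ε
  refine ⟨Complex.measurable_re.comp hm, ⟨_, integral_nonneg fun ξ => by positivity, fun z w => (Complex.abs_re_le_norm _).trans (hB z w)⟩, ?_, ?_⟩
  · intro f h hf hfi hh hhi
    have hphi : Integrable fun p : Pt d × Pt d => (h p.1 : ℂ) * (f p.2 : ℂ) := hhi.ofReal.mul_prod hfi.ofReal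
    have hint : Integrable fun p : Pt d × Pt d => ((h p.1 : ℂ) * (f p.2 : ℂ)) * KC l 𝒜 ε p.1 p.2 :=
      hphi.mul_bdd (c := ∫ ξ : Spc d, exp (-(c * ε * ‖ξ‖^2)) * ‖ξ‖^2) hm.aestronglyMeasurable (of_forall fun p => hB _ _)
    have e : ∫ p : Pt d × Pt d, (h p.1 * f p.2) * KR l 𝒜 ε p.1 p.2 = (∫ p : Pt d × Pt d, ((h p.1 : ℂ) * (f p.2 : ℂ)) * KC l 𝒜 ε p.1 p.2).re := by
      rw [← Complex.reCLM_apply, ← Complex.reCLM.integral_comp_comm hint]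
      refine integral_congr_ae (of_forall fun p => ?_)
      simp only [Complex.reCLM_apply, KR]
      rw [← Complex.ofReal_mul, Complex.re_ofReal_mul]
    rw [e]
    calc _ ≤ ‖∫ p : Pt d × Pt d, ((h p.1 : ℂ) * (f p.2 : ℂ)) * KC l 𝒜 ε p.1 p.2‖ₑ := by
          rw [← ofReal_norm_eq_enorm]
          exact ENNReal.ofReal_le_ofReal (Complex.abs_re_le_norm _)
      _ ≤ _ := h1 𝒜 h𝒜 ε hε f h hf hfi hh hhi
      _ ≤ _ := by
          gcongr
          conv_lhs => rw [← ENNReal.ofReal_toReal hC1]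
          exact ENNReal.ofReal_le_ofReal (by linarith)
  · intro z w z' w' e he a1 a2 a3 a4 a5
    have := h2 𝒜 h𝒜 ε hε z w z' w' e he a1 a2 a3 a4 a5
    have hn := prho_nonneg (w - z)
    unfold KR
    rw [← Complex.sub_re]
    refine (Complex.abs_re_le_norm _).trans (this.trans ?_)
    gcongr
    linarith [ENNReal.toReal_nonneg (a := C1)]

def Tk (K : Pt d → Pt d → ℝ) (f : Pt d → ℝ) (z : Pt d) : ℝ := ∫ w, K z w * f w

section
variable {A : ℝ} {K : Pt d → Pt d → ℝ}

lemma Kn.m1 (h : Kn A K) (z : Pt d) : Measurable (K z) := h.meas.comp (by fun_prop : Measurable fun w => (z, w))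

lemma Kn.int (h : Kn A K) {f : Pt d → ℝ} (hf : Integrable f) (z : Pt d) : Integrable fun w => K z w * f w := by
  obtain ⟨B, _, hB⟩ := h.bdd
  exact hf.bdd_mul (c := B) (h.m1 z).aestronglyMeasurable (of_forall fun w => hB _ _)

lemma Kn.mT (h : Kn A K) {f : Pt d → ℝ} (hf : Measurable f) : Measurable (Tk K f) := by
  have : Measurable fun p : Pt d × Pt d => K p.1 p.2 * f p.2 := h.meas.mul (by fun_prop)
  exact this.stronglyMeasurable.integral_prod_right.measurable

lemma Kn.Tb (h : Kn A K) {f : Pt d → ℝ} (hf : Integrable f) : ∃ B, ∀ z, |Tk K f z| ≤ B := by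
  obtain ⟨B, _, hB⟩ := h.bdd
  refine ⟨∫ w, B * |f w|, fun z => ?_⟩
  rw [← Real.norm_eq_abs]
  refine norm_integral_le_of_norm_le (hf.abs.const_mul B) (of_forall fun w => ?_)
  rw [Real.norm_eq_abs, abs_mul]
  gcongr
  exact hB _ _

lemma Kn.l2 (h : Kn A K) (hA : 0 < A) {f : Pt d → ℝ} (hf : Measurable f) (hfi : Integrable f) {B : Set (Pt d)} (hB : MeasurableSet B) (hBf : volume B ≠ ⊤) :
    ∫⁻ z in B, ofReal ((Tk K f z)^2) ≤ ofReal (4 * A^2) * ∫⁻ z, ofReal ((f z)^2) := by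
  have mT := h.mT hf
  obtain ⟨b, hb⟩ := h.Tb hfi
  obtain ⟨k, _, hk⟩ := h.bdd
  set l : ℝ := (2 * A)⁻¹ with hl
  have hl0 : 0 < l := by positivity
  set g : Pt d → ℝ := B.indicator fun z => l * Tk K f z with hg
  have hgm : Measurable g := (mT.const_mul l).indicator hB
  have hTi : IntegrableOn (fun z => l * Tk K f z) B := by
    refine Measure.integrableOn_of_bounded (M := l * b) hBf (mT.const_mul l).aestronglyMeasurable (of_forall fun z => ?_)
    rw [Real.norm_eq_abs, abs_mul, abs_of_pos hl0]
    gcongr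
    exact hb z
  have hgi : Integrable g := hTi.integrable_indicator hB
  have h0 := h.bl f g hf hfi hgm hgi
  have hint : Integrable fun p : Pt d × Pt d => (g p.1 * f p.2) * K p.1 p.2 :=
    (hgi.mul_prod hfi).mul_bdd (c := k) h.meas.aestronglyMeasurable (of_forall fun p => hk _ _)
  have h2i : IntegrableOn (fun z => (Tk K f z)^2) B := by
    refine Measure.integrableOn_of_bounded (M := b^2) hBf (mT.pow_const 2).aestronglyMeasurable (of_forall fun z => ?_)
    rw [Real.norm_eq_abs, abs_pow]
    gcongr
    exact hb z
  have e1 : ∫ p : Pt d × Pt d, (g p.1 * f p.2) * K p.1 p.2 = l * ∫ z in B, (Tk K f z)^2 := by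
    rw [Measure.volume_eq_prod, integral_prod _ (by rwa [← Measure.volume_eq_prod]), ← integral_const_mul, ← integral_indicator hB]
    refine integral_congr_ae (of_forall fun z => ?_)
    have : ∫ w, g z * f w * K z w = g z * Tk K f z := by
      rw [Tk, ← integral_const_mul]
      exact integral_congr_ae (of_forall fun w => by ring)
    dsimp only
    rw [this, hg]
    by_cases hz : z ∈ B
    · rw [indicator_of_mem hz, indicator_of_mem hz]; ring
    · rw [indicator_of_notMem hz, indicator_of_notMem hz]; ring
  set X := ∫⁻ z in B, ofReal ((Tk K f z)^2) with hX
  have eX : X = ofReal (∫ z in B, (Tk K f z)^2) := by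
    rw [ofReal_integral_eq_lintegral_ofReal h2i (of_forall fun z => sq_nonneg _)]
  have hXf : X ≠ ⊤ := by rw [eX]; exact ENNReal.ofReal_ne_top
  have e2 : ∫⁻ z, ofReal ((g z)^2) = ofReal (l^2) * X := by
    rw [hX, ← lintegral_const_mul' _ _ ENNReal.ofReal_ne_top, ← lintegral_indicator hB]
    refine lintegral_congr fun z => ?_
    rw [hg]
    by_cases hz : z ∈ B
    · rw [indicator_of_mem hz, indicator_of_mem hz, mul_pow, ENNReal.ofReal_mul (by positivity)]
    · rw [indicator_of_notMem hz, indicator_of_notMem hz]; simp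
  rw [e1, e2, abs_of_nonneg (mul_nonneg hl0.le (integral_nonneg fun z => sq_nonneg _)), ENNReal.ofReal_mul hl0.le, ← eX] at h0
  set F := ∫⁻ z, ofReal ((f z)^2) with hF
  rcases eq_or_ne F ⊤ with hFt | hFt
  · rw [hFt, ENNReal.mul_top (by simpa using hA.ne')]; exact le_top
  clear_value X F
  clear hX hF
  obtain ⟨x, hx, rfl⟩ : ∃ x : ℝ, 0 ≤ x ∧ X = ofReal x := ⟨X.toReal, ENNReal.toReal_nonneg, (ENNReal.ofReal_toReal hXf).symm⟩
  obtain ⟨y, hy, rfl⟩ : ∃ x : ℝ, 0 ≤ x ∧ F = ofReal x := ⟨F.toReal, ENNReal.toReal_nonneg, (ENNReal.ofReal_toReal hFt).symm⟩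
  rw [← ENNReal.ofReal_mul hl0.le, ← ENNReal.ofReal_mul (by positivity), ← ENNReal.ofReal_add (by positivity) hy, ← ENNReal.ofReal_mul hA.le,
    ENNReal.ofReal_le_ofReal_iff (by positivity)] at h0
  rw [← ENNReal.ofReal_mul (by positivity)]
  refine ENNReal.ofReal_le_ofReal ?_
  have hAl : 2 * A * l = 1 := by rw [hl]; field_simp
  have : 2 * A * (l * x) ≤ 2 * A * (A * (l^2 * x + y)) := by gcongr
  have q : 2 * A * (A * (l^2 * x + y)) = (2 * A * l)^2 / 2 * x + 2 * A^2 * y := by ring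
  rw [q, hAl, ← mul_assoc, hAl] at this
  linarith

end
end

section
variable {X : Type} [TopologicalSpace X] [MeasurableSpace X] {μ : Measure X}

lemma Grid.cz [OpensMeasurableSpace X] [μ.OuterRegular] (G : Grid X μ) {F : X → ENNReal} (hF : Measurable F) (hfin : ∫⁻ x, F x ∂μ ≠ ∞) {L : ENNReal} (hL0 : L ≠ 0) (hLt : L ≠ ∞) :
    ∃ (T : ℤ → Set X) (g : X → ENNReal), (∀ k, G.Sat k (T k)) ∧ Measurable g ∧ (∀ᵐ x ∂μ, g x ≤ G.D * L) ∧ L * μ (⋃ k, T k) ≤ ∫⁻ x, F x ∂μ ∧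
      (∀ κ : X → ENNReal, Measurable κ → ∃ R, ∫⁻ x, κ x * F x ∂μ = R + ∑' k, ∫⁻ x in T k, κ x * F x ∂μ ∧
        ∫⁻ x, κ x * g x ∂μ = R + ∑' k, ∫⁻ x in T k, G.E k κ x * F x ∂μ) := by
  obtain ⟨k0, hk0⟩ := G.big ((∫⁻ x, F x ∂μ) / L) (by finiteness)
  have hlow : ∀ k ≤ k0, ∀ x, G.E k F x ≤ L := by
    intro k hk x
    have h1 := (ENNReal.div_le_iff hL0 hLt).1 (hk0 k hk)
    calc G.E k F x ≤ (G.v k)⁻¹ * (G.v k * L) := mul_le_mul' le_rfl ((setLIntegral_le_lintegral _ _).trans h1)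
      _ = L := by rw [← mul_assoc, ENNReal.inv_mul_cancel (G.v0 k) (G.vt k), one_mul]
  set P : ℤ → X → Prop := fun k x => L < G.E k F x with hPd
  have hP : ∀ k x y, G.c k x = G.c k y → P k x → P k y := fun k x y h hx => by
    show L < _
    rw [← G.E_eq h]; exact hx
  set T := St k0 P with hT
  have hsat := fun k => G.St_sat k0 hP k
  have hTm : ∀ k, MeasurableSet (T k) := fun k => (hsat k).meas
  have hU := St_union k0 P
  have hlU := G.lint_St k0 hP
  rw [← hU] at hlU
  set S := ⋃ k, St k0 P k with hS
  have hSm : MeasurableSet S := MeasurableSet.iUnion hTm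
  set g : X → ENNReal := fun x => (∑' k, (T k).indicator (G.E k F) x) + Sᶜ.indicator F x with hg
  have hgT : ∀ k, ∀ x ∈ T k, g x = G.E k F x := by
    intro k x hx
    have hxS : x ∈ S := mem_iUnion.2 ⟨k, hx⟩
    rw [hg]
    dsimp only
    rw [indicator_of_notMem (by simpa using hxS), add_zero, tsum_eq_single k, indicator_of_mem hx]
    intro j hj
    refine indicator_of_notMem (fun hj' => ?_) _
    exact (Set.disjoint_left.1 (St_disj k0 P hj)) hj' hx
  have hgS : ∀ x ∈ Sᶜ, g x = F x := by
    intro x hx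
    rw [hg]
    dsimp only
    rw [indicator_of_mem hx]
    rw [ENNReal.tsum_eq_zero.2, zero_add]
    intro k
    exact indicator_of_notMem (fun h => hx (mem_iUnion.2 ⟨k, h⟩)) _
  refine ⟨T, g, hsat, ?_, ?_, ?_, ?_⟩
  · exact (Measurable.ennreal_tsum fun k => (G.mE k F).indicator (hTm k)).add (hF.indicator hSm.compl)
  · filter_upwards [G.diff hF hfin] with x hx
    by_cases hxS : x ∈ S
    · obtain ⟨k, hk⟩ := mem_iUnion.1 hxS
      rw [hgT k x hk]
      obtain ⟨h1, h2, h3⟩ := hk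
      have h4 : k0 ≠ k := by rintro rfl; exact absurd h2 (not_lt.2 (hlow _ le_rfl x))
      have h5 : k0 ≤ k - 1 := by omega
      have := G.E_dbl (k - 1) F x
      rw [sub_add_cancel] at this
      exact this.trans (mul_le_mul' le_rfl (not_lt.1 (h3 (k-1) h5 (by omega))))
    · rw [hgS x hxS]
      refine hx.trans ?_
      have : G.M F x ≤ L := by
        refine iSup_le fun k => ?_
        rcases le_total k k0 with h | h
        · exact hlow k h x
        · by_contra hc
          rw [hU] at hxS
          exact hxS ⟨k, h, not_le.1 hc⟩
      exact this.trans (le_mul_of_one_le_left (zero_le) G.D1)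
  · refine le_trans ?_ (G.weak1 hF L)
    refine mul_le_mul' le_rfl (measure_mono (μ := μ) ?_)
    intro x hx
    change x ∈ S at hx
    rw [hU] at hx
    obtain ⟨k, _, hk⟩ := hx
    exact lt_of_lt_of_le hk (G.E_le_M _ _ _)
  · intro κ hκ
    refine ⟨∫⁻ x in Sᶜ, κ x * F x ∂μ, ?_, ?_⟩
    · rw [← hlU, add_comm, lintegral_add_compl _ hSm]
    · rw [← lintegral_add_compl _ hSm, hlU, add_comm]
      congr 1
      · exact setLIntegral_congr_fun hSm.compl fun x hx => congrArg (κ x * ·) (hgS x hx)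
      · congr 1; ext k
        rw [setLIntegral_congr_fun (hTm k) (fun x hx => congrArg (κ x * ·) (hgT k x hx) : EqOn (fun x => κ x * g x) (fun x => κ x * G.E k F x) _)]
        exact (G.adj (hsat k) hκ hF).symm
end

section
variable {d : ℕ} (hd : 1 ≤ d)

lemma e16 (k : ℤ) : (((16:ℕ):ℝ)^k)⁻¹ = (((4:ℝ)^k)⁻¹)^2 := by
  rw [inv_pow, ← zpow_natCast, ← zpow_mul, mul_comm, zpow_mul]; norm_num

lemma gP_v (α) (k : ℤ) : (gP d hd α).v k = ofReal ((((4:ℝ)^k)⁻¹)^(d+2)) := by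
  show ofReal (((16:ℕ):ℝ)^k)⁻¹ * ofReal (((4:ℕ):ℝ)^k)⁻¹ ^ d = _
  rw [e16, ← ENNReal.ofReal_pow (by positivity), ← ENNReal.ofReal_mul (by positivity), pow_add, mul_comm]
  push_cast
  rfl

lemma gP_close {α} {k : ℤ} {z w : Pt d} (h : (gP d hd α).c k z = (gP d hd α).c k w) :
    |z.1 - w.1| ≤ (((4:ℝ)^k)⁻¹)^2 ∧ ∀ i, |z.2 i - w.2 i| ≤ ((4:ℝ)^k)⁻¹ := by
  constructor
  · have := cd_close (by norm_num) (Prod.ext_iff.1 h).1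
    rwa [e16] at this
  · intro i
    have := cd_close (by norm_num) (congrFun (Prod.ext_iff.1 h).2 i)
    exact_mod_cast this

lemma gP_close' {α} {k : ℤ} {z w : Pt d} (h : (gP d hd α).c k z = (gP d hd α).c k w) :
    ‖z.2 - w.2‖ ≤ d * ((4:ℝ)^k)⁻¹ := nsp (by positivity) (gP_close hd h).2

lemma MM_weak {g : Pt d → ENNReal} (hg : Measurable g) (θ : ENNReal) :
    θ * volume {z | Fintype.card (Bool × (Fin d → Bool)) * θ < MM hd g z} ≤ Fintype.card (Bool × (Fin d → Bool)) * ∫⁻ z, g z := by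
  have h1 : {z | Fintype.card (Bool × (Fin d → Bool)) * θ < MM hd g z} ⊆ ⋃ α, {z | θ < (gP d hd α).M g z} := by
    intro z hz
    by_contra hc
    simp only [mem_iUnion, mem_setOf_eq, not_exists, not_lt] at hc hz
    refine absurd hz (not_lt.2 ?_)
    calc MM hd g z ≤ ∑ α : Bool × (Fin d → Bool), θ := Finset.sum_le_sum fun α _ => hc α
      _ = _ := by rw [Finset.sum_const, nsmul_eq_mul]; rfl
  calc _ ≤ θ * ∑ α, volume {z | θ < (gP d hd α).M g z} := by
        gcongr
        refine (measure_mono (μ := volume) h1).trans ?_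
        exact (measure_iUnion_le _).trans (by rw [tsum_fintype])
    _ = ∑ α, θ * volume {z | θ < (gP d hd α).M g z} := Finset.mul_sum _ _ _
    _ ≤ ∑ α : Bool × (Fin d → Bool), ∫⁻ z, g z := Finset.sum_le_sum fun α _ => (gP d hd α).weak1 hg θ
    _ = _ := by rw [Finset.sum_const, nsmul_eq_mul]; rfl

lemma prho_symm (z w : Pt d) : prho (z - w) = prho (w - z) := by
  unfold prho
  rw [Prod.fst_sub, Prod.fst_sub, Prod.snd_sub, Prod.snd_sub, norm_sub_rev, abs_sub_comm]

lemma near {α} {T : ℤ → Set (Pt d)} (hT : ∀ k, (gP d hd α).Sat k (T k)) {k : ℤ} {z w : Pt d} (hw : w ∈ T k) {e : ℝ} (he : e = d * ((4:ℝ)^k)⁻¹) (h : prho (w - z) ≤ 12 * e) :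
    ofReal ((312 * (d:ℝ))⁻¹ ^ (d+2)) ≤ MM hd ((⋃ k, T k).indicator fun _ => 1) z := by
  have hd0 : (1:ℝ) ≤ d := by exact_mod_cast hd
  have he0 : 0 < ((4:ℝ)^k)⁻¹ := by positivity
  have hle : ((4:ℝ)^k)⁻¹ ≤ e := by rw [he]; nlinarith
  have hbx := prho_bx h
  have hsub : (gP d hd α).Q k w ⊆ bx z (13 * e) ∩ ⋃ k, T k := by
    intro y hy
    refine ⟨?_, mem_iUnion.2 ⟨k, (gP d hd α).Q_sub_sat (hT k) hw hy⟩⟩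
    have h1 := gP_close hd (show (gP d hd α).c k y = (gP d hd α).c k w from hy)
    constructor
    · have := abs_sub_le y.1 w.1 z.1
      have := hbx.1
      have := h1.1
      have := pow_le_pow_left₀ he0.le hle 2
      nlinarith
    · intro i
      have := abs_sub_le (y.2 i) (w.2 i) (z.2 i)
      have := hbx.2 i
      have := h1.2 i
      linarith
  have hTm : MeasurableSet (⋃ k, T k) := MeasurableSet.iUnion fun k => (hT k).meas
  have hb := MM_box hd z (R := 13 * e) (by linarith) ((⋃ k, T k).indicator fun _ => 1) (y := z)
    ⟨by simp; positivity, fun i => by simp; linarith⟩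
  rw [setLIntegral_indicator hTm, setLIntegral_one, inter_comm] at hb
  have h2 := (measure_mono (μ := volume) hsub).trans hb
  rw [(gP d hd α).vol', gP_v] at h2
  have e1 : (24 * (13 * e))^(d+2) = (312 * (d:ℝ))^(d+2) * (((4:ℝ)^k)⁻¹)^(d+2) := by rw [← mul_pow, he]; ring_nf
  have p1 : 0 < (312 * (d:ℝ))^(d+2) := by positivity
  have p2 : 0 < (((4:ℝ)^k)⁻¹)^(d+2) := by positivity
  rw [e1, mul_comm (_ ^ _) (_ ^ _), ENNReal.ofReal_mul p2.le, mul_assoc] at h2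
  nth_rewrite 1 [← mul_one (ofReal ((((4:ℝ)^k)⁻¹)^(d+2)))] at h2
  rw [ENNReal.mul_le_mul_iff_right (by simpa using p2) ENNReal.ofReal_ne_top] at h2
  rw [inv_pow, ENNReal.ofReal_inv_of_pos p1]
  rw [ENNReal.inv_le_iff_le_mul (fun _ => (ENNReal.ofReal_pos.2 p1).ne') (fun h => absurd h ENNReal.ofReal_ne_top)]
  exact h2

end

section
variable {d : ℕ}

def ok (d : ℕ) (A e : ℝ) (z w : Pt d) : ENNReal := {w | 12 * e ≤ prho (w - z)}.indicator (fun w => ofReal (A * e * (prho (w - z))⁻¹^(d+3))) w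

lemma mok (A e : ℝ) : Measurable fun p : Pt d × Pt d => ok d A e p.1 p.2 := by
  have h1 : Measurable fun p : Pt d × Pt d => prho (p.2 - p.1) := mprho.comp (by fun_prop)
  have hs : MeasurableSet {p : Pt d × Pt d | 12 * e ≤ prho (p.2 - p.1)} := measurableSet_le measurable_const h1
  have h2 : Measurable fun p : Pt d × Pt d => ofReal (A * e * (prho (p.2 - p.1))⁻¹^(d+3)) := by fun_prop
  exact h2.indicator hs

lemma mok1 (A e : ℝ) (w : Pt d) : Measurable fun z : Pt d => ok d A e z w := by
  have hp : Measurable fun z : Pt d => (z, w) := by fun_prop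
  have h := (mok (d := d) A e).comp hp
  exact h

lemma mok2 (A e : ℝ) (z : Pt d) : Measurable fun w : Pt d => ok d A e z w := by
  have hp : Measurable fun w : Pt d => (z, w) := by fun_prop
  have h := (mok (d := d) A e).comp hp
  exact h

lemma lok (hd : 1 ≤ d) {A e : ℝ} (hA : 0 < A) (he : 0 < e) (w : Pt d) : ∫⁻ z, ok d A e z w ≤ ofReal (A * (48^(d+2) / 6)) * Fintype.card (Bool × (Fin d → Bool)) := by
  have hm : MeasurableSet {z : Pt d | 12 * e ≤ prho (z - w)} := measurableSet_le measurable_const (mprho.comp (by fun_prop))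
  have h := ann hd (g := fun _ => 1) measurable_const w (R := 12 * e) (by linarith) (y := w) ⟨by simp; positivity, fun i => by simp; linarith⟩
  rw [MM_one] at h
  have : ∀ z, ok d A e z w = ofReal (A * e) * {z | 12 * e ≤ prho (z - w)}.indicator (fun z => ofReal ((prho (z - w))⁻¹^(d+3)) * 1) z := by
    intro z
    unfold ok
    simp only [indicator, mem_setOf_eq, prho_symm z w]
    split_ifs
    · rw [ENNReal.ofReal_mul (by positivity), mul_one]
    · rw [mul_zero]
  simp_rw [this]
  rw [lintegral_const_mul' _ _ ENNReal.ofReal_ne_top, lintegral_indicator hm]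
  refine (mul_le_mul' le_rfl h).trans (le_of_eq ?_)
  rw [← mul_assoc, ← ENNReal.ofReal_mul (by positivity)]
  congr 2
  field_simp
  ring

lemma lokO {C : ENNReal} {A e : ℝ} (hC : ∀ w, ∫⁻ z, ok d A e z w ≤ C) (T : Set (Pt d)) {F : Pt d → ENNReal} (hF : Measurable F) :
    ∫⁻ z, ∫⁻ w in T, ok d A e z w * F w ≤ C * ∫⁻ w in T, F w := by
  have m : Measurable fun p : Pt d × Pt d => ok d A e p.1 p.2 * F p.2 := (mok A e).mul (hF.comp measurable_snd)
  calc _ = ∫⁻ w in T, ∫⁻ z, ok d A e z w * F w := lintegral_lintegral_swap m.aemeasurable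
    _ ≤ ∫⁻ w in T, C * F w := by
        refine lintegral_mono fun w => ?_
        rw [lintegral_mul_const _ (mok1 A e w)]
        exact mul_le_mul' (hC w) le_rfl
    _ = _ := lintegral_const_mul _ hF

lemma sub_le_of {x y : ℝ} {O : ENNReal} (hy : 0 ≤ y) (h : ofReal x ≤ ofReal y + O) : ofReal (x - y) ≤ O := by
  rw [ENNReal.ofReal_sub _ hy]
  exact tsub_le_iff_left.2 h

lemma Kn.plus {A : ℝ} {K : Pt d → Pt d → ℝ} (h : Kn A K) {b : ℝ} (hb : ∀ z w, |K z w| ≤ b) {f : Pt d → ℝ} (hfi : Integrable f) (h0 : ∀ z, 0 ≤ f z) (z : Pt d) :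
    0 ≤ Tk K f z + b * ∫ w, f w ∧ ∫⁻ w, ofReal (K z w + b) * ofReal (f w) = ofReal (Tk K f z + b * ∫ w, f w) := by
  have hp : ∀ w, 0 ≤ K z w + b := fun w => by linarith [neg_abs_le (K z w), hb z w]
  have e : Tk K f z + b * ∫ w, f w = ∫ w, (K z w + b) * f w := by
    rw [Tk, ← integral_const_mul, ← integral_add (h.int hfi z) (hfi.const_mul b)]
    exact integral_congr_ae (of_forall fun w => by ring)
  have hi : Integrable fun w => (K z w + b) * f w := by
    refine ((h.int hfi z).add (hfi.const_mul b)).congr (of_forall fun w => ?_)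
    show K z w * f w + b * f w = _
    ring
  rw [e]
  refine ⟨integral_nonneg fun w => mul_nonneg (hp w) (h0 w), ?_⟩
  rw [ofReal_integral_eq_lintegral_ofReal hi (of_forall fun w => mul_nonneg (hp w) (h0 w))]
  exact lintegral_congr fun w => (ENNReal.ofReal_mul (hp w)).symm

set_option maxHeartbeats 1000000 in
lemma Kn.weak_pos (hd : 1 ≤ d) {A : ℝ} (hA : 0 < A) : ∃ C : ENNReal, C ≠ ⊤ ∧ ∀ K : Pt d → Pt d → ℝ, Kn A K → ∀ f : Pt d → ℝ, Measurable f → Integrable f → (∀ z, 0 ≤ f z) →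
    ∀ B : Set (Pt d), MeasurableSet B → volume B ≠ ⊤ → ∀ l : ℝ, 0 < l →
    ofReal l * volume (B ∩ {z | 2 * l < |Tk K f z|}) ≤ C * ∫⁻ z, ofReal (f z) := by
  set G := gP d hd default with hG
  have hd0 : (1:ℝ) ≤ d := by exact_mod_cast hd
  set cN : ENNReal := ((Fintype.card (Bool × (Fin d → Bool)) : ℕ) : ENNReal) with hcN
  have hcN0 : cN ≠ 0 := by rw [hcN]; simp
  have hcNt : cN ≠ ⊤ := by rw [hcN]; finiteness
  set θ0 : ENNReal := ofReal ((312 * (d:ℝ))⁻¹ ^ (d+2)) with hθ0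
  have hθp : θ0 ≠ 0 := (ENNReal.ofReal_pos.2 (by positivity)).ne'
  have hθt : θ0 ≠ ⊤ := ENNReal.ofReal_ne_top
  set θ : ENNReal := θ0 / 2 / cN with hθ
  have hθ1 : cN * θ < θ0 := by rw [hθ, ENNReal.mul_div_cancel hcN0 hcNt]; exact ENNReal.half_lt_self hθp hθt
  have hθ2 : θ ≠ 0 := (ENNReal.div_pos (ENNReal.div_pos hθp (by simp)).ne' hcNt).ne'
  have hθ3 : θ ≠ ⊤ := by rw [hθ]; finiteness
  set C1 := ofReal (A * (48^(d+2) / 6)) * cN with hC1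
  refine ⟨θ⁻¹ * cN + C1 + ofReal (4 * A^2) * G.D, ?_, ?_⟩
  · have := G.Dt
    finiteness
  intro K hK f hf hfi h0 B hB hBf l hl
  set L := ofReal l with hL
  have hL0 : L ≠ 0 := (ENNReal.ofReal_pos.2 hl).ne'
  have hLt : L ≠ ⊤ := ENNReal.ofReal_ne_top
  set F : Pt d → ENNReal := fun z => ofReal (f z) with hF
  have hFm : Measurable F := by fun_prop
  have hFi : ∫⁻ z, F z ≠ ⊤ := by
    rw [hF, ← ofReal_integral_eq_lintegral_ofReal hfi (of_forall h0)]; exact ENNReal.ofReal_ne_top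
  obtain ⟨T, g, hT, hgm, hgD, hTS, hκ⟩ := G.cz hFm hFi hL0 hLt
  set S := ⋃ k, T k with hS
  have hTm : ∀ k, MeasurableSet (T k) := fun k => (hT k).meas
  have hSm : MeasurableSet S := MeasurableSet.iUnion hTm
  have hsum : ∑' k, ∫⁻ z in T k, F z ≤ ∫⁻ z, F z := by
    obtain ⟨R, h1, _⟩ := hκ (fun _ => 1) measurable_const
    simp only [one_mul] at h1
    rw [h1]; exact le_add_self
  have hgF : ∫⁻ z, g z = ∫⁻ z, F z := by
    obtain ⟨R, h1, h2⟩ := hκ (fun _ => 1) measurable_const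
    simp only [Grid.E_const, one_mul] at h1 h2
    rw [h1, h2]
  set e : ℤ → ℝ := fun k => d * ((4:ℝ)^k)⁻¹ with he
  have he0 : ∀ k, 0 < e k := fun k => by rw [he]; positivity
  set O : Pt d → ENNReal := fun z => ∑' k, ∫⁻ w in T k, ok d A (e k) z w * F w with hO
  have mO1 : ∀ k, Measurable fun p : Pt d × Pt d => ok d A (e k) p.1 p.2 * F p.2 := fun k => (mok A (e k)).mul (hFm.comp measurable_snd)
  have mO : Measurable O := Measurable.ennreal_tsum fun k => (mO1 k).lintegral_prod_right'
  have iO : ∫⁻ z, O z ≤ C1 * ∫⁻ z, F z := by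
    rw [hO, lintegral_tsum fun k => ((mO1 k).lintegral_prod_right').aemeasurable]
    calc _ ≤ ∑' k, C1 * ∫⁻ w in T k, F w := by
          exact ENNReal.tsum_le_tsum fun k => lokO (lok hd hA (he0 k)) (T k) hFm
      _ ≤ _ := by rw [ENNReal.tsum_mul_left]; gcongr
  set Z : Set (Pt d) := {z | cN * θ < MM hd (S.indicator fun _ => 1) z} with hZ
  have hZv : L * volume Z ≤ θ⁻¹ * cN * ∫⁻ z, F z := by
    have h1 := MM_weak hd (g := S.indicator fun _ => 1) (measurable_const.indicator hSm) θ
    rw [lintegral_indicator hSm, setLIntegral_one] at h1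
    have h2 : volume Z ≤ θ⁻¹ * (cN * volume S) := by
      rw [← ENNReal.div_eq_inv_mul, ENNReal.le_div_iff_mul_le (Or.inl hθ2) (Or.inl hθ3), mul_comm]
      exact h1
    calc _ ≤ L * (θ⁻¹ * (cN * volume S)) := by gcongr
      _ = θ⁻¹ * cN * (L * volume S) := by ring
      _ ≤ _ := by gcongr
  have hfar : ∀ z, z ∉ Z → ∀ k, ∀ w ∈ T k, 12 * e k ≤ prho (w - z) := by
    intro z hz k w hw
    by_contra hc
    have := near hd hT hw (e := e k) rfl (le_of_lt (not_le.1 hc))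
    exact hz (lt_of_lt_of_le hθ1 this)
  set g' : Pt d → ℝ := fun z => (g z).toReal with hg'
  have hg'm : Measurable g' := hgm.ennreal_toReal
  have hgfin : ∀ᵐ z, g z ≠ ⊤ := by
    filter_upwards [hgD] with z hz
    exact ne_top_of_le_ne_top (ENNReal.mul_ne_top G.Dt hLt) hz
  have hg'g : ∀ᵐ z, ofReal (g' z) = g z := by
    filter_upwards [hgfin] with z hz
    exact ENNReal.ofReal_toReal hz
  have hg'i : Integrable g' := integrable_toReal_of_lintegral_ne_top hgm.aemeasurable (by rw [hgF]; exact hFi)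
  have hg'0 : ∀ z, 0 ≤ g' z := fun z => ENNReal.toReal_nonneg
  have hfg : ∫ z, f z = ∫ z, g' z := by
    have h1 := ofReal_integral_eq_lintegral_ofReal hfi (of_forall h0)
    have h2 := ofReal_integral_eq_lintegral_ofReal hg'i (of_forall hg'0)
    rw [lintegral_congr_ae hg'g, hgF, ← h1, ENNReal.ofReal_eq_ofReal_iff (integral_nonneg hg'0) (integral_nonneg h0)] at h2
    exact h2.symm
  have hcmp : ∀ z, z ∉ Z → ofReal |Tk K f z - Tk K g' z| ≤ O z := by
    intro z hz
    obtain ⟨b, _, hb⟩ := hK.bdd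
    obtain ⟨p1, q1⟩ := hK.plus hb hfi h0 z
    obtain ⟨p2, q2⟩ := hK.plus hb hg'i hg'0 z
    set κ : Pt d → ENNReal := fun w => ofReal (K z w + b) with hκd
    have hκm : Measurable κ := ((hK.m1 z).add_const b).ennreal_ofReal
    have hosc : ∀ k, ∀ w ∈ T k, κ w ≤ G.E k κ w + ok d A (e k) z w ∧ G.E k κ w ≤ κ w + ok d A (e k) z w := by
      intro k w hw
      have hf := hfar z hz k w hw
      have h1 : ∀ w' ∈ G.Q k w, |K z w - K z w'| ≤ A * e k * (prho (w - z))⁻¹^(d+3) := by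
        intro w' hw'
        have hc : G.c k w' = G.c k w := hw'
        have c1 := (gP_close hd hc.symm).1
        have c2 := gP_close' hd hc.symm
        refine hK.kd z w z w' (e k) (he0 k) (by simpa using sq_nonneg (e k)) (c1.trans ?_) (by simpa using (he0 k).le) c2 hf
        have : ((4:ℝ)^k)⁻¹ ≤ e k := by
          have : 0 < ((4:ℝ)^k)⁻¹ := by positivity
          rw [he]; dsimp only; nlinarith
        gcongr
      have h2 : ok d A (e k) z w = ofReal (A * e k * (prho (w - z))⁻¹^(d+3)) := indicator_of_mem (show w ∈ {w | 12 * e k ≤ prho (w - z)} from hf) _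
      have h3 : 0 ≤ A * e k * (prho (w - z))⁻¹^(d+3) := by
        have := prho_nonneg (w - z)
        have := he0 k
        positivity
      set o := A * e k * (prho (w - z))⁻¹^(d+3) with ho
      rw [h2]
      have h4 : ∀ w' ∈ G.Q k w, κ w ≤ κ w' + ofReal o ∧ κ w' ≤ κ w + ofReal o := by
        intro w' hw'
        have := abs_le.1 (h1 w' hw')
        have a1 : 0 ≤ K z w + b := by linarith [neg_abs_le (K z w), hb z w]
        have a2 : 0 ≤ K z w' + b := by linarith [neg_abs_le (K z w'), hb z w']
        simp only [hκd]
        rw [← ENNReal.ofReal_add a2 h3, ← ENNReal.ofReal_add a1 h3]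
        exact ⟨ENNReal.ofReal_le_ofReal (by linarith), ENNReal.ofReal_le_ofReal (by linarith)⟩
      constructor
      · calc κ w = G.E k (fun _ => κ w) w := (G.E_const _ _ _).symm
          _ ≤ G.E k (fun w' => κ w' + ofReal o) w := mul_le_mul' le_rfl (setLIntegral_mono' (G.mQ k w) fun w' hw' => (h4 w' hw').1)
          _ = _ := by rw [G.E_add k hκm, G.E_const]
      · calc _ ≤ G.E k (fun _ => κ w + ofReal o) w := mul_le_mul' le_rfl (setLIntegral_mono' (G.mQ k w) fun w' hw' => (h4 w' hw').2)
          _ = _ := G.E_const _ _ _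
    obtain ⟨R, r1, r2⟩ := hκ κ hκm
    have mw : ∀ k, Measurable fun w => ok d A (e k) z w * F w := fun k => (mok2 A (e k) z).mul hFm
    have s1 : ∫⁻ w, κ w * F w ≤ (∫⁻ w, κ w * g w) + O z := by
      rw [r1, r2, add_assoc, hO]
      dsimp only
      rw [← ENNReal.tsum_add]
      refine add_le_add le_rfl (ENNReal.tsum_le_tsum fun k => ?_)
      rw [← lintegral_add_right _ (mw k)]
      refine setLIntegral_mono' (hTm k) fun w hw => ?_
      rw [← add_mul]
      exact mul_le_mul' (hosc k w hw).1 le_rfl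
    have s2 : ∫⁻ w, κ w * g w ≤ (∫⁻ w, κ w * F w) + O z := by
      rw [r1, r2, add_assoc, hO]
      dsimp only
      rw [← ENNReal.tsum_add]
      refine add_le_add le_rfl (ENNReal.tsum_le_tsum fun k => ?_)
      rw [← lintegral_add_right _ (mw k)]
      refine setLIntegral_mono' (hTm k) fun w hw => ?_
      rw [← add_mul]
      exact mul_le_mul' (hosc k w hw).2 le_rfl
    have q3 : ∫⁻ w, κ w * g w = ofReal (Tk K g' z + b * ∫ w, g' w) := by
      rw [← q2]
      refine lintegral_congr_ae ?_
      filter_upwards [hg'g] with w hw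
      rw [hw]
    rw [q3, q1] at s1 s2
    have t1 := sub_le_of p2 s1
    have t2 := sub_le_of p1 s2
    rw [hfg] at t1 t2
    rcases le_total (Tk K g' z) (Tk K f z) with h | h
    · rw [abs_of_nonneg (by linarith)]; convert! t1 using 2; ring
    · rw [abs_of_nonpos (by linarith)]; convert! t2 using 2; ring
  have hsub : B ∩ {z | 2 * l < |Tk K f z|} ⊆ Z ∪ {z | L ≤ O z} ∪ (B ∩ {z | l < |Tk K g' z|}) := by
    rintro z ⟨hzB, hz⟩
    by_cases hzZ : z ∈ Z
    · exact Or.inl (Or.inl hzZ)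
    by_cases hzO : L ≤ O z
    · exact Or.inl (Or.inr hzO)
    refine Or.inr ⟨hzB, ?_⟩
    have h1 := lt_of_le_of_lt (hcmp z hzZ) (not_le.1 hzO)
    rw [hL, ENNReal.ofReal_lt_ofReal_iff hl] at h1
    have h2 := abs_sub_abs_le_abs_sub (Tk K f z) (Tk K g' z)
    simp only [mem_setOf_eq] at hz ⊢
    linarith
  have h3 : L * volume (B ∩ {z | l < |Tk K g' z|}) ≤ ofReal (4 * A^2) * G.D * ∫⁻ z, F z := by
    have a1 := hK.l2 hA hg'm hg'i hB hBf
    have a2 : ∫⁻ z, ofReal ((g' z)^2) ≤ G.D * L * ∫⁻ z, F z := by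
      rw [← hgF, ← lintegral_const_mul _ hgm]
      refine lintegral_mono_ae ?_
      filter_upwards [hgD, hg'g] with z z1 z2
      rw [sq, ENNReal.ofReal_mul (hg'0 z), z2]
      exact mul_le_mul' z1 le_rfl
    have mTg := hK.mT hg'm
    have a3 : L^2 * volume (B ∩ {z | l < |Tk K g' z|}) ≤ ∫⁻ z in B, ofReal ((Tk K g' z)^2) := by
      have a4 := mul_meas_ge_le_lintegral (μ := volume.restrict B) (f := fun z => ofReal ((Tk K g' z)^2)) (by fun_prop) (L^2)
      refine le_trans (mul_le_mul' le_rfl ?_) a4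
      rw [Measure.restrict_apply' hB, inter_comm]
      refine measure_mono (μ := volume) (inter_subset_inter_left _ ?_)
      intro z hz
      simp only [mem_setOf_eq] at hz ⊢
      rw [hL, ← ENNReal.ofReal_pow hl.le]
      refine ENNReal.ofReal_le_ofReal ?_
      rw [← sq_abs (Tk K g' z)]
      gcongr
    have a5 : L * (L * volume (B ∩ {z | l < |Tk K g' z|})) ≤ L * (ofReal (4 * A^2) * G.D * ∫⁻ z, F z) := by
      calc _ = L^2 * volume (B ∩ {z | l < |Tk K g' z|}) := by ring
        _ ≤ _ := a3.trans (a1.trans (mul_le_mul' le_rfl a2))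
        _ = _ := by ring
    rwa [ENNReal.mul_le_mul_iff_right hL0 hLt] at a5
  calc _ ≤ L * (volume Z + volume {z | L ≤ O z} + volume (B ∩ {z | l < |Tk K g' z|})) := by
        gcongr
        refine (measure_mono (μ := volume) hsub).trans ((measure_union_le _ _).trans ?_)
        gcongr
        exact measure_union_le _ _
    _ = L * volume Z + L * volume {z | L ≤ O z} + L * volume (B ∩ {z | l < |Tk K g' z|}) := by ring
    _ ≤ θ⁻¹ * cN * (∫⁻ z, F z) + C1 * (∫⁻ z, F z) + ofReal (4 * A^2) * G.D * ∫⁻ z, F z := by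
        exact add_le_add (add_le_add hZv ((mul_meas_ge_le_lintegral mO L).trans iO)) h3
    _ = _ := by ring

lemma Kn.weak (hd : 1 ≤ d) {A : ℝ} (hA : 0 < A) : ∃ C : ENNReal, C ≠ ⊤ ∧ ∀ K : Pt d → Pt d → ℝ, Kn A K → ∀ f : Pt d → ℝ, Measurable f → Integrable f →
    ∀ B : Set (Pt d), MeasurableSet B → volume B ≠ ⊤ → ∀ l : ℝ, 0 < l →
    ofReal l * volume (B ∩ {z | 4 * l < |Tk K f z|}) ≤ C * ∫⁻ z, ofReal |f z| := by
  obtain ⟨C, hC, h⟩ := Kn.weak_pos hd hA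
  refine ⟨C + C, by finiteness, fun K hK f hf hfi B hB hBf l hl => ?_⟩
  have h1 := h K hK (fun z => max (f z) 0) (hf.max measurable_const) hfi.pos_part (fun z => le_max_right _ _) B hB hBf l hl
  have h2 := h K hK (fun z => max (-f z) 0) (hf.neg.max measurable_const) hfi.neg_part (fun z => le_max_right _ _) B hB hBf l hl
  have e : ∀ z, Tk K f z = Tk K (fun z => max (f z) 0) z - Tk K (fun z => max (-f z) 0) z := by
    intro z
    unfold Tk
    rw [← integral_sub (hK.int hfi.pos_part z) (hK.int hfi.neg_part z)]
    refine integral_congr_ae (of_forall fun w => ?_)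
    dsimp only
    rcases le_total (f w) 0 with hw | hw
    · rw [max_eq_right hw, max_eq_left (by linarith)]; ring
    · rw [max_eq_left hw, max_eq_right (by linarith)]; ring
  calc _ ≤ ofReal l * (volume (B ∩ {z | 2 * l < |Tk K (fun z => max (f z) 0) z|}) + volume (B ∩ {z | 2 * l < |Tk K (fun z => max (-f z) 0) z|})) := by
        gcongr
        refine (measure_mono (μ := volume) ?_).trans (measure_union_le _ _)
        rintro z ⟨hz, hz2⟩
        rw [← inter_union_distrib_left]
        refine ⟨hz, ?_⟩
        by_contra hc
        simp only [mem_union, mem_setOf_eq, not_or, not_lt] at hc hz2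
        rw [e z] at hz2
        have := abs_sub (Tk K (fun z => max (f z) 0) z) (Tk K (fun z => max (-f z) 0) z)
        linarith [hc.1, hc.2]
    _ ≤ C * (∫⁻ z, ofReal |f z|) + C * ∫⁻ z, ofReal |f z| := by
        rw [mul_add]
        refine add_le_add (h1.trans ?_) (h2.trans ?_)
        · gcongr with z
          exact max_le (le_abs_self _) (abs_nonneg _)
        · gcongr with z
          exact max_le (neg_le_abs _) (abs_nonneg _)
    _ = _ := by ring

end

section
open scoped FourierTransform RealInnerProductSpace
variable {d : ℕ} {u : Pt d → ℝ}

lemma CinfC.dfx (hu : CinfC u) (i : Fin d) : Dx i u = fun z => fderiv ℝ u z (0, EuclideanSpace.single i 1) := by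
  funext ⟨s, y⟩
  have h1 : HasFDerivAt u (fderiv ℝ u (s, y)) (s, y) := (hu.1.differentiable (by simp) _).hasFDerivAt
  have h2 := h1.comp y (hasFDerivAt_prodMk_right s y)
  have h3 : HasFDerivAt (fun y => u (s, y)) _ y := h2
  simp only [Dx]
  rw [h3.fderiv]; simp

lemma CinfC.dft (hu : CinfC u) : Dt u = fun z => fderiv ℝ u z (1, 0) := by
  funext ⟨s, y⟩
  have h1 : HasFDerivAt u (fderiv ℝ u (s, y)) (s, y) := (hu.1.differentiable (by simp) _).hasFDerivAt
  have h2 := h1.comp s (hasFDerivAt_prodMk_left (𝕜 := ℝ) s y)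
  have h3 : HasFDerivAt (fun s => u (s, y)) _ s := h2
  simp only [Dt]
  rw [h3.hasDerivAt.deriv]; simp

lemma CinfC.dv (hu : CinfC u) (v : Pt d) : CinfC fun z => fderiv ℝ u z v :=
  ⟨(hu.1.fderiv_right (m := (⊤ : ℕ∞)) (by simp)).clm_apply contDiff_const, hu.2.fderiv_apply ℝ v⟩

lemma CinfC.dx (hu : CinfC u) (i : Fin d) : CinfC (Dx i u) := by rw [hu.dfx]; exact hu.dv _
lemma CinfC.dt (hu : CinfC u) : CinfC (Dt u) := by rw [hu.dft]; exact hu.dv _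
lemma CinfC.dxx (hu : CinfC u) (i j : Fin d) : CinfC (Dxx i j u) := (hu.dx j).dx i

lemma CinfC.box (hu : CinfC u) : ∃ R, 0 < R ∧ ∀ z : Pt d, R < |z.1| ∨ R < ‖z.2‖ → u z = 0 := by
  obtain ⟨R, hR⟩ := hu.2.isBounded.subset_closedBall 0
  refine ⟨max R 1, by positivity, fun z hz => ?_⟩
  by_contra h
  have h1 := hR (subset_tsupport u h)
  rw [mem_closedBall, dist_zero_right] at h1
  have h2 := norm_fst_le z
  have h3 := norm_snd_le z
  rw [Real.norm_eq_abs] at h2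
  rcases hz with hz | hz <;> linarith [le_max_left R 1]

lemma CinfC.bd (hu : CinfC u) : ∃ C, 0 ≤ C ∧ ∀ z, |u z| ≤ C := by
  obtain ⟨C, hC⟩ := hu.1.continuous.bounded_above_of_compact_support hu.2
  exact ⟨C, (norm_nonneg _).trans (hC 0), hC⟩

lemma CinfC.int (hu : CinfC u) : Integrable u := hu.1.continuous.integrable_of_hasCompactSupport hu.2

lemma CinfC.cc (hu : CinfC u) (s : ℝ) : ContDiff ℝ (⊤ : ℕ∞) fun y => u (s, y) := hu.1.comp (by fun_prop)

lemma CinfC.cs (hu : CinfC u) (s : ℝ) : HasCompactSupport fun y => u (s, y) := by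
  obtain ⟨R, hR, h⟩ := hu.box
  exact HasCompactSupport.intro (isCompact_closedBall 0 R) fun y hy => h _ (Or.inr (by simpa using hy))

lemma CinfC.sint (hu : CinfC u) (s : ℝ) : Integrable fun y => u (s, y) := (hu.cc s).continuous.integrable_of_hasCompactSupport (hu.cs s)

lemma CinfC.Ft_set (hu : CinfC u) : ∃ R, 0 < R ∧ ∀ s ξ, Ft (fun y => u (s, y)) ξ = ∫ y in closedBall 0 R, ex y ξ * (u (s, y) : ℂ) := by
  obtain ⟨R, hR, h⟩ := hu.box
  refine ⟨R, hR, fun s ξ => ?_⟩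
  rw [Ft, setIntegral_eq_integral_of_forall_compl_eq_zero]
  intro y hy
  rw [h _ (Or.inr (by simpa using hy))]; simp

lemma CinfC.Ft_cont (hu : CinfC u) (ξ) : Continuous fun s => Ft (fun y => u (s, y)) ξ := by
  obtain ⟨R, hR, h⟩ := hu.Ft_set
  simp only [h]
  refine continuous_parametric_integral_of_continuous ?_ (isCompact_closedBall 0 R)
  have h1 : Continuous fun p : ℝ × Spc d => ex p.2 ξ := ex_cont.comp (by fun_prop : Continuous fun p : ℝ × Spc d => (p.2, ξ))
  exact h1.mul (Complex.continuous_ofReal.comp hu.1.continuous)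

lemma CinfC.Ft_b (hu : CinfC u) : ∃ C, 0 ≤ C ∧ ∀ s ξ, ‖Ft (fun y => u (s, y)) ξ‖ ≤ C := by
  obtain ⟨R, hR, h⟩ := hu.Ft_set
  obtain ⟨C, hC, hb⟩ := hu.bd
  refine ⟨C * volume.real (closedBall (0 : Spc d) R), by positivity, fun s ξ => ?_⟩
  rw [h]
  refine norm_setIntegral_le_of_norm_le_const measure_closedBall_lt_top fun y _ => ?_
  rw [norm_mul, ex_norm, one_mul, Complex.norm_real]; exact hb _

lemma CinfC.Ft_dx (hu : CinfC u) (i : Fin d) (s) (ξ : Spc d) : Ft (fun y => Dx i u (s, y)) ξ = (2 * Real.pi * ξ i) * Complex.I * Ft (fun y => u (s, y)) ξ := by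
  have hg : ∀ y, HasFDerivAt (fun y => (u (s, y) : ℂ)) (Complex.ofRealCLM.comp (fderiv ℝ (fun y => u (s, y)) y)) y := fun y =>
    Complex.ofRealCLM.hasFDerivAt.comp y ((hu.cc s).differentiable (by simp) y).hasFDerivAt
  have he : ∀ y, HasFDerivAt (fun y => ex y ξ) (ex y ξ • ((Complex.ofRealCLM.comp ((-2 * Real.pi) • innerSL ℝ ξ)).smulRight Complex.I)) y := by
    intro y
    have h1 : HasFDerivAt (fun y : Spc d => -2 * Real.pi * ⟪ξ, y⟫) ((-2 * Real.pi) • innerSL ℝ ξ) y :=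
      ((-2 * Real.pi) • innerSL ℝ ξ).hasFDerivAt
    have h2 := (Complex.ofRealCLM.hasFDerivAt.comp y h1).mul_const Complex.I
    have h3 := h2.cexp
    convert! h3 using 1
    ext v; simp [ex]; ring
  have hev : ∀ y, fderiv ℝ (fun y => ex y ξ) y (EuclideanSpace.single i 1) = ex y ξ * (-(2 * Real.pi * ξ i * Complex.I)) := by
    intro y
    rw [(he y).fderiv]
    simp [EuclideanSpace.inner_single_right]
  have hgv : ∀ y, fderiv ℝ (fun y => (u (s, y) : ℂ)) y (EuclideanSpace.single i 1) = (Dx i u (s, y) : ℂ) := fun y => by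
    rw [(hg y).fderiv]; rfl
  have key := integral_mul_fderiv_eq_neg_fderiv_mul_of_integrable (μ := (volume : Measure (Spc d))) (f := fun y => ex y ξ) (g := fun y => (u (s, y) : ℂ)) (v := EuclideanSpace.single i 1)
    (by
      simp only [hev]
      have := (mexl (hu.sint s) ξ).mul_const (-(2 * Real.pi * ξ i * Complex.I))
      refine this.congr (of_forall fun y => by ring))
    (by simp only [hgv]; exact mexl ((hu.dx i).sint s) ξ) (mexl (hu.sint s) ξ)
    (fun y _ => (he y).differentiableAt) (fun y _ => (hg y).differentiableAt)
  simp only [hgv, hev] at key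
  rw [Ft, key, Ft, ← integral_const_mul, ← integral_neg]
  congr 1; funext y; ring

lemma CinfC.Ft_dxx (hu : CinfC u) (i j : Fin d) (s) (ξ : Spc d) : Ft (fun y => Dxx i j u (s, y)) ξ = -(4 * Real.pi^2 * (ξ i * ξ j)) * Ft (fun y => u (s, y)) ξ := by
  rw [Dxx, (hu.dx j).Ft_dx, hu.Ft_dx]
  ring_nf; rw [Complex.I_sq]; ring

lemma CinfC.Ft_pow (i : Fin d) (n : ℕ) : ∀ {u : Pt d → ℝ}, CinfC u → ∃ C, 0 ≤ C ∧ ∀ s ξ, |ξ i|^n * ‖Ft (fun y => u (s, y)) ξ‖ ≤ C := by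
  induction n with
  | zero => intro u hu; simpa using hu.Ft_b
  | succ n ih =>
    intro u hu
    obtain ⟨C, hC, h⟩ := ih (hu.dx i)
    refine ⟨C, hC, fun s ξ => (le_trans ?_ (h s ξ))⟩
    rw [hu.Ft_dx, norm_mul, norm_mul, norm_mul, norm_mul, Complex.norm_I, Complex.norm_real, Complex.norm_real, Real.norm_eq_abs, Real.norm_eq_abs, abs_of_pos Real.pi_pos, pow_succ, Complex.norm_ofNat]
    have h1 : 1 ≤ 2 * Real.pi := by linarith [Real.pi_gt_three]
    calc |ξ i|^n * |ξ i| * ‖Ft (fun y => u (s, y)) ξ‖ = 1 * (|ξ i|^n * |ξ i| * ‖Ft (fun y => u (s, y)) ξ‖) := (one_mul _).symm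
      _ ≤ (2 * Real.pi) * (|ξ i|^n * |ξ i| * ‖Ft (fun y => u (s, y)) ξ‖) := by gcongr
      _ = _ := by ring

lemma CinfC.Ft_J (hu : CinfC u) : ∃ C, 0 ≤ C ∧ ∀ s ξ, ‖Ft (fun y => u (s, y)) ξ‖ ≤ C * J ξ := by
  obtain ⟨C0, hC0, h0⟩ := hu.Ft_b
  choose C hC h using fun i => CinfC.Ft_pow i (d+1) hu
  refine ⟨2^d * (C0 + d^d * ∑ i, C i), by have := Finset.sum_nonneg fun i (_ : i ∈ Finset.univ) => hC i; positivity, fun s ξ => ?_⟩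
  set F := ‖Ft (fun y => u (s, y)) ξ‖ with hF
  rw [J, ← div_eq_mul_inv, le_div_iff₀ (by positivity)]
  have h1 : ‖ξ‖ ≤ ∑ i, |ξ i| := by
    have : ξ = ∑ i, ξ i • EuclideanSpace.single i (1:ℝ) := by
      have := (EuclideanSpace.basisFun (Fin d) ℝ).sum_repr ξ
      simpa using this.symm
    calc ‖ξ‖ = ‖∑ i, ξ i • EuclideanSpace.single i (1:ℝ)‖ := by rw [← this]
      _ ≤ ∑ i, ‖ξ i • EuclideanSpace.single i (1:ℝ)‖ := norm_sum_le _ _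
      _ = _ := by simp [norm_smul]
  have h2 : ‖ξ‖^(d+1) ≤ d^d * ∑ i, |ξ i|^(d+1) := by
    refine (pow_le_pow_left₀ (norm_nonneg _) h1 _).trans ?_
    have := pow_sum_div_card_le_sum_pow (s := Finset.univ) (f := fun i => |ξ i|) (fun i _ => abs_nonneg _) d
    rw [Finset.card_univ, Fintype.card_fin] at this
    rcases Nat.eq_zero_or_pos d with hd | hd
    · subst hd; simp
    · rw [div_le_iff₀ (by positivity)] at this
      linarith
  calc F * (1 + ‖ξ‖)^(d+1) ≤ F * (2^d * (1^(d+1) + ‖ξ‖^(d+1))) := by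
        gcongr; exact add_pow_le zero_le_one (norm_nonneg _) _
    _ ≤ F * (2^d * (1 + d^d * ∑ i, |ξ i|^(d+1))) := by rw [one_pow]; gcongr
    _ = 2^d * (F + d^d * ∑ i, |ξ i|^(d+1) * F) := by rw [← Finset.sum_mul]; ring
    _ ≤ _ := by gcongr; exacts [h0 s ξ, h _ s ξ]

lemma CinfC.inv (hu : CinfC u) (s) (x : Spc d) : ∫ ξ, (starRingEnd ℂ) (ex x ξ) * Ft (fun y => u (s, y)) ξ = (u (s, x) : ℂ) := by
  have hF : 𝓕 (fun y => (u (s, y) : ℂ)) = Ft fun y => u (s, y) := by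
    funext ξ; rw [Real.fourier_eq']
    refine integral_congr_ae (of_forall fun y => ?_)
    simp only [ex, smul_eq_mul, real_inner_comm]
  have hi : Integrable (𝓕 fun y => (u (s, y) : ℂ)) := by
    rw [hF]
    obtain ⟨C, _, h⟩ := hu.Ft_J
    refine (J_int.const_mul C).mono' ?_ (of_forall fun ξ => h s ξ)
    exact ((mFt' hu.1.continuous.measurable).comp (by fun_prop : Measurable fun ξ : Spc d => (ξ, s))).aestronglyMeasurable
  have := Continuous.fourierInv_fourier_eq (f := fun y => (u (s, y) : ℂ)) (Complex.continuous_ofReal.comp (hu.cc s).continuous) (hu.sint s).ofReal hi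
  have := congrFun this x
  rw [Real.fourierInv_eq', hF] at this
  rw [← this]
  refine integral_congr_ae (of_forall fun ξ => ?_)
  simp only [ex, smul_eq_mul]
  congr 1
  rw [← Complex.exp_conj]
  congr 1
  simp [Complex.conj_ofNat]

end

section
variable {d : ℕ}

lemma inS.qf {δ : ℝ} {a : Matrix (Fin d) (Fin d) ℝ} (h : inS d δ a) (ξ : Spc d) : δ * ‖ξ‖^2 ≤ qf a ξ ∧ qf a ξ ≤ δ⁻¹ * ‖ξ‖^2 := by
  have e : ‖ξ‖^2 = ∑ i, ξ i ^ 2 := by rw [EuclideanSpace.norm_sq_eq]; simp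
  have e2 : _root_.qf a ξ = ∑ i, ∑ j, a i j * ξ i * ξ j := by simp only [_root_.qf, mul_assoc]
  rw [e, e2]; exact h.2 _

lemma inS.ent {δ : ℝ} (hδ : 0 < δ) {a : Matrix (Fin d) (Fin d) ℝ} (h : inS d δ a) (i j) : |a i j| ≤ δ⁻¹ := by
  have hp : ∀ ξ η : Fin d → ℝ, (∑ k, ∑ l, a k l * (ξ k + η k) * (ξ l + η l)) - (∑ k, ∑ l, a k l * (ξ k - η k) * (ξ l - η l))
      = 2 * (∑ k, ∑ l, a k l * ξ k * η l) + 2 * ∑ k, ∑ l, a k l * η k * ξ l := by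
    intro ξ η
    simp only [Finset.mul_sum, ← Finset.sum_sub_distrib, ← Finset.sum_add_distrib]
    refine Finset.sum_congr rfl fun k _ => Finset.sum_congr rfl fun l _ => by ring
  have hn : ∀ ξ η : Fin d → ℝ, (∑ k, (ξ k + η k)^2) ≤ 2 * (∑ k, ξ k ^2) + 2 * ∑ k, η k ^ 2 := by
    intro ξ η
    simp only [Finset.mul_sum, ← Finset.sum_add_distrib]
    refine Finset.sum_le_sum fun k _ => by nlinarith [sq_nonneg (ξ k - η k)]
  have s1 : ∀ i : Fin d, ∑ k, (Pi.single i (1:ℝ) : Fin d → ℝ) k ^ 2 = 1 := fun i => by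
    rw [Finset.sum_eq_single i (fun k _ hk => by simp [hk]) (by simp)]; simp
  have s2 : ∀ i j : Fin d, ∑ k, ∑ l, a k l * (Pi.single i (1:ℝ) : Fin d → ℝ) k * (Pi.single j (1:ℝ) : Fin d → ℝ) l = a i j := fun i j => by
    rw [Finset.sum_eq_single i (fun k _ hk => by simp [hk]) (by simp), Finset.sum_eq_single j (fun k _ hk => by simp [hk]) (by simp)]; simp
  have h1 := hp (Pi.single i 1) (Pi.single j 1)
  have h2 := hn (Pi.single i 1) (Pi.single j 1)
  have h3 := h.2 fun k => (Pi.single i (1:ℝ) : Fin d → ℝ) k + (Pi.single j (1:ℝ) : Fin d → ℝ) k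
  have h4 := h.2 fun k => (Pi.single i (1:ℝ) : Fin d → ℝ) k - (Pi.single j (1:ℝ) : Fin d → ℝ) k
  have h5 : 0 ≤ ∑ k, ((Pi.single i (1:ℝ) : Fin d → ℝ) k - (Pi.single j (1:ℝ) : Fin d → ℝ) k)^2 := Finset.sum_nonneg fun _ _ => sq_nonneg _
  have h5' : 0 ≤ ∑ k, ((Pi.single i (1:ℝ) : Fin d → ℝ) k + (Pi.single j (1:ℝ) : Fin d → ℝ) k)^2 := Finset.sum_nonneg fun _ _ => sq_nonneg _
  have h6 : (∑ k, ((Pi.single i (1:ℝ) : Fin d → ℝ) k - (Pi.single j (1:ℝ) : Fin d → ℝ) k)^2) ≤ 4 := by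
    have := hn (Pi.single i 1) (-Pi.single j 1)
    simp only [Pi.neg_apply, ← sub_eq_add_neg, neg_sq, s1] at this
    linarith
  rw [s1, s1] at h2
  rw [s2, s2, h.1.apply i j] at h1
  have g1 := mul_nonneg hδ.le h5
  have g2 := mul_nonneg hδ.le h5'
  have hi : 0 < δ⁻¹ := inv_pos.2 hδ
  have g3 := mul_le_mul_of_nonneg_left h6 hi.le
  have g4 := mul_le_mul_of_nonneg_left h2 hi.le
  rw [abs_le]; constructor <;> linarith [h3.1, h3.2, h4.1, h4.2]

def AA (b : ℝ → Fin d → Fin d → ℝ) (t s : ℝ) : Fin d → Fin d → ℝ := fun i j => 4 * Real.pi^2 * ∫ r in t..s, b r i j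

structure Bm (δ : ℝ) (b : ℝ → Matrix (Fin d) (Fin d) ℝ) : Prop where
  pos : 0 < δ
  le : δ ≤ 1
  m : ∀ i j, Measurable fun s => b s i j
  S : ∀ s, inS d δ (b s)

section
variable {δ : ℝ} {b : ℝ → Matrix (Fin d) (Fin d) ℝ} 

lemma Bm.int (H : Bm δ b) (i j) (t s : ℝ) : IntervalIntegrable (fun r => b r i j) volume t s := by
  refine (intervalIntegrable_const (c := δ⁻¹)).mono_fun (H.m i j).aestronglyMeasurable (of_forall fun r => ?_)
  show |b r i j| ≤ |δ⁻¹|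
  exact ((H.S r).ent H.pos i j).trans (le_abs_self _)

lemma Bm.qi (H : Bm δ b) (ξ : Spc d) (t s) : IntervalIntegrable (fun r => 4 * Real.pi^2 * _root_.qf (b r) ξ) volume t s := by
  refine IntervalIntegrable.const_mul ?_ _
  have := IntervalIntegrable.sum Finset.univ fun i _ => IntervalIntegrable.sum Finset.univ fun j _ => (H.int i j t s).mul_const (ξ i * ξ j)
  refine this.congr fun r _ => ?_
  simp [qf, Finset.sum_apply]

lemma Bm.qf (H : Bm δ b) (t s) (ξ : Spc d) : _root_.qf (AA b t s) ξ = ∫ r in t..s, 4 * Real.pi^2 * _root_.qf (b r) ξ := by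
  simp only [_root_.qf, AA]
  rw [intervalIntegral.integral_const_mul, intervalIntegral.integral_finset_sum, Finset.mul_sum]
  · refine Finset.sum_congr rfl fun i _ => ?_
    rw [intervalIntegral.integral_finset_sum, Finset.mul_sum]
    · refine Finset.sum_congr rfl fun j _ => ?_
      rw [intervalIntegral.integral_mul_const]; ring
    · exact fun j _ => (H.int i j t s).mul_const _
  · intro i _
    have := IntervalIntegrable.sum Finset.univ fun j _ => (H.int i j t s).mul_const (ξ i * ξ j)
    refine this.congr fun r _ => ?_
    simp [Finset.sum_apply]

lemma Bm.ac (H : Bm δ b) : Ac (δ/40) (AA b) := by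
  have hp : 4 * Real.pi^2 ≤ 40 := by nlinarith [Real.pi_lt_d2, Real.pi_pos]
  have hp1 : 1 ≤ 4 * Real.pi^2 := by nlinarith [Real.pi_gt_three]
  have hδ := H.pos
  have hinv : (δ/40)⁻¹ = 40 * δ⁻¹ := by rw [inv_div, div_eq_mul_inv]
  have h0 : ∀ t s i j, |AA b t s i j| ≤ (δ/40)⁻¹ * |s - t| := by
    intro t s i j
    have : ‖∫ r in t..s, b r i j‖ ≤ δ⁻¹ * |s - t| :=
      intervalIntegral.norm_integral_le_of_norm_le_const fun r _ => (H.S r).ent H.pos i j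
    rw [show AA b t s i j = 4 * Real.pi^2 * ∫ r in t..s, b r i j from rfl, abs_mul, abs_of_nonneg (by positivity), hinv, mul_assoc 40]
    exact mul_le_mul hp this (abs_nonneg _) (by norm_num)
  refine ⟨fun t s hts => ⟨fun ξ => ?_, fun i j => ?_⟩, fun t s t' s' i j => ?_⟩
  · rw [H.qf]
    calc δ/40 * (s - t) * ‖ξ‖^2 = ∫ r in t..s, δ/40 * ‖ξ‖^2 := by rw [intervalIntegral.integral_const, smul_eq_mul]; ring
      _ ≤ _ := by
        refine intervalIntegral.integral_mono_on hts (by simp) ?_ fun r _ => ?_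
        · exact H.qi ξ t s
        · have := ((H.S r).qf ξ).1
          have h2 : 0 ≤ δ * ‖ξ‖^2 := by positivity
          nlinarith
  · have := h0 t s i j; rwa [abs_of_nonneg (sub_nonneg.2 hts)] at this
  · have e : AA b t s i j - AA b t' s' i j = AA b s' s i j - AA b t' t i j := by
      have e1 := intervalIntegral.integral_add_adjacent_intervals (H.int i j t' t) (H.int i j t s)
      have e2 := intervalIntegral.integral_add_adjacent_intervals (H.int i j t' s') (H.int i j s' s)
      simp only [AA]
      linear_combination (4 * Real.pi^2) * (e1 - e2)
    rw [e]
    refine (abs_sub _ _).trans ?_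
    linarith [h0 s' s i j, h0 t' t i j]

end

lemma exp_lip {x y : ℝ} (hx : 0 ≤ x) (hy : 0 ≤ y) : |exp (-x) - exp (-y)| ≤ |x - y| := by
  wlog h : x ≤ y generalizing x y
  · rw [abs_sub_comm, abs_sub_comm x]; exact this hy hx (le_of_not_ge h)
  rw [abs_of_nonneg (sub_nonneg.2 (Real.exp_le_exp.2 (by linarith))), abs_of_nonpos (by linarith)]
  have h1 : exp (-y) = exp (-x) * exp (x - y) := by rw [← Real.exp_add]; ring_nf
  have h2 := Real.add_one_le_exp (x - y)
  have h3 : exp (-x) ≤ 1 := Real.exp_le_one_iff.2 (by linarith)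
  have h4 := Real.exp_pos (-x)
  rw [h1]
  nlinarith

lemma ode {b φ : ℝ → ℝ} {B R : ℝ} (hb : Measurable b) (h0 : ∀ s, 0 ≤ b s) (hB : ∀ s, b s ≤ B) (hφ : ContDiff ℝ 1 φ) (hR : ∀ s, R < |s| → φ s = 0) (t : ℝ) {ε : ℝ} (hε : 0 < ε) :
    ∫ s, chi ((max s t - t)/ε) * exp (-(∫ r in t..max s t, b r)) * (deriv φ s - b s * φ s) = -(ε⁻¹ * ∫ s in t..t+ε, exp (-(∫ r in t..s, b r)) * φ s) := by
  have hbi : ∀ x y, IntervalIntegrable b volume x y := fun x y => by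
    refine (intervalIntegrable_const (c := B)).mono_fun hb.aestronglyMeasurable (of_forall fun r => ?_)
    show |b r| ≤ |B|
    rw [abs_of_nonneg (h0 r)]
    exact (hB r).trans (le_abs_self _)
  have hB0 : 0 ≤ B := (h0 0).trans (hB 0)
  set T := |R| + |t| + ε + 1 with hT
  have hTR : R < T := by have := le_abs_self R; have := abs_nonneg t; linarith
  have hT0 : 0 < T := by positivity
  have hTt : t + ε < T := by have := le_abs_self t; have := abs_nonneg R; linarith
  have hφT : ∀ s, R < s → φ s = 0 := fun s hs => hR s (hs.trans_le (le_abs_self s))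
  have hφT' : ∀ s, R < s → deriv φ s = 0 := fun s hs => by
    have : φ =ᶠ[nhds s] fun _ => 0 := Filter.eventually_of_mem (Ioi_mem_nhds hs) fun r hr => hφT r hr
    rw [this.deriv_eq]; simp
  set q : ℝ → ℝ := fun s => ∫ r in t..s, b r with hq
  set E : ℝ → ℝ := fun s => exp (-(q s)) with hE
  set X : ℝ → ℝ := fun s => min 1 ((s - t)/ε) with hX
  have hq0 : ∀ s, t ≤ s → 0 ≤ q s := fun s hs => intervalIntegral.integral_nonneg hs fun r _ => h0 r
  have huI : uIcc t T = Icc t T := uIcc_of_le (by linarith)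
  have hEl : AbsolutelyContinuousOnInterval E t T := by
    refine LipschitzOnWith.absolutelyContinuousOnInterval (K := ⟨B, hB0⟩) (LipschitzOnWith.of_dist_le_mul fun x hx y hy => ?_)
    rw [huI] at hx hy
    rw [Real.dist_eq, Real.dist_eq]
    refine (exp_lip (hq0 x hx.1) (hq0 y hy.1)).trans ?_
    have e := intervalIntegral.integral_interval_sub_left (hbi t x) (hbi t y)
    rw [hq]; simp only; rw [e, ← Real.norm_eq_abs]
    refine intervalIntegral.norm_integral_le_of_norm_le_const fun r _ => ?_
    rw [Real.norm_eq_abs, abs_of_nonneg (h0 r)]; exact hB r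
  have hFl : AbsolutelyContinuousOnInterval (fun s => E s * φ s) t T := hEl.mul hφ.contDiffOn.absolutelyContinuousOnInterval
  have hXl : AbsolutelyContinuousOnInterval X t T := by
    refine LipschitzOnWith.absolutelyContinuousOnInterval (K := ⟨ε⁻¹, by positivity⟩) (LipschitzOnWith.of_dist_le_mul fun x _ y _ => ?_)
    rw [Real.dist_eq, Real.dist_eq]
    refine (abs_min_sub_min_le_max _ _ _ _).trans ?_
    rw [sub_self, abs_zero, max_eq_right (abs_nonneg _), ← sub_div, abs_div, abs_of_pos hε, sub_sub_sub_cancel_right, div_eq_inv_mul]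
    exact le_rfl
  have ibp := hXl.integral_mul_deriv_eq_deriv_mul hFl
  have hc1 : ∫ s, chi ((max s t - t)/ε) * exp (-(∫ r in t..max s t, b r)) * (deriv φ s - b s * φ s) = ∫ s in t..T, X s * deriv (fun s => E s * φ s) s := by
    rw [intervalIntegral.integral_of_le (by linarith), ← setIntegral_eq_integral_of_forall_compl_eq_zero (s := Ioc t T)]
    · refine setIntegral_congr_ae measurableSet_Ioc ?_
      filter_upwards [(hbi t T).ae_hasDerivAt_integral] with s hs hsI
      have hs' : s ∈ uIcc t T := by rw [huI]; exact ⟨hsI.1.le, hsI.2⟩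
      have d1 : HasDerivAt q (b s) s := hs hs' t left_mem_uIcc
      have d2 := d1.neg.exp.mul (hφ.differentiable (by simp) s).hasDerivAt
      have d3 : HasDerivAt (fun s => E s * φ s) _ s := d2
      rw [d3.deriv, max_eq_left hsI.1.le]
      simp only [hX, hE, chi, hq, Pi.neg_apply]; ring
    · intro s hs
      rw [mem_Ioc, not_and_or, not_lt, not_le] at hs
      rcases hs with hs | hs
      · simp [max_eq_right hs, chi]
      · rw [hφT s (by linarith), hφT' s (by linarith)]; simp
  rw [hc1, ibp, hφT T hTR]
  have hXt : X t = 0 := by simp [hX]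
  rw [hXt]
  have hdi : IntervalIntegrable (fun s => deriv X s * (E s * φ s)) volume t T :=
    hXl.intervalIntegrable_deriv.mul_continuousOn hFl.continuousOn
  have hsp := intervalIntegral.integral_add_adjacent_intervals (hdi.mono_set (c := t) (d := t+ε) (by rw [huI, uIcc_of_le (by linarith)]; exact Icc_subset_Icc le_rfl hTt.le))
    (hdi.mono_set (c := t+ε) (d := T) (by rw [huI, uIcc_of_le hTt.le]; exact Icc_subset_Icc (by linarith) le_rfl))
  have i1 : ∫ s in t..t+ε, deriv X s * (E s * φ s) = ε⁻¹ * ∫ s in t..t+ε, E s * φ s := by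
    rw [← intervalIntegral.integral_const_mul, intervalIntegral.integral_of_le (by linarith), intervalIntegral.integral_of_le (by linarith), integral_Ioc_eq_integral_Ioo, integral_Ioc_eq_integral_Ioo]
    refine setIntegral_congr_fun measurableSet_Ioo fun s hs => ?_
    have : X =ᶠ[nhds s] fun s => (s - t)/ε := by
      filter_upwards [Ioo_mem_nhds hs.1 hs.2] with r hr
      exact min_eq_right (by rw [div_le_one hε]; linarith [hr.2])
    have h2 : HasDerivAt (fun s => (s - t)/ε) (1/ε) s := ((hasDerivAt_id s).sub_const t).div_const ε
    simp only [this.deriv_eq, h2.deriv, one_div]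
  have i2 : ∫ s in t+ε..T, deriv X s * (E s * φ s) = 0 := by
    rw [intervalIntegral.integral_of_le hTt.le]
    refine setIntegral_eq_zero_of_forall_eq_zero fun s hs => ?_
    have : X =ᶠ[nhds s] fun s => 1 := by
      filter_upwards [Ioi_mem_nhds hs.1] with r hr
      exact min_eq_left (by rw [one_le_div hε]; linarith [mem_Ioi.1 hr])
    rw [this.deriv_eq]; simp
  rw [← hsp, i1, i2]; ring

end

section
variable {d : ℕ}

lemma prodFt {k : ℝ → ℝ} (hk : Measurable k) {K : ℝ} (hK : ∀ s, |k s| ≤ K) {h : Pt d → ℝ} (hh : Integrable h) (ξ : Spc d) :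
    ∫ w : Pt d, (k w.1 : ℂ) * (ex w.2 ξ * (h w : ℂ)) = ∫ s, (k s : ℂ) * Ft (fun y => h (s, y)) ξ ∧
    ∫ w : Pt d, (k w.1 : ℂ) * (ex w.2 ξ * (h w : ℂ)) = ∫ y, ex y ξ * ((∫ s, k s * h (s, y) : ℝ) : ℂ) := by
  have hi : Integrable fun w : Pt d => (k w.1 : ℂ) * (ex w.2 ξ * (h w : ℂ)) := by
    have h1 : Measurable fun w : Pt d => (k w.1 : ℂ) * ex w.2 ξ := by
      have h2 : Measurable fun w : Pt d => ex w.2 ξ := (ex_cont.comp (by fun_prop : Continuous fun w : Pt d => (w.2, ξ))).measurable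
      exact (Complex.measurable_ofReal.comp (hk.comp measurable_fst)).mul h2
    have := hh.ofReal (𝕜 := ℂ) |>.bdd_mul (c := K) h1.aestronglyMeasurable (of_forall fun w => by
      rw [norm_mul, ex_norm, mul_one, Complex.norm_real]; exact hK _)
    refine this.congr (of_forall fun w => ?_)
    simp only [mul_assoc]; rfl
  constructor
  · rw [Measure.volume_eq_prod, integral_prod _ (by rwa [← Measure.volume_eq_prod])]
    refine integral_congr_ae (of_forall fun s => ?_)
    simp only [Ft]; rw [integral_const_mul]
  · rw [Measure.volume_eq_prod, integral_prod_symm _ (by rwa [← Measure.volume_eq_prod])]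
    refine integral_congr_ae (of_forall fun y => ?_)
    simp only
    rw [← integral_complex_ofReal, ← integral_const_mul]
    refine integral_congr_ae (of_forall fun s => ?_)
    push_cast; ring

variable {δ : ℝ} {b : ℝ → Matrix (Fin d) (Fin d) ℝ} {u : Pt d → ℝ}

def ft (b : ℝ → Matrix (Fin d) (Fin d) ℝ) (u : Pt d → ℝ) (w : Pt d) : ℝ := Dt u w + ∑ i, ∑ j, b w.1 i j * Dxx i j u w

lemma Bm.i1 (H : Bm δ b) (hu : CinfC u) (i j) : Integrable fun w : Pt d => b w.1 i j * Dxx i j u w :=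
  (hu.dxx i j).int.bdd_mul (c := δ⁻¹) ((H.m i j).comp measurable_fst).aestronglyMeasurable (of_forall fun w => (H.S w.1).ent H.pos i j)

lemma Bm.fi (H : Bm δ b) (hu : CinfC u) : Integrable (ft b u) :=
  hu.dt.int.add (integrable_finsetSum _ fun i _ => integrable_finsetSum _ fun j _ => H.i1 hu i j)

lemma Bm.fm (H : Bm δ b) (hu : CinfC u) : Measurable (ft b u) :=
  hu.dt.1.continuous.measurable.add (Finset.measurable_fun_sum _ fun i _ => Finset.measurable_fun_sum _ fun j _ => ((H.m i j).comp measurable_fst).mul (hu.dxx i j).1.continuous.measurable)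

lemma Bm.qb (H : Bm δ b) (ξ : Spc d) (s) : 0 ≤ 4 * Real.pi^2 * _root_.qf (b s) ξ ∧ 4 * Real.pi^2 * _root_.qf (b s) ξ ≤ 4 * Real.pi^2 * (δ⁻¹ * ‖ξ‖^2) := by
  have h := (H.S s).qf ξ
  have := H.pos
  have h0 : 0 ≤ δ * ‖ξ‖^2 := by positivity
  exact ⟨mul_nonneg (by positivity) (h0.trans h.1), mul_le_mul_of_nonneg_left h.2 (by positivity)⟩

lemma Bm.qm (H : Bm δ b) (ξ : Spc d) : Measurable fun s => 4 * Real.pi^2 * _root_.qf (b s) ξ :=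
  (Finset.measurable_fun_sum _ fun i _ => Finset.measurable_fun_sum _ fun j _ => (H.m i j).mul_const _).const_mul _

lemma Bm.ftF (H : Bm δ b) (hu : CinfC u) (ξ : Spc d) (s) :
    Ft (fun y => ft b u (s, y)) ξ = Ft (fun y => Dt u (s, y) - 4 * Real.pi^2 * _root_.qf (b s) ξ * u (s, y)) ξ := by
  have e1 : Ft (fun y => ft b u (s, y)) ξ = Ft (fun y => Dt u (s, y)) ξ + ∑ i, ∑ j, (b s i j : ℂ) * Ft (fun y => Dxx i j u (s, y)) ξ := by
    have hj : ∀ i j, Integrable fun y => (b s i j : ℂ) * (ex y ξ * (Dxx i j u (s, y) : ℂ)) := fun i j => (mexl ((hu.dxx i j).sint s) ξ).const_mul _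
    simp only [Ft, ← integral_const_mul]
    simp_rw [← integral_finsetSum _ fun j _ => hj _ j]
    rw [← integral_finsetSum _ fun i _ => integrable_finsetSum _ fun j _ => hj i j, ← integral_add (mexl (hu.dt.sint s) ξ) (integrable_finsetSum _ fun i _ => integrable_finsetSum _ fun j _ => hj i j)]
    refine integral_congr_ae (of_forall fun y => ?_)
    simp only [ft]; push_cast
    rw [mul_add, Finset.mul_sum]
    simp_rw [Finset.mul_sum]
    congr 1
    exact Finset.sum_congr rfl fun i _ => Finset.sum_congr rfl fun j _ => by ring
  have e2 : Ft (fun y => Dt u (s, y) - 4 * Real.pi^2 * _root_.qf (b s) ξ * u (s, y)) ξ = Ft (fun y => Dt u (s, y)) ξ - (4 * Real.pi^2 * _root_.qf (b s) ξ : ℝ) * Ft (fun y => u (s, y)) ξ := by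
    simp only [Ft, ← integral_const_mul]
    rw [← integral_sub (mexl (hu.dt.sint s) ξ) ((mexl (hu.sint s) ξ).const_mul _)]
    refine integral_congr_ae (of_forall fun y => ?_)
    push_cast; ring
  rw [e1, e2, sub_eq_add_neg]
  congr 1
  simp only [hu.Ft_dxx, _root_.qf, ← mul_assoc, ← Finset.sum_mul]
  push_cast
  rw [← neg_mul, ← mul_neg, ← Finset.sum_neg_distrib, Finset.mul_sum]
  simp only [Finset.mul_sum, Finset.sum_mul, ← Finset.sum_neg_distrib]
  exact Finset.sum_congr rfl fun i _ => Finset.sum_congr rfl fun j _ => by ring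

lemma Bm.xi (H : Bm δ b) (hu : CinfC u) (i j : Fin d) (ξ : Spc d) (t : ℝ) {ε : ℝ} (hε : 0 < ε) :
    ∫ w : Pt d, (mtt [i, j] (AA b) ε ξ t w.1 : ℂ) * (ex w.2 ξ * (ft b u w : ℂ))
    = -(ξ i * ξ j * exp (-(ε * ‖ξ‖^2)) * ε⁻¹ : ℝ) * ∫ s in Ioc t (t+ε), (exp (-(∫ r in t..s, 4 * Real.pi^2 * _root_.qf (b r) ξ)) : ℂ) * Ft (fun y => u (s, y)) ξ := by
  set β : ℝ → ℝ := fun r => 4 * Real.pi^2 * _root_.qf (b r) ξ with hβ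
  have hc : 0 < δ/40 := by have := H.pos; positivity
  have hc1 : δ/40 ≤ 1 := by have := H.le; linarith
  have hm : Measurable fun s => mtt [i, j] (AA b) ε ξ t s :=
    ((mtt_cont hc H.ac [i, j] ε).comp (by fun_prop : Continuous fun s : ℝ => ((t, s), ξ))).measurable
  have hmb := fun s => mtt_W hc hc1 [i, j] rfl H.ac hε ξ t s
  have hme : ∀ s, mtt [i, j] (AA b) ε ξ t s = (ξ i * ξ j * exp (-(ε * ‖ξ‖^2))) * (chi ((max s t - t)/ε) * exp (-(∫ r in t..max s t, β r))) := by
    intro s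
    have e : Am (AA b) ε t s = fun i j => AA b t (max s t) i j + (if i = j then ε else 0) := rfl
    rw [mtt, wR, e, qf_add, qf_id, H.qf, mono_cons, mono_cons, mono_nil, neg_add, Real.exp_add]; ring
  have hub := (hu.int.bdd_mul (c := 4 * Real.pi^2 * (δ⁻¹ * ‖ξ‖^2)) ((H.qm ξ).comp (measurable_fst (α := ℝ) (β := Spc d))).aestronglyMeasurable (of_forall fun w => by
    show |4 * Real.pi^2 * _root_.qf (b w.1) ξ| ≤ _
    rw [abs_of_nonneg (H.qb ξ w.1).1]; exact (H.qb ξ w.1).2))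
  have hh : Integrable fun w : Pt d => Dt u w - 4 * Real.pi^2 * _root_.qf (b w.1) ξ * u w := hu.dt.int.sub hub
  rw [(prodFt hm hmb (H.fi hu) ξ).1]
  simp_rw [H.ftF hu ξ]
  rw [← (prodFt hm hmb hh ξ).1, (prodFt hm hmb hh ξ).2]
  obtain ⟨R, hR, hbox⟩ := hu.box
  have ho : ∀ y, ∫ s, mtt [i, j] (AA b) ε ξ t s * (Dt u (s, y) - 4 * Real.pi^2 * _root_.qf (b s) ξ * u (s, y)) =
      -(ξ i * ξ j * exp (-(ε * ‖ξ‖^2)) * ε⁻¹) * ∫ s, (Ioc t (t+ε)).indicator (fun s => exp (-(∫ r in t..s, β r))) s * u (s, y) := by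
    intro y
    have hφ : ContDiff ℝ 1 fun s => u (s, y) := (hu.1.of_le (by exact_mod_cast le_top)).comp (by fun_prop)
    have := ode (H.qm ξ) (fun s => (H.qb ξ s).1) (fun s => (H.qb ξ s).2) hφ (R := R) (fun s hs => hbox _ (Or.inl hs)) t hε
    simp_rw [hme, mul_assoc (ξ i * ξ j * exp (-(ε * ‖ξ‖^2)))]
    rw [integral_const_mul]
    rw [show (∫ s, (Ioc t (t+ε)).indicator (fun s => exp (-(∫ r in t..s, β r))) s * u (s, y)) = ∫ s in t..t+ε, exp (-(∫ r in t..s, β r)) * u (s, y) by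
      rw [intervalIntegral.integral_of_le (by linarith), ← integral_indicator measurableSet_Ioc]
      refine integral_congr_ae (of_forall fun s => ?_)
      simp only [indicator]; split_ifs <;> simp]
    rw [neg_mul, mul_assoc _ ε⁻¹]
    refine Eq.trans ?_ (mul_neg _ _)
    exact congrArg (_ * ·) this
  simp_rw [ho]
  have hqc : Continuous fun s => ∫ r in t..s, β r := intervalIntegral.continuous_primitive (fun x y => H.qi ξ x y) t
  have hkm : Measurable ((Ioc t (t+ε)).indicator (fun s => exp (-(∫ r in t..s, β r)))) := (Real.continuous_exp.comp hqc.neg).measurable.indicator measurableSet_Ioc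
  have hkb : ∀ s, |(Ioc t (t+ε)).indicator (fun s => exp (-(∫ r in t..s, β r))) s| ≤ 1 := by
    intro s
    simp only [indicator]; split_ifs with hs
    · rw [abs_of_pos (Real.exp_pos _), Real.exp_le_one_iff, neg_nonpos]
      exact intervalIntegral.integral_nonneg hs.1.le fun r _ => (H.qb ξ r).1
    · simp
  have hk := prodFt hkm hkb hu.int ξ
  have hl : ∀ (c : ℝ) (g : Spc d → ℝ), ∫ y, ex y ξ * ((c * g y : ℝ) : ℂ) = c * ∫ y, ex y ξ * (g y : ℂ) := by
    intro c g; rw [← integral_const_mul]; congr 1; funext y; push_cast; ring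
  rw [hl, ← hk.2, hk.1, ← integral_indicator measurableSet_Ioc, Complex.ofReal_neg]
  congr 1
  refine integral_congr_ae (of_forall fun s => ?_)
  simp only [indicator]; split_ifs <;> simp

def Rx (b : ℝ → Matrix (Fin d) (Fin d) ℝ) (U : Pt d → ℝ) (z : Pt d) (ε : ℝ) (ξ : Spc d) : ℂ :=
  (starRingEnd ℂ) (ex z.2 ξ) * ((exp (-(ε * ‖ξ‖^2)) : ℂ) * ((ε⁻¹ : ℝ) * ∫ s in Ioc z.1 (z.1+ε), (exp (-(∫ r in z.1..s, 4 * Real.pi^2 * _root_.qf (b r) ξ)) : ℂ) * Ft (fun y => U (s, y)) ξ))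

lemma Bm.rep (H : Bm δ b) (hu : CinfC u) (i j : Fin d) (z : Pt d) {ε : ℝ} (hε : 0 < ε) :
    4 * Real.pi^2 * Tk (KR [i, j] (AA b) ε) (ft b u) z = (∫ ξ, Rx b (Dxx i j u) z ε ξ).re := by
  have hc : 0 < δ/40 := by have := H.pos; positivity
  have hc1 : δ/40 ≤ 1 := by have := H.le; linarith
  have hB : ∀ w, ‖KC [i, j] (AA b) ε z w‖ ≤ ∫ ξ : Spc d, exp (-(δ/40 * ε * ‖ξ‖^2)) * ‖ξ‖^2 := by
    intro w
    rw [KC_eq]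
    refine norm_integral_le_of_norm_le (W_int (mul_pos hc hε)) (of_forall fun ξ => ?_)
    rw [norm_mul, ex_norm, one_mul, Complex.norm_real]
    exact mtt_W hc hc1 [i, j] rfl H.ac hε ξ _ _
  have hKm : Measurable fun w => KC [i, j] (AA b) ε z w := (mKC hc H.ac [i, j] ε).comp (by fun_prop : Measurable fun w => (z, w))
  have hi : Integrable fun w => (ft b u w : ℂ) * KC [i, j] (AA b) ε z w :=
    (H.fi hu).ofReal.mul_bdd (c := _) hKm.aestronglyMeasurable (of_forall hB)
  have e1 : Tk (KR [i, j] (AA b) ε) (ft b u) z = (∫ w, (ft b u w : ℂ) * KC [i, j] (AA b) ε z w).re := by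
    have := Complex.reCLM.integral_comp_comm hi
    simp only [Complex.reCLM_apply] at this
    rw [← this, Tk]
    refine integral_congr_ae (of_forall fun w => ?_)
    simp [KR, mul_comm]
  have hmm : Measurable (Function.uncurry fun (w : Pt d) (ξ : Spc d) => (mtt [i, j] (AA b) ε ξ z.1 w.1 : ℂ)) :=
    (Complex.continuous_ofReal.comp ((mtt_cont hc H.ac [i, j] ε).comp (by fun_prop : Continuous fun p : Pt d × Spc d => ((z.1, p.1.1), p.2)))).measurable
  have e2 := fubx (d := d) (φ := fun w => (ft b u w : ℂ)) (H.fi hu).ofReal (θ := fun w : Pt d => w.2 - z.2) (by fun_prop) hmm (W_int (mul_pos hc hε))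
    (fun w ξ => by rw [Complex.norm_real]; exact mtt_W hc hc1 [i, j] rfl H.ac hε ξ _ _)
  simp_rw [← KC_eq] at e2
  rw [e1, e2, ← Complex.re_ofReal_mul, ← integral_const_mul]
  congr 2; funext ξ
  have e3 : ∀ w : Pt d, (ft b u w : ℂ) * (ex (w.2 - z.2) ξ * (mtt [i, j] (AA b) ε ξ z.1 w.1 : ℂ)) = (starRingEnd ℂ) (ex z.2 ξ) * ((mtt [i, j] (AA b) ε ξ z.1 w.1 : ℂ) * (ex w.2 ξ * (ft b u w : ℂ))) := by
    intro w; rw [ex_sub]; ring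
  simp_rw [e3]
  rw [integral_const_mul, H.xi hu i j ξ z.1 hε, Rx]
  simp_rw [hu.Ft_dxx, mul_left_comm _ (-(4 * (Real.pi : ℂ)^2 * (ξ i * ξ j))) _]
  rw [integral_const_mul]
  push_cast; ring

lemma Bm.lim (H : Bm δ b) (hu : CinfC u) (i j : Fin d) (z : Pt d) {e : ℕ → ℝ} (he : ∀ n, 0 < e n) (h0 : Filter.Tendsto e Filter.atTop (nhds 0)) :
    Filter.Tendsto (fun n => 4 * Real.pi^2 * Tk (KR [i, j] (AA b) (e n)) (ft b u) z) Filter.atTop (nhds (Dxx i j u z)) := by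
  have hU := hu.dxx i j
  set U := Dxx i j u
  obtain ⟨C, hC, hJ⟩ := hU.Ft_J
  simp_rw [fun n => H.rep hu i j z (he n)]
  have hq : ∀ ξ, Continuous fun s => ∫ r in z.1..s, 4 * Real.pi^2 * _root_.qf (b r) ξ := fun ξ => intervalIntegral.continuous_primitive (fun x y => H.qi ξ x y) z.1
  have hG : ∀ ξ, Continuous fun s => (exp (-(∫ r in z.1..s, 4 * Real.pi^2 * _root_.qf (b r) ξ)) : ℂ) * Ft (fun y => U (s, y)) ξ := fun ξ =>
    (Complex.continuous_ofReal.comp (Real.continuous_exp.comp (hq ξ).neg)).mul (hU.Ft_cont ξ)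
  have key : Filter.Tendsto (fun n => ∫ ξ, Rx b U z (e n) ξ) Filter.atTop (nhds (∫ ξ, (starRingEnd ℂ) (ex z.2 ξ) * Ft (fun y => U (z.1, y)) ξ)) := by
    refine tendsto_integral_of_dominated_convergence (fun ξ => C * J ξ) (fun n => ?_) (J_int.const_mul C) (fun n => of_forall fun ξ => ?_) (of_forall fun ξ => ?_)
    · have m1 : Measurable fun p : Spc d × ℝ => (exp (-(∫ r in z.1..p.2, 4 * Real.pi^2 * _root_.qf (b r) p.1)) : ℂ) * Ft (fun y => U (p.2, y)) p.1 := by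
        simp_rw [← H.qf]
        have hA : ∀ i j, Continuous fun p : Spc d × ℝ => AA b z.1 p.2 i j := fun i j =>
          (H.ac.cont (by have := H.pos; positivity) i j).comp (by fun_prop : Continuous fun p : Spc d × ℝ => (z.1, p.2))
        have hB : Continuous fun p : Spc d × ℝ => _root_.qf (AA b z.1 p.2) p.1 := by
          unfold _root_.qf
          refine continuous_finsetSum _ fun i _ => continuous_finsetSum _ fun j _ => (hA i j).mul (by fun_prop)
        exact (Complex.continuous_ofReal.comp (Real.continuous_exp.comp hB.neg)).measurable.mul (mFt' hU.1.continuous.measurable)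
      have m2 : Measurable fun ξ : Spc d => ∫ s in Ioc z.1 (z.1+e n), (exp (-(∫ r in z.1..s, 4 * Real.pi^2 * _root_.qf (b r) ξ)) : ℂ) * Ft (fun y => U (s, y)) ξ :=
        (m1.stronglyMeasurable.integral_prod_right (ν := volume.restrict (Ioc z.1 (z.1+e n)))).measurable
      have m3 : Measurable fun ξ : Spc d => (starRingEnd ℂ) (ex z.2 ξ) :=
        (Complex.continuous_conj.comp (ex_cont.comp (by fun_prop : Continuous fun ξ : Spc d => (z.2, ξ)))).measurable
      have m4 : Measurable fun ξ : Spc d => (exp (-(e n * ‖ξ‖^2)) : ℂ) := by fun_prop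
      exact (m3.mul (m4.mul (m2.const_mul _))).aestronglyMeasurable
    · have hn := he n
      rw [Rx, norm_mul, RCLike.norm_conj, ex_norm, one_mul, norm_mul, norm_mul, Complex.norm_real, Complex.norm_real, Real.norm_eq_abs, Real.norm_eq_abs, abs_of_pos (Real.exp_pos _), abs_of_pos (by positivity)]
      have h1 : ‖∫ s in Ioc z.1 (z.1 + e n), (exp (-(∫ r in z.1..s, 4 * Real.pi^2 * _root_.qf (b r) ξ)) : ℂ) * Ft (fun y => U (s, y)) ξ‖ ≤ C * J ξ * volume.real (Ioc z.1 (z.1 + e n)) := by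
        refine norm_setIntegral_le_of_norm_le_const measure_Ioc_lt_top fun s hs => ?_
        rw [norm_mul, Complex.norm_real, Real.norm_eq_abs, abs_of_pos (Real.exp_pos _)]
        calc _ ≤ 1 * (C * J ξ) := mul_le_mul (by
                rw [Real.exp_le_one_iff, neg_nonpos]
                exact intervalIntegral.integral_nonneg hs.1.le fun r _ => (H.qb ξ r).1) (hJ s ξ) (norm_nonneg _) zero_le_one
          _ = _ := one_mul _
      rw [Real.volume_real_Ioc_of_le (by linarith), add_sub_cancel_left] at h1
      have h2 : exp (-(e n * ‖ξ‖^2)) ≤ 1 := by rw [Real.exp_le_one_iff, neg_nonpos]; positivity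
      calc _ ≤ 1 * ((e n)⁻¹ * (C * J ξ * e n)) := by gcongr
        _ = _ := by field_simp
    · simp only [Rx]
      refine Filter.Tendsto.mul tendsto_const_nhds ?_
      have t1 : Filter.Tendsto (fun n => (exp (-(e n * ‖ξ‖^2)) : ℂ)) Filter.atTop (nhds ((exp (-(0 * ‖ξ‖^2)) : ℝ) : ℂ)) :=
        (Complex.continuous_ofReal.tendsto _).comp ((Real.continuous_exp.tendsto _).comp (h0.mul_const _).neg)
      have d1 : HasDerivAt (fun x => ∫ s in z.1..x, (exp (-(∫ r in z.1..s, 4 * Real.pi^2 * _root_.qf (b r) ξ)) : ℂ) * Ft (fun y => U (s, y)) ξ) _ z.1 :=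
        (hG ξ).integral_hasStrictDerivAt z.1 z.1 |>.hasDerivAt
      have t2 := d1.tendsto_slope_zero.comp (tendsto_nhdsWithin_iff.2 ⟨h0, of_forall fun n => (he n).ne'⟩)
      have t3 := t1.mul t2
      simp only [zero_mul, neg_zero, Real.exp_zero, Complex.ofReal_one, one_mul, intervalIntegral.integral_same] at t3
      refine t3.congr fun n => ?_
      simp only [Function.comp]
      rw [sub_zero, intervalIntegral.integral_of_le (by linarith [he n]), Complex.real_smul]
  rw [hU.inv] at key
  have := (Complex.continuous_re.tendsto _).comp key
  simp only [Complex.ofReal_re] at this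
  exact this

end

section
variable {d : ℕ}

lemma Kn.far (hd : 1 ≤ d) {A : ℝ} {K : Pt d → Pt d → ℝ} (h : Kn A K) {l R : ℝ} (hl : 0 < l) (hR : 24 * d * l ≤ R) {z z0 : Pt d} (h1 : |z.1 - z0.1| ≤ l^2) (h2 : ‖z.2 - z0.2‖ ≤ d * l)
    {g : Pt d → ℝ} (hg : Integrable g) {C : Set (Pt d)} (hC : MeasurableSet C) (hCR : ∀ w, w ∉ C → R/2 ≤ prho (w - z0)) :
    ofReal |Tk K (Cᶜ.indicator g) z - Tk K (Cᶜ.indicator g) z0| ≤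
      ofReal (A * (d * l)) * ∫⁻ w in {w | R/2 ≤ prho (w - z0)}, ofReal ((prho (w - z0))⁻¹^(d+3)) * ofReal |g w| := by
  have hd1 : (1:ℝ) ≤ d := by exact_mod_cast hd
  have hi := hg.indicator hC.compl
  unfold Tk
  rw [← integral_sub (h.int hi z) (h.int hi z0), ← lintegral_const_mul' _ _ ENNReal.ofReal_ne_top, ← Real.norm_eq_abs, ofReal_norm_eq_enorm]
  refine (enorm_integral_le_lintegral_enorm _).trans ?_
  have hm : MeasurableSet {w : Pt d | R/2 ≤ prho (w - z0)} := measurableSet_le measurable_const (mprho.comp (by fun_prop))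
  rw [← lintegral_indicator hm]
  refine lintegral_mono fun w => ?_
  by_cases hw : w ∈ C
  · have : Cᶜ.indicator g w = 0 := indicator_of_notMem (by simpa using hw) _
    simp [this]
  rw [indicator_of_mem (show w ∈ {w : Pt d | R/2 ≤ prho (w - z0)} from hCR w hw), indicator_of_mem (show w ∈ Cᶜ from hw), ← sub_mul, enorm_mul,
    ← mul_assoc, ← ofReal_norm_eq_enorm, ← ofReal_norm_eq_enorm, Real.norm_eq_abs, Real.norm_eq_abs]
  refine mul_le_mul' ?_ le_rfl
  have hp := prho_nonneg (w - z0)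
  have hk := h.kd z0 w z w (d * l) (by positivity) (by rw [abs_sub_comm]; nlinarith [mul_nonneg (mul_nonneg hl.le hl.le) (by nlinarith : (0:ℝ) ≤ (d:ℝ)^2-1)]) (by simp; positivity) (by rw [norm_sub_rev]; exact h2) (by simp; positivity)
    (by linarith [hCR w hw])
  rw [abs_sub_comm] at hk
  rw [← ENNReal.ofReal_mul' (by positivity)]
  exact ENNReal.ofReal_le_ofReal hk

set_option maxHeartbeats 1000000 in
lemma osc1 (hd : 1 ≤ d) {A : ℝ} (hA : 0 < A) : ∃ Cw : ENNReal, Cw ≠ ⊤ ∧ ∀ K : ℕ → Pt d → Pt d → ℝ, (∀ n, Kn A (K n)) → ∀ U g : Pt d → ℝ, Measurable U → Measurable g → Integrable g →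
    (∀ z, Filter.Tendsto (fun n => 4 * Real.pi^2 * Tk (K n) g z) Filter.atTop (nhds (U z))) → ∀ (k : ℤ) (z0 : Pt d) (R : ℝ), 24 * d * ((4:ℝ)^k)⁻¹ ≤ R →
    ∀ C : Set (Pt d), MeasurableSet C → (∀ w, w ∉ C → R/2 ≤ prho (w - z0)) → ∀ η : ℝ, 0 < η → ∃ c : ℝ, 
    8 * (gP d hd default).D * volume {y | y ∈ (gP d hd default).Q k z0 ∧ ofReal η + Cw * (((gP d hd default).v k)⁻¹ * ∫⁻ w in C, ofReal |g w|) 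
      + Cw * (ofReal ((4:ℝ)^k)⁻¹ * ∫⁻ w in {w | R/2 ≤ prho (w - z0)}, ofReal ((prho (w - z0))⁻¹^(d+3)) * ofReal |g w|) < ofReal |U y - c|} ≤ (gP d hd default).v k := by
  obtain ⟨C0, hC0, hw⟩ := Kn.weak hd hA
  set G := gP d hd default with hG
  have hDt := G.Dt
  have hD1 := G.D1
  have hD0 : G.D ≠ 0 := (lt_of_lt_of_le one_pos hD1).ne'
  refine ⟨ofReal (16 * Real.pi^2) * (16 * G.D * C0) + ofReal (4 * Real.pi^2 * (A * d)), by finiteness, ?_⟩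
  intro K hK U g hU hg hgi hlim k z0 R hR C hC hCR η hη
  set l := ((4:ℝ)^k)⁻¹ with hl
  have hl0 : 0 < l := by rw [hl]; positivity
  clear_value l
  set v := G.v k with hv
  have hv0 : v ≠ 0 := G.v0 k
  have hvt : v ≠ ⊤ := G.vt k
  set Q := G.Q k z0 with hQ
  have hQm : MeasurableSet Q := G.mQ k z0
  have hQv : volume Q = v := G.vol k z0
  set F := ∫⁻ w in C, ofReal |g w| with hF
  set J := ∫⁻ w in {w | R/2 ≤ prho (w - z0)}, ofReal ((prho (w - z0))⁻¹^(d+3)) * ofReal |g w| with hJ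
  have hFt : F ≠ ⊤ := by
    have : Integrable g (volume.restrict C) := hgi.restrict
    have := this.2
    simp only [hasFiniteIntegral_iff_norm, Real.norm_eq_abs] at this
    exact this.ne

  haveI : IsFiniteMeasure (volume.restrict Q) := ⟨by rw [Measure.restrict_apply_univ, hQv]; exact hvt.lt_top⟩
  have hcm := tendstoInMeasure_iff_dist.1 (tendstoInMeasure_of_tendsto_ae (μ := volume.restrict Q) (f := fun n z => 4 * Real.pi^2 * Tk (K n) g z) (g := U)
    (fun n => (((hK n).mT hg).const_mul _).aestronglyMeasurable) (of_forall hlim)) (η/2) (by linarith)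
  have hpos : 0 < v / (16 * G.D) := ENNReal.div_pos hv0 (by finiteness)
  obtain ⟨n, hn⟩ := (hcm.eventually (gt_mem_nhds hpos)).exists
  have hk := hK n
  set g1 := C.indicator g with hg1
  set g2 := Cᶜ.indicator g with hg2
  have hg1i : Integrable g1 := hgi.indicator hC
  have hg2i : Integrable g2 := hgi.indicator hC.compl
  have hT : ∀ z, Tk (K n) g z = Tk (K n) g1 z + Tk (K n) g2 z := by
    intro z
    unfold Tk
    rw [← integral_add (hk.int hg1i z) (hk.int hg2i z)]
    refine integral_congr_ae (of_forall fun w => ?_)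
    show K n z w * g w = K n z w * g1 w + K n z w * g2 w
    rw [← mul_add, hg1, hg2, ← Pi.add_apply, indicator_self_add_compl]
  refine ⟨4 * Real.pi^2 * Tk (K n) g2 z0, ?_⟩
  set L := 16 * G.D * C0 * (v⁻¹ * F) with hL
  have hLt : L ≠ ⊤ := by finiteness
  set lam := L.toReal + η / (32 * Real.pi^2) with hlam
  have hpi := Real.pi_pos
  have hlam0 : 0 < lam := by have := ENNReal.toReal_nonneg (a := L); positivity
  have hLl : L ≤ ofReal lam := by
    rw [← ENNReal.ofReal_toReal hLt]
    exact ENNReal.ofReal_le_ofReal (by rw [hlam]; linarith [show 0 < η / (32 * Real.pi^2) by positivity])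
  have hwk := hw (K n) hk g1 (hg.indicator hC) hg1i Q hQm (by rw [hQv]; exact hvt) lam hlam0
  have hF1 : ∫⁻ z, ofReal |g1 z| = F := by
    rw [hF, ← lintegral_indicator hC]
    refine lintegral_congr fun z => ?_
    rw [hg1]
    by_cases hz : z ∈ C <;> simp [hz]
  rw [hF1] at hwk
  set S1 := Q ∩ {z | 4 * lam < |Tk (K n) g1 z|} with hS1
  set S2 := {x | η / 2 ≤ dist (4 * Real.pi^2 * Tk (K n) g x) (U x)} ∩ Q with hS2
  have hS2v : volume S2 ≤ v / (16 * G.D) := by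
    refine le_trans ?_ hn.le
    rw [Measure.restrict_apply' hQm]
  have hS1v : volume S1 ≤ v / (16 * G.D) := by
    rw [ENNReal.le_div_iff_mul_le (Or.inl (by positivity)) (Or.inl (by finiteness))]
    have hl1 : ofReal lam ≠ 0 := (ENNReal.ofReal_pos.2 hlam0).ne'
    rw [← ENNReal.mul_le_mul_iff_right hl1 ENNReal.ofReal_ne_top]
    calc ofReal lam * (volume S1 * (16 * G.D)) = (ofReal lam * volume S1) * (16 * G.D) := by ring
      _ ≤ C0 * F * (16 * G.D) := by gcongr
      _ = L * v := by
          rw [hL]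
          calc _ = 16 * G.D * C0 * F * (v⁻¹ * v) := by rw [ENNReal.inv_mul_cancel hv0 hvt]; ring
            _ = _ := by ring
      _ ≤ _ := by gcongr
  have hsub : {y | y ∈ Q ∧ ofReal η + (ofReal (16 * Real.pi^2) * (16 * G.D * C0) + ofReal (4 * Real.pi^2 * (A * d))) * (v⁻¹ * F) 
      + (ofReal (16 * Real.pi^2) * (16 * G.D * C0) + ofReal (4 * Real.pi^2 * (A * d))) * (ofReal l * J) < ofReal |U y - 4 * Real.pi^2 * Tk (K n) g2 z0|} ⊆ S1 ∪ S2 := by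
    rintro y ⟨hy, hy2⟩
    by_contra hc
    simp only [mem_union, not_or, hS1, hS2, mem_inter_iff, mem_setOf_eq, not_and, not_lt, not_le] at hc
    have h1 := hc.1 hy
    have h2 : dist (4 * Real.pi^2 * Tk (K n) g y) (U y) < η/2 := by
      by_contra h
      exact hc.2 (not_lt.1 h) hy
    rw [Real.dist_eq] at h2
    have hcl := gP_close hd (α := default) (z := y) (w := z0) (k := k) hy
    have hcl' := gP_close' hd (α := default) (z := y) (w := z0) (k := k) hy
    rw [← hl] at hcl hcl'
    have h3 := hk.far hd hl0 hR hcl.1 hcl' hgi hC hCR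
    refine absurd hy2 (not_lt.2 ?_)
    have hab : |U y - 4 * Real.pi^2 * Tk (K n) g2 z0| ≤ η/2 + 16 * Real.pi^2 * lam + 4 * Real.pi^2 * |Tk (K n) g2 y - Tk (K n) g2 z0| := by
      have e : U y - 4 * Real.pi^2 * Tk (K n) g2 z0 = -(4 * Real.pi^2 * Tk (K n) g y - U y) + 4 * Real.pi^2 * Tk (K n) g1 y + 4 * Real.pi^2 * (Tk (K n) g2 y - Tk (K n) g2 z0) := by
        rw [hT]; ring
      rw [e]
      refine (abs_add_three _ _ _).trans ?_
      rw [abs_neg, abs_mul, abs_mul (4 * Real.pi^2), abs_of_pos (show 0 < 4 * Real.pi^2 by positivity)]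
      nlinarith [mul_le_mul_of_nonneg_left h1 (show 0 ≤ 4 * Real.pi^2 by positivity)]
    have e2 : η/2 + 16 * Real.pi^2 * lam = η + 16 * Real.pi^2 * L.toReal := by
      rw [hlam]; field_simp; ring
    rw [e2] at hab
    refine (ENNReal.ofReal_le_ofReal hab).trans ?_
    rw [ENNReal.ofReal_add (by positivity) (by positivity), ENNReal.ofReal_add hη.le (by positivity), ENNReal.ofReal_mul (by positivity), ENNReal.ofReal_toReal hLt, ENNReal.ofReal_mul (p := 4 * Real.pi^2) (by positivity)]
    refine add_le_add (add_le_add le_rfl ?_) ?_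
    · rw [hL, add_mul, mul_assoc (ofReal _)]; exact le_self_add
    · refine (mul_le_mul' le_rfl h3).trans ?_
      rw [← mul_assoc A, ENNReal.ofReal_mul (p := A * d) (by positivity), add_mul, ENNReal.ofReal_mul (p := 4 * Real.pi^2) (by positivity)]
      refine le_trans (le_of_eq ?_) le_add_self
      ring
  calc _ ≤ 8 * G.D * (volume S1 + volume S2) := by
        gcongr
        exact (measure_mono hsub).trans (measure_union_le _ _)
    _ ≤ 8 * G.D * (v / (16 * G.D) + v / (16 * G.D)) := by gcongr
    _ = 16 * G.D * (v / (16 * G.D)) := by ring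
    _ = v := ENNReal.mul_div_cancel (by positivity) (by finiteness)
end

section
variable {d : ℕ}

structure Cf (δ θ : ℝ) (a : Pt d → Matrix (Fin d) (Fin d) ℝ) : Prop where
  pos : 0 < δ
  le : δ ≤ 1
  m : Measurable a
  S : ∀ z, inS d δ (a z)
  sh : aSharp a ≤ ofReal θ

def VV (u : Pt d → ℝ) (w : Pt d) : ℝ := ∑ i, ∑ j, |Dxx i j u w|

def ff (a : Pt d → Matrix (Fin d) (Fin d) ℝ) (u : Pt d → ℝ) (z : Pt d) : ℝ := Dt u z + ∑ i, ∑ j, a z i j * Dxx i j u z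

def aT (a : Pt d → Matrix (Fin d) (Fin d) ℝ) (R : ℝ) (x : Spc d) (t : ℝ) : Matrix (Fin d) (Fin d) ℝ := Matrix.of (aTilde a R x t)

lemma VV0 (u : Pt d → ℝ) (w) : 0 ≤ VV u w := Finset.sum_nonneg fun i _ => Finset.sum_nonneg fun j _ => abs_nonneg _

lemma le_VV (u : Pt d → ℝ) (w) (i j) : |Dxx i j u w| ≤ VV u w :=
  (Finset.single_le_sum (f := fun j => |Dxx i j u w|) (fun _ _ => abs_nonneg _) (Finset.mem_univ j)).trans
    (Finset.single_le_sum (f := fun i => ∑ j, |Dxx i j u w|) (fun _ _ => Finset.sum_nonneg fun _ _ => abs_nonneg _) (Finset.mem_univ i))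

variable {δ θ : ℝ} {a : Pt d → Matrix (Fin d) (Fin d) ℝ} {u : Pt d → ℝ}

lemma CinfC.VVc (hu : CinfC u) : Continuous (VV u) :=
  continuous_finsetSum _ fun i _ => continuous_finsetSum _ fun j _ => (hu.dxx i j).1.continuous.abs

lemma Cf.ma (H : Cf δ θ a) (i j) : Measurable fun z => a z i j := (measurable_pi_apply j).comp ((measurable_pi_apply i).comp H.m)

lemma Cf.mf (H : Cf δ θ a) (hu : CinfC u) : Measurable (ff a u) :=
  hu.dt.1.continuous.measurable.add (Finset.measurable_fun_sum _ fun i _ => Finset.measurable_fun_sum _ fun j _ => (H.ma i j).mul (hu.dxx i j).1.continuous.measurable)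

lemma mnorm_le (m : Fin d → Fin d → ℝ) : mnorm m ≤ ∑ i, ∑ j, |m i j| := by
  have h0 : 0 ≤ ∑ i, ∑ j, |m i j| := Finset.sum_nonneg fun i _ => Finset.sum_nonneg fun j _ => abs_nonneg _
  unfold mnorm
  rw [← Fintype.sum_prod_type' (f := fun i j => m i j ^ 2), ← Fintype.sum_prod_type' (f := fun i j => |m i j|)] at *
  refine Real.sqrt_le_iff.2 ⟨h0, ?_⟩
  have := Finset.sum_sq_le_sq_sum_of_nonneg (s := Finset.univ) (f := fun x : Fin d × Fin d => |m x.1 x.2|) (fun _ _ => abs_nonneg _)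
  simpa using this

lemma le_mnorm (m : Fin d → Fin d → ℝ) (i j) : |m i j| ≤ mnorm m := by
  unfold mnorm
  refine Real.abs_le_sqrt ?_
  exact (Finset.single_le_sum (f := fun j => m i j ^ 2) (fun _ _ => sq_nonneg _) (Finset.mem_univ j)).trans
    (Finset.single_le_sum (f := fun i => ∑ j, m i j ^ 2) (fun _ _ => Finset.sum_nonneg fun _ _ => sq_nonneg _) (Finset.mem_univ i))

lemma Cf.bm (H : Cf δ θ a) {R : ℝ} (hR : 0 < R) (x : Spc d) : Bm δ (aT a R x) := by
  refine ⟨H.pos, H.le, fun i j => ?_, fun s => ?_⟩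
  · have h : StronglyMeasurable fun s : ℝ => ∫ y in ball x R, a (s, y) i j := (H.ma i j).stronglyMeasurable.integral_prod_right
    have : (fun s => aT a R x s i j) = fun s => (volume.real (ball x R))⁻¹ * ∫ y in ball x R, a (s, y) i j := by
      funext s; exact setAverage_eq _ _ _
    rw [this]
    exact h.measurable.const_mul _
  · haveI : NeZero (volume.restrict (ball x R)) := ⟨by
      rw [Ne, Measure.restrict_eq_zero]; exact (measure_ball_pos _ _ hR).ne'⟩
    set ν := ((volume.restrict (ball x R)) univ)⁻¹ • volume.restrict (ball x R) with hν
    haveI : IsFiniteMeasure (volume.restrict (ball x R)) := ⟨by rw [Measure.restrict_apply_univ]; exact measure_ball_lt_top⟩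
    haveI : IsProbabilityMeasure ν := inferInstance
    have hA : ∀ i j, aT a R x s i j = ∫ y, a (s, y) i j ∂ν := fun i j => rfl
    have hI : ∀ i j, Integrable (fun y => a (s, y) i j) ν := fun i j =>
      Integrable.of_bound ((H.ma i j).comp (by fun_prop : Measurable fun y : Spc d => (s, y))).aestronglyMeasurable δ⁻¹ (of_forall fun y => (H.S _).ent H.pos i j)
    refine ⟨?_, fun ξ => ?_⟩
    · ext i j
      rw [Matrix.transpose_apply, hA, hA]
      refine integral_congr_ae (of_forall fun y => ?_)
      exact (H.S (s, y)).1.apply i j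
    · have e : ∑ i, ∑ j, aT a R x s i j * ξ i * ξ j = ∫ y, ∑ i, ∑ j, a (s, y) i j * ξ i * ξ j ∂ν := by
        rw [integral_finsetSum _ fun i _ => integrable_finsetSum _ fun j _ => ((hI i j).mul_const _).mul_const _]
        refine Finset.sum_congr rfl fun i _ => ?_
        rw [integral_finsetSum _ fun j _ => ((hI i j).mul_const _).mul_const _]
        refine Finset.sum_congr rfl fun j _ => ?_
        rw [integral_mul_const, integral_mul_const, hA]
      have hi : Integrable (fun y => ∑ i, ∑ j, a (s, y) i j * ξ i * ξ j) ν := integrable_finsetSum _ fun i _ => integrable_finsetSum _ fun j _ => ((hI i j).mul_const _).mul_const _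
      rw [e]
      constructor
      · have := integral_mono (integrable_const (δ * ∑ i, ξ i ^ 2)) hi fun y => ((H.S (s, y)).2 ξ).1
        simpa using this
      · have := integral_mono hi (integrable_const (δ⁻¹ * ∑ i, ξ i ^ 2)) fun y => ((H.S (s, y)).2 ξ).2
        simpa using this

def oo (a : Pt d → Matrix (Fin d) (Fin d) ℝ) (R : ℝ) (x : Spc d) (z : Pt d) : ℝ := mnorm (fun i j => a z i j - aTilde a R x z.1 i j)

lemma Cf.om (H : Cf δ θ a) {R : ℝ} (hR : 0 < R) (x : Spc d) : Measurable (oo a R x) := by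
  refine (Finset.measurable_fun_sum _ fun i _ => Finset.measurable_fun_sum _ fun j _ => ?_).sqrt
  exact ((H.ma i j).sub (((H.bm hR x).m i j).comp measurable_fst)).pow_const 2

lemma Cf.ob (H : Cf δ θ a) {R : ℝ} (hR : 0 < R) (x : Spc d) (z) : oo a R x z ≤ 2 * d^2 * δ⁻¹ := by
  refine (mnorm_le _).trans ?_
  calc _ ≤ ∑ i : Fin d, ∑ j : Fin d, 2 * δ⁻¹ := by
        refine Finset.sum_le_sum fun i _ => Finset.sum_le_sum fun j _ => ?_
        refine (abs_sub _ _).trans ?_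
        have h1 := (H.S z).ent H.pos i j
        have h2 : |aTilde a R x z.1 i j| ≤ δ⁻¹ := ((H.bm hR x).S z.1).ent H.pos i j
        linarith
    _ = _ := by simp; ring

lemma Cf.fb (H : Cf δ θ a) {R : ℝ} (hR : 0 < R) (x : Spc d) (z) : |ft (aT a R x) u z| ≤ |ff a u z| + oo a R x z * VV u z := by
  have e : ft (aT a R x) u z = ff a u z + ∑ i, ∑ j, (aTilde a R x z.1 i j - a z i j) * Dxx i j u z := by
    simp only [ft, ff, sub_mul, Finset.sum_sub_distrib, aT, Matrix.of_apply]; ring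
  rw [e]
  refine (abs_add_le _ _).trans (add_le_add le_rfl ?_)
  unfold VV
  rw [Finset.mul_sum]
  refine (Finset.abs_sum_le_sum_abs _ _).trans (Finset.sum_le_sum fun i _ => ?_)
  rw [Finset.mul_sum]
  refine (Finset.abs_sum_le_sum_abs _ _).trans (Finset.sum_le_sum fun j _ => ?_)
  rw [abs_mul, abs_sub_comm]
  exact mul_le_mul_of_nonneg_right (le_mnorm (fun i j => a z i j - aTilde a R x z.1 i j) i j) (abs_nonneg _)

def cy (z : Pt d) (R : ℝ) : Set (Pt d) := cyl d R (z.1 - R^2/2) z.2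

lemma mcy (z : Pt d) (R : ℝ) : MeasurableSet (cy z R) := measurableSet_Ioo.prod measurableSet_ball

lemma cy_bx {z : Pt d} {R : ℝ} (hR : 0 < R) : cy z R ⊆ bx z R := by
  rintro w ⟨h1, h2⟩
  rw [mem_Ioo] at h1
  rw [mem_ball, dist_eq_norm] at h2
  refine ⟨abs_le.2 ⟨by nlinarith, by nlinarith⟩, fun i => ?_⟩
  have := PiLp.norm_apply_le (w.2 - z.2) i
  rw [Real.norm_eq_abs] at this
  exact this.trans h2.le

lemma cy_far {z w : Pt d} {R : ℝ} (hR : 0 < R) (h : w ∉ cy z R) : R/2 ≤ prho (w - z) := by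
  have n1 := norm_nonneg (w.2 - z.2)
  have n2 := Real.sqrt_nonneg |w.1 - z.1|
  show R/2 ≤ ‖w.2 - z.2‖ + √|w.1 - z.1|
  by_cases h2 : ‖w.2 - z.2‖ < R
  · have h3 : R^2/2 ≤ |w.1 - z.1| := by
      by_contra hc
      have := abs_lt.1 (not_le.1 hc)
      exact h ⟨⟨by linarith [this.1], by linarith [this.2]⟩, by rwa [mem_ball, dist_eq_norm]⟩
    have : R/2 ≤ √|w.1 - z.1| := Real.le_sqrt_of_sq_le (by nlinarith)
    linarith
  · linarith

lemma Cf.near (H : Cf δ θ a) (hd : 1 ≤ d) (hu : CinfC u) {r r' : ℝ} (hr : r'.HolderConjugate r) {z y : Pt d} {R : ℝ} (hR : 0 < R) (hy : y ∈ bx z R) :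
    ∫⁻ w in cy z R, ofReal |ft (aT a R z.2) u w| ≤ ofReal ((24 * R)^(d+2)) * (MM hd (fun w => ofReal |ff a u w|) y
      + (ofReal (2 * d^2 * δ⁻¹) ^ (r' - 1) * (ofReal θ * Fintype.card (Bool × (Fin d → Bool)))) ^ (1/r') * (MM hd (fun w => ofReal (VV u w) ^ r) y)^(1/r)) := by
  set T := ofReal ((24 * R)^(d+2)) with hT
  have hT0 : T ≠ 0 := (ENNReal.ofReal_pos.2 (by positivity)).ne'
  have hTt : T ≠ ⊤ := ENNReal.ofReal_ne_top
  set o : Pt d → ENNReal := fun w => ofReal (oo a R z.2 w) with ho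
  have mo : Measurable o := (H.om hR z.2).ennreal_ofReal
  have mV : Measurable fun w => ofReal (VV u w) := hu.VVc.measurable.ennreal_ofReal
  have hb : ∀ g : Pt d → ENNReal, ∫⁻ w in cy z R, g w ≤ T * MM hd g y := fun g => (lintegral_mono_set (cy_bx hR)).trans (MM_box hd z hR g hy)
  have hoo : ∫⁻ w in cy z R, o w ≤ ofReal θ * (T * Fintype.card (Bool × (Fin d → Bool))) := by
    have h1 : aSharpCyl a R (z.1 - R^2/2) z.2 ≤ ofReal θ :=
      le_trans (le_iSup₂_of_le R hR (le_iSup₂_of_le (f := fun t₀ x₀ => aSharpCyl a R t₀ x₀) (z.1 - R^2/2) z.2 le_rfl)) H.sh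
    have h2 := hb fun _ => 1
    rw [setLIntegral_one, MM_one] at h2
    have h3 : volume (cy z R) ≠ 0 := by
      refine ((isOpen_Ioo.prod isOpen_ball).measure_pos volume ⟨(z.1, z.2), ?_, mem_ball_self hR⟩).ne'
      constructor <;> nlinarith
    have h4 : volume (cy z R) ≠ ⊤ := ne_top_of_le_ne_top (by finiteness) h2
    calc _ = volume (cy z R) * aSharpCyl a R (z.1 - R^2/2) z.2 := by
          show _ = volume (cy z R) * ((volume (cy z R))⁻¹ * ∫⁻ w in cy z R, o w)
          rw [← mul_assoc, ENNReal.mul_inv_cancel h3 h4, one_mul]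
      _ ≤ _ := by rw [mul_comm]; exact mul_le_mul' h1 h2
  have h0 := hr.pos
  have hor : ∫⁻ w in cy z R, o w ^ r' ≤ ofReal (2 * d^2 * δ⁻¹) ^ (r' - 1) * (ofReal θ * (T * Fintype.card (Bool × (Fin d → Bool)))) := by
    refine le_trans ?_ (mul_le_mul' le_rfl hoo)
    rw [← lintegral_const_mul _ mo]
    refine lintegral_mono fun w => ?_
    show o w ^ r' ≤ _
    rw [show r' = (r' - 1) + 1 by ring, ENNReal.rpow_add_of_nonneg _ _ (by linarith [hr.lt]) zero_le_one, ENNReal.rpow_one, add_sub_cancel_right]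
    exact mul_le_mul' (ENNReal.rpow_le_rpow (ENNReal.ofReal_le_ofReal (H.ob hR _ _)) (by linarith [hr.lt])) le_rfl
  calc _ ≤ ∫⁻ w in cy z R, (ofReal |ff a u w| + o w * ofReal (VV u w)) := by
        refine lintegral_mono fun w => ?_
        rw [ho, ← ENNReal.ofReal_mul' (VV0 u w), ← ENNReal.ofReal_add (abs_nonneg _) (mul_nonneg (show 0 ≤ oo a R z.2 w from Real.sqrt_nonneg _) (VV0 u w))]
        exact ENNReal.ofReal_le_ofReal (H.fb hR _ _)
    _ = (∫⁻ w in cy z R, ofReal |ff a u w|) + ∫⁻ w in cy z R, o w * ofReal (VV u w) := lintegral_add_right _ (mo.mul mV)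
    _ ≤ T * MM hd (fun w => ofReal |ff a u w|) y + (ofReal (2 * d^2 * δ⁻¹) ^ (r' - 1) * (ofReal θ * (T * Fintype.card (Bool × (Fin d → Bool)))))^(1/r') * (T * MM hd (fun w => ofReal (VV u w) ^ r) y)^(1/r) := by
        refine add_le_add (hb _) ((ENNReal.lintegral_mul_le_Lp_mul_Lq _ hr mo.aemeasurable mV.aemeasurable).trans ?_)
        exact mul_le_mul' (ENNReal.rpow_le_rpow hor (by positivity)) (ENNReal.rpow_le_rpow (hb _) (by have := hr.symm.pos; positivity))
    _ = _ := by
        rw [mul_add]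
        congr 1
        have e1 : (1/r':ℝ) + 1/r = 1 := by rw [one_div, one_div]; exact hr.inv_add_inv_eq_one
        have n1 : 0 ≤ 1/r' := by positivity
        have n2 : 0 ≤ 1/r := by have := hr.symm.pos; positivity
        set B := ofReal (2 * d^2 * δ⁻¹) ^ (r' - 1)
        set N := (Fintype.card (Bool × (Fin d → Bool)) : ENNReal)
        rw [show B * (ofReal θ * (T * N)) = T * (B * (ofReal θ * N)) by ring, ENNReal.mul_rpow_of_nonneg T _ n1, ENNReal.mul_rpow_of_nonneg T _ n2]
        have e2 : T ^ (1/r') * T ^ (1/r) = T := by rw [← ENNReal.rpow_add _ _ hT0 hTt, e1, ENNReal.rpow_one]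
        calc _ = (T ^ (1/r') * T ^ (1/r)) * ((B * (ofReal θ * N)) ^ (1/r') * (MM hd (fun w => ofReal (VV u w) ^ r) y)^(1/r)) := by ring
          _ = _ := by rw [e2]

lemma Cf.far (H : Cf δ θ a) (hd : 1 ≤ d) (hu : CinfC u) {z y : Pt d} {R : ℝ} (hR : 0 < R) (hy : y ∈ bx z (R/2)) :
    ∫⁻ w in {w | R/2 ≤ prho (w - z)}, ofReal ((prho (w - z))⁻¹^(d+3)) * ofReal |ft (aT a R z.2) u w| ≤
     ofReal (2 * 48^(d+2) * (R/2)⁻¹) * (MM hd (fun w => ofReal |ff a u w|) y + ofReal (2 * d^2 * δ⁻¹) * MM hd (fun w => ofReal (VV u w)) y) := by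
  have mf : Measurable fun w => ofReal |ff a u w| := by have := H.mf hu; fun_prop
  have mV : Measurable fun w => ofReal (VV u w) := hu.VVc.measurable.ennreal_ofReal
  have mr : Measurable fun w : Pt d => ofReal ((prho (w - z))⁻¹^(d+3)) := by
    have : Measurable fun w : Pt d => prho (w - z) := mprho.comp (by fun_prop)
    fun_prop
  have h1 := ann hd mf z (half_pos hR) hy
  have h2 := ann hd mV z (half_pos hR) hy
  set S := {w : Pt d | R/2 ≤ prho (w - z)}
  calc _ ≤ ∫⁻ w in S, (ofReal ((prho (w - z))⁻¹^(d+3)) * ofReal |ff a u w| + ofReal (2 * d^2 * δ⁻¹) * (ofReal ((prho (w - z))⁻¹^(d+3)) * ofReal (VV u w))) := by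
        refine lintegral_mono fun w => ?_
        show _ ≤ ofReal ((prho (w - z))⁻¹^(d+3)) * ofReal |ff a u w| + ofReal (2 * d^2 * δ⁻¹) * (ofReal ((prho (w - z))⁻¹^(d+3)) * ofReal (VV u w))
        rw [mul_left_comm, ← mul_add]
        refine mul_le_mul' le_rfl ?_
        rw [← ENNReal.ofReal_mul' (VV0 u w), ← ENNReal.ofReal_add (abs_nonneg _) (mul_nonneg (by have := H.pos; positivity) (VV0 u w))]
        exact ENNReal.ofReal_le_ofReal ((H.fb hR z.2 w).trans (add_le_add le_rfl (mul_le_mul_of_nonneg_right (H.ob hR _ _) (VV0 u w))))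
    _ = (∫⁻ w in S, ofReal ((prho (w - z))⁻¹^(d+3)) * ofReal |ff a u w|) + ofReal (2 * d^2 * δ⁻¹) * ∫⁻ w in S, (ofReal ((prho (w - z))⁻¹^(d+3)) * ofReal (VV u w)) := by
        rw [lintegral_add_left (mr.fun_mul mf), lintegral_const_mul _ (mr.fun_mul mV)]
    _ ≤ _ := by
        rw [mul_add, mul_left_comm]
        exact add_le_add h1 (mul_le_mul' le_rfl h2)
end

section
variable {d : ℕ} {δ θ : ℝ} {a : Pt d → Matrix (Fin d) (Fin d) ℝ} {u : Pt d → ℝ}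

lemma slack (hd : 1 ≤ d) (hu : CinfC u) (hV : ∃ z, VV u z ≠ 0) (z0 : Pt d) {l : ℝ} (hl : 0 < l) : ∃ m : ENNReal, m ≠ 0 ∧ ∀ y ∈ bx z0 l, m ≤ MM hd (fun w => ofReal (VV u w)) y := by
  have mV : Measurable fun w => ofReal (VV u w) := hu.VVc.measurable.ennreal_ofReal
  by_cases h : ∀ n : ℕ, ∫⁻ w in bx z0 (n + l), ofReal (VV u w) = 0
  · exfalso
    have h1 : ⋃ n : ℕ, bx z0 (n + l) = univ := by
      refine eq_univ_of_forall fun w => mem_iUnion.2 ?_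
      obtain ⟨n, hn⟩ := exists_nat_ge (prho (w - z0))
      exact ⟨n, prho_bx (by linarith)⟩
    have h2 : ∫⁻ w, ofReal (VV u w) = 0 := by
      rw [← setLIntegral_univ, ← h1]
      refine le_antisymm ((lintegral_iUnion_le _ _).trans ?_) zero_le
      simp [h]
    rw [lintegral_eq_zero_iff mV] at h2
    have h3 : VV u = fun _ => 0 := by
      refine (hu.VVc.ae_eq_iff_eq volume continuous_const).1 ?_
      filter_upwards [h2] with w hw
      exact le_antisymm (ENNReal.ofReal_eq_zero.1 hw) (VV0 u w)
    obtain ⟨z, hz⟩ := hV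
    exact hz (congrFun h3 z)
  · push Not at h
    obtain ⟨n, hn⟩ := h
    have hR : 0 < n + l := by positivity
    refine ⟨(∫⁻ w in bx z0 (n + l), ofReal (VV u w)) / ofReal ((24 * (n + l))^(d+2)), (ENNReal.div_pos hn ENNReal.ofReal_ne_top).ne', fun y hy => ?_⟩
    refine ENNReal.div_le_of_le_mul' ?_
    exact MM_box hd z0 hR _ (bx_mono hl.le (by simp) hy)

lemma CinfC.fine (hu : CinfC u) (hd : 1 ≤ d) : ∀ ε > 0, ∃ K : ℤ, ∀ x y, (gP d hd default).c K x = (gP d hd default).c K y → |u x - u y| ≤ ε := by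
  intro ε hε
  have huc := hu.2.uniformContinuous_of_continuous hu.1.continuous
  obtain ⟨η, hη, h⟩ := Metric.uniformContinuous_iff.1 huc ε hε
  have hd1 : (1:ℝ) ≤ d := by exact_mod_cast hd
  obtain ⟨n, hn⟩ := exists_pow_lt_of_lt_one (show 0 < η / d by positivity) (show (1/4:ℝ) < 1 by norm_num)
  refine ⟨n, fun x y hxy => ?_⟩
  have h1 := (gP_close hd hxy).1
  have h2 := gP_close' hd hxy
  have e : ((4:ℝ)^(n:ℤ))⁻¹ = (1/4)^n := by simp
  rw [e] at h1 h2
  have h3 : (1/4:ℝ)^n ≤ 1 := pow_le_one₀ (by norm_num) (by norm_num)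
  have h4 : (0:ℝ) < (1/4:ℝ)^n := by positivity
  rw [lt_div_iff₀ (by positivity)] at hn
  have := h (a := x) (b := y) (by
    rw [Prod.dist_eq, Real.dist_eq, dist_eq_norm]
    exact max_lt (by nlinarith) (by nlinarith))
  rw [Real.dist_eq] at this
  exact this.le

def GG (hd : 1 ≤ d) (r r' θ κ : ℝ) (P C1 : ENNReal) (a : Pt d → Matrix (Fin d) (Fin d) ℝ) (u : Pt d → ℝ) (y : Pt d) : ENNReal :=
  P * MM hd (fun w => ofReal |ff a u w|) y + P * ofReal θ ^ (1/r') * (MM hd (fun w => ofReal (VV u w) ^ r) y)^(1/r) + C1 * ofReal κ⁻¹ * MM hd (fun w => ofReal (VV u w)) y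

set_option maxHeartbeats 1000000 in
lemma key (hd : 1 ≤ d) (hδ : 0 < δ) (hδ1 : δ ≤ 1) {r r' : ℝ} (hr : r'.HolderConjugate r) (i j : Fin d) : ∃ C1 : ENNReal, C1 ≠ ⊤ ∧ ∀ κ : ℝ, 24 * d ≤ κ → ∃ P : ENNReal, P ≠ ⊤ ∧
    ∀ θ a u, Cf δ θ a → CinfC u → ∀ g : Pt d → ENNReal, Measurable g → ∫⁻ z, ofReal |Dxx i j u z| * g z ≤ 4 * ∫⁻ z, GG hd r r' θ κ P C1 a u z * (gP d hd default).M g z := by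
  have hd1 : (1:ℝ) ≤ d := by exact_mod_cast hd
  obtain ⟨A, hA, hK⟩ := Kn_KR (d := d) (c := δ/40) (by positivity) (by linarith) [i, j] rfl
  obtain ⟨Cw, hCw, ho⟩ := osc1 hd hA
  have hr0 := hr.pos
  have hr1 := hr.lt
  set b : ENNReal := ofReal (2 * d^2 * δ⁻¹) with hb
  set N : ENNReal := (Fintype.card (Bool × (Fin d → Bool)) : ENNReal) with hN
  set BN : ENNReal := (b ^ (r' - 1) * N) ^ (1/r') with hBN
  have hBNt : BN ≠ ⊤ := by
    have : b ^ (r' - 1) ≠ ⊤ := ENNReal.rpow_ne_top_of_nonneg (by linarith) ENNReal.ofReal_ne_top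
    exact ENNReal.rpow_ne_top_of_nonneg (by positivity) (ENNReal.mul_ne_top this (by rw [hN]; finiteness))
  refine ⟨Cw * ofReal (4 * 48^(d+2)) * b + 1, by finiteness, fun κ hκ => ?_⟩
  have hκ0 : 0 < κ := by linarith
  set X := Cw * ofReal ((24 * κ)^(d+2)) with hX
  set Y := Cw * ofReal (4 * 48^(d+2)) with hY
  refine ⟨X * (1 + BN) + Y * ofReal κ⁻¹, by finiteness, fun θ a u H hu g hg => ?_⟩
  by_cases hV : ∃ z, VV u z ≠ 0
  swap
  · push Not at hV
    have : ∀ z, Dxx i j u z = 0 := fun z => abs_eq_zero.1 (le_antisymm ((le_VV u z i j).trans (hV z).le) (abs_nonneg _))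
    simp [this]
  set G := gP d hd default with hG
  set P := X * (1 + BN) + Y * ofReal κ⁻¹ with hP
  set f : Pt d → ENNReal := fun w => ofReal |ff a u w| with hf
  set V : Pt d → ENNReal := fun w => ofReal (VV u w) with hVd
  have hU := hu.dxx i j
  have mG : Measurable (GG hd r r' θ κ P (Y * b + 1) a u) := by
    unfold GG
    have m1 := mMM hd f
    have m2 := mMM hd V
    have m3 := mMM hd fun w => V w ^ r
    exact ((m1.const_mul _).add ((m3.pow_const _).const_mul _)).add (m2.const_mul _)
  refine G.sharp hU.1.continuous.measurable mG hg ?_ (hU.fine hd) ?_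
  swap
  · exact (lt_of_le_of_lt (measure_mono (μ := volume) (subset_tsupport (Dxx i j u))) hU.2.isCompact.measure_lt_top).ne
  intro k z0
  set l := ((4:ℝ)^k)⁻¹ with hl
  have hl0 : 0 < l := by rw [hl]; positivity
  have hR : 0 < κ * l := by positivity
  have hQ : ∀ y ∈ G.Q k z0, y ∈ bx z0 l := fun y hy => gP_close hd hy
  obtain ⟨m, hm0, hm⟩ := slack hd hu hV z0 hl0
  set m1 := min m 1 with hm1
  have m1t : m1 ≠ ⊤ := ne_top_of_le_ne_top ENNReal.one_ne_top (min_le_right _ _)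
  have m10 : m1 ≠ 0 := (lt_min (pos_iff_ne_zero.2 hm0) one_pos).ne'
  have hb' := H.bm hR z0.2
  obtain ⟨c, hc⟩ := ho (fun n => KR [i, j] (AA (aT a (κ * l) z0.2)) (1 / ((n:ℝ) + 1))) (fun n => hK _ hb'.ac _ (by positivity)) (Dxx i j u) (ft (aT a (κ * l) z0.2) u)
    hU.1.continuous.measurable (hb'.fm hu) (hb'.fi hu) (fun z => hb'.lim hu i j z (fun n => by positivity) tendsto_one_div_add_atTop_nhds_zero_nat) k z0 (κ * l)
    (by rw [← hl]; exact mul_le_mul_of_nonneg_right hκ hl0.le) (cy z0 (κ * l)) (mcy _ _) (fun w hw => cy_far hR hw) (κ⁻¹ * m1.toReal) (mul_pos (by positivity) (ENNReal.toReal_pos m10 m1t))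
  refine ⟨c, _, fun y hy => ?_, hc⟩
  have hyl := hQ y hy
  have hy1 : y ∈ bx z0 (κ * l) := bx_mono hl0.le (by nlinarith) hyl
  have hy2 : y ∈ bx z0 (κ * l / 2) := bx_mono hl0.le (by nlinarith) hyl
  have n1 := H.near hd hu hr hR hy1
  have n2 := H.far hd hu hR hy2
  unfold GG
  rw [← hl]
  set Mf := MM hd f y with hMf
  set MV := MM hd V y with hMV
  set Mr := MM hd (fun w => V w ^ r) y ^ (1/r) with hMr
  set I1 := ∫⁻ w in cy z0 (κ * l), ofReal |ft (aT a (κ * l) z0.2) u w|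
  set I2 := ∫⁻ w in {w | κ * l/2 ≤ prho (w - z0)}, ofReal ((prho (w - z0))⁻¹^(d+3)) * ofReal |ft (aT a (κ * l) z0.2) u w|
  have t1 : ofReal (κ⁻¹ * m1.toReal) ≤ ofReal κ⁻¹ * MV := by
    rw [ENNReal.ofReal_mul (by positivity), ENNReal.ofReal_toReal m1t]
    exact mul_le_mul' le_rfl ((min_le_left _ _).trans (hm y hyl))
  have t2 : (G.v k)⁻¹ * I1 ≤ ofReal ((24 * κ)^(d+2)) * (Mf + BN * ofReal θ ^ (1/r') * Mr) := by
    have e : (G.v k)⁻¹ * ofReal ((24 * (κ * l))^(d+2)) = ofReal ((24 * κ)^(d+2)) := by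
      rw [hG, gP_v, ← hl, ← ENNReal.ofReal_inv_of_pos (by positivity), ← ENNReal.ofReal_mul (by positivity), ← mul_assoc 24, mul_pow _ l]
      congr 1
      field_simp
    have e2 : (b ^ (r' - 1) * (ofReal θ * N)) ^ (1/r') = BN * ofReal θ ^ (1/r') := by
      rw [hBN, ← ENNReal.mul_rpow_of_nonneg _ _ (by positivity)]
      congr 1; ring
    rw [e2] at n1
    refine (mul_le_mul' le_rfl n1).trans (le_of_eq ?_)
    rw [← mul_assoc, e]
  have t3 : ofReal l * I2 ≤ ofReal (4 * 48^(d+2)) * ofReal κ⁻¹ * (Mf + b * MV) := by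
    refine (mul_le_mul' le_rfl n2).trans (le_of_eq ?_)
    rw [← mul_assoc, ← ENNReal.ofReal_mul (by positivity), ← ENNReal.ofReal_mul (by positivity)]
    congr 2
    field_simp
    ring
  set T := ofReal θ ^ (1/r')
  set kk := ofReal κ⁻¹
  calc _ ≤ kk * MV + Cw * (ofReal ((24 * κ)^(d+2)) * (Mf + BN * T * Mr)) + Cw * (ofReal (4 * 48^(d+2)) * kk * (Mf + b * MV)) := by
        gcongr
    _ = kk * MV + X * Mf + X * BN * T * Mr + Y * kk * Mf + Y * b * kk * MV := by rw [hX, hY]; ring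
    _ ≤ kk * MV + X * Mf + X * BN * T * Mr + Y * kk * Mf + Y * b * kk * MV + (X * BN * Mf + (X + Y * kk) * T * Mr) := le_self_add
    _ = _ := by rw [hP]; ring
end

section
variable {d : ℕ} {δ θ : ℝ} {a : Pt d → Matrix (Fin d) (Fin d) ℝ} {u : Pt d → ℝ} {p q : ℝ}

def nr (q p : ℝ) (g : Pt d → ℝ) : ENNReal := NN q p fun z => ofReal |g z|

structure Bs (g : Pt d → ℝ) : Prop where
  m : Measurable g
  b : ∃ R C : ℝ, 0 ≤ C ∧ ∀ z, |g z| ≤ C ∧ (R < |z.1| ∨ R < ‖z.2‖ → g z = 0)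

lemma CinfC.bs (hu : CinfC u) : Bs u := by
  obtain ⟨R, _, h⟩ := hu.box
  obtain ⟨C, h0, h1⟩ := hu.bd
  exact ⟨hu.1.continuous.measurable, R, C, h0, fun z => ⟨h1 z, h z⟩⟩

lemma Bs.add {f g : Pt d → ℝ} (hf : Bs f) (hg : Bs g) : Bs fun z => f z + g z := by
  obtain ⟨R1, C1, h1, h2⟩ := hf.b
  obtain ⟨R2, C2, h3, h4⟩ := hg.b
  refine ⟨hf.m.add hg.m, max R1 R2, C1 + C2, by positivity, fun z => ⟨(abs_add_le _ _).trans (add_le_add (h2 z).1 (h4 z).1), fun h => ?_⟩⟩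
  rw [(h2 z).2 (h.imp (le_max_left _ _).trans_lt (le_max_left _ _).trans_lt), (h4 z).2 (h.imp (le_max_right _ _).trans_lt (le_max_right _ _).trans_lt), add_zero]

lemma Bs.sum {ι : Type} (s : Finset ι) {f : ι → Pt d → ℝ} (h : ∀ i, Bs (f i)) : Bs fun z => ∑ i ∈ s, f i z := by
  classical
  induction s using Finset.induction_on with
  | empty => exact ⟨by simp, 0, 0, le_rfl, by simp⟩
  | insert i s hi ih =>
    simp_rw [Finset.sum_insert hi]
    exact (h i).add ih

lemma Bs.mono {f g : Pt d → ℝ} (hg : Bs g) (hf : Measurable f) {c : ℝ} (hc : 0 ≤ c) (h : ∀ z, |f z| ≤ c * |g z|) : Bs f := by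
  obtain ⟨R, C, h1, h2⟩ := hg.b
  refine ⟨hf, R, c * C, by positivity, fun z => ⟨(h z).trans (mul_le_mul_of_nonneg_left (h2 z).1 hc), fun hz => ?_⟩⟩
  have := h z
  rw [(h2 z).2 hz] at this
  simpa using this

lemma Bs.nn {g : Pt d → ℝ} (hg : Bs g) (hq : 0 < q) (hp : 0 < p) : nr q p g ≠ ⊤ ∧ mixedNorm q p g = (nr q p g).toReal ^ (1/p) := by
  obtain ⟨R, C, h0, h⟩ := hg.b
  have mg : Measurable fun z => ofReal |g z| := by have := hg.m; fun_prop
  set I : Spc d → ENNReal := fun x => ∫⁻ t, ofReal |g (t, x)| ^ q with hI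
  have mI : Measurable I := mNN mg q
  set B : ENNReal := ofReal C ^ q * volume (Icc (-R) R) with hB
  have hBt : B ≠ ⊤ := ENNReal.mul_ne_top (ENNReal.rpow_ne_top_of_nonneg hq.le ENNReal.ofReal_ne_top) (by simp)
  have hIB : ∀ x, I x ≤ B := by
    intro x
    rw [hB, ← setLIntegral_const, ← lintegral_indicator measurableSet_Icc]
    refine lintegral_mono fun t => ?_
    by_cases ht : t ∈ Icc (-R) R
    · rw [indicator_of_mem ht]
      exact ENNReal.rpow_le_rpow (ENNReal.ofReal_le_ofReal (h _).1) hq.le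
    · have : g (t, x) = 0 := (h (t, x)).2 (Or.inl (by
        by_contra hc
        exact ht (abs_le.1 (not_lt.1 hc))))
      simp [this, hq]
  have hI0 : ∀ x, x ∉ closedBall (0 : Spc d) R → I x = 0 := by
    intro x hx
    have : ∀ t, g (t, x) = 0 := fun t => (h (t, x)).2 (Or.inr (by simpa using hx))
    simp [hI, this, hq]
  have hpq : 0 < p / q := by positivity
  have hN : nr q p g ≠ ⊤ := by
    have : nr q p g ≤ B ^ (p/q) * volume (closedBall (0 : Spc d) R) := by
      rw [← setLIntegral_const, ← lintegral_indicator measurableSet_closedBall]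
      refine lintegral_mono fun x => ?_
      show I x ^ (p/q) ≤ _
      by_cases hx : x ∈ closedBall (0 : Spc d) R
      · rw [indicator_of_mem hx]
        exact ENNReal.rpow_le_rpow (hIB x) hpq.le
      · rw [hI0 x hx, ENNReal.zero_rpow_of_pos hpq]; exact zero_le
    refine ne_top_of_le_ne_top (ENNReal.mul_ne_top (ENNReal.rpow_ne_top_of_nonneg hpq.le hBt) ?_) this
    exact measure_closedBall_lt_top.ne
  refine ⟨hN, ?_⟩
  unfold mixedNorm
  congr 1
  have e : ∀ x, (∫ t : ℝ, |g (t, x)| ^ q) ^ (p/q) = (I x ^ (p/q)).toReal := by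
    intro x
    have hm : Measurable fun t : ℝ => g (t, x) := hg.m.comp (by fun_prop)
    have hm2 : Measurable fun t : ℝ => |g (t, x)| ^ q := (continuous_abs.measurable.comp hm).pow_const q
    rw [← ENNReal.toReal_rpow, integral_eq_lintegral_of_nonneg_ae (of_forall fun t => by positivity) hm2.aestronglyMeasurable]
    simp only [hI, ENNReal.ofReal_rpow_of_nonneg (abs_nonneg _) hq.le]
  simp_rw [e]
  rw [integral_toReal (mI.pow_const _).aemeasurable]
  · rfl
  · exact of_forall fun x => (ENNReal.rpow_ne_top_of_nonneg hpq.le (ne_top_of_le_ne_top hBt (hIB x))).lt_top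

lemma nr_mono (hq : 0 < q) (hp : 0 < p) {f g : Pt d → ℝ} (h : ∀ z, |f z| ≤ |g z|) : nr q p f ≤ nr q p g :=
  NN_mono hq hp fun z => ENNReal.ofReal_le_ofReal (h z)

lemma est1 (hd : 1 ≤ d) (hδ : 0 < δ) (hδ1 : δ ≤ 1) (hq : 1 < q) (hp : 1 < p) {r r' : ℝ} (hr : r'.HolderConjugate r) (hrq : r < q) (hrp : r < p) (i j : Fin d) : ∃ C : ENNReal, C ≠ ⊤ ∧ ∀ κ : ℝ, 24 * d ≤ κ → ∃ P : ENNReal, P ≠ ⊤ ∧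
    ∀ θ a u, Cf δ θ a → CinfC u → nr q p (Dxx i j u) ≤ P * nr q p (ff a u) + (P * (ofReal θ ^ (1/r')) ^ p + C * ofReal κ⁻¹ ^ p) * nr q p (VV u) := by
  obtain ⟨C1, hC1, h⟩ := key hd hδ hδ1 hr i j
  obtain ⟨Cd, hCd, hdu⟩ := dual_NN hd hq hp default
  obtain ⟨Ca, hCa, hadd⟩ := NN_add (d := d) (q := q) (p := p) (by linarith) (by linarith)
  obtain ⟨Cm, hCm, hM⟩ := MM_NN hd hq hp
  have hr0 : 0 < r := hr.symm.pos
  obtain ⟨Cr, hCr, hMr⟩ := MM_NN (q := q/r) (p := p/r) hd ((one_lt_div hr0).2 hrq) ((one_lt_div hr0).2 hrp)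
  have hp0 : 0 < p := by linarith
  have hq0 : 0 < q := by linarith
  refine ⟨Cd * Ca * C1^p * Cm, by finiteness, fun κ hκ => ?_⟩
  obtain ⟨P, hP, h'⟩ := h κ hκ
  refine ⟨Cd * Ca * Ca * P^p * (Cm + Cr), by finiteness, fun θ a u H hu => ?_⟩
  have mf : Measurable fun w => ofReal |ff a u w| := by have := H.mf hu; fun_prop
  have mV : Measurable fun w => ofReal (VV u w) := hu.VVc.measurable.ennreal_ofReal
  set f : Pt d → ENNReal := fun w => ofReal |ff a u w| with hf
  set V : Pt d → ENNReal := fun w => ofReal (VV u w) with hVd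
  have hnV : nr q p (VV u) = NN q p V := by
    unfold nr
    simp_rw [abs_of_nonneg (VV0 u _), hVd]
  have m1 := mMM hd f
  have m2 := mMM hd V
  have m3 := (mMM hd fun w => V w ^ r).pow_const (1/r)
  set T := ofReal θ ^ (1/r')
  set kk := ofReal κ⁻¹
  have hU := hu.dxx i j
  have k1 := hdu (fun z => ofReal |Dxx i j u z|) (GG hd r r' θ κ P C1 a u) (by have := hU.1.continuous.measurable; fun_prop)
    (((m1.const_mul _).add (m3.const_mul _)).add (m2.const_mul _)) (hU.bs.nn hq0 hp0).1 (h' θ a u H hu)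
  have k2 : NN q p (GG hd r r' θ κ P C1 a u) ≤ Ca * (NN q p (fun z => P * MM hd f z + P * T * (MM hd (fun w => V w ^ r) z)^(1/r)) + NN q p (fun z => C1 * kk * MM hd V z)) :=
    hadd _ _ ((m1.const_mul _).add (m3.const_mul _)) (m2.const_mul _)
  have k3 : NN q p (fun z => P * MM hd f z + P * T * (MM hd (fun w => V w ^ r) z)^(1/r)) ≤ Ca * (P^p * (Cm * NN q p f) + (P * T)^p * (Cr * NN q p V)) := by
    refine (hadd _ _ (m1.const_mul _) (m3.const_mul _)).trans ?_
    rw [NN_smul hq0 hp0 _ m1, NN_smul hq0 hp0 _ m3, NN_rpow hr0 hq0]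
    have e : NN q p V = NN (q/r) (p/r) fun w => V w ^ r := by
      rw [← NN_rpow hr0 hq0]
      congr 1; funext w
      rw [← ENNReal.rpow_mul, mul_one_div_cancel hr0.ne', ENNReal.rpow_one]
    rw [e]
    gcongr
    · exact hM f mf
    · exact hMr _ (mV.pow_const r)
  have k4 : NN q p (fun z => C1 * kk * MM hd V z) ≤ (C1 * kk)^p * (Cm * NN q p V) := by
    rw [NN_smul hq0 hp0 _ m2]
    exact mul_le_mul' le_rfl (hM V mV)
  rw [hnV]
  show NN q p (fun z => ofReal |Dxx i j u z|) ≤ _ * NN q p f + _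
  calc _ ≤ Cd * (Ca * (Ca * (P^p * (Cm * NN q p f) + (P * T)^p * (Cr * NN q p V)) + (C1 * kk)^p * (Cm * NN q p V))) := by
        refine k1.trans (mul_le_mul' le_rfl (k2.trans (mul_le_mul' le_rfl (add_le_add k3 k4))))
    _ = Cd * Ca * Ca * P^p * Cm * NN q p f + (Cd * Ca * Ca * P^p * Cr * T^p + Cd * Ca * C1^p * Cm * kk^p) * NN q p V := by
        rw [ENNReal.mul_rpow_of_nonneg _ _ hp0.le, ENNReal.mul_rpow_of_nonneg _ _ hp0.le]; ring
    _ ≤ _ := by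
        gcongr
        · exact le_self_add
        · exact le_add_self

lemma sm {C : ENNReal} (hC : C ≠ ⊤) {s : ℝ} (hs : 0 < s) : ∃ x : ℝ, 0 < x ∧ C * ofReal x ^ s ≤ ofReal (1/4) := by
  set c : ℝ := 1 / (4 * (C.toReal + 1)) with hc
  have h0 := ENNReal.toReal_nonneg (a := C)
  have hc0 : 0 < c := by positivity
  refine ⟨c ^ (1/s), by positivity, ?_⟩
  rw [ENNReal.ofReal_rpow_of_pos (by positivity), ← Real.rpow_mul hc0.le, one_div_mul_cancel hs.ne', Real.rpow_one, ← ENNReal.ofReal_toReal hC, ← ENNReal.ofReal_mul h0]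
  refine ENNReal.ofReal_le_ofReal ?_
  rw [hc, mul_one_div, div_le_div_iff₀ (by positivity) (by norm_num)]
  linarith

lemma est2 (hd : 1 ≤ d) (hδ : 0 < δ) (hδ1 : δ ≤ 1) (hq : 1 < q) (hp : 1 < p) : ∃ θ : ℝ, 0 < θ ∧ ∃ C : ENNReal, C ≠ ⊤ ∧ ∀ a u, Cf (d := d) δ θ a → CinfC u → nr q p (VV u) ≤ C * nr q p (ff a u) := by
  have hmin : 1 < min q p := lt_min hq hp
  have h1 : 1 < (1 + min q p) / 2 := by linarith
  have hr := (Real.HolderConjugate.conjExponent h1).symm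
  set r := (1 + min q p) / 2 with hrd
  have hrm : r < min q p := by rw [hrd]; linarith
  set r' := Real.conjExponent r
  have hr'0 := hr.pos
  choose C hC h using est1 hd hδ hδ1 hq hp hr (hrm.trans_le (min_le_left _ _)) (hrm.trans_le (min_le_right _ _))
  have hp0 : 0 < p := by linarith
  have hq0 : 0 < q := by linarith
  obtain ⟨Cs, hCs, hsum⟩ := NN_sum (d := d) hq0 hp0 (Finset.univ : Finset (Fin d × Fin d))
  have hC2 : Cs * ∑ x : Fin d × Fin d, C x.1 x.2 ≠ ⊤ := ENNReal.mul_ne_top hCs (ENNReal.sum_ne_top.2 fun x _ => hC _ _)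
  obtain ⟨x, hx, hxC⟩ := sm hC2 hp0
  set κ : ℝ := max (24 * d) x⁻¹ with hκ
  have hkk : ofReal κ⁻¹ ≤ ofReal x := by
    refine ENNReal.ofReal_le_ofReal (inv_le_of_inv_le₀ hx (le_max_right _ _))
  choose P hP hE using fun i j => h i j κ (le_max_left _ _)
  set PP := Cs * ∑ x : Fin d × Fin d, P x.1 x.2 with hPP
  have hPt : PP ≠ ⊤ := ENNReal.mul_ne_top hCs (ENNReal.sum_ne_top.2 fun x _ => hP _ _)
  obtain ⟨θ, hθ, hθC⟩ := sm hPt (s := 1/r' * p) (by positivity)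
  refine ⟨θ, hθ, 2 * PP, by finiteness, fun a u H hu => ?_⟩
  have hVf : nr q p (VV u) ≠ ⊤ := by
    have : Bs (VV u) := Bs.sum _ fun i => Bs.sum _ fun j => (hu.dxx i j).bs.mono (hu.dxx i j).1.continuous.abs.measurable (c := 1) zero_le_one (fun z => by simp)
    exact (this.nn hq0 hp0).1
  have e1 : nr q p (VV u) ≤ Cs * ∑ x : Fin d × Fin d, nr q p (Dxx x.1 x.2 u) := by
    refine le_trans (le_of_eq ?_) (hsum (fun x z => ofReal |Dxx x.1 x.2 u z|) fun x => by have := (hu.dxx x.1 x.2).1.continuous.measurable; fun_prop)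
    unfold nr
    congr 1; funext z
    rw [abs_of_nonneg (VV0 u z), ← ENNReal.ofReal_sum_of_nonneg (fun _ _ => abs_nonneg _), Fintype.sum_prod_type]
    rfl
  set Nf := nr q p (ff a u)
  set NV := nr q p (VV u)
  set T := (ofReal θ ^ (1/r')) ^ p with hT
  set kk := ofReal κ⁻¹ ^ p with hk
  have e2 : NV ≤ PP * Nf + (PP * T + Cs * (∑ x : Fin d × Fin d, C x.1 x.2) * kk) * NV := by
    refine e1.trans ((mul_le_mul' le_rfl (Finset.sum_le_sum fun x _ => hE x.1 x.2 θ a u H hu)).trans (le_of_eq ?_))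
    rw [Finset.sum_add_distrib, ← Finset.sum_mul, ← Finset.sum_mul, Finset.sum_add_distrib, ← Finset.sum_mul, ← Finset.sum_mul, hPP]
    ring
  have e3 : PP * T + Cs * (∑ x : Fin d × Fin d, C x.1 x.2) * kk ≤ ofReal (1/4) + ofReal (1/4) := by
    refine add_le_add ?_ (le_trans ?_ hxC)
    · rw [hT, ← ENNReal.rpow_mul]; exact hθC
    · exact mul_le_mul' le_rfl (ENNReal.rpow_le_rpow hkk hp0.le)
  rw [← ENNReal.ofReal_add (by norm_num) (by norm_num)] at e3
  have e4 : NV ≤ PP * Nf + ofReal (1/4+1/4) * NV := e2.trans (add_le_add le_rfl (mul_le_mul' e3 le_rfl))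
  by_cases ht : PP * Nf = ⊤
  · rw [mul_assoc, ht]; simp
  rw [mul_assoc]
  obtain ⟨y, hy, hy'⟩ : ∃ y, 0 ≤ y ∧ PP * Nf = ofReal y := ⟨_, ENNReal.toReal_nonneg, (ENNReal.ofReal_toReal ht).symm⟩
  obtain ⟨v, hv, hv'⟩ : ∃ y, 0 ≤ y ∧ NV = ofReal y := ⟨_, ENNReal.toReal_nonneg, (ENNReal.ofReal_toReal hVf).symm⟩
  rw [hy', hv', ← ENNReal.ofReal_mul (by norm_num), ← ENNReal.ofReal_add hy (by positivity), ENNReal.ofReal_le_ofReal_iff (by positivity)] at e4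
  rw [hy', hv', show (2:ENNReal) = ofReal 2 by simp, ← ENNReal.ofReal_mul (by norm_num)]
  exact ENNReal.ofReal_le_ofReal (by linarith)

lemma nr_rpow {f g : Pt d → ℝ} (hf : Bs f) (hg : Bs g) (hq : 0 < q) (hp : 0 < p) {C : ENNReal} (hC : C ≠ ⊤) (h : nr q p f ≤ C * nr q p g) :
    mixedNorm q p f ≤ C.toReal ^ (1/p) * mixedNorm q p g := by
  rw [(hf.nn hq hp).2, (hg.nn hq hp).2, ← Real.mul_rpow ENNReal.toReal_nonneg ENNReal.toReal_nonneg, ← ENNReal.toReal_mul]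
  exact Real.rpow_le_rpow ENNReal.toReal_nonneg (ENNReal.toReal_mono (ENNReal.mul_ne_top hC (hg.nn hq hp).1) h) (by positivity)

lemma main12 (d : ℕ) (hd : 1 ≤ d) (δ : ℝ) (hδ0 : 0 < δ) (hδ1 : δ ≤ 1)
    (p q : ℝ) (hp : 1 < p) (hq : 1 < q) :
    ∃ aHat N : ℝ, 0 < aHat ∧ 0 < N ∧
      ∀ a : Pt d → Matrix (Fin d) (Fin d) ℝ, Measurable a → (∀ z, inS d δ (a z)) →
        aSharp a ≤ ofReal aHat →
        ∀ u : Pt d → ℝ, CinfC u →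
          mixedNorm q p (Dt u) + mixedNorm q p (fun z => mnorm fun i j => Dxx i j u z) ≤
            N * mixedNorm q p (fun z => Dt u z + ∑ i, ∑ j, a z i j * Dxx i j u z) := by
  obtain ⟨θ, hθ, C, hC, h⟩ := est2 (d := d) hd hδ0 hδ1 hq hp
  have hp0 : 0 < p := by linarith
  have hq0 : 0 < q := by linarith
  obtain ⟨Ca, hCa, hadd⟩ := NN_add (d := d) hq0 hp0
  set D := Ca * (1 + ofReal δ⁻¹ ^ p * C) with hD
  have hDt : D ≠ ⊤ := by rw [hD]; finiteness
  refine ⟨θ, D.toReal ^ (1/p) + C.toReal ^ (1/p) + 1, hθ, by positivity, fun a ha hS hsh u hu => ?_⟩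
  have H : Cf δ θ a := ⟨hδ0, hδ1, ha, hS, hsh⟩
  have hV := h a u H hu
  have bf : Bs (ff a u) := hu.dt.bs.add (Bs.sum _ fun i => Bs.sum _ fun j => (hu.dxx i j).bs.mono ((H.ma i j).mul (hu.dxx i j).1.continuous.measurable) (c := δ⁻¹) (by positivity)
    fun z => by rw [abs_mul]; exact mul_le_mul_of_nonneg_right ((H.S z).ent hδ0 i j) (abs_nonneg _))
  have bV : Bs (VV u) := Bs.sum _ fun i => Bs.sum _ fun j => (hu.dxx i j).bs.mono (hu.dxx i j).1.continuous.abs.measurable (c := 1) zero_le_one (fun z => by simp)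
  have hm0 : ∀ z, 0 ≤ mnorm fun i j => Dxx i j u z := fun z => Real.sqrt_nonneg _
  have hmV : ∀ z, |mnorm fun i j => Dxx i j u z| ≤ |VV u z| := fun z => by
    rw [abs_of_nonneg (hm0 z), abs_of_nonneg (VV0 u z)]; exact mnorm_le _
  have mm : Measurable fun z => mnorm fun i j => Dxx i j u z :=
    (Finset.measurable_fun_sum _ fun i _ => Finset.measurable_fun_sum _ fun j _ => (hu.dxx i j).1.continuous.measurable.pow_const 2).sqrt
  have bm : Bs fun z => mnorm fun i j => Dxx i j u z := bV.mono mm zero_le_one (fun z => by rw [one_mul]; exact hmV z)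
  have r1 := nr_rpow bm bf hq0 hp0 hC ((nr_mono hq0 hp0 hmV).trans hV)
  have r2 : nr q p (Dt u) ≤ D * nr q p (ff a u) := by
    have mf : Measurable fun w => ofReal |ff a u w| := by have := H.mf hu; fun_prop
    have mV : Measurable fun w => ofReal |VV u w| := by have := bV.m; fun_prop
    have k1 : nr q p (Dt u) ≤ NN q p fun z => ofReal |ff a u z| + ofReal δ⁻¹ * ofReal |VV u z| := by
      refine NN_mono hq0 hp0 fun z => ?_
      rw [← ENNReal.ofReal_mul (by positivity), ← ENNReal.ofReal_add (abs_nonneg _) (by positivity)]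
      refine ENNReal.ofReal_le_ofReal ?_
      have e : Dt u z = ff a u z - ∑ i, ∑ j, a z i j * Dxx i j u z := by unfold ff; ring
      rw [e]
      refine (abs_sub _ _).trans (add_le_add le_rfl ?_)
      rw [abs_of_nonneg (VV0 u z), VV, Finset.mul_sum]
      refine (Finset.abs_sum_le_sum_abs _ _).trans (Finset.sum_le_sum fun i _ => ?_)
      rw [Finset.mul_sum]
      refine (Finset.abs_sum_le_sum_abs _ _).trans (Finset.sum_le_sum fun j _ => ?_)
      rw [abs_mul]; exact mul_le_mul_of_nonneg_right ((H.S z).ent hδ0 i j) (abs_nonneg _)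
    refine k1.trans ((hadd _ _ mf (mV.const_mul _)).trans ?_)
    rw [NN_smul hq0 hp0 _ mV]
    calc _ ≤ Ca * (nr q p (ff a u) + ofReal δ⁻¹ ^ p * (C * nr q p (ff a u))) := mul_le_mul' le_rfl (add_le_add le_rfl (mul_le_mul' le_rfl hV))
      _ = _ := by rw [hD]; ring
  have r3 := nr_rpow hu.dt.bs bf hq0 hp0 hDt r2
  have n0 : 0 ≤ mixedNorm q p (ff a u) := by rw [(bf.nn hq0 hp0).2]; positivity
  show _ ≤ _ * mixedNorm q p (ff a u)
  linarith
end

theorem stmt12 (d : ℕ) (hd : 1 ≤ d) (δ : ℝ) (hδ0 : 0 < δ) (hδ1 : δ ≤ 1)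
    (p q : ℝ) (hp : 1 < p) (hq : 1 < q) :
    ∃ aHat N : ℝ, 0 < aHat ∧ 0 < N ∧
      ∀ a : Pt d → Matrix (Fin d) (Fin d) ℝ, Measurable a → (∀ z, inS d δ (a z)) →
        aSharp a ≤ ENNReal.ofReal aHat →
        ∀ u : Pt d → ℝ, CinfC u →
          mixedNorm q p (Dt u) + mixedNorm q p (fun z => mnorm fun i j => Dxx i j u z) ≤
            N * mixedNorm q p (fun z => Dt u z + ∑ i, ∑ j, a z i j * Dxx i j u z) := by
  exact main12 d hd δ hδ0 hδ1 p q hp hq
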